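/- Let q be a power of 2, n ≥ 5, α ∈ {+1,−1}, with (n,q,α) ≠ (5,2,+1). Define D(n,q,α) = (q−1)(q²+1)(q³−1)(q⁴+1) if (n,α) = (5,−1), and D(n,q,α) = q^{4n−10}+1 otherwise. Let χ be an irreducible complex character of G = Ω^α_{2n}(q). Then either χ(1) ≥ D(n,q,α), or χ(1) is one of the following values, with the indicated number of characters of G of each degree: degree 1 (exactly 1 character); degree (q^n−α)(q^{n−1}+αq)/(q²−1) (exactly 1 character); degree (q^{2n}−q²)/(q²−1) (exactly 1 character); degree (q^n−α)(q^{n−1}+αβ)/(q−β) for β ∈ {1,−1} (exactly (q−β−1)/2 characters for each β). -/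

import Mathlib

open CategoryTheory Matrix

/-- `χ` is the character of an irreducible complex representation of the group `G`. -/
def IsIrrChar (G : Type) [Group G] (χ : G → ℂ) : Prop :=
  ∃ V : FDRep ℂ G, Simple V ∧ χ = fun g => V.character g

section Orth

variable {F : Type} [Field F] {m : ℕ}

/-- The isometry group `O(Q)` of a quadratic form `Q` on `F^m`,
as a subgroup of `GL (Fin m) F`. -/
def isomGroup (Q : QuadraticForm F (Fin m → F)) : Subgroup (GL (Fin m) F) where
  carrier := {g | ∀ v, Q ((g : Matrix (Fin m) (Fin m) F) *ᵥ v) = Q v}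
  one_mem' := by intro v; simp
  mul_mem' := by
    intro a b ha hb v
    rw [Units.val_mul, ← Matrix.mulVec_mulVec, ha, hb]
  inv_mem' := by
    intro a ha v
    have h := ha ((↑(a⁻¹) : Matrix (Fin m) (Fin m) F) *ᵥ v)
    rw [Matrix.mulVec_mulVec, Units.mul_inv, Matrix.one_mulVec] at h
    exact h.symm

/-- The special isometry group `SO(Q)` (isometries of determinant `1`). -/
def sisomGroup (Q : QuadraticForm F (Fin m → F)) : Subgroup (GL (Fin m) F) :=
  isomGroup Q ⊓ (Matrix.GeneralLinearGroup.det : GL (Fin m) F →* Fˣ).ker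

/-- Nondegeneracy of a quadratic form: no nonzero singular vector is in the radical of the
polar form. -/
def IsNondegQF (Q : QuadraticForm F (Fin m → F)) : Prop :=
  ∀ v, (∀ w, QuadraticMap.polar ⇑Q v w = 0) → Q v = 0 → v = 0

/-- `Q` has Witt index `w`: `w` is the largest dimension of a totally singular subspace. -/
def HasWittIndex (Q : QuadraticForm F (Fin m → F)) (w : ℕ) : Prop :=
  IsGreatest {d : ℕ | ∃ W : Submodule F (Fin m → F),
    (∀ x ∈ W, Q x = 0) ∧ Module.finrank F ↥W = d} w

end Orth

set_option linter.unusedSectionVars false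

namespace OC

open Module
open Submodule (span subset_span mem_span_singleton)

section Basic

variable {F V : Type} [Field F] [AddCommGroup V] [Module F V]

/-- The polar form of `Q` as a bilinear map. -/
def bl (Q : QuadraticForm F V) : V →ₗ[F] V →ₗ[F] F := Q.polarBilin

variable (Q : QuadraticForm F V)

theorem bl_comm (v w : V) : bl Q v w = bl Q w v := by
  simp only [bl, QuadraticMap.polarBilin_apply_apply]
  exact QuadraticMap.polar_comm _ _ _

theorem Q_add (v w : V) : Q (v + w) = Q v + Q w + bl Q v w := by
  simp only [bl, QuadraticMap.polarBilin_apply_apply, QuadraticMap.polar]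
  ring

theorem Q_smul (c : F) (v : V) : Q (c • v) = c * c * Q v := by
  rw [QuadraticMap.map_smul, smul_eq_mul]

variable [CharP F 2]

variable (F) in
theorem two_eq : (2 : F) = 0 := CharTwo.two_eq_zero

variable (F) in
include F in
theorem add_self_v (v : V) : v + v = 0 := by
  rw [← two_smul F v, two_eq F, zero_smul]

variable (F) in
include F in
theorem add_add_cancel_v (v w : V) : v + (v + w) = w := by
  rw [← add_assoc, add_self_v F, zero_add]

variable (F) in
include F in
theorem neg_v (v : V) : -v = v := by
  rw [neg_eq_iff_add_eq_zero, add_self_v F]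

variable (F) in
include F in
theorem sub_v (v w : V) : v - w = v + w := by
  rw [sub_eq_add_neg, neg_v F]

@[simp] theorem bl_self (v : V) : bl Q v v = 0 := by
  have h := Q_add Q v v
  rw [add_self_v F, QuadraticMap.map_zero] at h
  linear_combination -h - Q v * two_eq F

/-- Nondegeneracy of the polar form. -/
def Nondeg (Q : QuadraticForm F V) : Prop := ∀ v, (∀ w, bl Q v w = 0) → v = 0

/-- The underlying linear map of a Siegel transformation. -/
def sgl (a w : V) : V →ₗ[F] V :=
  LinearMap.id + ((bl Q w).smulRight a) + ((bl Q a).smulRight w) + (Q w • (bl Q a).smulRight a)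

theorem sgl_apply (a w v : V) :
    sgl Q a w v = v + bl Q v w • a + bl Q v a • w + (Q w * bl Q v a) • a := by
  simp [sgl, bl_comm Q v, smul_smul]

open Classical in
/-- The Siegel transformation attached to a singular vector `a` and `w ⊥ a`
(the identity for other pairs). -/
noncomputable def S (a w : V) : V ≃ₗ[F] V :=
  if h : Q a = 0 ∧ bl Q a w = 0 then
    LinearEquiv.ofInvolutive (sgl Q a w) (by
      obtain ⟨h1, h2⟩ := h
      intro v
      simp only [sgl_apply, map_add, map_smul, bl_self,
        bl_comm Q w a, h2]
      have h3 := two_eq F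
      match_scalars <;> grind)
  else 1

variable {Q}

theorem S_apply {a w : V} (ha : Q a = 0) (haw : bl Q a w = 0) (v : V) :
    S Q a w v = v + bl Q v w • a + bl Q v a • w + (Q w * bl Q v a) • a := by
  rw [S, dif_pos ⟨ha, haw⟩, ← sgl_apply]
  rfl

theorem S_fix {a w v : V} (h1 : bl Q v a = 0) (h2 : bl Q v w = 0) : S Q a w v = v := by
  by_cases h : Q a = 0 ∧ bl Q a w = 0
  · rw [S_apply h.1 h.2, h1, h2]; simp
  · rw [S, dif_neg h]; rfl

/-- Isometry groups as subgroups of `V ≃ₗ[F] V`. -/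
def isom (Q : QuadraticForm F V) : Subgroup (V ≃ₗ[F] V) where
  carrier := {g | ∀ v, Q (g v) = Q v}
  one_mem' := fun v => rfl
  mul_mem' := by
    intro a b ha hb v
    rw [LinearEquiv.mul_apply, ha, hb]
  inv_mem' := by
    intro a ha v
    rw [← ha (a⁻¹ v), ← LinearEquiv.mul_apply, mul_inv_cancel]
    rfl

theorem isom_Q {g : V ≃ₗ[F] V} (hg : g ∈ isom Q) (v : V) : Q (g v) = Q v := hg v

theorem isom_bl {g : V ≃ₗ[F] V} (hg : g ∈ isom Q) (v w : V) : bl Q (g v) (g w) = bl Q v w := by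
  have h1 := Q_add Q (g v) (g w)
  rw [← map_add, isom_Q hg, isom_Q hg, isom_Q hg, Q_add] at h1
  linear_combination -h1

theorem isom_bl' {g : V ≃ₗ[F] V} (hg : g ∈ isom Q) (v w : V) :
    bl Q (g v) w = bl Q v (g⁻¹ w) := by
  rw [← isom_bl ((isom Q).inv_mem hg), ← LinearEquiv.mul_apply, inv_mul_cancel]
  rfl

theorem S_isom (a w : V) : S Q a w ∈ isom Q := by
  intro v
  by_cases h : Q a = 0 ∧ bl Q a w = 0
  · obtain ⟨h1, h2⟩ := h
    have h3 := two_eq F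
    have h4 := bl_comm Q w a
    rw [S_apply h1 h2]
    simp only [Q_add, Q_smul, map_add, map_smul, LinearMap.add_apply, LinearMap.smul_apply, bl_self,
      smul_eq_mul, h4, h1, h2]
    grind
  · rw [S, dif_neg h]; rfl

theorem S_add {a w w' : V} (ha : Q a = 0) (h : bl Q a w = 0) (h' : bl Q a w' = 0) :
    S Q a (w + w') = S Q a w * S Q a w' := by
  ext v
  have h3 := two_eq F
  have h4 := bl_comm Q w' a
  rw [LinearEquiv.mul_apply, S_apply ha h', S_apply ha h, S_apply ha (by rw [map_add, h, h', zero_add])]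
  simp only [Q_add, map_add, map_smul, LinearMap.add_apply, LinearMap.smul_apply, bl_self,
      smul_eq_mul, h4, h', h, bl_comm Q w' w]
  match_scalars <;> grind

theorem S_zero (a : V) : S Q a 0 = 1 := by
  ext v
  by_cases h : Q a = 0 ∧ bl Q a 0 = 0
  · rw [S_apply h.1 h.2]; simp
  · rw [S, dif_neg h]

theorem S_smul_left {a w : V} {c : F} (ha : Q a = 0) (h : bl Q a w = 0) :
    S Q (c • a) w = S Q a (c • w) := by
  ext v
  rw [S_apply (by rw [Q_smul, ha, mul_zero]) (by simp [h]), S_apply ha (by simp [h])]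
  simp only [Q_smul, map_smul, smul_eq_mul]
  match_scalars <;> ring

theorem S_self {a : V} (ha : Q a = 0) (c : F) : S Q a (c • a) = 1 := by
  ext v
  have h3 := two_eq F
  rw [S_apply ha (by simp)]
  simp only [Q_smul, map_smul, smul_eq_mul, ha, LinearEquiv.coe_one, id_eq]
  match_scalars <;> grind

theorem S_swap {a w : V} (ha : Q a = 0) (hw : Q w = 0) (h : bl Q a w = 0) :
    S Q a w = S Q w a := by
  ext v
  rw [S_apply ha h, S_apply hw (by rw [bl_comm, h]), ha, hw]
  module

theorem S_add_left {a b w : V} (ha : Q a = 0) (hb : Q b = 0) (hab : bl Q a b = 0)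
    (haw : bl Q a w = 0) (hbw : bl Q b w = 0) :
    S Q (a + b) w = S Q a w * S Q b w * S Q a (Q w • b) := by
  ext v
  have h3 := two_eq F
  have h4 := bl_comm Q b a
  have h5 := bl_comm Q w a
  have h6 := bl_comm Q w b
  rw [LinearEquiv.mul_apply, LinearEquiv.mul_apply,
    S_apply (a := a + b) (by rw [Q_add, ha, hb, hab]; simp) (by simp [haw, hbw]),
    S_apply ha (w := Q w • b) (by simp [hab]), S_apply hb hbw, S_apply ha haw]
  simp only [Q_smul, map_add, map_smul, LinearMap.add_apply, LinearMap.smul_apply, bl_self,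
      smul_eq_mul, h4, h5, hb, hab, haw, hbw]
  match_scalars <;> grind

theorem S_conj {g : V ≃ₗ[F] V} (hg : g ∈ isom Q) (a w : V) :
    g * S Q a w * g⁻¹ = S Q (g a) (g w) := by
  ext v
  by_cases h : Q a = 0 ∧ bl Q a w = 0
  · rw [LinearEquiv.mul_apply, LinearEquiv.mul_apply, S_apply h.1 h.2,
      S_apply (by rw [isom_Q hg, h.1]) (by rw [isom_bl hg, h.2])]
    have hv : g (g⁻¹ v) = v := by rw [← LinearEquiv.mul_apply, mul_inv_cancel]; rfl
    have hb : ∀ u, bl Q v (g u) = bl Q (g⁻¹ v) u := fun u => by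
      conv_lhs => rw [← hv]
      rw [isom_bl hg]
    simp only [map_add, map_smul, hv, hb, isom_Q hg]
  · have h' : ¬ (Q (g a) = 0 ∧ bl Q (g a) (g w) = 0) := by rwa [isom_Q hg, isom_bl hg]
    rw [S, dif_neg h, S, dif_neg h', mul_one, mul_inv_cancel]

variable (Q) in
/-- The orthogonal transvection (reflection) attached to `d`; the identity if `Q d = 0`. -/
noncomputable def r (d : V) : V ≃ₗ[F] V :=
  LinearEquiv.ofInvolutive (LinearMap.id + (bl Q d).smulRight ((Q d)⁻¹ • d)) (by
    intro v
    have h3 := two_eq F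
    simp only [LinearMap.add_apply, LinearMap.id_apply, LinearMap.smulRight_apply, map_add, map_smul,
      bl_self]
    match_scalars <;> grind)

theorem r_apply (d v : V) : r Q d v = v + (bl Q v d * (Q d)⁻¹) • d := by
  rw [mul_smul, bl_comm]
  rfl

theorem r_fix {d v : V} (h : bl Q v d = 0) : r Q d v = v := by
  rw [r_apply, h]; simp

theorem r_isom (d : V) : r Q d ∈ isom Q := by
  intro v
  rw [r_apply, Q_add, Q_smul, map_smul, smul_eq_mul]
  by_cases h : Q d = 0
  · simp [h]
  · field_simp
    linear_combination (bl Q v d) * (bl Q v d) * two_eq F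

theorem r_conj {g : V ≃ₗ[F] V} (hg : g ∈ isom Q) (d : V) : g * r Q d * g⁻¹ = r Q (g d) := by
  ext v
  have hv : g (g⁻¹ v) = v := by rw [← LinearEquiv.mul_apply, mul_inv_cancel]; rfl
  rw [LinearEquiv.mul_apply, LinearEquiv.mul_apply, r_apply, r_apply, isom_Q hg, map_add, map_smul,
    hv]
  conv_rhs => rw [← hv]
  rw [isom_bl hg]
  conv_rhs => rw [hv]

theorem r_mul_r (d : V) : r Q d * r Q d = 1 := by
  ext v
  rw [LinearEquiv.mul_apply, r_apply, r_apply]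
  have h3 := two_eq F
  simp only [LinearMap.add_apply, map_add, map_smul, LinearMap.smul_apply, bl_self, smul_eq_mul,
    LinearEquiv.coe_one, id_eq]
  match_scalars <;> grind

theorem r_inv (d : V) : (r Q d)⁻¹ = r Q d := inv_eq_of_mul_eq_one_left (r_mul_r d)

theorem r_smul {c : F} (hc : c ≠ 0) (d : V) : r Q (c • d) = r Q d := by
  ext v
  rw [r_apply, r_apply, Q_smul, map_smul, smul_smul, smul_eq_mul]
  congr 2
  field_simp

theorem S_eq_r {a d : V} (ha : Q a = 0) (hd : Q d ≠ 0) (h : bl Q a d = 0) :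
    S Q a ((Q d)⁻¹ • d) = r Q d * r Q (d + a) := by
  ext v
  have h3 := two_eq F
  have h4 : bl Q d a = 0 := by rw [bl_comm, h]
  rw [LinearEquiv.mul_apply, r_apply, r_apply, S_apply ha (by simp [h]), Q_add, ha, h4]
  simp only [Q_smul, map_add, map_smul, LinearMap.add_apply, LinearMap.smul_apply, bl_self,
      smul_eq_mul, h, add_zero]
  match_scalars <;> field_simp <;> grind

/-- The swapping reflection. -/
theorem r_swap {u u' : V} (h : Q u = Q u') (h' : bl Q u u' ≠ 0) : r Q (u + u') u = u' := by
  have h3 := two_eq F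
  have e : Q (u + u') = bl Q u u' := by rw [Q_add, h]; linear_combination (Q u') * h3
  rw [r_apply, e, map_add, bl_self, zero_add, mul_inv_cancel₀ h', one_smul, add_add_cancel_v F]

end Basic

section Witt

variable {F V : Type} [Field F] [AddCommGroup V] [Module F V] [CharP F 2]
variable {Q : QuadraticForm F V}

theorem exists_bl_eq [FiniteDimensional F V] (hQ : Nondeg Q) (f : V →ₗ[F] F) :
    ∃ w, ∀ v, bl Q v w = f v := by
  have hinj : Function.Injective (bl Q) := by
    rw [injective_iff_map_eq_zero]
    intro v hv
    exact hQ v fun w => by rw [hv]; rfl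
  have hsurj : Function.Surjective (bl Q) :=
    (LinearMap.injective_iff_surjective_of_finrank_eq_finrank
      (Subspace.dual_finrank_eq).symm).1 hinj
  obtain ⟨w, hw⟩ := hsurj f
  exact ⟨w, fun v => by rw [bl_comm, hw]⟩

/-- `d` is orthogonal to all of `U`. -/
def Perp (Q : QuadraticForm F V) (U : Set V) (d : V) : Prop := ∀ u ∈ U, bl Q u d = 0

theorem Perp.span {U : Set V} {d : V} (h : Perp Q U d) {u : V} (hu : u ∈ span F U) :
    bl Q u d = 0 := by
  induction hu using Submodule.span_induction with
  | mem x hx => exact h x hx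
  | zero => simp
  | add x y _ _ hx hy => simp [hx, hy]
  | smul c x _ hx => simp [hx]

theorem Perp.mono {U U' : Set V} {d : V} (h : Perp Q U' d) (hU : U ⊆ U') : Perp Q U d :=
  fun u hu => h u (hU hu)

theorem Perp.add {U : Set V} {d d' : V} (h : Perp Q U d) (h' : Perp Q U d') :
    Perp Q U (d + d') := fun u hu => by rw [map_add, h u hu, h' u hu, add_zero]

theorem Perp.smul {U : Set V} {d : V} (c : F) (h : Perp Q U d) :
    Perp Q U (c • d) := fun u hu => by rw [map_smul, h u hu, smul_zero]

@[simp] theorem perp_insert {U : Set V} {x d : V} :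
    Perp Q (insert x U) d ↔ bl Q x d = 0 ∧ Perp Q U d := by
  simp [Perp]

@[simp] theorem perp_singleton {x d : V} : Perp Q {x} d ↔ bl Q x d = 0 := by
  simp [Perp]

@[simp] theorem perp_empty {d : V} : Perp Q ∅ d := by
  simp [Perp]

theorem exists_perp [FiniteDimensional F V] (hQ : Nondeg Q) {U : Set V} {v : V}
    (hv : v ∉ span F U) : ∃ w, Perp Q U w ∧ bl Q v w = 1 := by
  obtain ⟨f, hf, hU⟩ := Submodule.exists_le_ker_of_notMem hv
  obtain ⟨w, hw⟩ := exists_bl_eq hQ ((f v)⁻¹ • f)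
  refine ⟨w, fun u hu => ?_, ?_⟩
  · rw [hw, LinearMap.smul_apply, hU (subset_span hu), smul_zero]
  · rw [hw, LinearMap.smul_apply, smul_eq_mul, inv_mul_cancel₀ hf]

/-- The group generated by the reflections and Siegel transformations supported on `U^⊥`. -/
def RS (Q : QuadraticForm F V) (U : Set V) : Subgroup (V ≃ₗ[F] V) :=
  Subgroup.closure ({g | ∃ d, Perp Q U d ∧ g = r Q d} ∪
    {g | ∃ a w, Perp Q U a ∧ Perp Q U w ∧ g = S Q a w})

theorem r_mem_RS {U : Set V} {d : V} (h : Perp Q U d) : r Q d ∈ RS Q U :=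
  Subgroup.subset_closure (Or.inl ⟨d, h, rfl⟩)

theorem S_mem_RS {U : Set V} {a w : V} (h : Perp Q U a) (h' : Perp Q U w) : S Q a w ∈ RS Q U :=
  Subgroup.subset_closure (Or.inr ⟨a, w, h, h', rfl⟩)

theorem RS_mono {U U' : Set V} (h : U ⊆ U') : RS Q U' ≤ RS Q U := by
  refine Subgroup.closure_mono ?_
  rintro g (⟨d, hd, rfl⟩ | ⟨a, w, ha, hw, rfl⟩)
  · exact Or.inl ⟨d, hd.mono h, rfl⟩
  · exact Or.inr ⟨a, w, ha.mono h, hw.mono h, rfl⟩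

theorem RS_le_isom (U : Set V) : RS Q U ≤ isom Q := by
  refine (Subgroup.closure_le _).2 ?_
  rintro g (⟨d, hd, rfl⟩ | ⟨a, w, ha, hw, rfl⟩)
  · exact r_isom d
  · exact S_isom a w

/-- The pointwise stabilizer of `U` in `V ≃ₗ[F] V`. -/
def fixer (F : Type) {V : Type} [Field F] [AddCommGroup V] [Module F V] (U : Set V) :
    Subgroup (V ≃ₗ[F] V) where
  carrier := {g | ∀ u ∈ U, g u = u}
  one_mem' := fun u hu => rfl
  mul_mem' := by
    intro a b ha hb u hu
    rw [LinearEquiv.mul_apply, hb u hu, ha u hu]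
  inv_mem' := by
    intro a ha u hu
    conv_lhs => rw [← ha u hu]
    rw [← LinearEquiv.mul_apply, inv_mul_cancel]
    rfl

theorem fixer_span {U : Set V} {g : V ≃ₗ[F] V} (hg : g ∈ fixer F U) {u : V}
    (hu : u ∈ span F U) : g u = u := by
  induction hu using Submodule.span_induction with
  | mem x hx => exact hg x hx
  | zero => simp
  | add x y _ _ hx hy => simp [hx, hy]
  | smul c x _ hx => simp [hx]

theorem RS_le_fixer (U : Set V) : RS Q U ≤ fixer F U := by
  refine (Subgroup.closure_le _).2 ?_
  rintro g (⟨d, hd, rfl⟩ | ⟨a, w, ha, hw, rfl⟩) u hu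
  · exact r_fix (hd u hu)
  · exact S_fix (ha u hu) (hw u hu)

/-- An isometry moving one vector to another while fixing `U` pointwise. -/
theorem witt_step [FiniteDimensional F V] (hQ : Nondeg Q) {U : Set V} {u u' : V}
    (hu : u ∉ span F U) (hu' : u' ∉ span F U) (h : Q u = Q u')
    (hb : ∀ y ∈ U, bl Q y u = bl Q y u') : ∃ g ∈ RS Q U, g u = u' := by
  have h3 := two_eq F
  set d := u + u' with hd
  have hdU : Perp Q U d := fun y hy => by
    rw [hd, map_add, hb y hy]; linear_combination (bl Q y u') * h3
  have hQd : Q d = bl Q u u' := by rw [hd, Q_add, h]; linear_combination (Q u') * h3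
  have hu'd : u' = u + d := by rw [hd, add_add_cancel_v F]
  by_cases h0 : bl Q u u' = 0
  · by_cases hd0 : d = 0
    · exact ⟨1, one_mem _, by rw [hu'd, hd0, add_zero]; rfl⟩
    by_cases hs : u ∈ span F (insert d U)
    · obtain ⟨l, u0, hu0, hl⟩ := Submodule.mem_span_insert.1 hs
      have hl0 : l ≠ 0 := by
        rintro rfl
        apply hu; rw [hl, zero_smul, zero_add]; exact hu0
      have hl1 : l + 1 ≠ 0 := by
        intro hl1
        apply hu'
        rw [hu'd, hl]
        have : l • d + u0 + d = (l + 1) • d + u0 := by module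
        rw [this, hl1, zero_smul, zero_add]; exact hu0
      have hdn : d ∉ span F U := by
        intro hdn
        apply hu
        rw [hl]
        exact Submodule.add_mem _ (Submodule.smul_mem _ _ hdn) hu0
      obtain ⟨f0, hf0, hf1⟩ := exists_perp hQ hdn
      set f := f0 + Q f0 • d with hf
      have hfU : Perp Q U f := hf0.add (hdU.smul _)
      have hdf : bl Q d f = 1 := by rw [hf]; simp [hf1]
      have hfd : bl Q f d = 1 := by rw [bl_comm, hdf]
      have hQf : Q f = 0 := by
        rw [hf, Q_add, Q_smul, hQd, h0, map_smul, bl_comm, hf1]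
        simp; linear_combination (Q f0) * h3
      have hQd0 : Q d = 0 := by rw [hQd, h0]
      set m := (l + 1) / l
      have hm : m ≠ 0 := div_ne_zero hl1 hl0
      refine ⟨r Q (f + m • d) * r Q (d + f), mul_mem (r_mem_RS (hfU.add (hdU.smul _)))
        (r_mem_RS (hdU.add hfU)), ?_⟩
      have e1 : r Q (d + f) d = f := r_swap (by rw [hQd0, hQf]) (by rw [hdf]; exact one_ne_zero)
      have e2 : r Q (f + m • d) f = m • d :=
        r_swap (by rw [Q_smul, hQd0, hQf, mul_zero]) (by rw [map_smul, hfd]; simpa using hm)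
      have e3 : ∀ x, Perp Q U x → r Q x u0 = u0 := fun x hx => r_fix (hx.span hu0)
      rw [LinearEquiv.mul_apply]
      nth_rewrite 1 [hl]
      rw [map_add, map_smul, e1, e3 _ (hdU.add hfU), map_add, map_smul, e2,
        e3 _ (hfU.add (hdU.smul _)), smul_smul, hu'd, hl]
      have : l * m = l + 1 := by simp only [m]; field_simp
      rw [this]; module
    · obtain ⟨w, hw, hw1⟩ := exists_perp hQ hs
      rw [perp_insert] at hw
      refine ⟨S Q d w, S_mem_RS hdU hw.2, ?_⟩
      rw [S_apply (by rw [hQd, h0]) hw.1, hw1]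
      have : bl Q u d = 0 := by rw [hd, map_add, h0, bl_self, add_zero]
      rw [this, hu'd]; simp
  · exact ⟨r Q d, r_mem_RS hdU, r_swap h h0⟩

theorem mem_RS_of_fix [FiniteDimensional F V] (hQ : Nondeg Q) {g : V ≃ₗ[F] V} (hg : g ∈ isom Q) :
    ∀ (k : ℕ) (U : Set V), finrank F V ≤ finrank F (span F U) + k →
      g ∈ fixer F U → g ∈ RS Q U := by
  intro k
  induction k generalizing g with
  | zero =>
    intro U hU hgU
    have : span F U = ⊤ := Submodule.eq_top_of_finrank_eq
      (le_antisymm (Submodule.finrank_le _) (by simpa using hU))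
    have hg1 : g = 1 := by
      ext v
      exact fixer_span hgU (this ▸ Submodule.mem_top)
    rw [hg1]; exact one_mem _
  | succ k ih =>
    intro U hU hgU
    by_cases hT : span F U = ⊤
    · have hg1 : g = 1 := by
        ext v
        exact fixer_span hgU (hT ▸ Submodule.mem_top)
      rw [hg1]; exact one_mem _
    obtain ⟨u, hu⟩ : ∃ u, u ∉ span F U := by
      by_contra! hc
      exact hT (eq_top_iff.2 fun u _ => hc u)
    have hgu : g u ∉ span F U := by
      intro hc
      have := fixer_span hgU hc
      exact hu (g.injective this ▸ hc)
    obtain ⟨h, hh, hhu⟩ := witt_step hQ hu hgu (isom_Q hg u).symm (fun y hy => by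
      conv_rhs => rw [← hgU y hy]
      rw [isom_bl hg])
    have hmem : h⁻¹ * g ∈ fixer F (insert u U) := by
      rintro x (rfl | hx)
      · rw [LinearEquiv.mul_apply, ← hhu, ← LinearEquiv.mul_apply, inv_mul_cancel]; rfl
      · exact mul_mem (inv_mem (RS_le_fixer U hh)) hgU x hx
    have hlt : finrank F (span F U) <
        finrank F (span F (insert u U)) := by
      apply Submodule.finrank_lt_finrank_of_lt
      refine lt_of_le_of_ne (Submodule.span_mono (Set.subset_insert _ _)) ?_
      intro hc
      exact hu (hc ▸ subset_span (Set.mem_insert _ _))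
    have := ih (mul_mem (inv_mem (RS_le_isom U hh)) hg) (insert u U) (by omega) hmem
    have h2 := mul_mem hh (RS_mono (Set.subset_insert u U) this)
    rwa [mul_inv_cancel_left] at h2

theorem isom_inf_fixer [FiniteDimensional F V] (hQ : Nondeg Q) (U : Set V) :
    isom Q ⊓ fixer F U = RS Q U := by
  refine le_antisymm (fun g hg => ?_) (le_inf (RS_le_isom U) (RS_le_fixer U))
  exact mem_RS_of_fix hQ hg.1 (finrank F V) U (by omega) hg.2

/-- The group generated by the Siegel transformations supported on `U^⊥`. -/
def El (Q : QuadraticForm F V) (U : Set V) : Subgroup (V ≃ₗ[F] V) :=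
  Subgroup.closure {g | ∃ a w, Perp Q U a ∧ Perp Q U w ∧ g = S Q a w}

theorem S_mem_El {U : Set V} {a w : V} (h : Perp Q U a) (h' : Perp Q U w) : S Q a w ∈ El Q U :=
  Subgroup.subset_closure ⟨a, w, h, h', rfl⟩

theorem El_le_RS (U : Set V) : El Q U ≤ RS Q U :=
  Subgroup.closure_mono Set.subset_union_right

theorem El_mono {U U' : Set V} (h : U ⊆ U') : El Q U' ≤ El Q U := by
  refine Subgroup.closure_mono ?_
  rintro g ⟨a, w, ha, hw, rfl⟩
  exact ⟨a, w, ha.mono h, hw.mono h, rfl⟩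

theorem El_conj {U : Set V} {g h : V ≃ₗ[F] V} (hg : g ∈ isom Q) (hU : g ∈ fixer F U)
    (hh : h ∈ El Q U) : g * h * g⁻¹ ∈ El Q U := by
  have hP : ∀ a, Perp Q U a → Perp Q U (g a) := fun a ha u hu => by
    rw [← hU u hu, isom_bl hg, ha u hu]
  induction hh using Subgroup.closure_induction with
  | mem x hx =>
    obtain ⟨a, w, ha, hw, rfl⟩ := hx
    rw [S_conj hg]
    exact S_mem_El (hP a ha) (hP w hw)
  | one => rw [mul_one, mul_inv_cancel]; exact one_mem _
  | mul x y _ _ hx hy =>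
    have := mul_mem hx hy
    rwa [show g * x * g⁻¹ * (g * y * g⁻¹) = g * (x * y) * g⁻¹ by group] at this
  | inv x _ hx =>
    have := inv_mem hx
    rwa [show (g * x * g⁻¹)⁻¹ = g * x⁻¹ * g⁻¹ by group] at this

variable (F) in
theorem exists_sqrt [Finite F] (x : F) : ∃ c : F, c * c = x := by
  obtain ⟨c, hc⟩ := FiniteField.isSquare_of_char_two (ringChar.eq_iff.2 inferInstance) x
  exact ⟨c, hc.symm⟩

theorem r_mul_r_mem_of_perp [Finite F] {U : Set V} {d d' : V} (hd : Perp Q U d)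
    (hd' : Perp Q U d') (h : Q d ≠ 0) (h' : Q d' ≠ 0) (hb : bl Q d d' = 0) :
    r Q d * r Q d' ∈ El Q U := by
  obtain ⟨c, hc⟩ := exists_sqrt F (Q d / Q d')
  have hc0 : c ≠ 0 := by
    rintro rfl
    rw [zero_mul] at hc
    exact div_ne_zero h h' hc.symm
  have hQ : Q (c • d') = Q d := by rw [Q_smul, hc]; field_simp
  have h3 := two_eq F
  have ha : Q (d + c • d') = 0 := by
    rw [Q_add, hQ, map_smul, hb, smul_zero]; linear_combination (Q d) * h3
  have hP := hd.add (hd'.smul c)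
  have key := S_eq_r (a := d + c • d') (d := d) ha h (by
    rw [bl_comm, map_add, map_smul, hb, bl_self]; simp)
  rw [add_add_cancel_v F, r_smul hc0] at key
  rw [← key]
  exact S_mem_El hP (hd.smul _)

/-- Any two vectors have a common nonsingular orthogonal vector inside `U^⊥`. -/
def Ample (Q : QuadraticForm F V) (U : Set V) : Prop :=
  ∀ d d', ∃ m, Perp Q U m ∧ bl Q d m = 0 ∧ bl Q d' m = 0 ∧ Q m ≠ 0

theorem r_mul_r_mem [Finite F] {U : Set V} (hU : Ample Q U) {d d' : V} (hd : Perp Q U d)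
    (hd' : Perp Q U d') (h : Q d ≠ 0) (h' : Q d' ≠ 0) : r Q d * r Q d' ∈ El Q U := by
  obtain ⟨m, hm, h1, h2, h3⟩ := hU d d'
  have := mul_mem (r_mul_r_mem_of_perp hd hm h h3 h1)
    (r_mul_r_mem_of_perp hm hd' h3 h' (by rw [bl_comm, h2]))
  rwa [mul_assoc, ← mul_assoc (r Q m), r_mul_r, one_mul] at this

theorem RS_cases [Finite F] {U : Set V} (hU : Ample Q U) {d : V} (hd : Perp Q U d) (h : Q d ≠ 0)
    {g : V ≃ₗ[F] V} (hg : g ∈ RS Q U) : g ∈ El Q U ∨ g * r Q d ∈ El Q U := by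
  have hc : ∀ {x}, x ∈ El Q U → r Q d * x * r Q d ∈ El Q U := fun {x} hx => by
    have := El_conj (r_isom d) (RS_le_fixer U (r_mem_RS hd)) hx
    rwa [r_inv] at this
  have rr := r_mul_r (Q := Q) d
  induction hg using Subgroup.closure_induction with
  | mem x hx =>
    obtain (⟨d', hd', rfl⟩ | ⟨a, w, ha, hw, rfl⟩) := hx
    · by_cases h' : Q d' = 0
      · left
        have : r Q d' = 1 := by ext v; rw [r_apply, h']; simp
        rw [this]; exact one_mem _
      · right; exact r_mul_r_mem hU hd' hd h' h
    · left; exact S_mem_El ha hw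
  | one => left; exact one_mem _
  | mul x y _ _ hx hy =>
    obtain hx | hx := hx <;> obtain hy | hy := hy
    · left; exact mul_mem hx hy
    · right; rw [mul_assoc]; exact mul_mem hx hy
    · right
      have := mul_mem hx (hc hy)
      rwa [show x * r Q d * (r Q d * y * r Q d) = x * (r Q d * r Q d) * y * r Q d by group, rr,
        mul_one] at this
    · left
      have := mul_mem hx (hc hy)
      rwa [show x * r Q d * (r Q d * (y * r Q d) * r Q d) =
        x * (r Q d * r Q d) * y * (r Q d * r Q d) by group, rr, mul_one, mul_one] at this
  | inv x _ hx =>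
    obtain hx | hx := hx
    · left; exact inv_mem hx
    · right
      have := hc (inv_mem hx)
      rwa [_root_.mul_inv_rev, r_inv, ← mul_assoc, rr, one_mul] at this

end Witt

section Parity

variable {F V : Type} [Field F] [AddCommGroup V] [Module F V] [CharP F 2]
variable {Q : QuadraticForm F V}

theorem finrank_inf_ker [FiniteDimensional F V] (K : Submodule F V) (f : V →ₗ[F] F) {x : V}
    (hx : x ∈ K) (hfx : f x ≠ 0) :
    finrank F (K ⊓ LinearMap.ker f : Submodule F V) + 1 = finrank F K := by
  have h1 := LinearMap.finrank_range_add_finrank_ker (f.domRestrict K)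
  have h2 : LinearMap.range (f.domRestrict K) = ⊤ := by
    rw [LinearMap.range_eq_top]
    intro c
    refine ⟨(c / f x) • ⟨x, hx⟩, ?_⟩
    simp [hfx]
  rw [h2, finrank_top, Module.finrank_self] at h1
  have h3 : finrank F (LinearMap.ker (f.domRestrict K)) =
      finrank F (K ⊓ LinearMap.ker f : Submodule F V) := by
    rw [LinearMap.ker_domRestrict]
    have := (Submodule.comap K.subtype (LinearMap.ker f)).equivMapOfInjective K.subtype
      K.injective_subtype
    rw [this.finrank_eq, Submodule.map_comap_subtype]
  omega

/-- The dimension of the space of vectors fixed by `g`. -/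
noncomputable def fixDim (g : V ≃ₗ[F] V) : ℕ :=
  finrank F (LinearMap.ker ((g : V →ₗ[F] V) - LinearMap.id))

theorem fixDim_r_mul [FiniteDimensional F V] (hQ : Nondeg Q) {g : V ≃ₗ[F] V} (hg : g ∈ isom Q)
    {d : V} (hd : Q d ≠ 0) :
    fixDim (r Q d * g) + 1 = fixDim g ∨ fixDim (r Q d * g) = fixDim g + 1 := by
  set K := LinearMap.ker ((g : V →ₗ[F] V) - LinearMap.id) with hK
  set K' := LinearMap.ker (((r Q d * g : V ≃ₗ[F] V) : V →ₗ[F] V) - LinearMap.id) with hK'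
  have mK : ∀ v, v ∈ K ↔ g v = v := fun v => by
    rw [hK, LinearMap.mem_ker, LinearMap.sub_apply, sub_eq_zero]; rfl
  have mK' : ∀ v, v ∈ K' ↔ g v = r Q d v := fun v => by
    rw [hK', LinearMap.mem_ker, LinearMap.sub_apply, sub_eq_zero]
    constructor
    · intro h
      have h' : r Q d (g v) = v := h
      nth_rewrite 2 [← h']
      rw [← LinearEquiv.mul_apply, r_mul_r]; rfl
    · intro h
      change r Q d (g v) = v
      rw [h, ← LinearEquiv.mul_apply, r_mul_r]; rfl
  have hinf : K ⊓ LinearMap.ker (bl Q d) = K' ⊓ LinearMap.ker (bl Q d) := by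
    ext v
    simp only [Submodule.mem_inf, mK, mK', LinearMap.mem_ker]
    refine and_congr_left fun h => ?_
    rw [r_fix (by rw [bl_comm, h])]
  change finrank F K' + 1 = finrank F K ∨ finrank F K' = finrank F K + 1
  by_cases hdi : d ∈ LinearMap.range ((g : V →ₗ[F] V) - LinearMap.id)
  · right
    obtain ⟨u, hu⟩ := hdi
    have hu' : d = g u + u := by
      rw [← hu, LinearMap.sub_apply, sub_v F]; rfl
    have hQd : Q d = bl Q d u := by
      rw [hu', Q_add, isom_Q hg, map_add, LinearMap.add_apply, bl_self]
      linear_combination (Q u) * two_eq F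
    have huK : u ∈ K' := by
      rw [mK', r_apply, bl_comm, ← hQd, mul_inv_cancel₀ hd, one_smul, hu', add_comm (g u),
        add_add_cancel_v F]
    have hle : K ≤ LinearMap.ker (bl Q d) := by
      intro v hv
      rw [mK] at hv
      rw [LinearMap.mem_ker, hu', map_add, LinearMap.add_apply]
      nth_rewrite 1 [← hv]
      rw [isom_bl hg]
      linear_combination (bl Q u v) * two_eq F
    have := finrank_inf_ker K' (bl Q d) huK (by rw [← hQd]; exact hd)
    rw [← hinf, inf_eq_left.2 hle] at this
    exact this.symm
  · left
    have hdi' : d ∉ span F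
        (LinearMap.range ((g : V →ₗ[F] V) - LinearMap.id) : Set V) := by
      rwa [Submodule.span_eq]
    obtain ⟨w, hw, hw1⟩ := exists_perp hQ hdi'
    have hwK : w ∈ K := by
      rw [mK, ← sub_eq_zero]
      apply hQ
      intro v
      obtain ⟨v, rfl⟩ := g.surjective v
      rw [map_sub, LinearMap.sub_apply, isom_bl hg]
      have := hw (((g : V →ₗ[F] V) - (LinearMap.id : V →ₗ[F] V)) v) ⟨v, rfl⟩
      rw [LinearMap.sub_apply, map_sub, LinearMap.sub_apply, bl_comm, sub_eq_zero] at this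
      change bl Q w (g v) = bl Q v w at this
      rw [this, bl_comm, sub_self]
    have hle : K' ≤ LinearMap.ker (bl Q d) := by
      intro v hv
      rw [mK', r_apply] at hv
      rw [LinearMap.mem_ker, bl_comm]
      by_contra hc
      apply hdi
      refine ⟨(bl Q v d * (Q d)⁻¹)⁻¹ • v, ?_⟩
      rw [map_smul, LinearMap.sub_apply]
      change _ • (g v - v) = d
      rw [hv, add_sub_cancel_left, smul_smul, inv_mul_cancel₀ (mul_ne_zero hc (inv_ne_zero hd)),
        one_smul]
    have := finrank_inf_ker K (bl Q d) hwK (by rw [hw1]; exact one_ne_zero)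
    rw [hinf, inf_eq_left.2 hle] at this
    exact this

theorem exists_split [FiniteDimensional F V] {U : Set V} (hU : Ample Q U) {a w : V}
    (ha : Q a = 0) (haw : bl Q a w = 0) (hw : Q w = 0) :
    ∃ y, Perp Q U y ∧ bl Q a y = 0 ∧ bl Q w y = 0 ∧ Q y ≠ 0 ∧ Q (w + y) ≠ 0 ∧
      bl Q a (w + y) = 0 ∧ S Q a w = S Q a (w + y) * S Q a y := by
  obtain ⟨y, h1, h2, h3, h4⟩ := hU a w
  have h5 : bl Q a (w + y) = 0 := by rw [map_add, haw, h2, add_zero]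
  refine ⟨y, h1, h2, h3, h4, by rw [Q_add, hw, h3]; simpa, h5, ?_⟩
  rw [← S_add ha h5 h2, add_assoc, add_self_v F, add_zero]

theorem S_eq_r' {a w : V} (ha : Q a = 0) (haw : bl Q a w = 0) (hw : Q w ≠ 0) :
    ∃ d, Q d ≠ 0 ∧ bl Q a d = 0 ∧ S Q a w = r Q d * r Q (d + a) := by
  have hQ : Q ((Q w)⁻¹ • w) = (Q w)⁻¹ := by rw [Q_smul]; field_simp
  refine ⟨(Q w)⁻¹ • w, by rw [hQ]; exact inv_ne_zero hw, by simp [haw], ?_⟩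
  rw [← S_eq_r ha (by rw [hQ]; exact inv_ne_zero hw) (by simp [haw]), hQ, smul_smul, inv_inv,
    mul_inv_cancel₀ hw, one_smul]

theorem fixDim_S_mul [FiniteDimensional F V] (hQ : Nondeg Q) (hA : Ample Q ∅) {g : V ≃ₗ[F] V}
    (hg : g ∈ isom Q) (a w : V) : (fixDim (S Q a w * g) + fixDim g) % 2 = 0 := by
  have key : ∀ w, ∀ g ∈ isom Q, Q a = 0 → bl Q a w = 0 → Q w ≠ 0 →
      (fixDim (S Q a w * g) + fixDim g) % 2 = 0 := by
    intro w g hg ha haw hw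
    obtain ⟨d, hd, had, e⟩ := S_eq_r' ha haw hw
    rw [e, mul_assoc]
    have h1 := fixDim_r_mul hQ hg (d := d + a) (by rw [Q_add, ha, bl_comm, had]; simpa)
    have h2 := fixDim_r_mul hQ (mul_mem (r_isom (d + a)) hg) hd
    omega
  by_cases h : Q a = 0 ∧ bl Q a w = 0
  · by_cases hw : Q w = 0
    · obtain ⟨y, h1, h2, h3, h4, h5, h6, h7⟩ := exists_split hA h.1 h.2 hw
      have e1 := key y g hg h.1 h2 h4
      have e2 := key (w + y) _ (mul_mem (S_isom a y) hg) h.1 h6 h5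
      rw [h7, mul_assoc]
      omega
    · exact key w g hg h.1 h.2 hw
  · rw [S, dif_neg h, one_mul]; omega

theorem fixDim_El [FiniteDimensional F V] (hQ : Nondeg Q) (hA : Ample Q ∅) {s : V ≃ₗ[F] V}
    (hs : s ∈ El Q ∅) : ∀ g ∈ isom Q, (fixDim (s * g) + fixDim g) % 2 = 0 := by
  have hle : El Q ∅ ≤ isom Q := (El_le_RS _).trans (RS_le_isom _)
  induction hs using Subgroup.closure_induction with
  | mem x hx =>
    obtain ⟨a, w, _, _, rfl⟩ := hx
    exact fun g hg => fixDim_S_mul hQ hA hg a w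
  | one => intro g _; rw [one_mul]; omega
  | mul x y hx hy ihx ihy =>
    intro g hg
    have h1 := ihy g hg
    have h2 := ihx (y * g) (mul_mem (hle hy) hg)
    rw [mul_assoc]; omega
  | inv x hx ihx =>
    intro g hg
    have h2 := ihx (x⁻¹ * g) (mul_mem (inv_mem (hle hx)) hg)
    rw [mul_inv_cancel_left] at h2; omega

theorem r_notMem_El [FiniteDimensional F V] (hQ : Nondeg Q) (hA : Ample Q ∅) {d : V}
    (hd : Q d ≠ 0) : r Q d ∉ El Q ∅ := by
  intro h
  have h1 := fixDim_El hQ hA h 1 (one_mem _)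
  have h2 := fixDim_r_mul hQ (one_mem _) hd
  omega

variable [Finite F] [FiniteDimensional F V]

/-- Pointwise stabilizers in `El Q ∅` are generated by Siegel transformations. -/
theorem mem_El_of_fix (hQ : Nondeg Q) (hA : Ample Q ∅) {U : Set V} (hU : Ample Q U)
    {g : V ≃ₗ[F] V} (hg : g ∈ El Q ∅) (hgU : g ∈ fixer F U) : g ∈ El Q U := by
  obtain ⟨d, hd, -, -, hd'⟩ := hU 0 0
  have hRS : g ∈ RS Q U := by
    rw [← isom_inf_fixer hQ]
    exact ⟨((El_le_RS _).trans (RS_le_isom _)) hg, hgU⟩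
  refine (RS_cases hU hd hd' hRS).resolve_right fun h => ?_
  have := mul_mem (inv_mem hg) (El_mono (Set.empty_subset U) h)
  rw [inv_mul_cancel_left] at this
  exact r_notMem_El hQ hA hd' this

/-- An isometry may be replaced by an element of `El Q ∅` without changing the images of vectors
orthogonal to a given nonsingular vector. -/
theorem exists_El_of_isom (hQ : Nondeg Q) (hA : Ample Q ∅) {g : V ≃ₗ[F] V} (hg : g ∈ isom Q)
    {d : V} (hd : Q d ≠ 0) : ∃ h ∈ El Q ∅, ∀ v, bl Q (g v) d = 0 → h v = g v := by
  have hRS : g ∈ RS Q ∅ := mem_RS_of_fix hQ hg (finrank F V) ∅ (by omega)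
    (fun u hu => absurd hu (Set.notMem_empty u))
  obtain h | h := RS_cases hA perp_empty hd hRS
  · exact ⟨g, h, fun v _ => rfl⟩
  · refine ⟨r Q d * g, ?_, fun v hv => by rw [LinearEquiv.mul_apply, r_fix hv]⟩
    have := El_conj (r_isom d) (fun u hu => absurd hu (Set.notMem_empty u)) h
    rwa [r_inv, mul_assoc, mul_assoc, r_mul_r, mul_one] at this

theorem commutator_isom (hQ : Nondeg Q) (hA : Ample Q ∅) (hA1 : ∀ a, Ample Q {a}) :
    ⁅isom Q, isom Q⁆ = El Q ∅ := by
  apply le_antisymm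
  · obtain ⟨d, hd, -, -, hd'⟩ := hA 0 0
    have hf : ∀ g, g ∈ fixer F (∅ : Set V) := fun g u hu => absurd hu (Set.notMem_empty u)
    set N := (El Q ∅).subgroupOf (isom Q) with hN
    have hNn : N.Normal := ⟨fun n hn g => by
      rw [hN, Subgroup.mem_subgroupOf] at hn ⊢
      exact El_conj g.2 (hf _) hn⟩
    have hq : ∀ x : (isom Q) ⧸ N, x = 1 ∨ x = QuotientGroup.mk ⟨r Q d, r_isom d⟩ := by
      intro x
      obtain ⟨g, rfl⟩ := QuotientGroup.mk_surjective x
      have hRS : g.1 ∈ RS Q ∅ := mem_RS_of_fix hQ g.2 (finrank F V) ∅ (by omega) (hf _)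
      obtain h | h := RS_cases hA perp_empty hd' hRS
      · left; exact (QuotientGroup.eq_one_iff g).2 h
      · right
        rw [eq_comm, QuotientGroup.eq]
        change (r Q d)⁻¹ * g.1 ∈ El Q ∅
        have := El_conj (r_isom d) (hf _) h
        rwa [r_inv, mul_assoc, mul_assoc, r_mul_r, mul_one] at this
    rw [Subgroup.commutator_le]
    intro g hg h hh
    have hcomm : (QuotientGroup.mk ⟨g, hg⟩ : (isom Q) ⧸ N) * QuotientGroup.mk ⟨h, hh⟩ =
        QuotientGroup.mk ⟨h, hh⟩ * QuotientGroup.mk ⟨g, hg⟩ := by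
      obtain h1 | h1 := hq (QuotientGroup.mk ⟨g, hg⟩) <;>
        obtain h2 | h2 := hq (QuotientGroup.mk ⟨h, hh⟩) <;> rw [h1, h2] <;> simp
    set g' : isom Q := ⟨g, hg⟩
    set h' : isom Q := ⟨h, hh⟩
    have h5 : ((g' * h' * g'⁻¹ * h'⁻¹ : isom Q) : (isom Q) ⧸ N) = 1 := by
      rw [QuotientGroup.mk_mul, QuotientGroup.mk_mul, QuotientGroup.mk_mul,
        hcomm, QuotientGroup.mk_inv, QuotientGroup.mk_inv]
      group
    exact (QuotientGroup.eq_one_iff (N := N) _).1 h5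
  · refine (Subgroup.closure_le _).2 ?_
    rintro g ⟨a, w, -, -, rfl⟩
    have key : ∀ w, Q a = 0 → bl Q a w = 0 → Q w ≠ 0 → S Q a w ∈ ⁅isom Q, isom Q⁆ := by
      intro w ha haw hw
      obtain ⟨d, hd, had, e⟩ := S_eq_r' ha haw hw
      have hQe : Q (d + a) = Q d := by rw [Q_add, ha, bl_comm, had]; simp
      have hne : ∀ x, Q x ≠ 0 → x ∉ span F (∅ : Set V) := fun x hx h => by
        rw [Submodule.span_empty, Submodule.mem_bot] at h
        exact hx (by rw [h]; simp)
      obtain ⟨g, hg, hgd⟩ := witt_step hQ (hne d hd) (hne (d + a) (by rwa [hQe])) hQe.symm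
        (fun y hy => absurd hy (Set.notMem_empty y))
      have := Subgroup.commutator_mem_commutator (r_isom (Q := Q) d) (RS_le_isom _ hg)
      rwa [commutatorElement_def, r_inv, mul_assoc, mul_assoc, ← mul_assoc g,
        r_conj (RS_le_isom _ hg), hgd, ← e] at this
    by_cases h : Q a = 0 ∧ bl Q a w = 0
    · by_cases hw : Q w = 0
      · obtain ⟨y, h1, h2, h3, h4, h5, h6, h7⟩ := exists_split (hA1 a) h.1 h.2 hw
        rw [h7]
        exact mul_mem (key _ h.1 h6 h5) (key _ h.1 h2 h4)
      · exact key w h.1 h.2 hw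
    · rw [S, dif_neg h]; exact one_mem _

end Parity

section Count

open Finset Classical

variable {F V : Type} [Field F] [AddCommGroup V] [Module F V] [CharP F 2]
variable {Q : QuadraticForm F V}

theorem card_fiber {W : Type} [AddCommGroup W] [Module F W] [Fintype W] [Fintype F]
    (f : W →ₗ[F] F) (hf : f ≠ 0) (c : F) :
    (univ.filter fun w => f w = c).card * Fintype.card F = Fintype.card W := by
  have hs : Function.Surjective f := LinearMap.surjective hf
  have h1 : ∀ c', (univ.filter fun w => f w = c').card = (univ.filter fun w => f w = c).card :=
    fun c' => AddMonoidHom.card_fiber_eq_of_mem_range f.toAddMonoidHom (hs c') (hs c)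
  have h2 := Finset.card_eq_sum_card_fiberwise (f := f) (s := univ) (t := univ)
    (fun _ _ => by simp)
  rw [Finset.sum_congr rfl fun c' _ => h1 c', sum_const, card_univ, card_univ, smul_eq_mul] at h2
  rw [h2, mul_comm]

/-- Translation by a totally singular subspace equidistributes the values of `Q`. -/
theorem card_Q_eq [Fintype V] [Fintype F] (U : Submodule F V) (hU : ∀ u ∈ U, Q u = 0)
    (P : Finset V) (hP : ∀ v ∈ P, ∀ u ∈ U, v + u ∈ P) (hP' : ∀ v ∈ P, ∃ u ∈ U, bl Q v u ≠ 0)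
    (s : F) : (P.filter fun v => Q v = s).card * Fintype.card F = P.card := by
  have h1 : ∑ v ∈ P, (univ.filter fun u : U => Q (v + u) = s).card =
      (P.filter fun v => Q v = s).card * Fintype.card U := by
    simp_rw [card_filter]
    rw [sum_comm]
    have : ∀ u : U, ∑ v ∈ P, (if Q (v + u) = s then 1 else 0) =
        ∑ v ∈ P, (if Q v = s then 1 else 0) := fun u => by
      refine sum_bij' (fun v _ => v + u) (fun v _ => v + u) ?_ ?_ ?_ ?_ ?_
      · exact fun v hv => hP v hv u u.2
      · exact fun v hv => hP v hv u u.2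
      · intro v _; rw [add_assoc, add_self_v F, add_zero]
      · intro v _; rw [add_assoc, add_self_v F, add_zero]
      · intro v _; rfl
    rw [sum_congr rfl fun u _ => this u, sum_const, card_univ, smul_eq_mul, mul_comm]
  have h2 : ∀ v ∈ P, (univ.filter fun u : U => Q (v + u) = s).card * Fintype.card F =
      Fintype.card U := by
    intro v hv
    obtain ⟨u, hu, huv⟩ := hP' v hv
    rw [← card_fiber ((bl Q v).domRestrict U) (fun h => huv ?_) (s - Q v)]
    · congr 2
      ext u
      rw [mem_filter, mem_filter, Q_add, hU u u.2, LinearMap.domRestrict_apply, eq_sub_iff_add_eq]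
      simp only [mem_univ, true_and, add_zero]
      rw [add_comm]
    · exact LinearMap.congr_fun h ⟨u, hu⟩
  have h3 : 0 < Fintype.card U := Fintype.card_pos
  have h4 : (∑ v ∈ P, (univ.filter fun u : U => Q (v + u) = s).card) * Fintype.card F =
      P.card * Fintype.card U := by
    rw [sum_mul, sum_congr rfl h2, sum_const, smul_eq_mul]
  rw [h1] at h4
  refine Nat.eq_of_mul_eq_mul_right h3 ?_
  rw [← h4]; ring

/-- The orthogonal complement of a set. -/
def orth (Q : QuadraticForm F V) (U : Set V) : Submodule F V where
  carrier := {d | Perp Q U d}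
  add_mem' h h' := h.add h'
  zero_mem' := fun u _ => map_zero _
  smul_mem' c _ h := h.smul c

@[simp] theorem mem_orth {U : Set V} {d : V} : d ∈ orth Q U ↔ Perp Q U d := Iff.rfl

theorem orth_span (U : Set V) : orth Q (span F U : Set V) = orth Q U := by
  ext d
  exact ⟨fun h => h.mono subset_span, fun h u hu => h.span hu⟩

theorem finrank_orth [FiniteDimensional F V] (hQ : Nondeg Q) (U : Set V) :
    finrank F (orth Q U) + finrank F (span F U) = finrank F V := by
  have hB : (bl Q : LinearMap.BilinForm F V).Nondegenerate := by
    have hs : (bl Q : LinearMap.BilinForm F V).IsSymm := ⟨fun v w => bl_comm Q v w⟩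
    refine ⟨fun v hv => hQ v hv, fun v hv => hQ v fun w => by rw [bl_comm]; exact hv w⟩
  have h1 := LinearMap.BilinForm.finrank_orthogonal hB
    (span F U)
  have h2 : LinearMap.BilinForm.orthogonal (bl Q) (span F U) = orth Q U := by
    rw [← orth_span]
    ext d
    exact Iff.rfl
  rw [h2] at h1
  have h3 := Submodule.finrank_le (span F U)
  omega

/-- The number of singular vectors. -/
noncomputable def nsing (Q : QuadraticForm F V) : ℕ := Nat.card {v // Q v = 0}

/-- `Q` is nondegenerate of dimension `2 * k`, with the number of zeros of a form of type `α`. -/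
structure IsType (Q : QuadraticForm F V) (k : ℕ) (α : ℤ) : Prop where
  pos : 0 < k
  nondeg : Nondeg Q
  rank : finrank F V = 2 * k
  sign : α = 1 ∨ α = -1
  card : (Nat.card F : ℤ) * nsing Q =
    (Nat.card F : ℤ) ^ (2 * k) + α * ((Nat.card F : ℤ) - 1) * (Nat.card F : ℤ) ^ k

theorem nsing_totSing [Fintype V] [Fintype F] [FiniteDimensional F V] (hQ : Nondeg Q)
    (U : Submodule F V) (hU : ∀ u ∈ U, Q u = 0) :
    Fintype.card F * nsing Q + Fintype.card F ^ finrank F (orth Q (U : Set V)) =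
      Fintype.card F ^ finrank F V +
        Fintype.card F * (univ.filter fun v => v ∈ orth Q (U : Set V) ∧ Q v = 0).card := by
  set P : Finset V := univ.filter fun v => v ∉ orth Q (U : Set V) with hP
  have hUU : ∀ u ∈ U, u ∈ orth Q (U : Set V) := fun u hu w hw => by
    have := hU _ (U.add_mem hu hw)
    rw [Q_add, hU u hu, hU w hw, zero_add, zero_add] at this
    rw [bl_comm, this]
  have h1 := card_Q_eq U hU P (fun v hv u hu => by
    rw [hP, mem_filter] at hv ⊢
    refine ⟨mem_univ _, fun h => hv.2 ?_⟩
    have := Submodule.add_mem _ h (hUU u hu)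
    rwa [add_assoc, add_self_v F, add_zero] at this) (fun v hv => by
    rw [hP, mem_filter] at hv
    by_contra hc
    push Not at hc
    exact hv.2 fun u hu => by rw [bl_comm]; exact hc u hu) 0
  have h2 : P.card + Fintype.card (orth Q (U : Set V)) = Fintype.card V := by
    rw [Fintype.card_subtype, add_comm, hP]
    exact card_filter_add_card_filter_not _
  have h3 : nsing Q = (P.filter fun v => Q v = 0).card +
      (univ.filter fun v => v ∈ orth Q (U : Set V) ∧ Q v = 0).card := by
    rw [nsing, Nat.card_eq_fintype_card, Fintype.card_subtype, hP, filter_filter, add_comm,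
      ← card_union_of_disjoint]
    · congr 1
      ext v
      simp only [mem_union, mem_filter, mem_univ, true_and]
      tauto
    · rw [disjoint_filter]
      tauto
  rw [← card_eq_pow_finrank, ← card_eq_pow_finrank (K := F) (V := V), ← h2, ← h1, h3]
  ring

theorem IsType.totSing_le [Finite F] [FiniteDimensional F V] {k : ℕ} {α : ℤ} (h : IsType Q k α)
    (U : Submodule F V) (hU : ∀ u ∈ U, Q u = 0) :
    finrank F U ≤ k ∧ (α = -1 → finrank F U + 1 ≤ k) := by
  have := finite_of_finite F (M := V)
  have := Fintype.ofFinite V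
  have := Fintype.ofFinite F
  have h1 := nsing_totSing h.nondeg U hU
  have hUU : U ≤ orth Q (U : Set V) := fun u hu w hw => by
    have := hU _ (U.add_mem hu hw)
    rw [Q_add, hU u hu, hU w hw, zero_add, zero_add] at this
    rw [bl_comm, this]
  have h2 := finrank_orth h.nondeg (U : Set V)
  rw [Submodule.span_eq, h.rank] at h2
  have h3 := Submodule.finrank_mono hUU
  have h4 : finrank F U ≤ k := by omega
  refine ⟨h4, fun hα => ?_⟩
  by_contra hc
  have h5 : finrank F U = k := by omega
  have h6 : finrank F (orth Q (U : Set V)) = k := by omega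
  have h7 := Submodule.eq_of_le_of_finrank_eq hUU (by omega)
  rw [← h7, h5, h.rank] at h1
  have h8 : (univ.filter fun v => v ∈ U ∧ Q v = 0).card = Fintype.card F ^ k := by
    rw [← h5, ← card_eq_pow_finrank, Fintype.card_subtype]
    congr 1
    ext v
    simp only [mem_filter, mem_univ, true_and]
    exact ⟨fun h => h.1, fun h => ⟨h, hU v h⟩⟩
  rw [h8] at h1
  have h9 := h.card
  rw [hα, Nat.card_eq_fintype_card] at h9
  have hq : 2 ≤ Fintype.card F := Fintype.one_lt_card
  have h10 : (Fintype.card F : ℤ) * nsing Q + (Fintype.card F : ℤ) ^ k =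
      (Fintype.card F : ℤ) ^ (2 * k) + Fintype.card F * (Fintype.card F : ℤ) ^ k := by
    exact_mod_cast h1
  have h11 : (0 : ℤ) < (Fintype.card F : ℤ) ^ k := by positivity
  have h12 : (2 : ℤ) ≤ Fintype.card F := by exact_mod_cast hq
  nlinarith

end Count

section Count2

open Finset Classical

variable {F V : Type} [Field F] [AddCommGroup V] [Module F V] [CharP F 2]
variable {Q : QuadraticForm F V}

/-- The restriction of `Q` to a subspace. -/
noncomputable def res (Q : QuadraticForm F V) (W : Submodule F V) : QuadraticForm F W :=
  Q.comp W.subtype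

@[simp] theorem res_apply (W : Submodule F V) (w : W) : res Q W w = Q w := rfl

@[simp] theorem bl_res (W : Submodule F V) (v w : W) : bl (res Q W) v w = bl Q v w := rfl

/-- A hyperbolic pair. -/
structure Hyp (Q : QuadraticForm F V) (e f : V) : Prop where
  e0 : Q e = 0
  f0 : Q f = 0
  ef : bl Q e f = 1

/-- The complement of a hyperbolic pair. -/
abbrev hc (Q : QuadraticForm F V) (e f : V) : Submodule F V := orth Q {e, f}

theorem Hyp.fe {e f : V} (h : Hyp Q e f) : bl Q f e = 1 := by rw [bl_comm, h.ef]

theorem Hyp.symm {e f : V} (h : Hyp Q e f) : Hyp Q f e := ⟨h.f0, h.e0, h.fe⟩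

theorem Hyp.ne {e f : V} (h : Hyp Q e f) : e ≠ 0 := by
  rintro rfl
  have := h.ef
  simp at this

theorem Hyp.be {e f : V} (h : Hyp Q e f) (w : hc Q e f) : bl Q e w = 0 := w.2 e (by simp)

theorem Hyp.bf {e f : V} (h : Hyp Q e f) (w : hc Q e f) : bl Q f w = 0 := w.2 f (by simp)

/-- The orthogonal projection to the complement of a hyperbolic pair. -/
noncomputable def Hyp.pr {e f : V} (h : Hyp Q e f) : V →ₗ[F] hc Q e f :=
  LinearMap.codRestrict _
    (LinearMap.id + (bl Q f).smulRight e + (bl Q e).smulRight f) (by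
      intro v
      rw [mem_orth, perp_insert, perp_singleton]
      simp [h.ef, h.fe, add_self_eq_zero'])
where
  add_self_eq_zero' : ∀ x : F, x + x = 0 := fun x => by linear_combination x * two_eq F

theorem Hyp.pr_coe {e f : V} (h : Hyp Q e f) (v : V) :
    (h.pr v : V) = v + bl Q f v • e + bl Q e v • f := rfl

theorem Hyp.decomp {e f : V} (h : Hyp Q e f) (v : V) :
    v = h.pr v + bl Q f v • e + bl Q e v • f := by
  rw [h.pr_coe]
  have h3 := two_eq F
  match_scalars <;> grind

theorem Hyp.pr_of_mem {e f : V} (h : Hyp Q e f) (w : hc Q e f) : h.pr w = w := by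
  apply Subtype.ext
  rw [h.pr_coe, h.be, h.bf]; simp

theorem Hyp.bl_pr {e f : V} (h : Hyp Q e f) (v : V) (w : hc Q e f) :
    bl Q (h.pr v) w = bl Q v w := by
  rw [h.pr_coe]; simp [h.be, h.bf]

theorem Hyp.nondeg {e f : V} (h : Hyp Q e f) (hQ : Nondeg Q) : Nondeg (res Q (hc Q e f)) := by
  intro v hv
  apply Subtype.ext
  apply hQ
  intro w
  rw [bl_comm, ← h.bl_pr, bl_comm]
  exact hv _

theorem Hyp.finrank [FiniteDimensional F V] {e f : V} (h : Hyp Q e f) (hQ : Nondeg Q) :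
    finrank F (hc Q e f) + 2 = finrank F V := by
  have h1 := finrank_orth hQ {e, f}
  have h2 : LinearIndependent F ![e, f] := by
    rw [LinearIndependent.pair_iff]
    intro s t hst
    have h1 := congrArg (bl Q e) hst
    have h2 := congrArg (bl Q f) hst
    simp [h.ef] at h1
    simp [h.fe] at h2
    exact ⟨h2, h1⟩
  have h3 := finrank_span_eq_card h2
  rw [Matrix.range_cons, Matrix.range_cons, Matrix.range_empty, Set.union_empty,
    Set.singleton_union, Fintype.card_fin] at h3
  rw [h3] at h1
  exact h1

theorem perp_span_singleton {e v : V} :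
    Perp Q (span F {e} : Set V) v ↔ bl Q e v = 0 := by
  rw [← mem_orth, orth_span, mem_orth, perp_singleton]

theorem Hyp.card_perp_sing [Fintype V] [Fintype F] {e f : V} (h : Hyp Q e f) :
    (univ.filter fun v => bl Q e v = 0 ∧ Q v = 0).card =
      Fintype.card F * nsing (res Q (hc Q e f)) := by
  rw [nsing, ← Fintype.card_subtype, ← Nat.card_eq_fintype_card, ← Nat.card_eq_fintype_card,
    ← Nat.card_prod]
  refine Nat.card_congr ⟨fun v => (bl Q f v.1, ⟨h.pr v.1, ?_⟩),
    fun p => ⟨p.1 • e + (p.2.1 : V), ?_, ?_⟩, ?_, ?_⟩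
  · rw [res_apply, h.pr_coe, v.2.1]
    rw [zero_smul, add_zero, Q_add, Q_smul, v.2.2, h.e0, map_smul, bl_comm Q (v : V) e, v.2.1]; simp
  · simp [h.be]
  · rw [Q_add, Q_smul, h.e0, map_smul, LinearMap.smul_apply, h.be]
    have : Q (p.2.1 : V) = 0 := p.2.2
    rw [this]; simp
  · rintro ⟨v, hv1, hv2⟩
    apply Subtype.ext
    change bl Q f v • e + (h.pr v : V) = v
    conv_rhs => rw [h.decomp v, hv1]
    rw [zero_smul, add_zero, add_comm]
  · rintro ⟨c, w, hw⟩
    have h1 : bl Q f (c • e + (w : V)) = c := by simp [h.bf, h.fe]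
    refine Prod.ext h1 (Subtype.ext ?_)
    change h.pr (c • e + (w : V)) = w
    rw [map_add, map_smul, h.pr_of_mem]
    have : h.pr e = 0 := Subtype.ext (by
      rw [h.pr_coe, h.fe, bl_self, one_smul, zero_smul, add_zero, add_self_v F]; rfl)
    rw [this, smul_zero, zero_add]

theorem card_orth_singleton_sing [Fintype V] [Fintype F] [FiniteDimensional F V] (hQ : Nondeg Q)
    {e : V} (he : Q e = 0) (he0 : e ≠ 0) :
    Fintype.card F * nsing Q + Fintype.card F ^ (finrank F V - 1) =
      Fintype.card F ^ finrank F V +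
        Fintype.card F * (univ.filter fun v => bl Q e v = 0 ∧ Q v = 0).card := by
  have h1 := nsing_totSing hQ (span F {e}) (by
    intro u hu
    obtain ⟨c, rfl⟩ := mem_span_singleton.1 hu
    rw [Q_smul, he, mul_zero])
  have h2 := finrank_orth hQ (span F {e} : Set V)
  rw [Submodule.span_eq, finrank_span_singleton he0] at h2
  rw [show finrank F V - 1 = finrank F (orth Q (span F {e} : Set V)) by
    omega, h1]
  simp_rw [mem_orth, perp_span_singleton]

variable [Finite F] [FiniteDimensional F V]

theorem Hyp.isType {k : ℕ} {α : ℤ} (h : IsType Q (k + 1) α) (hk : 0 < k) {e f : V}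
    (hef : Hyp Q e f) : IsType (res Q (hc Q e f)) k α := by
  have := finite_of_finite F (M := V)
  have := Fintype.ofFinite V
  have := Fintype.ofFinite F
  have h1 := hef.finrank h.nondeg
  refine ⟨hk, hef.nondeg h.nondeg, ?_, h.sign, ?_⟩
  · rw [h.rank] at h1; omega
  · have h2 := card_orth_singleton_sing h.nondeg hef.e0 hef.ne
    rw [hef.card_perp_sing, h.rank] at h2
    have h3 := h.card
    rw [Nat.card_eq_fintype_card] at h3 ⊢
    have h4 : 2 * (k + 1) - 1 = 2 * k + 1 := by omega
    rw [h4] at h2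
    have h5 : (Fintype.card F : ℤ) * nsing Q + (Fintype.card F : ℤ) ^ (2 * k + 1) =
      (Fintype.card F : ℤ) ^ (2 * (k + 1)) + Fintype.card F *
        (Fintype.card F * nsing (res Q (hc Q e f))) := by exact_mod_cast h2
    rw [h3] at h5
    have h6 : (Fintype.card F : ℤ) ≠ 0 := by exact_mod_cast Fintype.card_ne_zero
    apply mul_left_cancel₀ h6
    linear_combination -h5

/-- Vectors orthogonal to `U` which are not singular. -/
theorem IsType.exists_nonsing_perp {k : ℕ} {α : ℤ} (h : IsType Q k α) {U : Set V} {u : ℕ}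
    (hu : finrank F (span F U) ≤ u) (hk : u < k ∨ α = -1 ∧ u ≤ k) :
    ∃ y, Perp Q U y ∧ Q y ≠ 0 := by
  by_contra hc
  push Not at hc
  have h1 := h.totSing_le (orth Q U) (fun v hv => hc v hv)
  have h2 := finrank_orth h.nondeg U
  rw [h.rank] at h2
  obtain hk | ⟨h3, hk⟩ := hk
  · omega
  · have := h1.2 h3; omega

theorem finrank_span_insert_le {a : V} {U : Set V} {u : ℕ}
    (hu : finrank F (span F U) ≤ u) :
    finrank F (span F (insert a U)) ≤ u + 1 := by
  rw [Submodule.span_insert]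
  have h1 := Submodule.finrank_add_le_finrank_add_finrank (span F {a}) (span F U)
  have h2 : finrank F (span F {a}) ≤ 1 := by
    have := finrank_span_finset_le_card (R := F) ({a} : Finset V)
    change Set.finrank F {a} ≤ 1
    simpa using this
  omega

theorem finrank_span_empty_le : finrank F (span F (∅ : Set V)) ≤ 0 := by simp

theorem finrank_span_singleton_le {a : V} :
    finrank F (span F ({a} : Set V)) ≤ 1 := by
  rw [← insert_empty_eq]
  exact finrank_span_insert_le finrank_span_empty_le

theorem IsType.exists_nonsing {k : ℕ} {α : ℤ} (h : IsType Q k α) {U : Set V} {u : ℕ}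
    (hu : finrank F (span F U) ≤ u) (hk : u < k) {s : F} (hs : s ≠ 0) :
    ∃ y, Perp Q U y ∧ y ∉ span F U ∧ Q y = s := by
  have key : ∃ y, Perp Q U y ∧ y ∉ span F U ∧ Q y ≠ 0 := by
    obtain ⟨y, hy, hQy⟩ := h.exists_nonsing_perp hu (Or.inl hk)
    by_cases hyU : y ∈ span F U
    · have h2 := finrank_orth h.nondeg U
      rw [h.rank] at h2
      have h3 : ∃ z ∈ orth Q U, z ∉ span F U := by
        by_contra hc
        push Not at hc
        have := Submodule.finrank_mono (show orth Q U ≤ span F U from hc)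
        omega
      obtain ⟨z, hz, hzU⟩ := h3
      by_cases hQz : Q z = 0
      · refine ⟨z + y, hz.add hy, fun hc => hzU ?_, ?_⟩
        · have := Submodule.add_mem _ hc hyU
          rwa [add_assoc, add_self_v F, add_zero] at this
        · have hyz : bl Q y z = 0 := Perp.span hz hyU
          rw [Q_add, hQz, bl_comm, hyz]; simpa
      · exact ⟨z, hz, hzU, hQz⟩
    · exact ⟨y, hy, hyU, hQy⟩
  obtain ⟨y, hy, hyU, hQy⟩ := key
  obtain ⟨c, hc⟩ := exists_sqrt F (s * (Q y)⁻¹)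
  have hc0 : c ≠ 0 := by
    rintro rfl
    rw [zero_mul, eq_comm, mul_eq_zero] at hc
    exact hc.elim hs (inv_ne_zero hQy)
  refine ⟨c • y, hy.smul c, fun h => hyU ?_, ?_⟩
  · have := Submodule.smul_mem _ c⁻¹ h
    rwa [smul_smul, inv_mul_cancel₀ hc0, one_smul] at this
  · rw [Q_smul, hc, inv_mul_cancel_right₀ hQy]

theorem IsType.exists_sing {k : ℕ} {α : ℤ} (h : IsType Q k α) {U : Set V} {u : ℕ}
    (hu : finrank F (span F U) ≤ u) (hk : u + 1 < k) :
    ∃ y, Perp Q U y ∧ y ∉ span F U ∧ Q y = 0 := by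
  obtain ⟨y, hy, hyU, hQy⟩ := h.exists_nonsing hu (by omega) one_ne_zero
  obtain ⟨z, hz, hzU, hQz⟩ := h.exists_nonsing (finrank_span_insert_le (a := y) hu) hk one_ne_zero
  rw [perp_insert] at hz
  refine ⟨z + y, hz.2.add hy, fun hc => hzU ?_, ?_⟩
  · have h1 := Submodule.add_mem _ (Submodule.span_mono (Set.subset_insert y U) hc)
      (subset_span (Set.mem_insert y U))
    rwa [add_assoc, add_self_v F, add_zero] at h1
  · rw [Q_add, hQy, hQz, bl_comm, hz.1]
    linear_combination two_eq F

theorem IsType.ample' {k : ℕ} {α : ℤ} (h : IsType Q k α) {U : Set V} {u : ℕ}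
    (hu : finrank F (span F U) ≤ u) (hk : u + 2 < k ∨ α = -1 ∧ u + 2 ≤ k) :
    Ample Q U := by
  intro d d'
  obtain ⟨m, h1, h2⟩ := h.exists_nonsing_perp
    (finrank_span_insert_le (a := d) (finrank_span_insert_le (a := d') hu)) hk
  rw [perp_insert, perp_insert] at h1
  exact ⟨m, h1.2.2, h1.1, h1.2.1, h2⟩

end Count2

section WittType

open Finset Classical

theorem odd_finrank_of_rad {F : Type} [Field F] [CharP F 2] : ∀ (m : ℕ) (V : Type) [AddCommGroup V]
    [Module F V] [FiniteDimensional F V] (B : V →ₗ[F] V →ₗ[F] F), (∀ v, B v v = 0) →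
    finrank F V = m → ∀ v0 : V, v0 ≠ 0 → B v0 = 0 →
    (∀ v, B v = 0 → v ∈ span F {v0}) → Odd m := by
  intro m
  induction m using Nat.strong_induction_on with
  | _ m ih =>
    intro V _ _ _ B hB hm v0 hv0 h0 hr
    have hsymm : ∀ v w, B v w = - B w v := fun v w => by
      have := hB (v + w)
      simp only [map_add, LinearMap.add_apply, hB, zero_add, add_zero] at this
      rw [eq_neg_iff_add_eq_zero, add_comm, this]
    by_cases hz : B = 0
    · have : span F {v0} = ⊤ := by
        rw [eq_top_iff]
        intro v _
        exact hr v (by rw [hz]; rfl)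
      rw [← hm, ← finrank_top F V, ← this, finrank_span_singleton hv0]
      exact odd_one
    · have hex : ∃ e f, B e f ≠ 0 := by
        by_contra hc
        push Not at hc
        exact hz (LinearMap.ext fun e => LinearMap.ext fun f => hc e f)
      obtain ⟨e, f, hef⟩ := hex
      have h1 := finrank_inf_ker (⊤ : Submodule F V) (B e) (x := f) trivial hef
      have h2 := finrank_inf_ker (⊤ ⊓ LinearMap.ker (B e)) (B f) (x := e) ⟨trivial, hB e⟩
        (by rw [hsymm]; exact neg_ne_zero.2 hef)
      rw [finrank_top] at h1
      set W := (⊤ ⊓ LinearMap.ker (B e)) ⊓ LinearMap.ker (B f) with hW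
      have hWm : ∀ v, v ∈ W ↔ B e v = 0 ∧ B f v = 0 := fun v => by
        rw [hW]; simp
      have hv0W : v0 ∈ W := by
        rw [hWm, hsymm, hsymm f, h0]; simp
      have := ih (m - 2) (by omega) W ((B.domRestrict W).compl₂ W.subtype) (fun v => hB v)
        (by omega) ⟨v0, hv0W⟩ (fun h => hv0 (congrArg Subtype.val h))
        (by ext w; change B v0 w = 0; rw [h0]; rfl) (by
          intro v hv
          have hvr : B v = 0 := by
            ext x
            have hx : x - (B e x / B e f) • f + (B f x / B e f) • e ∈ W := by
              rw [hWm]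
              simp only [map_add, map_sub, map_smul, hB, smul_eq_mul]
              rw [hsymm f e]
              constructor <;> field_simp <;> ring
            have h5 := LinearMap.congr_fun hv ⟨_, hx⟩
            change B v (x - (B e x / B e f) • f + (B f x / B e f) • e) = 0 at h5
            have h6 := (hWm v).1 v.2
            rw [map_add, map_sub, map_smul, map_smul, hsymm v f, hsymm v e, h6.1, h6.2] at h5
            simpa using h5
          obtain ⟨c, hc⟩ := mem_span_singleton.1 (hr v hvr)
          exact mem_span_singleton.2 ⟨c, Subtype.ext hc⟩)
      have h7 : m = (m - 2) + 2 := by omega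
      rw [h7]
      exact this.add_even even_two

variable {F V : Type} [Field F] [AddCommGroup V] [Module F V] [CharP F 2]
variable {Q : QuadraticForm F V} [Finite F] [FiniteDimensional F V]

theorem nondeg_of_even {n : ℕ} (hd : finrank F V = 2 * n)
    (hQ : ∀ v, (∀ w, bl Q v w = 0) → Q v = 0 → v = 0) : Nondeg Q := by
  intro v0 hv0
  by_contra hne
  have hq : Q v0 ≠ 0 := fun h => hne (hQ v0 hv0 h)
  have := odd_finrank_of_rad _ V (bl Q) (fun v => bl_self Q v) hd v0 hne
    (LinearMap.ext hv0) (fun v hv => by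
      obtain ⟨c, hc⟩ := exists_sqrt F (Q v * (Q v0)⁻¹)
      have : v + c • v0 = 0 := by
        apply hQ
        · intro w
          rw [map_add, map_smul, LinearMap.add_apply, LinearMap.smul_apply, hv, hv0]; simp
        · rw [Q_add, Q_smul, hc, inv_mul_cancel_right₀ hq, hv]
          simp only [LinearMap.zero_apply, add_zero]
          linear_combination Q v * two_eq F
      refine mem_span_singleton.2 ⟨c, ?_⟩
      rw [← add_add_cancel_v F (c • v0) v, add_comm (c • v0) v, this, add_zero])
  rw [Nat.odd_iff] at this
  omega

theorem isType_of_witt {n : ℕ} (hn : 0 < n) {α : ℤ} (hα : α = 1 ∨ α = -1)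
    (hd : finrank F V = 2 * n)
    (hQ : ∀ v, (∀ w, bl Q v w = 0) → Q v = 0 → v = 0) (W : Submodule F V)
    (hW : ∀ x ∈ W, Q x = 0) (hWd : finrank F W = if α = 1 then n else n - 1)
    (hmax : ∀ W' : Submodule F V, (∀ x ∈ W', Q x = 0) →
      finrank F W' ≤ finrank F W) : IsType Q n α := by
  have := finite_of_finite F (M := V)
  have := Fintype.ofFinite V
  have := Fintype.ofFinite F
  have hnd := nondeg_of_even hd hQ
  refine ⟨hn, hnd, hd, hα, ?_⟩
  have h1 := nsing_totSing hnd W hW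
  have h2 := finrank_orth hnd (W : Set V)
  rw [Submodule.span_eq, hd] at h2
  have hs : ∀ v, (v ∈ orth Q (W : Set V) ∧ Q v = 0) ↔ v ∈ W := by
    intro v
    constructor
    · rintro ⟨h3, h4⟩
      by_contra h5
      have h6 := hmax (W ⊔ span F {v}) (by
        intro x hx
        obtain ⟨y, hy, z, hz, rfl⟩ := Submodule.mem_sup.1 hx
        obtain ⟨c, rfl⟩ := mem_span_singleton.1 hz
        rw [Q_add, hW y hy, Q_smul, h4, map_smul, h3 y hy]; simp)
      have h7 := Submodule.eq_of_le_of_finrank_le le_sup_left h6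
      apply h5
      rw [h7]
      exact Submodule.mem_sup_right (Submodule.mem_span_singleton_self v)
    · intro hv
      refine ⟨fun u hu => ?_, hW v hv⟩
      have := hW _ (W.add_mem hu hv)
      rwa [Q_add, hW u hu, hW v hv, zero_add, zero_add] at this
  have h3 : (univ.filter fun v => v ∈ orth Q (W : Set V) ∧ Q v = 0).card =
      Fintype.card F ^ finrank F W := by
    simp_rw [hs]
    rw [← card_eq_pow_finrank, Fintype.card_subtype]
  rw [h3, hd] at h1
  rw [Nat.card_eq_fintype_card]
  obtain rfl | rfl := hα
  · rw [if_pos rfl] at hWd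
    rw [hWd, show finrank F (orth Q (W : Set V)) = n by omega] at h1
    have h5 : (Fintype.card F : ℤ) * nsing Q + (Fintype.card F : ℤ) ^ n =
      (Fintype.card F : ℤ) ^ (2 * n) + Fintype.card F * (Fintype.card F : ℤ) ^ n := by
      exact_mod_cast h1
    linear_combination h5
  · rw [if_neg (by norm_num)] at hWd
    rw [hWd, show finrank F (orth Q (W : Set V)) = n + 1 by omega, ← pow_succ',
      show n - 1 + 1 = n by omega] at h1
    have h5 : (Fintype.card F : ℤ) * nsing Q + (Fintype.card F : ℤ) ^ (n + 1) =
      (Fintype.card F : ℤ) ^ (2 * n) + (Fintype.card F : ℤ) ^ n := by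
      exact_mod_cast h1
    linear_combination h5

/-- The number of vectors of a given norm. -/
noncomputable def nval (Q : QuadraticForm F V) (s : F) : ℕ := Nat.card {v // Q v = s}

theorem nval_eq {s : F} (hs : s ≠ 0) : nval Q s = nval Q 1 := by
  obtain ⟨c, hc⟩ := exists_sqrt F s
  have hc0 : c ≠ 0 := by rintro rfl; exact hs (by rw [← hc, zero_mul])
  refine Nat.card_congr ⟨fun v => ⟨c⁻¹ • v.1, ?_⟩, fun v => ⟨c • v.1, ?_⟩, ?_, ?_⟩
  · rw [Q_smul, v.2, ← hc]; field_simp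
  · rw [Q_smul, v.2, ← hc, mul_one]
  · intro v; apply Subtype.ext; simp [smul_smul, hc0]
  · intro v; apply Subtype.ext; simp [smul_smul, hc0]

theorem IsType.nval_one {k : ℕ} {α : ℤ} (h : IsType Q k α) :
    (Nat.card F : ℤ) * nval Q 1 = (Nat.card F : ℤ) ^ (2 * k) - α * (Nat.card F : ℤ) ^ k := by
  have := finite_of_finite F (M := V)
  have := Fintype.ofFinite V
  have := Fintype.ofFinite F
  have h1 : Nat.card V = ∑ s : F, nval Q s := by
    rw [← Nat.card_congr (Equiv.sigmaFiberEquiv Q), Nat.card_sigma]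
    rfl
  rw [← add_sum_erase _ _ (mem_univ (0 : F)), sum_congr rfl
    (fun s hs => nval_eq (ne_of_mem_erase hs)), sum_const, card_erase_of_mem (mem_univ _), card_univ,
    smul_eq_mul] at h1
  have h2 : Nat.card V = Nat.card F ^ (2 * k) := by
    rw [← h.rank, Module.natCard_eq_pow_finrank (K := F)]
  have h3 := h.card
  rw [h2, ← Nat.card_eq_fintype_card] at h1
  have hq : 1 < Nat.card F := Finite.one_lt_card
  obtain ⟨p, hp⟩ : ∃ p, Nat.card F = p + 1 := ⟨Nat.card F - 1, by omega⟩
  have h4 : ((Nat.card F ^ (2 * k) : ℕ) : ℤ) = nsing Q + (p : ℤ) * nval Q 1 := by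
    rw [h1, hp]; push_cast; simp [nval, nsing]
  rw [hp] at h4 h3 ⊢
  push_cast at h4 h3 ⊢
  have h5 : (p : ℤ) ≠ 0 := by
    have : p ≠ 0 := by omega
    exact_mod_cast this
  apply mul_left_cancel₀ h5
  linear_combination (-(p:ℤ) - 1) * h4 - h3

end WittType

section Psi

variable (F : Type) [Field F] [Finite F]

/-- A nontrivial additive character of `F`. -/
noncomputable def psi : AddChar F ℂ :=
  ((AddChar.exists_apply_ne_zero (a := (1 : F))).2 one_ne_zero).choose

theorem psi_ne : psi F 1 ≠ 1 :=
  ((AddChar.exists_apply_ne_zero (a := (1 : F))).2 one_ne_zero).choose_spec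

variable {F}

theorem psi_zero : psi F 0 = 1 := AddChar.map_zero_eq_one _

theorem psi_add (x y : F) : psi F (x + y) = psi F x * psi F y := AddChar.map_add_eq_mul _ _ _

theorem psi_mul_self [CharP F 2] (x : F) : psi F x * psi F x = 1 := by
  rw [← psi_add, show x + x = 0 by linear_combination x * two_eq F, psi_zero]

theorem psi_cases [CharP F 2] (x : F) : psi F x = 1 ∨ psi F x = -1 :=
  mul_self_eq_one_iff.1 (psi_mul_self x)

theorem psi_conj [CharP F 2] (x : F) : (starRingEnd ℂ) (psi F x) = psi F x := by
  obtain h | h := psi_cases x <;> rw [h] <;> simp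

theorem psi_ne_zero [CharP F 2] (x : F) : psi F x ≠ 0 := by
  obtain h | h := psi_cases x <;> rw [h] <;> simp

theorem sum_psi_lin {W : Type} [AddCommGroup W] [Module F W] [Fintype W] (f : W →ₗ[F] F)
    (hf : f ≠ 0) : ∑ w, psi F (f w) = 0 := by
  have h : (psi F).compAddMonoidHom f.toAddMonoidHom ≠ 1 := by
    intro h
    obtain ⟨w, hw⟩ := LinearMap.surjective hf 1
    have := DFunLike.congr_fun h w
    rw [AddChar.compAddMonoidHom_apply] at this
    change psi F (f w) = 1 at this
    rw [hw] at this
    exact psi_ne F this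
  exact AddChar.sum_eq_zero_of_ne_one h

theorem sum_psi_mul [Fintype F] {a : F} (ha : a ≠ 0) : ∑ s, psi F (s * a) = 0 :=
  sum_psi_lin (LinearMap.mulRight F a) fun h => ha (by
    have := LinearMap.congr_fun h 1
    simpa using this)

theorem exists_psi_mul_ne {a : F} (ha : a ≠ 0) : ∃ s, psi F (s * a) ≠ 1 :=
  ⟨a⁻¹, by rw [inv_mul_cancel₀ ha]; exact psi_ne F⟩

end Psi

section Rep

open Finset Classical

variable {F V : Type} [Field F] [AddCommGroup V] [Module F V] [CharP F 2] [Finite F]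
  [FiniteDimensional F V]
variable {Q : QuadraticForm F V}

/-- The group generated by all Siegel transformations. -/
abbrev Om (Q : QuadraticForm F V) : Type := ↥(El Q ∅)

instance : Finite (V ≃ₗ[F] V) := by
  have := finite_of_finite F (M := V)
  exact Finite.of_injective (fun g : V ≃ₗ[F] V => (g : V → V)) DFunLike.coe_injective

/-- Siegel transformations as elements of `Om Q`. -/
noncomputable def sg (Q : QuadraticForm F V) (a w : V) : Om Q :=
  ⟨S Q a w, S_mem_El perp_empty perp_empty⟩

@[simp] theorem sg_coe (a w : V) : (sg Q a w : V ≃ₗ[F] V) = S Q a w := rfl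

theorem Om.isom (g : Om Q) : g.1 ∈ OC.isom Q := (El_le_RS _).trans (RS_le_isom _) g.2

theorem Om.bl (g : Om Q) (v w : V) : bl Q (g.1 v) (g.1 w) = bl Q v w := isom_bl g.isom v w

theorem Om.quad (g : Om Q) (v : V) : Q (g.1 v) = Q v := isom_Q g.isom v

theorem Om.bl_inv (g : Om Q) (v w : V) : OC.bl Q (g.1 v) w = OC.bl Q v (g⁻¹.1 w) :=
  isom_bl' g.isom v w

theorem sg_conj (g : Om Q) (a w : V) : g * sg Q a w = sg Q (g.1 a) (g.1 w) * g := by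
  exact mul_inv_eq_iff_eq_mul.1 (Subtype.ext (S_conj g.isom a w))

theorem sg_add {a w w' : V} (ha : Q a = 0) (h : bl Q a w = 0) (h' : bl Q a w' = 0) :
    sg Q a (w + w') = sg Q a w * sg Q a w' := Subtype.ext (S_add ha h h')

theorem sg_zero (a : V) : sg Q a 0 = 1 := Subtype.ext (S_zero a)

theorem sg_smul_left {a w : V} {c : F} (ha : Q a = 0) (h : bl Q a w = 0) :
    sg Q (c • a) w = sg Q a (c • w) := Subtype.ext (S_smul_left ha h)

theorem sg_self {a : V} (ha : Q a = 0) (c : F) : sg Q a (c • a) = 1 := Subtype.ext (S_self ha c)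

theorem sg_swap {a w : V} (ha : Q a = 0) (hw : Q w = 0) (h : bl Q a w = 0) :
    sg Q a w = sg Q w a := Subtype.ext (S_swap ha hw h)

theorem sg_add_left {a b w : V} (ha : Q a = 0) (hb : Q b = 0) (hab : bl Q a b = 0)
    (haw : bl Q a w = 0) (hbw : bl Q b w = 0) :
    sg Q (a + b) w = sg Q a w * sg Q b w * sg Q a (Q w • b) :=
  Subtype.ext (S_add_left ha hb hab haw hbw)

theorem sg_junk {a w : V} (h : ¬(Q a = 0 ∧ bl Q a w = 0)) : sg Q a w = 1 :=
  Subtype.ext (by rw [sg_coe, S, dif_neg h]; rfl)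

theorem Om.induction {p : Om Q → Prop} (h1 : p 1) (hm : ∀ g h, p g → p h → p (g * h))
    (hs : ∀ a w, Q a = 0 → OC.bl Q a w = 0 → p (sg Q a w)) (g : Om Q) : p g := by
  have hs' : ∀ a w, p (sg Q a w) := fun a w => by
    by_cases h : Q a = 0 ∧ OC.bl Q a w = 0
    · exact hs a w h.1 h.2
    · rw [sg_junk h]; exact h1
  obtain ⟨g, hg⟩ := g
  have hfin : IsOfFinOrder g := isOfFinOrder_of_finite g
  have key : ∀ g (hg : g ∈ Submonoid.closure {g | ∃ a w, Perp Q ∅ a ∧ Perp Q ∅ w ∧ g = S Q a w}),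
      ∀ hg' : g ∈ El Q ∅, p ⟨g, hg'⟩ := by
    intro g hg
    induction hg using Submonoid.closure_induction with
    | mem x hx =>
      obtain ⟨a, w, _, _, rfl⟩ := hx
      exact fun _ => hs' a w
    | one => exact fun _ => h1
    | mul x y hx hy ihx ihy =>
      intro h
      have hle : Submonoid.closure {g | ∃ a w, Perp Q ∅ a ∧ Perp Q ∅ w ∧ g = S Q a w} ≤
        (El Q ∅).toSubmonoid := (Submonoid.closure_le).2 Subgroup.subset_closure
      exact hm ⟨x, hle hx⟩ ⟨y, hle hy⟩ (ihx _) (ihy _)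
  refine key g ?_ hg
  have := hg
  rw [El, ← Subgroup.mem_toSubmonoid, Subgroup.closure_toSubmonoid_of_finite] at this
  exact this

variable {M : Type} [AddCommGroup M] [Module ℂ M] (ρ : Representation ℂ (Om Q) M)

theorem rho_mul (g h : Om Q) (m : M) : ρ (g * h) m = ρ g (ρ h m) := by rw [map_mul]; rfl

theorem rho_sg_conj (g : Om Q) (a w : V) (m : M) :
    ρ g (ρ (sg Q a w) m) = ρ (sg Q (g.1 a) (g.1 w)) (ρ g m) := by
  rw [← rho_mul, sg_conj, rho_mul]

theorem rho_inv_self (g : Om Q) (m : M) : ρ g (ρ g⁻¹ m) = m := by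
  rw [← rho_mul, mul_inv_cancel, map_one]; rfl

theorem rho_self_inv (g : Om Q) (m : M) : ρ g⁻¹ (ρ g m) = m := by
  rw [← rho_mul, inv_mul_cancel, map_one]; rfl

theorem rho_one (m : M) : ρ 1 m = m := by rw [map_one]; rfl

/-- The eigenspace of the group of Siegel transformations at `e`. -/
def wsp (e x : V) : Submodule ℂ M where
  carrier := {m | ∀ w, bl Q e w = 0 → ρ (sg Q e w) m = psi F (bl Q w x) • m}
  add_mem' h h' w hw := by rw [map_add, h w hw, h' w hw, smul_add]
  zero_mem' w hw := by rw [map_zero, smul_zero]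
  smul_mem' c m h w hw := by rw [map_smul, h w hw, smul_comm]

theorem rho_mem_wsp {e x : V} {m : M} (h : m ∈ wsp ρ e x) (g : Om Q) :
    ρ g m ∈ wsp ρ (g.1 e) (g.1 x) := by
  intro w hw
  have h1 := h (g⁻¹.1 w) (by rw [← g.bl_inv]; exact hw)
  have h2 := congrArg (ρ g) h1
  have h3 : g.1 (g⁻¹.1 w) = w := by
    rw [← LinearEquiv.mul_apply, ← Subgroup.coe_mul, mul_inv_cancel]; rfl
  rw [rho_sg_conj, h3, map_smul, bl_comm, ← g.bl_inv, bl_comm] at h2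
  exact h2

theorem mem_wsp_smul {e x : V} {m : M} (he : Q e = 0) {c : F} (hc : c ≠ 0) :
    m ∈ wsp ρ (c • e) x ↔ m ∈ wsp ρ e (c⁻¹ • x) := by
  have hbl : ∀ w, bl Q (c • e) w = 0 ↔ bl Q e w = 0 := fun w => by
    rw [map_smul, LinearMap.smul_apply, smul_eq_zero]; simp [hc]
  constructor
  · intro h w hw
    have h1 := h (c⁻¹ • w) (by rw [hbl, map_smul, hw, smul_zero])
    rw [sg_smul_left he (by rw [map_smul, hw, smul_zero]), smul_smul, mul_inv_cancel₀ hc,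
      one_smul] at h1
    rw [h1]; simp
  · intro h w hw
    rw [hbl] at hw
    have h1 := h (c • w) (by rw [map_smul, hw, smul_zero])
    rw [sg_smul_left he hw, h1]
    congr 2
    simp only [map_smul, LinearMap.smul_apply, smul_eq_mul]
    field_simp

theorem wsp_disjoint {e x y : V} {w : V} (hw : bl Q e w = 0) (hxy : psi F (bl Q w x) ≠ psi F (bl Q w y))
    {m : M} (hx : m ∈ wsp ρ e x) (hy : m ∈ wsp ρ e y) : m = 0 := by
  have := hx w hw
  rw [hy w hw, ← sub_eq_zero, ← sub_smul, smul_eq_zero, sub_eq_zero] at this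
  exact this.resolve_left (Ne.symm hxy)

variable [Fintype V]

/-- The projection onto `wsp ρ e x`, for `x` in the complement of a hyperbolic pair. -/
noncomputable def wproj (e f x : V) : M →ₗ[ℂ] M :=
  (Fintype.card (hc Q e f) : ℂ)⁻¹ • ∑ w : hc Q e f, psi F (bl Q (w : V) x) • ρ (sg Q e w)

theorem wproj_isProj {e f : V} (h : Hyp Q e f) (x : V) (hx : bl Q e x = 0) :
    LinearMap.IsProj (wsp ρ e x) (wproj ρ e f x) := by
  have hc0 : (Fintype.card (hc Q e f) : ℂ) ≠ 0 := by
    exact_mod_cast Fintype.card_ne_zero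
  constructor
  · intro m w hw
    set w1 := h.pr w with hw1
    have hw2 : w = (w1 : V) + bl Q f w • e := by
      conv_lhs => rw [h.decomp w, hw, zero_smul, add_zero]
    have h1 : sg Q e w = sg Q e w1 := by
      rw [hw2, sg_add h.e0 (h.be w1) (by simp), sg_self h.e0, mul_one]
    have h2 : bl Q w x = bl Q (w1 : V) x := by
      rw [hw2, map_add, map_smul, LinearMap.add_apply, LinearMap.smul_apply, hx, smul_zero,
        add_zero]
    rw [h1, h2, wproj, LinearMap.smul_apply, map_smul, smul_comm]
    congr 1
    rw [LinearMap.sum_apply, map_sum, smul_sum]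
    refine Fintype.sum_equiv (Equiv.addRight w1) _ _ fun u => ?_
    rw [LinearMap.smul_apply, map_smul, ← rho_mul, ← sg_add h.e0 (h.be w1) (h.be u),
      LinearMap.smul_apply, smul_smul, Equiv.coe_addRight, Submodule.coe_add, map_add,
      LinearMap.add_apply, psi_add, add_comm (w1 : V)]
    congr 1
    have := psi_mul_self (bl Q (w1 : V) x)
    linear_combination (-psi F (bl Q (u : V) x)) * this
  · intro m hm
    rw [wproj, LinearMap.smul_apply, LinearMap.sum_apply]
    have : ∀ w : hc Q e f, (psi F (bl Q (w : V) x) • ρ (sg Q e w)) m = m := fun w => by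
      rw [LinearMap.smul_apply, hm w (h.be w), smul_smul, psi_mul_self, one_smul]
    rw [sum_congr rfl fun w _ => this w, sum_const, card_univ, ← Nat.cast_smul_eq_nsmul ℂ,
      smul_smul, inv_mul_cancel₀ hc0, one_smul]

theorem sum_wproj (hQ : Nondeg Q) {e f : V} (h : Hyp Q e f) :
    ∑ x : hc Q e f, wproj ρ e f x = LinearMap.id := by
  have hc0 : (Fintype.card (hc Q e f) : ℂ) ≠ 0 := by
    exact_mod_cast Fintype.card_ne_zero
  simp_rw [wproj]
  rw [← smul_sum, sum_comm]
  simp_rw [← sum_smul]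
  rw [sum_eq_single 0]
  · simp only [ZeroMemClass.coe_zero, map_zero, LinearMap.zero_apply, psi_zero, sum_const,
      card_univ, sg_zero, map_one, nsmul_eq_mul, mul_one]
    rw [smul_smul, inv_mul_cancel₀ hc0, one_smul]; rfl
  · intro w _ hw
    have := sum_psi_lin (F := F) (bl (res Q (hc Q e f)) w) (fun h0 => hw (h.nondeg hQ w fun v => by
      rw [h0]; rfl))
    simp only [bl_res] at this
    rw [this, zero_smul]
  · simp

theorem finrank_eq_sum_wsp [FiniteDimensional ℂ M] (hQ : Nondeg Q) {e f : V} (h : Hyp Q e f) :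
    finrank ℂ M = ∑ x : hc Q e f, finrank ℂ (wsp ρ e x) := by
  have h1 := congrArg (LinearMap.trace ℂ M) (sum_wproj ρ hQ h)
  rw [map_sum, LinearMap.trace_id,
    sum_congr rfl fun (x : hc Q e f) _ => (wproj_isProj ρ h x (h.be x)).trace] at h1
  exact_mod_cast h1.symm

theorem exists_wsp_ne_bot (hQ : Nondeg Q) {e f : V} (h : Hyp Q e f)
    (ht : ∀ x : hc Q e f, x ≠ 0 → wsp ρ e x = ⊥) (w : V) (hw : bl Q e w = 0) (m : M) :
    ρ (sg Q e w) m = m := by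
  have h1 : m ∈ wsp ρ e ((0 : hc Q e f) : V) := by
    have h2 := LinearMap.congr_fun (sum_wproj ρ hQ h) m
    rw [LinearMap.sum_apply, sum_eq_single 0] at h2
    · rw [LinearMap.id_apply] at h2
      rw [← h2]
      exact (wproj_isProj ρ h _ (by simp)).map_mem m
    · intro x _ hx
      have := (wproj_isProj ρ h x (h.be x)).map_mem m
      rwa [ht x hx, Submodule.mem_bot] at this
    · simp
  have := h1 w hw
  simpa [psi_zero] using this

end Rep

section Transport

open Finset Classical

variable {F V : Type} [Field F] [AddCommGroup V] [Module F V] [CharP F 2] [Finite F]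
  [FiniteDimensional F V]
variable {Q : QuadraticForm F V}

theorem notMem_span_insert {e v : V} {s : Set V} (hv : v ∉ span F (insert e s))
    (he : e ∉ span F s) : e ∉ span F (insert v s) := fun h =>
  hv (mem_span_insert_exchange h he)

theorem notMem_span_singleton {e x : V} (he : e ≠ 0) (hx : x ∉ span F {e}) :
    e ∉ span F {x} := by
  rw [← insert_empty_eq] at hx ⊢
  exact notMem_span_insert hx (by simpa using he)

theorem notMem_of_subset {v : V} {s t : Set V} (h : v ∉ span F t) (hst : s ⊆ t) :
    v ∉ span F s := fun hc => h (Submodule.span_mono hst hc)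

theorem notMem_of_bl {U : Set V} {v w : V} (hw : Perp Q U w) (h : bl Q v w ≠ 0) :
    v ∉ span F U := fun hc => h (hw.span hc)

theorem notMem_add {U : Set V} {v w : V} (hv : v ∈ span F U) (h : w ∉ span F U) :
    w + v ∉ span F U := fun hc => h (by
      have := Submodule.add_mem _ hc hv
      rwa [add_assoc, add_self_v F, add_zero] at this)

theorem Q_mem_span_eq_zero {U : Set V} (h : ∀ u ∈ U, Q u = 0) (h' : ∀ u ∈ U, Perp Q U u) {v : V}
    (hv : v ∈ span F U) : Q v = 0 := by
  have key : ∀ v ∈ span F U, Q v = 0 ∧ Perp Q U v := by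
    intro v hv
    induction hv using Submodule.span_induction with
    | mem x hx => exact ⟨h x hx, h' x hx⟩
    | zero => exact ⟨by simp, fun u _ => by simp⟩
    | add x y hx hy ihx ihy =>
      exact ⟨by rw [Q_add, ihx.1, ihy.1, ihy.2.span hx]; simp, ihx.2.add ihy.2⟩
    | smul c x _ ih => exact ⟨by rw [Q_smul, ih.1, mul_zero], ih.2.smul c⟩
  exact (key v hv).1

/-- Witt's theorem for the group generated by Siegel transformations. -/
theorem exists_map (hQ : Nondeg Q) (hA : Ample Q ∅) {U : Set V} {u u' d : V}
    (hu : u ∉ span F U) (hu' : u' ∉ span F U) (h : Q u = Q u')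
    (hb : ∀ y ∈ U, bl Q y u = bl Q y u') (hd : Q d ≠ 0) (hdU : Perp Q U d) (hdu : bl Q u' d = 0) :
    ∃ g : Om Q, g.1 u = u' ∧ ∀ y ∈ U, g.1 y = y := by
  obtain ⟨g, hg, hgu⟩ := witt_step hQ hu hu' h hb
  obtain ⟨h, hh, hhg⟩ := exists_El_of_isom hQ hA (RS_le_isom _ hg) hd
  have hgU := RS_le_fixer _ hg
  refine ⟨⟨h, hh⟩, ?_, fun y hy => ?_⟩
  · exact (hhg u (by rw [hgu, hdu])).trans hgu
  · have h1 : g y = y := hgU y hy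
    exact (hhg y (by rw [h1, hdU y hy])).trans h1

theorem IsType.exists_map {k : ℕ} {α : ℤ} (h : IsType Q k α) (hk : 2 < k ∨ α = -1 ∧ 2 ≤ k)
    {U : Set V} {m : ℕ} (hU : finrank F (span F U) ≤ m)
    (hm : m + 1 < k ∨ α = -1 ∧ m + 1 ≤ k) {u u' : V}
    (hu : u ∉ span F U) (hu' : u' ∉ span F U) (hq : Q u = Q u')
    (hb : ∀ y ∈ U, bl Q y u = bl Q y u') :
    ∃ g : Om Q, g.1 u = u' ∧ ∀ y ∈ U, g.1 y = y := by
  obtain ⟨d, hd, hd0⟩ := h.exists_nonsing_perp (finrank_span_insert_le (a := u') hU) hm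
  rw [perp_insert] at hd
  exact OC.exists_map h.nondeg (h.ample' finrank_span_empty_le (by simpa using hk)) hu hu' hq hb hd0
    hd.2 hd.1

theorem IsType.exists_map_sing {k : ℕ} {α : ℤ} (h : IsType Q k α)
    (hk : 2 < k ∨ α = -1 ∧ 2 ≤ k) {e e' : V} (he : Q e = 0) (he' : Q e' = 0) (h0 : e ≠ 0)
    (h0' : e' ≠ 0) : ∃ g : Om Q, g.1 e = e' := by
  obtain ⟨g, hg, -⟩ := h.exists_map hk (U := ∅) finrank_span_empty_le (by omega)
    (u := e) (u' := e') (by simpa) (by simpa) (by rw [he, he']) (by simp)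
  exact ⟨g, hg⟩

theorem Om.map_span (g : Om Q) {U : Set V} {v : V} :
    g.1 v ∈ span F (g.1 '' U) ↔ v ∈ span F U := by
  have : span F (g.1 '' U) = (span F U).map (g.1 : V →ₗ[F] V) := by
    rw [Submodule.map_span]; rfl
  rw [this]
  constructor
  · rintro ⟨w, hw, h⟩
    have : w = v := g.1.injective h
    rwa [← this]
  · exact fun h => ⟨v, h, rfl⟩

theorem Om.notMem_singleton (g : Om Q) {e v : V} (h : v ∉ span F {e}) :
    g.1 v ∉ span F {g.1 e} := by
  have := g.map_span (U := {e}) (v := v)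
  rw [Set.image_singleton] at this
  rwa [this]

theorem Om.ne_zero (g : Om Q) {e : V} (h : e ≠ 0) : g.1 e ≠ 0 := fun hc =>
  h (g.1.injective (by rw [hc, map_zero]))

theorem IsType.exists_map_pair {k : ℕ} {α : ℤ} (h : IsType Q k α)
    (hk : 2 < k ∨ α = -1 ∧ 2 ≤ k) {e e' x x' : V} (he : Q e = 0) (he' : Q e' = 0) (h0 : e ≠ 0)
    (h0' : e' ≠ 0) (hx : x ∉ span F {e}) (hx' : x' ∉ span F {e'})
    (hq : Q x = Q x') (hb : bl Q e x = bl Q e' x') : ∃ g : Om Q, g.1 e = e' ∧ g.1 x = x' := by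
  obtain ⟨g, rfl⟩ := h.exists_map_sing hk he he' h0 h0'
  obtain ⟨g', hg', hg''⟩ := h.exists_map hk (U := {g.1 e}) finrank_span_singleton_le (by omega)
    (u := g.1 x) (u' := x') (g.notMem_singleton hx) hx' (by rw [g.quad, hq]) (by
      intro y hy
      rw [Set.mem_singleton_iff.1 hy, g.bl, hb])
  refine ⟨g' * g, ?_, ?_⟩
  · rw [Subgroup.coe_mul, LinearEquiv.mul_apply, hg'' _ rfl]
  · rw [Subgroup.coe_mul, LinearEquiv.mul_apply, hg']

/-- Every singular vector has a hyperbolic partner orthogonal to a given set. -/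
theorem exists_hyp (hQ : Nondeg Q) {U : Set V} {e : V} (he : Q e = 0)
    (hU : e ∉ span F U) (heU : Perp Q U e) : ∃ f, Hyp Q e f ∧ Perp Q U f := by
  obtain ⟨f, hf, hef⟩ := exists_perp hQ hU
  refine ⟨f + Q f • e, ⟨he, ?_, ?_⟩, hf.add (heU.smul _)⟩
  · rw [Q_add, Q_smul, he, map_smul, bl_comm, hef, smul_eq_mul]
    linear_combination Q f * two_eq F
  · rw [map_add, hef, map_smul, bl_self, smul_zero, add_zero]

variable {M : Type} [AddCommGroup M] [Module ℂ M] (ρ : Representation ℂ (Om Q) M)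

/-- The stabilizer of `e` and `x` acts trivially on `wsp ρ e x`, on the level of generators. -/
def TT (ρ : Representation ℂ (Om Q) M) (e x : V) : Prop :=
  ∀ a w, Perp Q {e, x} a → Perp Q {e, x} w → ∀ m ∈ wsp ρ e x, ρ (sg Q a w) m = m

/-- The variant of `TT` for vectors in the complement of partners of `e` and `x`. -/
def TT0 (ρ : Representation ℂ (Om Q) M) (e x : V) : Prop :=
  ∀ f y, Hyp Q e f → Perp Q {x, y} e → Perp Q {x, y} f → bl Q x y = 1 → Q y = 0 →
    ∀ a w, Perp Q {e, f, x, y} a → Perp Q {e, f, x, y} w → ∀ m ∈ wsp ρ e x, ρ (sg Q a w) m = m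

theorem TT_of_TT0 {k : ℕ} {α : ℤ} (h : IsType Q k α) {e x : V} (he : Q e = 0) (he0 : e ≠ 0)
    (hx : x ∉ span F {e}) (hex : bl Q e x = 0)
    (hk : 5 ≤ k ∨ (4 ≤ k ∧ α = -1 ∧ Q x = 0)) (h0 : TT0 ρ e x) : TT ρ e x := by
  have h3 := two_eq F
  have hxe : bl Q x e = 0 := by rw [bl_comm, hex]
  intro a w ha hw m hm
  -- the main case
  have caseA : ∀ a w, Perp Q {e, x} a → Perp Q {e, x} w → a ∉ span F {x, e} →
      w ∉ span F {a, x, e} → Q w ≠ 0 → ρ (sg Q a w) m = m := by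
    intro a w ha hw hax hwx hw0
    by_cases hc : Q a = 0 ∧ bl Q a w = 0
    swap
    · rw [sg_junk hc, rho_one]
    simp only [perp_insert, perp_singleton] at ha hw
    have e1 : e ∉ span F {x} := notMem_span_singleton he0 hx
    have e2 : e ∉ span F {a, x} :=
      notMem_span_insert (notMem_of_subset hax (by grind)) e1
    have e3 : e ∉ span F {w, a, x} :=
      notMem_span_insert (notMem_of_subset hwx (by grind)) e2
    obtain ⟨f, hf, hfU⟩ := exists_hyp h.nondeg he e3 (by
      simp only [perp_insert, perp_singleton]
      exact ⟨by rw [bl_comm, hw.1], by rw [bl_comm, ha.1], hxe⟩)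
    simp only [perp_insert, perp_singleton] at hfU
    have x1 : x ∉ span F {a, e} := notMem_span_insert (notMem_of_subset hax (by grind)) hx
    have x2 : x ∉ span F {w, a, e} :=
      notMem_span_insert (notMem_of_subset hwx (by grind)) x1
    have f1 : f ∉ span F {x, w, a, e} := by
      refine notMem_of_bl (Q := Q) (w := e) ?_ (by rw [hf.fe]; exact one_ne_zero)
      simp only [perp_insert, perp_singleton]
      exact ⟨hxe, by rw [bl_comm, hw.1], by rw [bl_comm, ha.1], bl_self _ _⟩
    have x3 : x ∉ span F {f, w, a, e} :=
      notMem_span_insert f1 x2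
    obtain ⟨y0, hy0, hxy⟩ := exists_perp h.nondeg x3
    simp only [perp_insert, perp_singleton] at hy0
    obtain ⟨c, hc'⟩ := exists_sqrt F (Q y0 * (Q w)⁻¹)
    have b1 := bl_comm Q y0 w
    refine h0 f (y0 + c • w) hf ?_ ?_ ?_ ?_ a w ?_ ?_ m hm
    · simp only [perp_insert, perp_singleton]
      refine ⟨hxe, ?_⟩
      rw [bl_comm, map_add, hy0.2.2.2, map_smul, hw.1, smul_zero, add_zero]
    · simp only [perp_insert, perp_singleton]
      refine ⟨hfU.2.2, ?_⟩
      rw [bl_comm, map_add, hy0.1, map_smul, bl_comm, hfU.1, smul_zero, add_zero]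
    · rw [map_add, hxy, map_smul, hw.2, smul_zero, add_zero]
    · rw [Q_add, Q_smul, hc', map_smul, b1, hy0.2.1, inv_mul_cancel_right₀ hw0, smul_zero]
      linear_combination Q y0 * h3
    · simp only [perp_insert, perp_singleton]
      refine ⟨ha.1, by rw [bl_comm, hfU.2.1], ha.2, ?_⟩
      rw [bl_comm, map_add, hy0.2.2.1, map_smul, hc.2, smul_zero, add_zero]
    · simp only [perp_insert, perp_singleton]
      refine ⟨hw.1, by rw [bl_comm, hfU.1], hw.2, ?_⟩
      rw [bl_comm, map_add, hy0.2.1, map_smul, bl_self, smul_zero, add_zero]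
  -- splitting the second argument
  have split : ∀ a w y, Q a = 0 → bl Q a w = 0 → bl Q a y = 0 → ρ (sg Q a y) m = m →
      ρ (sg Q a (w + y)) m = m → ρ (sg Q a w) m = m := by
    intro a w y haa haw hay h1 h2
    have : w = (w + y) + y := by rw [add_assoc, add_self_v F, add_zero]
    rw [this, sg_add haa (by rw [map_add, haw, hay, add_zero]) hay, rho_mul, h1, h2]
  have caseB : ∀ a w, Perp Q {e, x} a → Perp Q {e, x} w → a ∉ span F {x, e} →
      w ∉ span F {a, x, e} → ρ (sg Q a w) m = m := by
    intro a w ha hw hax hwx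
    by_cases hc : Q a = 0 ∧ bl Q a w = 0
    swap
    · rw [sg_junk hc, rho_one]
    by_cases hw0 : Q w = 0
    swap
    · exact caseA a w ha hw hax hwx hw0
    have hfr : finrank F (span F {w, a, x, e}) ≤ 4 :=
      finrank_span_insert_le (finrank_span_insert_le (finrank_span_insert_le
        finrank_span_singleton_le))
    have ha' := ha
    have hw' := hw
    simp only [perp_insert, perp_singleton] at ha' hw'
    obtain ⟨y, hy, hyU, hy0⟩ : ∃ y, Perp Q {w, a, x, e} y ∧ y ∉ span F {w, a, x, e} ∧
        Q y ≠ 0 := by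
      obtain hk | ⟨hk, hα, hx0⟩ := hk
      · obtain ⟨y, h1, h2, h3⟩ := h.exists_nonsing hfr (by omega) one_ne_zero
        exact ⟨y, h1, h2, by rw [h3]; exact one_ne_zero⟩
      · obtain ⟨y, h1, h2⟩ := h.exists_nonsing_perp hfr (by omega)
        refine ⟨y, h1, fun hc' => h2 (Q_mem_span_eq_zero ?_ ?_ hc'), h2⟩
        · simp [hw0, hc.1, hx0, he]
        · simp [hc.2, hex, hxe, ha', hw', bl_comm Q w a, bl_comm Q w x, bl_comm Q w e,
            bl_comm Q a x, bl_comm Q a e]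
    simp only [perp_insert, perp_singleton] at hy
    have hyx : y ∉ span F {a, x, e} := notMem_of_subset hyU (by grind)
    have hyP : Perp Q {e, x} y := by simp [hy]
    refine split a w y hc.1 hc.2 hy.2.1 (caseA a y ha hyP hax hyx hy0)
      (caseA a (w + y) ha (hw.add hyP) hax ?_ ?_)
    · rw [add_comm]
      exact notMem_of_subset (notMem_add (subset_span (by simp)) hyU)
        (Set.subset_insert w _)
    · rw [Q_add, hw0, hy.1]; simpa
  have caseC : ∀ a w, Perp Q {e, x} a → Perp Q {e, x} w → a ∉ span F {x, e} →
      ρ (sg Q a w) m = m := by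
    intro a w ha hw hax
    by_cases hc : Q a = 0 ∧ bl Q a w = 0
    swap
    · rw [sg_junk hc, rho_one]
    by_cases hwx : w ∈ span F {a, x, e}
    swap
    · exact caseB a w ha hw hax hwx
    obtain ⟨y, hy, hyU, -⟩ := h.exists_nonsing (U := {a, x, e}) (u := 3) (finrank_span_insert_le
      (finrank_span_insert_le finrank_span_singleton_le)) (by omega) one_ne_zero
    simp only [perp_insert, perp_singleton] at hy
    have hyP : Perp Q {e, x} y := by simp [hy]
    refine split a w y hc.1 hc.2 hy.1 (caseB a y ha hyP hax hyU)
      (caseB a (w + y) ha (hw.add hyP) hax ?_)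
    rw [add_comm]
    exact notMem_add hwx hyU
  by_cases hax : a ∈ span F {x, e}
  swap
  · exact caseC a w ha hw hax
  by_cases hc : Q a = 0 ∧ bl Q a w = 0
  swap
  · rw [sg_junk hc, rho_one]
  have hw' := hw
  simp only [perp_insert, perp_singleton] at hw'
  obtain ⟨c, z, hz, rfl⟩ := Submodule.mem_span_insert.1 hax
  obtain ⟨c', rfl⟩ := mem_span_singleton.1 hz
  by_cases hcx : c • x = 0
  · rw [hcx, zero_add, sg_smul_left he hw'.1, hm _ (by rw [map_smul, hw'.1, smul_zero]),
      map_smul, LinearMap.smul_apply, bl_comm, hw'.2, smul_zero, psi_zero, one_smul]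
  have hc0 : c ≠ 0 := by rintro rfl; simp at hcx
  have hx0 : Q x = 0 := by
    have := hc.1
    rw [Q_add, Q_smul, Q_smul, he, map_smul, map_smul, LinearMap.smul_apply, hxe] at this
    simpa [hc0] using this
  obtain ⟨v, hv, hvw, hvU, hv0⟩ | hwm : (∃ v, Perp Q {e, x} v ∧ bl Q v w = 0 ∧
      v ∉ span F {x, e} ∧ Q v = 0) ∨ w ∈ span F {x, e} := by
    by_cases hw0 : Q w = 0
    · by_cases hwm : w ∈ span F {x, e}
      · exact Or.inr hwm
      · exact Or.inl ⟨w, hw, bl_self _ _, hwm, hw0⟩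
    · left
      obtain ⟨v, hv, hvU, -⟩ := h.exists_nonsing (U := {w, x, e}) (u := 3) (finrank_span_insert_le
        (finrank_span_insert_le finrank_span_singleton_le)) (by omega) one_ne_zero
      simp only [perp_insert, perp_singleton] at hv
      obtain ⟨t, ht⟩ := exists_sqrt F (Q v * (Q w)⁻¹)
      refine ⟨v + t • w, Perp.add (by simp [hv]) (hw.smul t), ?_, ?_, ?_⟩
      · rw [map_add, map_smul, LinearMap.add_apply, LinearMap.smul_apply, bl_comm, hv.1, bl_self,
          smul_zero, add_zero]
      · exact notMem_of_subset (notMem_add (Submodule.smul_mem _ t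
          (subset_span (by simp))) hvU) (Set.subset_insert w _)
      · rw [Q_add, Q_smul, ht, map_smul, bl_comm, hv.1, inv_mul_cancel_right₀ hw0, smul_zero]
        linear_combination Q v * h3
  · set a := c • x + c' • e with haa
    have hv' := hv
    simp only [perp_insert, perp_singleton] at hv'
    have hav : bl Q a v = 0 := by
      rw [haa]; simp [hv']
    have h1 : a = (a + v) + v := by rw [add_assoc, add_self_v F, add_zero]
    have hU : a + v ∉ span F {x, e} := by
      rw [add_comm]; exact notMem_add hax hvU
    rw [h1, sg_add_left (by rw [Q_add, hc.1, hv0, hav]; simp) hv0 (by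
      rw [map_add, LinearMap.add_apply, hav, bl_self, add_zero]) (by
      rw [map_add, LinearMap.add_apply, hc.2, hvw, add_zero]) hvw, rho_mul, rho_mul,
      caseC _ _ (ha.add hv) (hv.smul _) hU, caseC v w hv hw hvU, caseC _ w (ha.add hv) hw hU]
  · obtain ⟨d, z, hz, rfl⟩ := Submodule.mem_span_insert.1 hwm
    obtain ⟨d', rfl⟩ := mem_span_singleton.1 hz
    have h1 : d • x + d' • e = (d' + c' * (d * c⁻¹)) • e + (d * c⁻¹) • (c • x + c' • e) := by
      match_scalars <;> field_simp
      linear_combination (- d * c') * h3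
    have h2 : bl Q (c • x + c' • e) e = 0 := by simp [hxe]
    have h4 : bl Q e (c • x + c' • e) = 0 := by rw [bl_comm, h2]
    rw [h1, sg_add hc.1 (by rw [map_smul, h2, smul_zero]) (by rw [map_smul, bl_self, smul_zero]), sg_self hc.1, mul_one,
      sg_swap hc.1 (by rw [Q_smul, he, mul_zero]) (by rw [map_smul, h2, smul_zero]),
      sg_smul_left he h4, hm _ (by rw [map_smul, h4, smul_zero])]
    simp [hex]

end Transport

section InvariantForm

open Classical

variable {G M : Type} [Group G] [Finite G] [AddCommGroup M] [Module ℂ M]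

/-- Every complex representation of a finite group has an invariant inner product. -/
theorem exists_ip [FiniteDimensional ℂ M] (ρ : Representation ℂ G M) : ∃ ip : M →ₗ⋆[ℂ] M →ₗ[ℂ] ℂ,
    (∀ g m m', ip (ρ g m) (ρ g m') = ip m m') ∧ (∀ m, 0 ≤ (ip m m).re) ∧
      ∀ m, m ≠ 0 → 0 < (ip m m).re := by
  have := Fintype.ofFinite G
  set b := Module.finBasis ℂ M with hb
  set ip : M →ₗ⋆[ℂ] M →ₗ[ℂ] ℂ := LinearMap.mk₂'ₛₗ (starRingEnd ℂ) (RingHom.id ℂ)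
    (fun m m' => ∑ g, ∑ i, (starRingEnd ℂ) (b.repr (ρ g m) i) * b.repr (ρ g m') i)
    (fun m₁ m₂ n => by simp [add_mul, Finset.sum_add_distrib])
    (fun c m n => by simp [Finset.mul_sum, mul_assoc])
    (fun m n₁ n₂ => by simp [mul_add, Finset.sum_add_distrib])
    (fun c m n => by simp [Finset.mul_sum, mul_left_comm]) with hip
  have hself : ∀ m, (ip m m).re = ∑ g, ∑ i, Complex.normSq (b.repr (ρ g m) i) := fun m => by
    change (∑ g, ∑ i, (starRingEnd ℂ) (b.repr (ρ g m) i) * b.repr (ρ g m) i).re = _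
    simp_rw [← Complex.normSq_eq_conj_mul_self]
    norm_cast
  have hnn : ∀ m, 0 ≤ (ip m m).re := fun m => by
    rw [hself]
    exact Finset.sum_nonneg fun g _ => Finset.sum_nonneg fun i _ => Complex.normSq_nonneg _
  refine ⟨ip, fun g m m' => ?_, hnn, fun m hm => ?_⟩
  · change ∑ h, ∑ i, (starRingEnd ℂ) (b.repr (ρ h (ρ g m)) i) * b.repr (ρ h (ρ g m')) i =
      ∑ h, ∑ i, (starRingEnd ℂ) (b.repr (ρ h m) i) * b.repr (ρ h m') i
    refine Fintype.sum_equiv (Equiv.mulRight g) _ _ fun h => ?_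
    rw [Equiv.coe_mulRight, map_mul]; rfl
  · refine lt_of_le_of_ne (hnn m) fun h0 => hm ?_
    rw [hself, eq_comm, Finset.sum_eq_zero_iff_of_nonneg (fun g _ => Finset.sum_nonneg fun i _ =>
      Complex.normSq_nonneg _)] at h0
    have h1 := h0 1 (Finset.mem_univ _)
    rw [Finset.sum_eq_zero_iff_of_nonneg (fun i _ => Complex.normSq_nonneg _)] at h1
    apply b.repr.injective
    ext i
    have := h1 i (Finset.mem_univ _)
    rw [map_one] at this
    simpa using this

variable {ρ : Representation ℂ G M} {ip : M →ₗ⋆[ℂ] M →ₗ[ℂ] ℂ}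

theorem ip_inv (hip : ∀ g m m', ip (ρ g m) (ρ g m') = ip m m') (g : G) (m m' : M) :
    ip (ρ g m) m' = ip m (ρ g⁻¹ m') := by
  rw [← hip g m]
  congr 1
  rw [← End.mul_apply, ← map_mul, mul_inv_cancel, map_one]; rfl

end InvariantForm

section Fixed

open Finset Classical

variable {F V : Type} [Field F] [AddCommGroup V] [Module F V] [CharP F 2] [Finite F]
  [FiniteDimensional F V]
variable {Q : QuadraticForm F V}
variable {M : Type} [AddCommGroup M] [Module ℂ M] {ρ : Representation ℂ (Om Q) M}

theorem TT.fix (hQ : Nondeg Q) (hA : Ample Q ∅) {e x : V} (hA2 : Ample Q {e, x})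
    (hT : TT ρ e x) {g : Om Q} (hge : g.1 e = e) (hgx : g.1 x = x) {m : M} (hm : m ∈ wsp ρ e x) :
    ρ g m = m := by
  let N : Subgroup (Om Q) :=
    { carrier := {g | ρ g m = m}
      mul_mem' := fun {a b} ha hb => by
        change ρ (a * b) m = m
        rw [rho_mul, hb, ha]
      one_mem' := rho_one ρ m
      inv_mem' := fun {a} ha => by
        change ρ a⁻¹ m = m
        conv_lhs => rw [← show ρ a m = m from ha]
        exact rho_self_inv ρ a m }
  have h1 : El Q {e, x} ≤ N.map (El Q ∅).subtype := by
    refine (Subgroup.closure_le _).2 ?_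
    rintro _ ⟨a, w, ha, hw, rfl⟩
    exact ⟨sg Q a w, hT a w ha hw m hm, rfl⟩
  obtain ⟨g', hg', h⟩ := h1 (mem_El_of_fix hQ hA hA2 g.2 (by
    intro u hu
    simp only [Set.mem_insert_iff, Set.mem_singleton_iff] at hu
    obtain rfl | rfl := hu
    · exact hge
    · exact hgx))
  have : g' = g := Subtype.ext h
  exact this ▸ hg'

theorem sg_apply {a w : V} (ha : Q a = 0) (haw : bl Q a w = 0) (v : V) :
    (sg Q a w).1 v = v + bl Q v w • a + bl Q v a • w + (Q w * bl Q v a) • a := S_apply ha haw v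

/-- A vector with prescribed behaviour under the Siegel transformations attached to the totally
singular plane spanned by `e` and `e'` is fixed by the transformation interchanging them. -/
theorem flip_fixed {e e' f w₀ : V} (he : Q e = 0) (he' : Q e' = 0) (hee : bl Q e e' = 0)
    (hfe : bl Q f e = 1) (hfe' : bl Q f e' = 1) (hfw : bl Q f w₀ = 0)
    (hew : bl Q e w₀ = 0) (hew' : bl Q e' w₀ = 0)
    (hT : ∀ c : F, c ≠ 0 → TT ρ (e + e') (c • e)) {m : M}
    (h1 : ∀ w, bl Q e w = 0 → bl Q e' w = 0 → ρ (sg Q (e + e') w) m = m)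
    (h2 : ∀ r : F, ρ (sg Q e (r • w₀)) m = psi F r • m)
    (h3 : ∀ c : F, ρ (sg Q e (c • e')) m = m) : ρ (sg Q (e + e') f) m = m := by
  have h4 := two_eq F
  have := Fintype.ofFinite F
  set d := e + e' with hd
  have hd0 : Q d = 0 := by rw [hd, Q_add, he, he', hee]; simp
  have hde : bl Q d e = 0 := by rw [hd, map_add, LinearMap.add_apply, bl_self, bl_comm, hee]; simp
  have hdf : bl Q d f = 0 := by
    rw [hd, map_add, LinearMap.add_apply, bl_comm, hfe, bl_comm, hfe']; linear_combination h4
  have hdw : bl Q d w₀ = 0 := by rw [hd, map_add, LinearMap.add_apply, hew, hew', add_zero]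
  have hdsf : ∀ s : F, bl Q d (s • f) = 0 := fun s => by rw [map_smul, hdf, smul_zero]
  -- the translates of `m`
  have hcomm : ∀ s w, bl Q d w = 0 → ∀ m : M, ρ (sg Q d w) (ρ (sg Q d (s • f)) m) =
      ρ (sg Q d (s • f)) (ρ (sg Q d w) m) := fun s w hw m => by
    rw [← rho_mul, ← rho_mul, ← sg_add hd0 hw (hdsf s), ← sg_add hd0 (hdsf s) hw, add_comm]
  have hY : ∀ s r : F, ρ (sg Q e (r • w₀)) (ρ (sg Q d (s • f)) m) =
      psi F r • ρ (sg Q d (s • f)) m := by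
    intro s r
    have e1 : (sg Q d (s • f)).1 (e + s • d) = e := by
      have e2 : bl Q (e + s • d) (s • f) = s := by
        simp [hdf, bl_comm Q e f, hfe]
      have e3 : bl Q (e + s • d) d = 0 := by
        rw [bl_comm]; simp [hde]
      rw [sg_apply hd0 (hdsf s), e2, e3]
      match_scalars <;> grind
    have e2 : (sg Q d (s • f)).1 (r • w₀) = r • w₀ := by
      have e2 : bl Q (r • w₀) (s • f) = 0 := by simp [bl_comm Q w₀ f, hfw]
      have e3 : bl Q (r • w₀) d = 0 := by rw [bl_comm]; simp [hdw]
      rw [sg_apply hd0 (hdsf s), e2, e3]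
      simp
    have e4 := rho_sg_conj ρ (sg Q d (s • f)) (e + s • d) (r • w₀) m
    rw [e1, e2] at e4
    rw [← e4, ← map_smul]
    congr 1
    have hsd : Q (s • d) = 0 := by rw [Q_smul, hd0, mul_zero]
    rw [sg_add_left he hsd (by rw [map_smul, bl_comm, hde, smul_zero])
      (by rw [map_smul, hew, smul_zero]) (by simp [hdw]), rho_mul, rho_mul]
    have e5 : sg Q e (Q (r • w₀) • s • d) = sg Q e ((Q (r • w₀) * s) • e') := by
      rw [smul_smul, hd, smul_add, sg_add he (by simp) (by rw [map_smul, hee, smul_zero]),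
        sg_self he, one_mul]
    rw [e5, h3, sg_smul_left hd0 (by rw [map_smul, hdw, smul_zero]), h1 _ (by simp [hew])
      (by simp [hew']), h2]
  -- the Fourier coefficients
  set p : F → M := fun c => ∑ s : F, psi F (s * c) • ρ (sg Q d (s • f)) m with hp
  have hpf : ∀ c r : F, ρ (sg Q d (r • f)) (p c) = psi F (r * c) • p c := by
    intro c r
    rw [hp]
    simp only [map_sum, smul_sum]
    refine Fintype.sum_equiv (Equiv.addRight r) _ _ fun s => ?_
    rw [Equiv.coe_addRight, map_smul, ← rho_mul, ← sg_add hd0 (hdsf r) (hdsf s), ← add_smul,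
      smul_smul, add_comm r s, add_mul, psi_add]
    congr 1
    linear_combination (-psi F (s * c)) * psi_mul_self (r * c)
  have hp0 : ∀ c, c ≠ 0 → p c = 0 := by
    intro c hc
    have hmem : p c ∈ wsp ρ d (c • e) := by
      intro w hw
      set w' := w + bl Q w e • f with hw'
      have e1 : w = w' + bl Q w e • f := by rw [hw', add_assoc, add_self_v F, add_zero]
      have e2 : bl Q d w' = 0 := by rw [hw', map_add, hw, map_smul, hdf]; simp
      have e3 : bl Q e w' = 0 := by
        rw [hw', map_add, map_smul, bl_comm Q e f, hfe, bl_comm, smul_eq_mul]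
        linear_combination (bl Q w e) * h4
      have e4 : bl Q e' w' = 0 := by
        have h5 : bl Q d w' = bl Q e w' + bl Q e' w' := by rw [hd, map_add (bl Q) e e']; rfl
        rw [e2, e3, zero_add] at h5
        exact h5.symm
      have e5 : ρ (sg Q d w') (p c) = p c := by
        rw [hp]
        simp only [map_sum, map_smul]
        refine sum_congr rfl fun s _ => ?_
        rw [hcomm s w' e2, h1 w' e3 e4]
      rw [map_smul, smul_eq_mul, mul_comm]
      conv_lhs => rw [e1]
      rw [sg_add hd0 e2 (hdsf _), rho_mul, hpf, map_smul, e5]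
    have e1 : ρ (sg Q e ((1 : F) • w₀)) (p c) = p c := by
      refine hT c hc e _ ?_ ?_ _ hmem
      · simp [hde]
      · simp [hdw, hew]
    have e2 : ρ (sg Q e ((1 : F) • w₀)) (p c) = psi F 1 • p c := by
      rw [hp]
      simp only [map_sum, map_smul, smul_sum]
      refine sum_congr rfl fun s _ => ?_
      rw [hY, smul_comm]
    rw [e1, eq_comm, ← sub_eq_zero] at e2
    rw [show psi F 1 • p c - p c = (psi F 1 - 1) • p c by rw [sub_smul, one_smul],
      smul_eq_zero, sub_eq_zero] at e2
    exact e2.resolve_left (psi_ne F)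
  have hsum : ∑ c, p c = (Fintype.card F : ℂ) • m := by
    rw [hp]
    simp only
    rw [sum_comm]
    simp_rw [← sum_smul]
    rw [sum_eq_single 0]
    · simp [sg_zero]
    · intro s _ hs
      have := sum_psi_mul hs
      simp_rw [mul_comm s]
      rw [this, zero_smul]
    · simp
  rw [sum_eq_single 0 (fun c _ hc => hp0 c hc) (by simp)] at hsum
  have h5 := hpf 0 1
  rw [mul_zero, psi_zero, one_smul, one_smul, hsum, map_smul] at h5
  exact smul_right_injective M (Nat.cast_ne_zero.2 Fintype.card_ne_zero) h5

end Fixed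

section Gram

open Finset Classical

variable {F V : Type} [Field F] [AddCommGroup V] [Module F V] [CharP F 2] [Finite F]
  [FiniteDimensional F V]
variable {Q : QuadraticForm F V}
variable {M : Type} [AddCommGroup M] [Module ℂ M] {ρ : Representation ℂ (Om Q) M}
variable {ip : M →ₗ⋆[ℂ] M →ₗ[ℂ] ℂ}

theorem sg_mul_self {a w : V} (ha : Q a = 0) (haw : bl Q a w = 0) : sg Q a w * sg Q a w = 1 := by
  rw [← sg_add ha haw haw, add_self_v F, sg_zero]

theorem ip_sg (hip : ∀ g m m', ip (ρ g m) (ρ g m') = ip m m') {a w : V} (ha : Q a = 0)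
    (haw : bl Q a w = 0) (m m' : M) : ip (ρ (sg Q a w) m) m' = ip m (ρ (sg Q a w) m') := by
  have h : (sg Q a w)⁻¹ = sg Q a w := inv_eq_of_mul_eq_one_left (sg_mul_self ha haw)
  rw [ip_inv hip, h]

theorem ip_smul_psi (r : F) (m m' : M) : ip (psi F r • m) m' = psi F r * ip m m' := by
  rw [map_smulₛₗ, LinearMap.smul_apply, psi_conj, smul_eq_mul]

theorem ip_wsp_eq_zero (hip : ∀ g m m', ip (ρ g m) (ρ g m') = ip m m') {e x y : V} (he : Q e = 0)
    {w : V} (hw : bl Q e w = 0) (hxy : psi F (bl Q w x) ≠ psi F (bl Q w y)) {m m' : M}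
    (hm : m ∈ wsp ρ e x) (hm' : m' ∈ wsp ρ e y) : ip m m' = 0 := by
  have h1 := ip_sg hip he hw m m'
  rw [hm w hw, hm' w hw, ip_smul_psi, map_smul, smul_eq_mul, ← sub_eq_zero, ← sub_mul,
    mul_eq_zero, sub_eq_zero] at h1
  exact h1.resolve_left hxy

theorem exists_psi_ne (hQ : Nondeg Q) {e x y : V} (h : x - y ∉ span F {e}) :
    ∃ w, bl Q e w = 0 ∧ psi F (bl Q w x) ≠ psi F (bl Q w y) := by
  obtain ⟨w, hw, hxy⟩ := exists_perp hQ h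
  refine ⟨w, by simpa using hw, fun hc => psi_ne F ?_⟩
  rw [← hxy, bl_comm, map_sub, sub_eq_add_neg, neg_v F, psi_add, hc, psi_mul_self]

theorem ip_wsp_eq_zero' (hQ : Nondeg Q) (hip : ∀ g m m', ip (ρ g m) (ρ g m') = ip m m') {e x y : V}
    (he : Q e = 0) (h : x - y ∉ span F {e}) {m m' : M}
    (hm : m ∈ wsp ρ e x) (hm' : m' ∈ wsp ρ e y) : ip m m' = 0 := by
  obtain ⟨w, hw, hne⟩ := exists_psi_ne hQ h
  exact ip_wsp_eq_zero hip he hw hne hm hm'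

variable [Fintype F]

/-- The inner product of a vector in a weight space with its image under the transformation
interchanging two orthogonal singular vectors. -/
theorem gram_perp (hQ : Nondeg Q) (hip : ∀ g m m', ip (ρ g m) (ρ g m') = ip m m') {e e' x : V}
    (he : Q e = 0) (he' : Q e' = 0) (hee : bl Q e e' = 0) (hex : bl Q e x = 0) (hex' : bl Q e' x = 0)
    (he0 : e ≠ 0) (hx : x ∉ span F {e}) (hU : e' ∉ span F {x, e})
    (hT : ∀ c : F, c ≠ 0 → TT ρ (e + e') (c • e)) (hT' : TT ρ e x) {v : M} (hv : v ∈ wsp ρ e x) :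
    ∃ u : Om Q, u.1 e = e' ∧ u.1 x = x ∧ Fintype.card F * ip v (ρ u v) = ip v v := by
  have h4 := two_eq F
  have hee' : bl Q e' e = 0 := by rw [bl_comm, hee]
  have hx2 : x ∉ span F {e', e} := notMem_span_insert hU hx
  obtain ⟨w₀, hw₀, hxw⟩ := exists_perp hQ hx2
  simp only [perp_insert, perp_singleton] at hw₀
  obtain ⟨hew', hew⟩ := hw₀
  have he2 : e ∉ span F {w₀, e + e', x} := by
    intro hc
    obtain ⟨a, z, hz, h1⟩ := Submodule.mem_span_insert.1 hc
    obtain ⟨b, z', hz', rfl⟩ := Submodule.mem_span_insert.1 hz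
    obtain ⟨c, rfl⟩ := mem_span_singleton.1 hz'
    have h2 := congrArg (bl Q x) h1
    simp only [map_add, map_smul, hxw, bl_self, bl_comm Q x e, bl_comm Q x e', hex, hex'] at h2
    have ha : a = 0 := by simpa using h2.symm
    rw [ha, zero_smul, zero_add] at h1
    have hb : b = 0 := by
      by_contra hb
      apply hU
      have : e' = (b⁻¹ * c) • x + (b⁻¹ + 1) • e := by
        have h6 : e = b • (e + e') + c • x := h1
        have h7 := congrArg (fun z => b⁻¹ • z) h6
        simp only [smul_add, smul_smul, inv_mul_cancel₀ hb, one_smul] at h7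
        rw [add_smul, one_smul, h7]
        match_scalars <;> grind
      rw [this]
      exact Submodule.add_mem _ (Submodule.smul_mem _ _ (subset_span (by simp)))
        (Submodule.smul_mem _ _ (subset_span (by simp)))
    rw [hb, zero_smul, zero_add] at h1
    exact notMem_span_singleton he0 hx (mem_span_singleton.2 ⟨c, h1.symm⟩)
  obtain ⟨f, hf, hef⟩ := exists_perp hQ he2
  simp only [perp_insert, perp_singleton] at hf
  obtain ⟨hwf, hdf, hxf⟩ := hf
  have hd0 : Q (e + e') = 0 := by rw [Q_add, he, he', hee]; simp
  have hef' : bl Q e' f = 1 := by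
    have := hdf
    rw [map_add, LinearMap.add_apply, hef] at this
    linear_combination this - h4
  have hdx : bl Q (e + e') x = 0 := by rw [map_add, LinearMap.add_apply, hex, hex', add_zero]
  have hdw : bl Q (e + e') w₀ = 0 := by rw [map_add, LinearMap.add_apply, hew, hew', add_zero]
  set u := sg Q (e + e') f with hu
  have hue : u.1 e = e' := by
    rw [hu, sg_apply hd0 hdf, hef, show bl Q e (e + e') = 0 by rw [map_add, bl_self, hee, add_zero]]
    match_scalars <;> grind
  have hue' : u.1 e' = e := by
    rw [hu, sg_apply hd0 hdf, hef', show bl Q e' (e + e') = 0 by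
      rw [map_add, bl_self, hee', add_zero]]
    match_scalars <;> grind
  have hux : u.1 x = x := by
    rw [hu, sg_apply hd0 hdf, hxf, bl_comm Q x, hdx]; simp
  have huw : u.1 w₀ = w₀ := by
    rw [hu, sg_apply hd0 hdf, hwf, bl_comm Q w₀, hdw]; simp
  refine ⟨u, hue, hux, ?_⟩
  -- the symmetrized vector
  have hsw : ∀ r : F, bl Q e (r • w₀) = 0 := fun r => by rw [map_smul, hew, smul_zero]
  have hsw' : ∀ r : F, bl Q e' (r • w₀) = 0 := fun r => by rw [map_smul, hew', smul_zero]
  have happ : ∀ r : F, ∀ z, bl Q e' z = 0 → (sg Q e' (r • w₀)).1 z = z + (r * bl Q w₀ z) • e' := by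
    intro r z hz
    rw [sg_apply he' (hsw' r), bl_comm Q z e', hz, bl_comm Q z]; simp
  have hne : ∀ r : F, (sg Q e' (r • w₀)).1 e = e := fun r => by
    rw [happ r e hee', bl_comm, hew]; simp
  have hcomm : ∀ (r : F) (w : V), bl Q e' w = 0 → ∀ m, ρ (sg Q e w) (ρ (sg Q e' (r • w₀)) m) =
      ρ (sg Q e' (r • w₀)) (ρ (sg Q e (w + (r * bl Q w₀ w) • e')) m) := by
    intro r w hw m
    rw [rho_sg_conj ρ (sg Q e' (r • w₀)), hne, map_add, map_smul, happ r w hw, happ r e' (bl_self _ _),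
      bl_comm Q w₀ e', hew', mul_zero, zero_smul, add_zero, add_assoc, add_self_v F, add_zero]
  set t : M := ∑ r : F, psi F r • ρ (sg Q e' (r • w₀)) v with ht
  have hr0 : ∀ r c : F, bl Q w₀ (r • w₀) = 0 := fun r _ => by rw [map_smul, bl_self, smul_zero]
  have hwx : ∀ r : F, bl Q (r • w₀) x = r := fun r => by
    rw [map_smul, LinearMap.smul_apply, bl_comm, hxw, smul_eq_mul, mul_one]
  -- action of the elements attached to `e`
  have ht1 : ∀ w, bl Q e w = 0 → bl Q e' w = 0 → ρ (sg Q e w) t = psi F (bl Q w x) • t := by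
    intro w hw hw'
    rw [ht, map_sum, smul_sum]
    refine sum_congr rfl fun r _ => ?_
    rw [map_smul, hcomm r w hw', hv _ (by rw [map_add, hw, map_smul, hee]; simp), map_smul,
      smul_comm]
    have h5 : bl Q (w + (r * bl Q w₀ w) • e') x = bl Q w x := by
      rw [map_add, map_smul, LinearMap.add_apply, LinearMap.smul_apply, hex', smul_zero, add_zero]
    rw [h5]
  have ht2 : ∀ r : F, ρ (sg Q e' (r • w₀)) t = psi F r • t := by
    intro r
    rw [ht, map_sum, smul_sum]
    refine Fintype.sum_equiv (Equiv.addRight r) _ _ fun s => ?_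
    rw [Equiv.coe_addRight, map_smul, ← rho_mul, ← sg_add he' (hsw' r) (hsw' s), ← add_smul,
      smul_smul, add_comm r s, psi_add]
    congr 1
    linear_combination (-psi F s) * psi_mul_self r
  have ht3 : ∀ w, bl Q e w = 0 → bl Q e' w = 0 → bl Q x w = 0 → ρ (sg Q e' w) t = t := by
    intro w hw hw' hxw'
    rw [ht, map_sum]
    refine sum_congr rfl fun r _ => ?_
    rw [map_smul, ← rho_mul, ← sg_add he' hw' (hsw' r), add_comm, sg_add he' (hsw' r) hw',
      rho_mul, hT' e' w (by simp [hee, bl_comm Q x e', hex']) (by simp [hw, hxw']) v hv]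
  have hfix : ρ u t = t := by
    refine flip_fixed (w₀ := w₀) he he' hee (by rw [bl_comm, hef]) (by rw [bl_comm, hef'])
      (by rw [bl_comm, hwf]) hew hew' hT ?_ (fun r => by rw [ht1 _ (hsw r) (hsw' r), hwx])
      (fun c => by
        rw [ht1 _ (by rw [map_smul, hee, smul_zero]) (by simp), map_smul, LinearMap.smul_apply,
          hex', smul_zero, psi_zero, one_smul])
    intro w hw hw'
    rw [sg_add_left he he' hee hw hw', rho_mul, rho_mul, ht1 (Q w • e') (by
      rw [map_smul, hee, smul_zero]) (by simp), map_smul (bl Q), LinearMap.smul_apply, hex',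
      smul_zero, psi_zero, one_smul]
    set s := bl Q w x with hs
    have e1 : w = (w + s • w₀) + s • w₀ := by rw [add_assoc, add_self_v F, add_zero]
    have e2 : ρ (sg Q e' w) t = psi F s • t := by
      conv_lhs => rw [e1]
      rw [sg_add he' (by rw [map_add, hw', hsw', add_zero]) (hsw' s), rho_mul, ht2, map_smul,
        ht3 _ (by rw [map_add, hw, hsw, add_zero]) (by rw [map_add, hw', hsw', add_zero])]
      rw [map_add, map_smul, hxw, bl_comm, ← hs, smul_eq_mul]
      linear_combination s * h4
    rw [e2, map_smul, ht1 w hw hw', smul_smul, ← hs, psi_mul_self, one_smul]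
  have hut : ρ u t = ∑ r : F, psi F r • ρ (sg Q e (r • w₀)) (ρ u v) := by
    rw [ht, map_sum]
    refine sum_congr rfl fun r _ => ?_
    rw [map_smul, rho_sg_conj, hue', map_smul, huw]
  have huv : ρ u v ∈ wsp ρ e' x := by
    have := rho_mem_wsp ρ hv u
    rwa [hue, hux] at this
  have hq0 : (Fintype.card F : ℂ) ≠ 0 := Nat.cast_ne_zero.2 Fintype.card_ne_zero
  -- `⟨u t, t⟩ = q ^ 2 ⟨u v, v⟩`
  have n1 : ip (ρ u v) t = Fintype.card F * ip (ρ u v) v := by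
    rw [ht, map_sum, ← nsmul_eq_mul, ← card_univ, ← sum_const]
    refine sum_congr rfl fun r _ => ?_
    rw [map_smul, smul_eq_mul, ← ip_sg hip he' (hsw' r), huv _ (hsw' r), hwx, ip_smul_psi,
      ← mul_assoc, psi_mul_self, one_mul]
  have n2 : ip t t = Fintype.card F * ip (ρ u v) t := by
    have n5 : ip t t = ip (ρ u t) t := by rw [hfix]
    rw [n5, hut, map_sum ip, LinearMap.sum_apply, ← nsmul_eq_mul, ← card_univ, ← sum_const]
    refine sum_congr rfl fun r _ => ?_
    rw [ip_smul_psi, ip_sg hip he (hsw r), ht1 _ (hsw r) (hsw' r), hwx, map_smul,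
      smul_eq_mul, ← mul_assoc, psi_mul_self, one_mul]
  -- `⟨t, t⟩ = q ⟨v, v⟩`
  have n3 : ip t t = Fintype.card F * ip v v := by
    rw [ht, map_sum ip, LinearMap.sum_apply, ← nsmul_eq_mul, ← card_univ, ← sum_const]
    refine sum_congr rfl fun r _ => ?_
    rw [map_sum, sum_eq_single r]
    · rw [ip_smul_psi, map_smul, smul_eq_mul, ← mul_assoc, psi_mul_self, one_mul, hip]
    · intro s _ hs
      rw [ip_smul_psi, map_smul]
      have key : ∀ r : F, ρ (sg Q e' (r • w₀)) v ∈ wsp ρ e (x + r • e') := fun r => by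
        have := rho_mem_wsp ρ hv (sg Q e' (r • w₀))
        rwa [hne, happ r x hex', bl_comm, hxw, mul_one] at this
      rw [ip_wsp_eq_zero' hQ hip he ?_ (key r) (key s), smul_zero, mul_zero]
      intro hc
      have h5 : x + r • e' - (x + s • e') = (r - s) • e' := by module
      rw [h5] at hc
      have h6 := Submodule.smul_mem _ (r - s)⁻¹ hc
      rw [smul_smul, inv_mul_cancel₀ (sub_ne_zero.2 (Ne.symm hs)), one_smul] at h6
      exact hU (Submodule.span_mono (by simp) h6)
    · simp
  have n4 : ip (ρ u v) v = ip v (ρ u v) := ip_sg hip hd0 hdf v v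
  rw [n1, n3, n4] at n2
  exact (mul_left_cancel₀ hq0 n2).symm

end Gram

section SumSubgroup

open Finset Classical

variable {G M : Type} [Group G] [Finite G] [AddCommGroup M] [Module ℂ M]
variable {ρ : Representation ℂ G M} {ip : M →ₗ⋆[ℂ] M →ₗ[ℂ] ℂ}

/-- The sum of the translates of `v` under a subgroup. -/
noncomputable def sumOver (ρ : Representation ℂ G M) (C : Subgroup G) (v : M) : M :=
  haveI := Fintype.ofFinite C
  ∑ k : C, ρ k.1 v

theorem sumOver_eq [Fintype G] (ρ : Representation ℂ G M) (C : Subgroup G) (v : M) :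
    sumOver ρ C v = ∑ k : C, ρ k.1 v := by
  rw [sumOver]
  congr!

theorem rho_sumOver (C : Subgroup G) (v : M) {g : G} (hg : g ∈ C) :
    ρ g (sumOver ρ C v) = sumOver ρ C v := by
  have := Fintype.ofFinite G
  rw [sumOver_eq, map_sum]
  refine Fintype.sum_equiv (Equiv.mulLeft (⟨g, hg⟩ : C)) _ _ fun k => ?_
  rw [Equiv.coe_mulLeft, Subgroup.coe_mul, map_mul]; rfl

theorem ip_sumOver_of_fixed (hip : ∀ g m m', ip (ρ g m) (ρ g m') = ip m m') [Fintype G]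
    (C : Subgroup G) (v : M) {m : M} (hm : ∀ g ∈ C, ρ g m = m) :
    ip (sumOver ρ C v) m = Fintype.card C * ip v m := by
  rw [sumOver_eq, map_sum, LinearMap.sum_apply, ← nsmul_eq_mul, ← card_univ, ← sum_const]
  refine sum_congr rfl fun k _ => ?_
  conv_lhs => rw [← hm k.1 k.2]
  exact hip _ _ _

theorem ip_sumOver (hip : ∀ g m m', ip (ρ g m) (ρ g m') = ip m m') [Fintype G]
    (C : Subgroup G) (v : M) :
    ip (sumOver ρ C v) (sumOver ρ C v) = Fintype.card C * ∑ k : C, ip v (ρ k.1 v) := by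
  rw [ip_sumOver_of_fixed hip C v fun g hg => rho_sumOver C v hg, sumOver_eq, map_sum]

theorem sum_ip_nonneg (hip : ∀ g m m', ip (ρ g m) (ρ g m') = ip m m') (hnn : ∀ m, 0 ≤ (ip m m).re)
    [Fintype G] (C : Subgroup G) (v : M) : 0 ≤ (∑ k : C, ip v (ρ k.1 v)).re := by
  have h := hnn (sumOver ρ C v)
  rw [ip_sumOver hip, ← Complex.ofReal_natCast, Complex.re_ofReal_mul] at h
  exact nonneg_of_mul_nonneg_right h (by exact_mod_cast Fintype.card_pos)

end SumSubgroup

section Fixed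

open Finset Classical

variable {F V : Type} [Field F] [AddCommGroup V] [Module F V] [CharP F 2] [Finite F]
  [FiniteDimensional F V]
variable {Q : QuadraticForm F V}

/-- The stabilizer of `x`. -/
def stab (Q : QuadraticForm F V) (x : V) : Subgroup (Om Q) where
  carrier := {g | g.1 x = x}
  one_mem' := rfl
  mul_mem' {g h} hg hh := by
    change g.1 (h.1 x) = x
    rw [show h.1 x = x from hh, show g.1 x = x from hg]
  inv_mem' {g} hg := by
    change g.1.symm x = x
    rw [LinearEquiv.symm_apply_eq]
    exact (show g.1 x = x from hg).symm

/-- The elements fixing `x` and preserving `U`. -/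
def stabLine (Q : QuadraticForm F V) (x : V) (U : Submodule F V) : Subgroup (Om Q) where
  carrier := {g | g.1 x = x ∧ U.map g.1.toLinearMap = U}
  one_mem' := ⟨rfl, Submodule.map_id U⟩
  mul_mem' {g h} hg hh := by
    refine ⟨(stab Q x).mul_mem hg.1 hh.1, ?_⟩
    have : (g * h).1.toLinearMap = g.1.toLinearMap ∘ₗ h.1.toLinearMap := rfl
    rw [this, Submodule.map_comp, hh.2, hg.2]
  inv_mem' {g} hg := by
    refine ⟨(stab Q x).inv_mem hg.1, ?_⟩
    conv_lhs => rw [← hg.2]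
    rw [← Submodule.map_comp]
    have : (g⁻¹).1.toLinearMap ∘ₗ g.1.toLinearMap = LinearMap.id := by
      ext v
      exact g.1.symm_apply_apply v
    rw [this, Submodule.map_id]

theorem mem_stab {x : V} {g : Om Q} : g ∈ stab Q x ↔ g.1 x = x := Iff.rfl

theorem mem_stabLine {x : V} {s : Set V} {g : Om Q} (hx : g.1 x = x)
    (hs : ∀ y ∈ s, g.1 y ∈ span F s) : g ∈ stabLine Q x (span F s) := by
  refine ⟨hx, Submodule.eq_of_le_of_finrank_eq ?_ (LinearEquiv.finrank_map_eq g.1 _)⟩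
  rw [Submodule.map_span_le]
  exact hs

theorem stabLine_apply {x y : V} {U : Submodule F V} {g : Om Q} (hg : g ∈ stabLine Q x U)
    (hy : y ∈ U) : g.1 y ∈ U := by
  have := Submodule.mem_map_of_mem (f := g.1.toLinearMap) hy
  rwa [hg.2] at this

theorem stabLine_singleton {x e : V} (he : e ≠ 0) {g : Om Q} :
    g ∈ stabLine Q x (span F {e}) ↔ g.1 x = x ∧ ∃ c : F, c ≠ 0 ∧ g.1 e = c • e := by
  constructor
  · intro hg
    obtain ⟨c, hc⟩ := mem_span_singleton.1
      (stabLine_apply hg (Submodule.mem_span_singleton_self e))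
    refine ⟨hg.1, c, ?_, hc.symm⟩
    rintro rfl
    rw [zero_smul] at hc
    exact g.ne_zero he hc.symm
  · rintro ⟨hx, c, -, hc⟩
    refine mem_stabLine hx fun y hy => ?_
    obtain rfl : y = e := hy
    rw [hc]
    exact mem_span_singleton.2 ⟨c, rfl⟩

theorem Om.mul_apply (g h : Om Q) (v : V) : (g * h).1 v = g.1 (h.1 v) := rfl

theorem Om.inv_apply_self (g : Om Q) (v : V) : (g⁻¹).1 (g.1 v) = v := g.1.symm_apply_apply v

theorem Om.apply_inv_self (g : Om Q) (v : V) : g.1 ((g⁻¹).1 v) = v := g.1.apply_symm_apply v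

theorem Om.inv_apply_eq (g : Om Q) {v w : V} (h : g.1 v = w) : (g⁻¹).1 w = v := by
  rw [← h, g.inv_apply_self]

variable {M : Type} [AddCommGroup M] [Module ℂ M] {ρ : Representation ℂ (Om Q) M}
variable {ip : M →ₗ⋆[ℂ] M →ₗ[ℂ] ℂ}

theorem ip_rho_rho (hip : ∀ g m m', ip (ρ g m) (ρ g m') = ip m m') (a b : Om Q) (m m' : M) :
    ip (ρ a m) (ρ b m') = ip m (ρ (a⁻¹ * b) m') := by
  rw [← hip a m, ← rho_mul, mul_inv_cancel_left]

end Fixed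

section Fixed

open Finset Classical

variable {F V : Type} [Field F] [AddCommGroup V] [Module F V] [CharP F 2] [Fintype F]
  [FiniteDimensional F V]
variable {Q : QuadraticForm F V} {k : ℕ} {α : ℤ}
variable {M : Type} [AddCommGroup M] [Module ℂ M] {ρ : Representation ℂ (Om Q) M}
variable {ip : M →ₗ⋆[ℂ] M →ₗ[ℂ] ℂ}

/-- The condition `TT` at all pairs. -/
def TTall (ρ : Representation ℂ (Om Q) M) : Prop :=
  ∀ e x, Q e = 0 → e ≠ 0 → bl Q e x = 0 → x ∉ span F {e} → TT ρ e x

theorem fixed_of_TTall (h : IsType Q k α) (hk : 5 ≤ k ∨ 4 ≤ k ∧ α = -1) (hT : TTall ρ) {e x : V}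
    (he : Q e = 0) (he0 : e ≠ 0) (hex : bl Q e x = 0) (hx : x ∉ span F {e}) {g : Om Q}
    (hge : g.1 e = e) (hgx : g.1 x = x) {m : M} (hm : m ∈ wsp ρ e x) : ρ g m = m := by
  have h2 : finrank F (span F {e, x}) ≤ 2 :=
    finrank_span_insert_le finrank_span_singleton_le
  exact TT.fix h.nondeg (h.ample' finrank_span_empty_le (by omega))
    (h.ample' h2 (by omega)) (hT e x he he0 hex hx) hge hgx hm

theorem sum_stabLine (h : IsType Q k α) (hk : 5 ≤ k ∨ 4 ≤ k ∧ α = -1) (hT : TTall ρ)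
    (hip : ∀ g m m', ip (ρ g m) (ρ g m') = ip m m') {e x : V}
    (he : Q e = 0) (he0 : e ≠ 0) (hex : bl Q e x = 0) (hx : x ∉ span F {e}) {v : M}
    (hv : v ∈ wsp ρ e x) [Fintype (Om Q)] :
    ∑ l : stabLine Q x (span F {e}), ip v (ρ l.1 v) =
      Fintype.card {l : stabLine Q x (span F {e}) // l.1.1 e = e} * ip v v := by
  rw [Fintype.card_subtype, ← nsmul_eq_mul, ← sum_const, sum_filter]
  refine sum_congr rfl fun l _ => ?_
  obtain ⟨hlx, c, hc, hle⟩ := (stabLine_singleton he0).1 l.2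
  split_ifs with h1
  · rw [fixed_of_TTall h hk hT he he0 hex hx h1 hlx hv]
  · have h3 : ρ l.1 v ∈ wsp ρ e (c⁻¹ • x) := by
      have := rho_mem_wsp ρ hv l.1
      rwa [hle, hlx, mem_wsp_smul ρ he hc] at this
    refine ip_wsp_eq_zero' h.nondeg hip he (fun h4 => hx ?_) hv h3
    have h5 : (1 - c⁻¹) ≠ 0 := fun h6 => h1 (by
      rw [hle, inv_eq_one.1 (sub_eq_zero.1 h6).symm, one_smul])
    have h6 := Submodule.smul_mem _ (1 - c⁻¹)⁻¹ h4
    rwa [← one_smul F x, smul_smul, mul_one, ← sub_smul, smul_smul, inv_mul_cancel₀ h5, one_smul]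
      at h6

theorem card_stabLine (h : IsType Q k α) (hk : 5 ≤ k ∨ 4 ≤ k ∧ α = -1) {e x : V}
    (he : Q e = 0) (he0 : e ≠ 0) (hex : bl Q e x = 0) (hx : x ∉ span F {e})
    [Fintype (Om Q)] :
    Fintype.card F * Fintype.card {l : stabLine Q x (span F {e}) // l.1.1 e = e} ≤
      2 * Fintype.card (stabLine Q x (span F {e})) := by
  set L := stabLine Q x (span F {e})
  have h1 : ∀ c : Fˣ, ∃ g : Om Q, g.1 x = x ∧ g.1 e = c.1 • e := by
    intro c
    obtain ⟨g, hg, hg'⟩ := h.exists_map (by omega) (U := {x}) (m := 1) finrank_span_singleton_le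
      (by omega) (notMem_span_singleton he0 hx)
      (u' := c.1 • e) (fun h2 => notMem_span_singleton he0 hx (by
        have := Submodule.smul_mem _ c.1⁻¹ h2
        rwa [smul_smul, inv_mul_cancel₀ c.ne_zero, one_smul] at this))
      (by rw [Q_smul, he, mul_zero]) (by
        intro y hy
        obtain rfl : y = x := hy
        rw [map_smul, bl_comm, hex, smul_zero])
    exact ⟨g, hg' x rfl, hg⟩
  choose g hgx hge using h1
  have hgL : ∀ c, g c ∈ L := fun c => (stabLine_singleton he0).2 ⟨hgx c, c.1, c.ne_zero, hge c⟩
  have h2 : Fintype.card (Fˣ × {l : L // l.1.1 e = e}) ≤ Fintype.card L := by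
    refine Fintype.card_le_of_injective (fun p => (⟨g p.1, hgL p.1⟩ : L) * p.2.1) ?_
    rintro ⟨c, l⟩ ⟨c', l'⟩ hp
    have h3 := congrArg (fun p : L => p.1.1 e) hp
    simp only [Subgroup.coe_mul] at h3
    have e1 : ∀ (c : Fˣ) (l : {l : L // l.1.1 e = e}), (g c * l.1.1).1 e = c.1 • e := by
      intro c l
      rw [Om.mul_apply, l.2, hge]
    have h4 : c.1 • e = c'.1 • e := by
      rw [← e1 c l, ← e1 c' l']; exact h3
    have h5 : c = c' := Units.ext (smul_left_injective F he0 h4)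
    subst h5
    have h6 := mul_left_cancel hp
    rw [Prod.mk.injEq]
    exact ⟨rfl, Subtype.ext h6⟩
  rw [Fintype.card_prod, Fintype.card_units] at h2
  have h3 : 2 ≤ Fintype.card F := Fintype.one_lt_card
  obtain ⟨r, hr⟩ := Nat.exists_eq_add_of_le h3
  rw [hr] at h2 ⊢
  rw [show 2 + r - 1 = r + 1 by omega] at h2
  nlinarith

theorem ip_perp (h : IsType Q k α) (hk : 5 ≤ k ∨ 4 ≤ k ∧ α = -1) (hT : TTall ρ)
    (hip : ∀ g m m', ip (ρ g m) (ρ g m') = ip m m') {e x : V}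
    (he : Q e = 0) (he0 : e ≠ 0) (hex : bl Q e x = 0) (hx : x ∉ span F {e}) {v : M}
    (hv : v ∈ wsp ρ e x) {g : Om Q} (hg : g.1 x = x) (h1 : bl Q e (g.1 e) = 0)
    (h2 : g.1 e ∉ span F {x, e}) : Fintype.card F * ip v (ρ g v) = ip v v := by
  have hge : Q (g.1 e) = 0 := by rw [g.quad, he]
  have hgex : bl Q (g.1 e) x = 0 := by
    conv_lhs => rw [← hg]
    rw [g.bl, hex]
  have h3 : g.1 e ∉ span F {e} := notMem_of_subset h2 (by simp)
  obtain ⟨u, hue, hux, hu⟩ := gram_perp h.nondeg hip he hge h1 hex hgex he0 hx h2 (fun c hc => by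
    refine hT _ _ (by rw [Q_add, he, hge, h1]; simp) (fun h4 => h3 ?_) ?_ fun h4 => ?_
    · rw [add_eq_zero_iff_eq_neg, neg_v F] at h4
      rw [← h4]
      exact Submodule.mem_span_singleton_self e
    · rw [map_smul, bl_comm, map_add, h1]; simp
    · have h4 := Submodule.smul_mem _ c⁻¹ h4
      rw [smul_smul, inv_mul_cancel₀ hc, one_smul] at h4
      obtain ⟨d, hd⟩ := mem_span_singleton.1 h4
      by_cases hd0 : d = 0
      · exact he0 (by rw [← hd, hd0, zero_smul])
      · apply h3
        have h5 : g.1 e = (d⁻¹ + 1) • e := by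
          have h6 := congrArg (fun z => d⁻¹ • z) hd
          simp only [smul_smul, inv_mul_cancel₀ hd0, one_smul] at h6
          rw [add_smul, ← h6, one_smul, add_comm e, add_assoc, add_self_v F, add_zero]
        rw [h5]
        exact mem_span_singleton.2 ⟨_, rfl⟩) (hT e x he he0 hex hx) hv
  have h4 : ρ (u⁻¹ * g) v = v := by
    refine fixed_of_TTall h hk hT he he0 hex hx ?_ ?_ hv
    · rw [Om.mul_apply, ← hue, Om.inv_apply_self]
    · rw [Om.mul_apply, hg]
      conv_lhs => rw [← hux]
      rw [Om.inv_apply_self]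
  have h5 : ρ g v = ρ u v := by
    conv_rhs => rw [← h4, ← rho_mul, mul_inv_cancel_left]
  rw [h5, hu]

theorem ip_perp_sum (h : IsType Q k α) (hk : 5 ≤ k ∨ 4 ≤ k ∧ α = -1) (hT : TTall ρ)
    (hip : ∀ g m m', ip (ρ g m) (ρ g m') = ip m m') {e x : V}
    (he : Q e = 0) (he0 : e ≠ 0) (hex : bl Q e x = 0) (hx : x ∉ span F {e}) {v : M}
    (hv : v ∈ wsp ρ e x) [Fintype (Om Q)] {a b : Om Q} (ha : a.1 x = x) (hb : b.1 x = x)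
    (h1 : bl Q (a.1 e) (b.1 e) = 0) (h2 : b.1 e ∉ span F {x, a.1 e}) :
    Fintype.card F * ip (ρ a (sumOver ρ (stabLine Q x (span F {e})) v))
      (ρ b (sumOver ρ (stabLine Q x (span F {e})) v)) =
      Fintype.card (stabLine Q x (span F {e})) *
        (Fintype.card (stabLine Q x (span F {e})) * ip v v) := by
  simp only [sumOver_eq, map_sum, LinearMap.sum_apply]
  have e0 : (Fintype.card (stabLine Q x (span F {e})) *
      (Fintype.card (stabLine Q x (span F {e})) * ip v v) : ℂ) =
      ∑ _ : stabLine Q x (span F {e}), ∑ _ : stabLine Q x (span F {e}),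
        ip v v := by
    simp
  rw [e0, mul_sum]
  refine sum_congr rfl fun l _ => ?_
  rw [mul_sum]
  refine sum_congr rfl fun l' _ => ?_
  obtain ⟨hlx, c, hc, hle⟩ := (stabLine_singleton he0).1 l.2
  obtain ⟨hlx', c', hc', hle'⟩ := (stabLine_singleton he0).1 l'.2
  rw [← rho_mul, ← rho_mul, ip_rho_rho hip]
  have e1 : ((a * l'.1)⁻¹ * (b * l.1)).1 e = ((a * l'.1)⁻¹).1 (c • b.1 e) := by
    rw [Om.mul_apply, Om.mul_apply b, hle, map_smul]
  have e2 : (a * l'.1).1 e = c' • a.1 e := by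
    rw [Om.mul_apply, hle', map_smul]
  have e3 : (a * l'.1).1 x = x := by rw [Om.mul_apply, hlx', ha]
  refine ip_perp h hk hT hip he he0 hex hx hv ?_ ?_ ?_
  · rw [Om.mul_apply, Om.mul_apply b, hlx, hb]
    exact Om.inv_apply_eq _ e3
  · rw [e1, ← (a * l'.1).bl, Om.apply_inv_self, e2]
    simp [h1]
  · rw [e1, ← (a * l'.1).map_span, Om.apply_inv_self, Set.image_pair, e2, e3]
    intro h4
    have h4 := Submodule.smul_mem _ c⁻¹ h4
    rw [smul_smul, inv_mul_cancel₀ hc, one_smul] at h4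
    refine h2 (Submodule.span_le.2 ?_ h4)
    rintro y (rfl | rfl)
    · exact subset_span (by simp)
    · exact Submodule.smul_mem _ _ (subset_span (by simp))

theorem ip_nonperp (h : IsType Q k α) (hk : 5 ≤ k ∨ 4 ≤ k ∧ α = -1)
    (hip : ∀ g m m', ip (ρ g m) (ρ g m') = ip m m') {e x : V}
    (he : Q e = 0) (he0 : e ≠ 0) {z : M}
    (hz : ∀ g ∈ stabLine Q x (span F {e}), ρ g z = z) {a b : Om Q}
    (ha : a.1 x = x) (hb : b.1 x = x) (hex : bl Q e x = 0) (ha1 : bl Q e (a.1 e) ≠ 0)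
    (hb1 : bl Q e (b.1 e) ≠ 0) : ip z (ρ a z) = ip z (ρ b z) := by
  set c := bl Q e (a.1 e) / bl Q e (b.1 e) with hc
  have hc0 : c ≠ 0 := div_ne_zero ha1 hb1
  have e1 : ∀ g : Om Q, g.1 x = x → bl Q x (g.1 e) = 0 := by
    intro g hg
    conv_lhs => rw [← hg]
    rw [g.bl, bl_comm, hex]
  obtain ⟨g, hg, hgU⟩ := h.exists_map (by omega) (U := {e, x}) (m := 2)
    (finrank_span_insert_le finrank_span_singleton_le) (by omega) (u := a.1 e) (u' := c • b.1 e)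
    (notMem_of_bl (Q := Q) (w := e) (by simp [bl_comm Q x e, hex]) (by rwa [bl_comm]))
    (notMem_of_bl (Q := Q) (w := e) (by simp [bl_comm Q x e, hex]) (by
      rw [bl_comm, map_smul]; exact mul_ne_zero hc0 hb1))
    (by rw [Q_smul, a.quad, b.quad, he, mul_zero]) (by
      rintro y (rfl | rfl)
      · rw [map_smul, hc, smul_eq_mul, div_mul_cancel₀ _ hb1]
      · rw [map_smul, e1 a ha, e1 b hb, smul_zero])
  have hge := hgU e (by simp)
  have hgx := hgU x (by simp)
  have h1 : ρ g z = z := hz g ((stabLine_singleton he0).2 ⟨hgx, 1, one_ne_zero, by rw [hge, one_smul]⟩)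
  have h2 : ρ (b⁻¹ * (g * a)) z = z := hz _ ((stabLine_singleton he0).2 ⟨by
    rw [Om.mul_apply, Om.mul_apply, ha, hgx]
    conv_lhs => rw [← hb]
    rw [Om.inv_apply_self], c, hc0, by
    rw [Om.mul_apply, Om.mul_apply, hg, map_smul, Om.inv_apply_self]⟩)
  have h3 : ρ b z = ρ (g * a) z := by
    conv_lhs => rw [← h2, ← rho_mul, mul_inv_cancel_left]
  rw [← hip g z, h1, ← rho_mul, h3]

/-- Two orthogonal hyperbolic pairs orthogonal to `x`, the first of them containing `e`. -/
theorem exists_two_hyp (h : IsType Q k α) (hk : 5 ≤ k ∨ 4 ≤ k ∧ α = -1) {e x : V}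
    (he : Q e = 0) (he0 : e ≠ 0) (hex : bl Q e x = 0) (hx : x ∉ span F {e}) :
    ∃ f e₂ f₂, Hyp Q e f ∧ Hyp Q e₂ f₂ ∧ Perp Q {e, f, x} e₂ ∧ Perp Q {e, f, x} f₂ ∧
      bl Q x f = 0 := by
  obtain ⟨f, hef, hxf⟩ := exists_hyp h.nondeg (U := {x}) he (notMem_span_singleton he0 hx)
    (by simp [bl_comm Q x e, hex])
  rw [perp_singleton] at hxf
  obtain ⟨k', rfl⟩ : ∃ k', k = k' + 1 := ⟨k - 1, by omega⟩
  have hW := hef.isType h (by omega)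
  have hxW : x ∈ hc Q e f := by
    rw [hc, mem_orth]
    simp [hex, bl_comm Q f x, hxf]
  obtain ⟨e₂, h1, h2, h3⟩ := hW.exists_sing (U := {⟨x, hxW⟩}) finrank_span_singleton_le (by omega)
  obtain ⟨f₂, h4, h5⟩ := exists_hyp hW.nondeg h3 h2 h1
  rw [perp_singleton] at h1 h5
  have p : ∀ y : hc Q e f, bl (res Q (hc Q e f)) ⟨x, hxW⟩ y = 0 → Perp Q {e, f, x} y.1 := by
    intro y hy
    simp only [perp_insert, perp_singleton]
    exact ⟨hef.be y, hef.bf y, by simpa using hy⟩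
  exact ⟨f, e₂, f₂, hef, ⟨h4.e0, h4.f0, by simpa using h4.ef⟩, p _ h1, p _ h5, hxf⟩

theorem exists_stab_map (h : IsType Q k α) (hk : 5 ≤ k ∨ 4 ≤ k ∧ α = -1) {e x : V}
    (he : Q e = 0) (he0 : e ≠ 0) (hex : bl Q e x = 0) (hx : x ∉ span F {e}) {y w : V}
    (hyw : Hyp Q y w) (hxy : bl Q x y = 0) (hxw : bl Q x w = 0) :
    ∃ g : Om Q, g.1 e = y ∧ g.1 x = x := by
  obtain ⟨g, hg, hg'⟩ := h.exists_map (by omega) (U := {x}) (m := 1) finrank_span_singleton_le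
    (by omega) (notMem_span_singleton he0 hx) (u' := y)
    (notMem_of_bl (Q := Q) (w := w) (by simpa using hxw) (by rw [hyw.ef]; exact one_ne_zero))
    (by rw [he, hyw.e0]) (by
      intro z hz
      obtain rfl : z = x := hz
      rw [hxy, bl_comm, hex])
  exact ⟨g, hg, hg' x rfl⟩

/-- If all the weight spaces are fixed by the stabilizer of their label, then there is a
nonzero vector fixed by the stabilizer of a nonzero vector of the natural module. -/
theorem exists_fixed_of_wsp (h : IsType Q k α) (hk : 5 ≤ k ∨ 4 ≤ k ∧ α = -1) (hT : TTall ρ)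
    (hip : ∀ g m m', ip (ρ g m) (ρ g m') = ip m m') (hnn : ∀ m, 0 ≤ (ip m m).re)
    (hpos : ∀ m, m ≠ 0 → 0 < (ip m m).re) {e x : V}
    (he : Q e = 0) (he0 : e ≠ 0) (hex : bl Q e x = 0) (hx : x ∉ span F {e}) {v : M}
    (hv : v ∈ wsp ρ e x) (hv0 : v ≠ 0) :
    ∃ t : M, t ≠ 0 ∧ ∀ g : Om Q, g.1 x = x → ρ g t = t := by
  have := Fintype.ofFinite (Om Q)
  set L := stabLine Q x (span F {e}) with hL
  set z := sumOver ρ L v with hz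
  have hzL : ∀ g ∈ L, ρ g z = z := fun g hg => rho_sumOver L v hg
  obtain ⟨f, e₂, f₂, hef, hef₂, he₂, hf₂, hxf⟩ := exists_two_hyp h hk he he0 hex hx
  simp only [perp_insert, perp_singleton] at he₂ hf₂
  obtain ⟨hee₂, hfe₂, hxe₂⟩ := he₂
  obtain ⟨hef₂', hff₂, hxf₂⟩ := hf₂
  have hxe : bl Q x e = 0 := by rw [bl_comm, hex]
  obtain ⟨k₁, hk₁, hk₁x⟩ := exists_stab_map h hk he he0 hex hx hef.symm hxf hxe
  obtain ⟨k₂, hk₂, hk₂x⟩ := exists_stab_map h hk he he0 hex hx hef₂ hxe₂ hxf₂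
  obtain ⟨k₃, hk₃, hk₃x⟩ := exists_stab_map h hk he he0 hex hx hef₂.symm hxf₂ hxe₂
  have h1x : (1 : Om Q).1 x = x := rfl
  have h1e : (1 : Om Q).1 e = e := rfl
  -- perpendicular and non-perpendicular entries of the Gram matrix
  set l := Fintype.card L
  set N := (ip v v).re
  have hN : 0 < N := hpos v hv0
  set q := Fintype.card F
  have hq2 : 2 ≤ q := Fintype.one_lt_card
  have hperp : ∀ {a b : Om Q} {y y' w' : V}, a.1 x = x → b.1 x = x → a.1 e = y → b.1 e = y' →
      bl Q y y' = 0 → Hyp Q y' w' → bl Q x w' = 0 → bl Q y w' = 0 →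
      (q : ℝ) * (ip (ρ a z) (ρ b z)).re = l * (l * N) := by
    rintro a b y y' w' ha hb rfl rfl h1 h2 h3 h4
    have h5 := ip_perp_sum h hk hT hip he he0 hex hx hv ha hb h1
      (notMem_of_bl (Q := Q) (w := w') (by simp [h3, h4]) (by rw [h2.ef]; exact one_ne_zero))
    have h6 := congrArg Complex.re h5
    rw [← Complex.ofReal_natCast, ← Complex.ofReal_natCast, Complex.re_ofReal_mul,
      Complex.re_ofReal_mul, Complex.re_ofReal_mul] at h6
    exact h6
  set γ := (ip z (ρ k₁ z)).re with hγ
  have hnon : ∀ b : Om Q, b.1 x = x → bl Q e (b.1 e) ≠ 0 → (ip z (ρ b z)).re = γ := by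
    intro b hb hb'
    rw [hγ, ip_nonperp h hk hip he he0 hzL hb hk₁x hex hb' (by rw [hk₁, hef.ef]; exact one_ne_zero)]
  have hnon' : ∀ {a b : Om Q}, a.1 x = x → b.1 x = x → bl Q (a.1 e) (b.1 e) = 1 →
      (ip (ρ a z) (ρ b z)).re = γ := by
    intro a b ha hb hab
    rw [ip_rho_rho hip]
    refine hnon _ ?_ ?_
    · rw [Om.mul_apply, hb]
      exact Om.inv_apply_eq _ ha
    · rw [Om.mul_apply, ← a.bl, Om.apply_inv_self, hab]
      exact one_ne_zero
  set l₀ := Fintype.card {l : L // l.1.1 e = e}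
  have hl₀ : 0 < l₀ := Fintype.card_pos_iff.2 ⟨⟨1, rfl⟩⟩
  have hvz : (∑ l : L, ip v (ρ l.1 v)).re = l₀ * N := by
    rw [sum_stabLine h hk hT hip he he0 hex hx hv, ← Complex.ofReal_natCast, Complex.re_ofReal_mul]
  have hzz : (ip z z).re = l * (l₀ * N) := by
    rw [hz, ip_sumOver hip, ← Complex.ofReal_natCast, Complex.re_ofReal_mul, hvz]
  have hll : q * l₀ ≤ 2 * l := card_stabLine h hk he he0 hex hx
  have hll' : (q : ℝ) * l₀ ≤ 2 * l := by exact_mod_cast hll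
  have hγ0 : 0 ≤ γ := by
    have h1 := hnn ((z + ρ k₁ z) - (ρ k₂ z + ρ k₃ z))
    have hz1 : ρ (1 : Om Q) z = z := by rw [map_one]; rfl
    have a1 := hperp h1x hk₂x h1e hk₂ hee₂ hef₂ hxf₂ hef₂'
    have a2 := hperp h1x hk₃x h1e hk₃ hef₂' hef₂.symm hxe₂ hee₂
    have a3 := hperp hk₁x hk₂x hk₁ hk₂ hfe₂ hef₂ hxf₂ hff₂
    have a4 := hperp hk₁x hk₃x hk₁ hk₃ hff₂ hef₂.symm hxe₂ hfe₂
    have a5 := hperp hk₂x h1x hk₂ h1e (by rw [bl_comm, hee₂]) hef hxf (by rw [bl_comm, hfe₂])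
    have a6 := hperp hk₃x h1x hk₃ h1e (by rw [bl_comm, hef₂']) hef hxf (by rw [bl_comm, hff₂])
    have a7 := hperp hk₂x hk₁x hk₂ hk₁ (by rw [bl_comm, hfe₂]) hef.symm hxe (by rw [bl_comm, hee₂])
    have a8 := hperp hk₃x hk₁x hk₃ hk₁ (by rw [bl_comm, hff₂]) hef.symm hxe
      (by rw [bl_comm, hef₂'])
    have b1 := hnon' h1x hk₁x (by rw [h1e, hk₁, hef.ef])
    have b2 := hnon' hk₁x h1x (by rw [h1e, hk₁, hef.fe])
    have b3 := hnon' hk₂x hk₃x (by rw [hk₂, hk₃, hef₂.ef])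
    have b4 := hnon' hk₃x hk₂x (by rw [hk₂, hk₃, hef₂.fe])
    rw [hz1] at a1 a2 a5 a6 b1 b2
    have c1 := congrArg Complex.re (hip k₁ z z)
    have c2 := congrArg Complex.re (hip k₂ z z)
    have c3 := congrArg Complex.re (hip k₃ z z)
    simp only [map_add, map_sub, LinearMap.add_apply, LinearMap.sub_apply, Complex.add_re,
      Complex.sub_re] at h1
    rw [b1, b2, b3, b4, c1, c2, c3, hzz] at h1
    have hq0 : (0 : ℝ) < q := by positivity
    have h2 : 0 ≤ (q : ℝ) * (4 * (l * (l₀ * N)) + 4 * γ) - 8 * (l * (l * N)) := by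
      have := mul_nonneg hq0.le h1
      linarith
    have h3 : (l * N) * ((q : ℝ) * l₀) ≤ (l * N) * (2 * l) :=
      mul_le_mul_of_nonneg_left hll' (by positivity)
    have h4 : 0 ≤ (q : ℝ) * γ := by linarith
    exact nonneg_of_mul_nonneg_right h4 hq0
  refine ⟨sumOver ρ (stab Q x) z, fun h0 => ?_, fun g hg => rho_sumOver _ _ (mem_stab.2 hg)⟩
  have hsum : (∑ g ∈ univ.filter (· ∈ stab Q x), (ip z (ρ g z)).re) = 0 := by
    have := congrArg (fun m => (ip z m).re) h0
    rw [sumOver_eq] at this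
    simp only [map_sum, map_zero, Complex.zero_re, Complex.re_sum] at this
    rw [← this]
    exact sum_subtype _ (by simp) _
  set C := stabLine Q x (span F {x, e}) with hC
  have hCsum : 0 ≤ ∑ g ∈ univ.filter (· ∈ C), (ip z (ρ g z)).re := by
    have := sum_ip_nonneg hip hnn C z
    rw [Complex.re_sum] at this
    rwa [sum_subtype (p := (· ∈ C)) _ (by simp)]
  have hCK : (univ.filter (· ∈ stab Q x)).filter (· ∈ C) = univ.filter (· ∈ C) := by
    ext g
    simp only [mem_filter, mem_univ, true_and, and_iff_right_iff_imp]
    exact fun hg => hg.1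
  rw [← sum_filter_add_sum_filter_not _ (· ∈ C), hCK] at hsum
  have hge : ∀ g : Om Q, g.1 x = x → g ∉ C → bl Q e (g.1 e) = 0 →
      (q : ℝ) * (ip z (ρ g z)).re = l * (l * N) := by
    intro g hg hgC hge
    have h2 : g.1 e ∉ span F {x, (1 : Om Q).1 e} := by
      intro h2
      refine hgC (mem_stabLine hg ?_)
      rintro y (rfl | rfl)
      · rw [hg]; exact subset_span (by simp)
      · exact h2
    have h5 := ip_perp_sum h hk hT hip he he0 hex hx hv h1x hg hge h2
    have h6 := congrArg Complex.re h5
    rw [← Complex.ofReal_natCast, ← Complex.ofReal_natCast, Complex.re_ofReal_mul,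
      Complex.re_ofReal_mul, Complex.re_ofReal_mul] at h6
    rw [map_one, End.one_apply] at h6
    exact h6
  have hq0 : (0 : ℝ) < q := by positivity
  have hl : 0 < l := Fintype.card_pos
  have hp : 0 < (l : ℝ) * (l * N) := by positivity
  refine (add_pos_of_nonneg_of_pos hCsum (sum_pos' (fun g hg => ?_) ⟨k₂, ?_, ?_⟩)).ne' hsum
  · simp only [mem_filter, mem_univ, true_and, mem_stab] at hg
    by_cases h1 : bl Q e (g.1 e) = 0
    · exact nonneg_of_mul_nonneg_right (by rw [hge g hg.1 hg.2 h1]; exact hp.le) hq0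
    · rw [hnon g hg.1 h1]; exact hγ0
  · simp only [mem_filter, mem_univ, true_and, mem_stab]
    refine ⟨hk₂x, fun h1 => ?_⟩
    have h2 := stabLine_apply h1 (subset_span (by simp : e ∈ ({x, e} : Set V)))
    rw [hk₂] at h2
    exact notMem_of_bl (Q := Q) (w := f₂) (by simp [hxf₂, hef₂'])
      (by rw [hef₂.ef]; exact one_ne_zero) h2
  · refine pos_of_mul_pos_right (a := (q : ℝ)) ?_ hq0.le
    rw [hge k₂ hk₂x ?_ (by rw [hk₂, hee₂])]
    · exact hp
    · intro h1
      have h2 := stabLine_apply h1 (subset_span (by simp : e ∈ ({x, e} : Set V)))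
      rw [hk₂] at h2
      exact notMem_of_bl (Q := Q) (w := f₂) (by simp [hxf₂, hef₂'])
        (by rw [hef₂.ef]; exact one_ne_zero) h2

/-- If the group acts nontrivially, some nontrivial weight space is nonzero. -/
theorem exists_wsp_of_nontrivial (hQ : Nondeg Q) {g : Om Q} {m : M} (hg : ρ g m ≠ m) :
    ∃ e x, Q e = 0 ∧ e ≠ 0 ∧ bl Q e x = 0 ∧ x ∉ span F {e} ∧
      ∃ v ∈ wsp ρ e x, v ≠ 0 := by
  have := finite_of_finite F (M := V)
  have := Fintype.ofFinite V
  by_contra hc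
  push Not at hc
  refine hg ?_
  revert m
  suffices h : ∀ m, ρ g m = m from fun {m} _ => h m
  induction g using Om.induction with
  | h1 => intro m; rw [map_one]; rfl
  | hm g h hg hh => intro m; rw [rho_mul, hh, hg]
  | hs a w ha haw =>
    intro m
    by_cases ha0 : a = 0
    · subst ha0
      have h0 : sg Q (0 : V) w = 1 := by
        have := sg_smul_left (Q := Q) (a := (0 : V)) (w := w) (c := (0 : F)) (by simp) (by simp)
        rw [zero_smul, zero_smul] at this
        rw [this, sg_zero]
      rw [h0, map_one]; rfl
    · obtain ⟨f, hf, -⟩ := exists_hyp hQ (U := ∅) ha (by simpa using ha0) (by simp)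
      refine exists_wsp_ne_bot ρ hQ hf (fun x hx => ?_) w haw m
      rw [Submodule.eq_bot_iff]
      intro v hv
      refine hc a x ha ha0 (hf.be x) (fun h1 => hx ?_) v hv
      obtain ⟨c, hcx⟩ := mem_span_singleton.1 h1
      have h2 := hf.bf x
      rw [← hcx, map_smul, hf.fe, smul_eq_mul, mul_one] at h2
      rw [h2, zero_smul] at hcx
      exact Subtype.ext hcx.symm

end Fixed

open Finset Representation

section Generic
variable {G : Type} [Group G]

/-- `χ` is the character of a finite-dimensional complex representation. -/
def IsChar (χ : G → ℂ) : Prop :=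
  ∃ (M : Type) (_ : AddCommGroup M) (_ : Module ℂ M) (_ : FiniteDimensional ℂ M)
    (ρ : Representation ℂ G M), χ = ρ.character

/-- `χ` is the character of an irreducible finite-dimensional complex representation. -/
def IrrChar (χ : G → ℂ) : Prop :=
  ∃ (M : Type) (_ : AddCommGroup M) (_ : Module ℂ M) (_ : FiniteDimensional ℂ M)
    (ρ : Representation ℂ G M), ρ.IsIrreducible ∧ χ = ρ.character

/-- A commuting idempotent cuts out a subrepresentation. -/
theorem isChar_of_idem {M : Type} [AddCommGroup M] [Module ℂ M] [FiniteDimensional ℂ M]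
    (ρ : Representation ℂ G M) (P : M →ₗ[ℂ] M) (hP : P ∘ₗ P = P)
    (hc : ∀ g, P ∘ₗ ρ g = ρ g ∘ₗ P) :
    ∃ σ : Representation ℂ G P.range, (∀ g m, ((σ g m : P.range) : M) = ρ g m) ∧
      ∀ g, σ.character g = LinearMap.trace ℂ M (P ∘ₗ ρ g) := by
  have hmem : ∀ g, ∀ m ∈ P.range, ρ g m ∈ P.range := by
    rintro g _ ⟨m, rfl⟩
    exact ⟨ρ g m, LinearMap.congr_fun (hc g) m⟩
  let N : Subrepresentation ρ := ⟨P.range, fun g m hm => hmem g m hm⟩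
  refine ⟨N.toRepresentation, fun g m => rfl, fun g => ?_⟩
  let P' : M →ₗ[ℂ] P.range := P.rangeRestrict
  have h1 : P = P.range.subtype ∘ₗ P' := rfl
  have h2 : P' ∘ₗ P.range.subtype = LinearMap.id := by
    ext ⟨_, m, rfl⟩
    exact LinearMap.congr_fun hP m
  have h3 : P ∘ₗ ρ g = P.range.subtype ∘ₗ (N.toRepresentation g ∘ₗ P') := by
    rw [hc]; rfl
  rw [h3, LinearMap.trace_comp_comm', LinearMap.comp_assoc, h2]
  rfl

theorem IsChar.exists_multiset [Finite G] {χ : G → ℂ} (h : IsChar χ) :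
    ∃ s : Multiset (G → ℂ), (∀ ψ ∈ s, IrrChar ψ) ∧ χ = s.sum := by
  obtain ⟨M, i1, i2, i3, ρ, rfl⟩ := h
  induction hn : finrank ℂ M using Nat.strong_induction_on generalizing M with
  | _ n ih =>
  subst hn
  by_cases hirr : ρ.IsIrreducible
  · exact ⟨{ρ.character}, by simpa using ⟨M, i1, i2, i3, ρ, hirr, rfl⟩, by simp⟩
  rcases subsingleton_or_nontrivial M with hs | hs
  · refine ⟨0, by simp, ?_⟩
    ext g
    have : ρ g = 0 := Subsingleton.elim _ _
    simp [Representation.character, this]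
  have hne : Nontrivial (Subrepresentation ρ) := by
    obtain ⟨m, hm⟩ := exists_ne (0 : M)
    refine ⟨⊥, ⊤, fun h => hm ?_⟩
    have : m ∈ (⊤ : Subrepresentation ρ) := Submodule.mem_top (R := ℂ) (M := M)
    rw [← h] at this
    exact this
  have : ∃ N : Subrepresentation ρ, N ≠ ⊥ ∧ N ≠ ⊤ := by
    by_contra hc
    push Not at hc
    exact hirr ⟨fun N => or_iff_not_imp_left.2 (hc N)⟩
  obtain ⟨N, hN0, hN1⟩ := this
  obtain ⟨N', hNN'⟩ := exists_isCompl N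
  have hcompl : IsCompl N.toSubmodule N'.toSubmodule := by
    refine ⟨?_, ?_⟩
    · rw [disjoint_iff, ← Subrepresentation.toSubmodule_inf, hNN'.inf_eq_bot]; rfl
    · rw [codisjoint_iff, ← Subrepresentation.toSubmodule_sup, hNN'.sup_eq_top]; rfl
  have key : ∀ (A B : Subrepresentation ρ) (h : IsCompl A.toSubmodule B.toSubmodule), 
      B ≠ ⊥ →
      ∃ P : M →ₗ[ℂ] M, P ∘ₗ P = P ∧ (∀ g, P ∘ₗ ρ g = ρ g ∘ₗ P) ∧ finrank ℂ P.range < finrank ℂ M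
        ∧ (∀ m ∈ A.toSubmodule, P m = m) ∧ (∀ m ∈ B.toSubmodule, P m = 0) := by
    intro A B h hB
    have e1 : ∀ m ∈ A.toSubmodule, (A.toSubmodule.projection B.toSubmodule h) m = m := fun m hm =>
      Submodule.projection_apply_left h ⟨m, hm⟩
    have e2 : ∀ m ∈ B.toSubmodule, (A.toSubmodule.projection B.toSubmodule h) m = 0 := fun m hm =>
      (Submodule.projection_apply_eq_zero_iff h).2 hm
    have hdec : ∀ m, ∃ a ∈ A.toSubmodule, ∃ b ∈ B.toSubmodule, a + b = m := fun m =>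
      Submodule.mem_sup.1 (h.sup_eq_top ▸ Submodule.mem_top)
    refine ⟨(A.toSubmodule.projection B.toSubmodule h), ?_, ?_, ?_, e1, e2⟩
    · ext m
      obtain ⟨a, ha, b, hb, rfl⟩ := hdec m
      simp [e1 _ ha, e2 _ hb]
    · intro g
      ext m
      obtain ⟨a, ha, b, hb, rfl⟩ := hdec m
      simp [e1 _ ha, e2 _ hb, e1 _ (A.apply_mem_toSubmodule g ha),
        e2 _ (B.apply_mem_toSubmodule g hb)]
    · refine lt_of_le_of_lt (Submodule.finrank_mono (t := A.toSubmodule) ?_) ?_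
      · rintro _ ⟨m, rfl⟩
        obtain ⟨a, ha, b, hb, rfl⟩ := hdec m
        simpa [e1 _ ha, e2 _ hb] using ha
      · refine Submodule.finrank_lt ?_
        intro hA
        apply hB
        apply Subrepresentation.toSubmodule_injective
        rw [hA] at h
        exact (by simpa using h.inf_eq_bot : B.toSubmodule = ⊥)
  have hN'0 : N' ≠ ⊥ := by
    rintro rfl
    exact hN1 (by simpa using hNN'.sup_eq_top)
  obtain ⟨P, hP, hPc, hPd, hPA, hPB⟩ := key N N' hcompl hN'0
  obtain ⟨P', hP', hPc', hPd', hPA', hPB'⟩ := key N' N hcompl.symm hN0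
  obtain ⟨σ, -, hσ⟩ := isChar_of_idem ρ P hP hPc
  obtain ⟨σ', -, hσ'⟩ := isChar_of_idem ρ P' hP' hPc'
  obtain ⟨s, hs, hs'⟩ := ih _ hPd _ _ _ inferInstance σ rfl
  obtain ⟨s', hs1, hs1'⟩ := ih _ hPd' _ _ _ inferInstance σ' rfl
  refine ⟨s + s', fun ψ hψ => (Multiset.mem_add.1 hψ).elim (hs ψ) (hs1 ψ), ?_⟩
  rw [Multiset.sum_add, ← hs', ← hs1']
  ext g
  rw [Pi.add_apply, hσ, hσ', ← map_add, ← LinearMap.add_comp]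
  have : P + P' = LinearMap.id := by
    ext m
    obtain ⟨a, ha, b, hb, rfl⟩ := Submodule.mem_sup.1 (hcompl.sup_eq_top ▸ Submodule.mem_top (x := m))
    simp [hPA _ ha, hPB _ hb, hPA' _ hb, hPB' _ ha]
  rw [this]; rfl

variable [Fintype G]

theorem cardG_ne : (Nat.card G : ℂ) ≠ 0 := by
  rw [Nat.card_eq_fintype_card]; exact_mod_cast Fintype.card_ne_zero

/-- The (bilinear) inner product of class functions. -/
noncomputable def cip : (G → ℂ) →ₗ[ℂ] (G → ℂ) →ₗ[ℂ] ℂ :=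
  LinearMap.mk₂ ℂ (fun φ ψ => (Nat.card G : ℂ)⁻¹ * ∑ g, φ g * ψ g⁻¹)
    (fun a b c => by simp [add_mul, sum_add_distrib, mul_add])
    (fun r a b => by simp [mul_sum, mul_assoc, mul_left_comm])
    (fun a b c => by simp [sum_add_distrib, mul_add])
    (fun r a b => by simp [mul_sum, mul_left_comm])

theorem cip_apply (φ ψ : G → ℂ) : cip φ ψ = (Nat.card G : ℂ)⁻¹ * ∑ g, φ g * ψ g⁻¹ := rfl

theorem cip_comm (φ ψ : G → ℂ) : cip φ ψ = cip ψ φ := by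
  rw [cip_apply, cip_apply, ← Equiv.sum_comp (Equiv.inv G)]
  simp [mul_comm]

theorem cip_char {M N : Type} [AddCommGroup M] [Module ℂ M] [FiniteDimensional ℂ M]
    [AddCommGroup N] [Module ℂ N] [FiniteDimensional ℂ N] (ρ : Representation ℂ G M)
    (σ : Representation ℂ G N) :
    cip σ.character ρ.character = finrank ℂ (IntertwiningMap ρ σ) := by
  have := invertibleOfNonzero (cardG_ne (G := G))
  exact card_inv_mul_sum_char_mul_char_eq_finrank ρ σ

open scoped Classical in
theorem IrrChar.cip {χ ψ : G → ℂ} (hχ : IrrChar χ) (hψ : IrrChar ψ) :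
    cip χ ψ = if χ = ψ then 1 else 0 := by
  obtain ⟨M, i1, i2, i3, ρ, hρ, rfl⟩ := hχ
  obtain ⟨N, j1, j2, j3, σ, hσ, rfl⟩ := hψ
  have := invertibleOfNonzero (cardG_ne (G := G))
  have h := char_orthonormal ρ σ
  rw [cip_apply, h]
  have h' := char_orthonormal ρ ρ
  by_cases he : ρ.character = σ.character
  · rw [he] at h' h
    rw [if_pos he, ← h, h', if_pos ⟨Representation.Equiv.refl ρ⟩]
  · rw [if_neg he, if_neg]
    rintro ⟨e⟩
    exact he (char_iso e).symm

theorem IrrChar.cip_self {χ : G → ℂ} (hχ : IrrChar χ) : OC.cip χ χ = 1 := by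
  simp [hχ.cip hχ]

theorem IrrChar.cip_ne {χ ψ : G → ℂ} (hχ : IrrChar χ) (hψ : IrrChar ψ) (h : χ ≠ ψ) :
    OC.cip χ ψ = 0 := by
  simp [hχ.cip hψ, h]

/-- A character is a combination of irreducible characters with multiplicities. -/
theorem IsChar.exists_finset {χ : G → ℂ} (h : IsChar χ) :
    ∃ (S : Finset (G → ℂ)) (m : (G → ℂ) → ℕ), (∀ ψ ∈ S, IrrChar ψ) ∧ (∀ ψ ∈ S, m ψ ≠ 0) ∧
      χ = ∑ ψ ∈ S, m ψ • ψ ∧ (∀ ψ ∈ S, cip χ ψ = m ψ) ∧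
      (∀ ψ, IrrChar ψ → ψ ∉ S → cip χ ψ = 0) ∧ cip χ χ = ∑ ψ ∈ S, (m ψ : ℂ) ^ 2 := by
  classical
  obtain ⟨s, hs, rfl⟩ := h.exists_multiset
  have h1 : ∀ ψ, IrrChar ψ → cip s.sum ψ = s.count ψ := by
    intro ψ hψ
    rw [sum_multiset_count, map_sum, LinearMap.sum_apply]
    rw [sum_eq_single ψ]
    · rw [map_nsmul, LinearMap.smul_apply, hψ.cip_self, nsmul_one]
    · intro φ hφ hne
      rw [map_nsmul, LinearMap.smul_apply, (hs φ (Multiset.mem_toFinset.1 hφ)).cip_ne hψ hne,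
        smul_zero]
    · intro hn
      simp [Multiset.count_eq_zero_of_notMem (fun h => hn (Multiset.mem_toFinset.2 h))]
  have hS : ∀ ψ ∈ s.toFinset, IrrChar ψ := fun ψ hψ => hs ψ (Multiset.mem_toFinset.1 hψ)
  refine ⟨s.toFinset, fun ψ => s.count ψ, hS, fun ψ hψ => ?_, sum_multiset_count s,
    fun ψ hψ => h1 ψ (hS ψ hψ), fun ψ hψ hn => ?_, ?_⟩
  · exact (Multiset.count_pos.2 (Multiset.mem_toFinset.1 hψ)).ne'
  · rw [h1 ψ hψ, Multiset.count_eq_zero_of_notMem (fun h => hn (Multiset.mem_toFinset.2 h)),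
      Nat.cast_zero]
  · have h2 : cip s.sum s.sum = cip s.sum (∑ ψ ∈ s.toFinset, s.count ψ • ψ) := by
      rw [← sum_multiset_count]
    rw [h2, map_sum]
    refine sum_congr rfl fun ψ hψ => ?_
    rw [map_nsmul, h1 ψ (hS ψ hψ)]
    simp [sq]

theorem IsChar.cip_nat {φ ψ : G → ℂ} (hφ : IsChar φ) (hψ : IsChar ψ) : ∃ k : ℕ, cip φ ψ = k := by
  obtain ⟨M, i1, i2, i3, ρ, rfl⟩ := hφ
  obtain ⟨N, j1, j2, j3, σ, rfl⟩ := hψ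
  exact ⟨_, cip_char σ ρ⟩

theorem IsChar.one_le_cip {φ : G → ℂ} (hφ : IsChar φ) (h0 : φ ≠ 0) {k : ℕ} (hk : cip φ φ = k) :
    1 ≤ k := by
  obtain ⟨S, m, hS, hm, h1, -, -, h2⟩ := hφ.exists_finset
  rw [h2] at hk
  obtain ⟨ψ, hψ⟩ : S.Nonempty := by
    by_contra hc
    rw [not_nonempty_iff_eq_empty] at hc
    subst hc
    exact h0 (by simpa using h1)
  have h3 : ∑ ψ ∈ S, (m ψ) ^ 2 = k := by exact_mod_cast hk
  have := single_le_sum (f := fun ψ => m ψ ^ 2) (fun _ _ => Nat.zero_le _) hψ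
  have := Nat.one_le_iff_ne_zero.2 (pow_ne_zero 2 (hm ψ hψ))
  omega

theorem IsChar.irr_of_cip {φ : G → ℂ} (hφ : IsChar φ) (h : cip φ φ = 1) : IrrChar φ := by
  obtain ⟨S, m, hS, hm, h1, -, -, h2⟩ := hφ.exists_finset
  rw [h2] at h
  have h3 : ∑ ψ ∈ S, (m ψ) ^ 2 = 1 := by exact_mod_cast h
  have hle : ∀ ψ ∈ S, 1 ≤ m ψ ^ 2 := fun ψ hψ => Nat.one_le_iff_ne_zero.2 (pow_ne_zero 2 (hm ψ hψ))
  have hc : S.card ≤ 1 := by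
    rw [← h3, card_eq_sum_ones]
    exact sum_le_sum hle
  have hne : S.Nonempty := by
    by_contra hc
    rw [not_nonempty_iff_eq_empty] at hc
    subst hc
    simp at h3
  obtain ⟨ψ, rfl⟩ := card_eq_one.1 (le_antisymm hc hne.card_pos)
  have : m ψ = 1 := by simpa using h3
  rw [h1, sum_singleton, this, one_smul]
  exact hS ψ (by simp)

theorem isChar_one : IrrChar (fun _ : G => (1 : ℂ)) := by
  refine IsChar.irr_of_cip ⟨ℂ, inferInstance, inferInstance, inferInstance,
    Representation.trivial ℂ G ℂ, ?_⟩ ?_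
  · ext g; simp [Representation.character]
  · rw [cip_apply]
    simp [Nat.card_eq_fintype_card]

end Generic

section Perm
variable {G X Y : Type} [Group G] [MulAction G X] [Fintype X] [DecidableEq X]
  [MulAction G Y] [Fintype Y] [DecidableEq Y]

/-- The permutation representation on functions. -/
noncomputable def permRep (G X : Type) [Group G] [MulAction G X] :
    Representation ℂ G (X → ℂ) where
  toFun g := LinearMap.funLeft ℂ ℂ (fun x => g⁻¹ • x)
  map_one' := by ext; simp [LinearMap.funLeft]
  map_mul' g h := by ext; simp [LinearMap.funLeft, mul_smul]

theorem permRep_apply (g : G) (f : X → ℂ) (x : X) : permRep G X g f x = f (g⁻¹ • x) := rfl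

theorem permRep_single (g : G) (x : X) (c : ℂ) :
    permRep G X g (Pi.single x c) = Pi.single (g • x) c := by
  ext y
  rw [permRep_apply, Pi.single_apply, Pi.single_apply]
  simp only [inv_smul_eq_iff]

/-- The class function attached to an invariant kernel. -/
noncomputable def kchar (k : Matrix X X ℂ) (g : G) : ℂ := ∑ x, k x (g • x)

theorem trace_kernel (k : Matrix X X ℂ) (g : G) :
    LinearMap.trace ℂ (X → ℂ) (Matrix.toLin' k ∘ₗ permRep G X g) = kchar k g := by
  have h : permRep G X g = Matrix.toLin' (Matrix.of fun x y => if y = g⁻¹ • x then (1 : ℂ) else 0) := by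
    ext x y
    simp [permRep_single, Pi.single_apply, eq_inv_smul_iff, eq_comm]
  rw [h, ← Matrix.toLin'_mul, Matrix.trace_toLin'_eq]
  simp only [Matrix.trace, Matrix.diag, Matrix.mul_apply, kchar, Matrix.of_apply]
  refine sum_congr rfl fun x _ => ?_
  rw [sum_eq_single (g • x)]
  · simp
  · intro y _ hy
    rw [if_neg, mul_zero]
    rintro rfl
    exact hy (by simp)
  · simp

theorem kchar_isChar {k : Matrix X X ℂ} (hk : k * k = k)
    (hG : ∀ (g : G) x y, k (g • x) (g • y) = k x y) : IsChar (kchar k : G → ℂ) := by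
  obtain ⟨σ, -, hσ⟩ := isChar_of_idem (permRep G X) (Matrix.toLin' k)
    (by rw [← Matrix.toLin'_mul, hk]) (fun g => by
      ext x y
      simp only [LinearMap.comp_apply, Matrix.toLin'_apply, permRep_apply, LinearMap.single_apply,
        permRep_single, Matrix.mulVec_single_one, Matrix.col_apply]
      rw [← hG g⁻¹, inv_smul_smul])
  exact ⟨_, _, _, inferInstance, σ, by ext g; rw [hσ, trace_kernel]⟩

theorem kchar_one (k : Matrix X X ℂ) : kchar k (1 : G) = k.trace := by
  simp [kchar, Matrix.trace]

theorem kchar_sum {ι : Type} (s : Finset ι) (k : ι → Matrix X X ℂ) :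
    (kchar (∑ i ∈ s, k i) : G → ℂ) = ∑ i ∈ s, kchar (k i) := by
  ext g
  simp only [kchar, Matrix.sum_apply, Finset.sum_apply]
  exact sum_comm

/-- The permutation character. -/
noncomputable def pchar (G X : Type) [Group G] [MulAction G X] [Fintype X] [DecidableEq X] :
    G → ℂ := kchar (1 : Matrix X X ℂ)

theorem pchar_eq : pchar G X = (permRep G X).character := by
  ext g
  rw [pchar, ← trace_kernel, Matrix.toLin'_one, LinearMap.id_comp]; rfl

theorem pchar_isChar : IsChar (pchar G X) := ⟨_, _, _, inferInstance, _, pchar_eq⟩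

theorem pchar_apply (g : G) : pchar G X g = ∑ x : X, if g • x = x then 1 else 0 := by
  simp [pchar, kchar, Matrix.one_apply, eq_comm]

theorem pchar_one : pchar G X 1 = Fintype.card X := by
  simp [pchar_apply]

variable [Fintype G]

theorem cip_pchar {I : Type} [Fintype I] (inv : X × Y → I) (hs : Function.Surjective inv)
    (h : ∀ p p', inv p = inv p' ↔ ∃ g : G, g • p = p') :
    cip (pchar G X) (pchar G Y) = Fintype.card I := by
  classical
  have e : MulAction.orbitRel.Quotient G (X × Y) ≃ I :=
    Equiv.ofBijective (Quotient.lift inv (fun p p' (hp : MulAction.orbitRel G _ p p') => by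
        obtain ⟨g, hg⟩ := MulAction.orbitRel_apply.1 hp
        exact ((h p' p).2 ⟨g, hg⟩).symm)) (by
      constructor
      · intro a b
        induction a using Quotient.inductionOn
        induction b using Quotient.inductionOn
        intro hab
        obtain ⟨g, hg⟩ := (h _ _).1 hab
        exact (Quotient.sound (s := MulAction.orbitRel G _)
          (MulAction.orbitRel_apply.2 ⟨g, hg⟩)).symm
      · intro i
        obtain ⟨p, hp⟩ := hs i
        exact ⟨Quotient.mk _ p, hp⟩)
  have hb := MulAction.sum_card_fixedBy_eq_card_orbits_mul_card_group G (X × Y)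
  rw [Fintype.card_congr e] at hb
  rw [cip_apply]
  have h2 : ∀ g : G, pchar G X g * pchar G Y g⁻¹ =
      (Fintype.card (MulAction.fixedBy (X × Y) g) : ℂ) := by
    intro g
    rw [pchar_apply, pchar_apply, sum_mul_sum, Fintype.card_subtype, card_filter,
      ← univ_product_univ, sum_product]
    push_cast
    refine sum_congr rfl fun x _ => sum_congr rfl fun y _ => ?_
    simp only [MulAction.mem_fixedBy, Prod.smul_mk, Prod.mk.injEq, inv_smul_eq_iff]
    have h0 : (y = g • y) ↔ (g • y = y) := eq_comm
    simp only [h0]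
    by_cases h1 : g • x = x <;> by_cases h2 : g • y = y <;> simp [h1, h2]
  rw [sum_congr rfl fun g _ => h2 g, ← Nat.cast_sum, hb]
  push_cast
  rw [Nat.card_eq_fintype_card, mul_comm, mul_assoc, mul_inv_cancel₀, mul_one]
  exact_mod_cast Fintype.card_ne_zero

variable {M : Type} [AddCommGroup M] [Module ℂ M] [FiniteDimensional ℂ M]
  (ρ : Representation ℂ G M)

theorem cip_pchar_ne_zero (x : X) (hx : ∀ y : X, ∃ g : G, g • x = y) {t : M} (ht : t ≠ 0)
    (hfix : ∀ g : G, g • x = x → ρ g t = t) : cip ρ.character (pchar G X) ≠ 0 := by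
  rw [pchar_eq, cip_char]
  choose γ hγ using hx
  have hm : ∀ g y, ρ g (ρ (γ y) t) = ρ (γ (g • y)) t := by
    intro g y
    have h1 := hfix ((γ (g • y))⁻¹ * (g * γ y)) (by
      rw [mul_smul, mul_smul, hγ, inv_smul_eq_iff, hγ])
    conv_rhs => rw [← h1]
    rw [← End.mul_apply, ← End.mul_apply, ← map_mul, ← map_mul, mul_inv_cancel_left]
  let T : IntertwiningMap (permRep G X) ρ := LinearMap.intertwiningMap_of_isIntertwiningMap _ _
    (Fintype.linearCombination ℂ (fun y => ρ (γ y) t)) (fun g f => by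
      simp only [Fintype.linearCombination_apply, map_sum, map_smul, hm, permRep_apply]
      rw [← Equiv.sum_comp (MulAction.toPerm g)]
      simp)
  have hT : T ≠ 0 := by
    intro h0
    have h1 : T (Pi.single (γ x • x) 1) = 0 := by rw [h0]; rfl
    have h2 : T (Pi.single (γ x • x) 1) = ρ (γ (γ x • x)) t := by
      change Fintype.linearCombination ℂ (fun y => ρ (γ y) t) _ = _
      rw [Fintype.linearCombination_apply_single, one_smul]
    rw [h2] at h1
    apply ht
    have h3 := congrArg (ρ (γ (γ x • x))⁻¹) h1
    rwa [← End.mul_apply, ← map_mul, inv_mul_cancel, map_one, map_zero] at h3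
  have hfin : FiniteDimensional ℂ (IntertwiningMap (permRep G X) ρ) :=
    (invariantsEquivIntertwiningMap (permRep G X) ρ).finiteDimensional
  have : Nontrivial (IntertwiningMap (permRep G X) ρ) := ⟨T, 0, hT⟩
  exact_mod_cast (finrank_pos (R := ℂ) (M := IntertwiningMap (permRep G X) ρ)).ne'

theorem fixed_of_cip_ne_zero (x : X) (hx : ∀ y : X, ∃ g : G, g • x = y)
    (h : cip ρ.character (pchar G X) ≠ 0) :
    ∃ t : M, t ≠ 0 ∧ ∀ g : G, g • x = x → ρ g t = t := by
  rw [pchar_eq, cip_char] at h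
  have h1 : 0 < finrank ℂ (IntertwiningMap (permRep G X) ρ) :=
    Nat.pos_of_ne_zero (by exact_mod_cast h)
  obtain ⟨T, hT⟩ := finrank_pos_iff_exists_ne_zero.1 h1
  refine ⟨T (Pi.single x 1), fun h0 => hT ?_, fun g hg => ?_⟩
  · apply IntertwiningMap.ext
    refine LinearMap.pi_ext' fun y => ?_
    obtain ⟨g, rfl⟩ := hx y
    ext
    change T (Pi.single (g • x) 1) = 0
    rw [← permRep_single, T.isIntertwining, h0, map_zero]
  · rw [← T.isIntertwining, permRep_single, hg]

theorem cip_pchar_le_one (x : X) (hx : ∀ y : X, ∃ g : G, g • x = y)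
    (h : ∀ t t' : M, t ≠ 0 → (∀ g : G, g • x = x → ρ g t = t) →
      (∀ g : G, g • x = x → ρ g t' = t') → ∃ c : ℂ, t' = c • t) {k : ℕ}
    (hk : cip ρ.character (pchar G X) = k) : k ≤ 1 := by
  rw [pchar_eq, cip_char] at hk
  rw [← (Nat.cast_injective hk : _ = k)]
  have hfix : ∀ T : IntertwiningMap (permRep G X) ρ, ∀ g : G, g • x = x →
      ρ g (T (Pi.single x 1)) = T (Pi.single x 1) := fun T g hg => by
    rw [← T.isIntertwining, permRep_single, hg]
  have hext : ∀ T T' : IntertwiningMap (permRep G X) ρ,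
      T (Pi.single x 1) = T' (Pi.single x 1) → T = T' := by
    intro T T' h
    apply IntertwiningMap.ext
    refine LinearMap.pi_ext' fun y => ?_
    obtain ⟨g, rfl⟩ := hx y
    ext
    change T (Pi.single (g • x) 1) = T' (Pi.single (g • x) 1)
    rw [← permRep_single, T.isIntertwining, h, T'.isIntertwining]
  by_cases h0 : ∃ T : IntertwiningMap (permRep G X) ρ, T ≠ 0
  · obtain ⟨T, hT⟩ := h0
    refine finrank_le_one T fun T' => ?_
    obtain ⟨c, hc⟩ := h _ (T' (Pi.single x 1))
      (fun h0 => hT (hext T 0 h0)) (hfix T) (hfix T')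
    exact ⟨c, hext _ _ hc.symm⟩
  · push Not at h0
    have : Subsingleton (IntertwiningMap (permRep G X) ρ) := ⟨fun a b => by rw [h0 a, h0 b]⟩
    rw [finrank_zero_of_subsingleton]
    exact Nat.zero_le _

omit [MulAction G X] [Fintype X] [DecidableEq X] [MulAction G Y] [Fintype Y] [DecidableEq Y] in
theorem schur [hρ : ρ.IsIrreducible] (T : M →ₗ[ℂ] M) (hT : ∀ g m, T (ρ g m) = ρ g (T m)) :
    ∃ c : ℂ, ∀ m, T m = c • m := by
  obtain ⟨c, hc⟩ := (IsIrreducible.algebraMap_intertwiningMap_bijective_of_isAlgClosed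
    (ρ := ρ)).2 (LinearMap.intertwiningMap_of_isIntertwiningMap _ _ T hT)
  refine ⟨c, fun m => ?_⟩
  exact (DFunLike.congr_fun hc m).symm

omit [MulAction G X] [Fintype X] [DecidableEq X] [MulAction G Y] [Fintype Y] [DecidableEq Y] in
/-- Schur orthogonality for an invariant form. -/
theorem schur_ip [hρ : ρ.IsIrreducible] {ip : M →ₗ⋆[ℂ] M →ₗ[ℂ] ℂ}
    (hip : ∀ (g : G) m m', ip (ρ g m) (ρ g m') = ip m m') (a b : M) :
    ∃ c : ℂ, c * finrank ℂ M = Fintype.card G * ip a b ∧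
      ∀ v, ∑ h : G, ip (ρ h a) v • ρ h b = c • v := by
  set T : M →ₗ[ℂ] M := ∑ h : G, (ip (ρ h a)).smulRight (ρ h b) with hTdef
  have hTa : ∀ v, T v = ∑ h : G, ip (ρ h a) v • ρ h b := by
    intro v; simp [hTdef, LinearMap.sum_apply]
  obtain ⟨c, hc⟩ := schur ρ T (fun g m => by
    rw [hTa, hTa, map_sum, ← Equiv.sum_comp (Equiv.mulLeft g)]
    refine sum_congr rfl fun h _ => ?_
    rw [map_smul, Equiv.coe_mulLeft, map_mul, End.mul_apply, End.mul_apply, hip])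
  refine ⟨c, ?_, fun v => by rw [← hTa, hc]⟩
  have h1 : LinearMap.trace ℂ M T = Fintype.card G * ip a b := by
    rw [hTdef, map_sum]
    simp [LinearMap.trace_smulRight, hip]
  have h2 : T = c • LinearMap.id := by ext m; rw [hc]; rfl
  rw [← h1, h2]
  simp

/-- Symmetric orbitals force multiplicity one. -/
theorem fixed_unique [hρ : ρ.IsIrreducible] (x : X)
    (hsym : ∀ g : G, ∃ k : G, k • x = g • x ∧ k • g • x = x) {t t' : M} (ht0 : t ≠ 0)
    (ht : ∀ g : G, g • x = x → ρ g t = t) (ht' : ∀ g : G, g • x = x → ρ g t' = t') :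
    ∃ c : ℂ, t' = c • t := by
  obtain ⟨ip, hip, hnn, hpos⟩ := exists_ip ρ
  have ht00 : ip t t ≠ 0 := fun h => by have := hpos t ht0; rw [h] at this; simp at this
  set u := t' - ((starRingEnd ℂ) (ip t' t / ip t t)) • t with hu
  have hut : ip u t = 0 := by
    rw [hu, map_sub, LinearMap.sub_apply, LinearMap.map_smulₛₗ, LinearMap.smul_apply,
      Complex.conj_conj, smul_eq_mul, div_mul_cancel₀ _ ht00, sub_self]
  have hufix : ∀ g : G, g • x = x → ρ g u = u := fun g hg => by
    rw [hu, map_sub, map_smul, ht g hg, ht' g hg]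
  suffices hu0 : u = 0 from ⟨_, sub_eq_zero.1 hu0⟩
  by_contra hu0
  have huu : ip u u ≠ 0 := fun h => by have := hpos u hu0; rw [h] at this; simp at this
  have hsym1 : ∀ (a b : M), (∀ g : G, g • x = x → ρ g a = a) → (∀ g : G, g • x = x → ρ g b = b) →
      ∀ g : G, ip (ρ g a) b = ip a (ρ g b) := by
    intro a b ha hb g
    obtain ⟨k, hk1, hk2⟩ := hsym g
    rw [← hip k, ← End.mul_apply, ← map_mul, ha (k * g) (by rw [mul_smul, hk2])]
    congr 1
    have h1 := hb (g⁻¹ * k) (by rw [mul_smul, hk1, inv_smul_smul])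
    conv_rhs => rw [← h1]
    rw [← End.mul_apply, ← map_mul, mul_inv_cancel_left]
  have hsym2 : ∀ (a b : M), (∀ g : G, g • x = x → ρ g a = a) → (∀ g : G, g • x = x → ρ g b = b) →
      ∀ g h : G, ip (ρ g a) (ρ h b) = ip (ρ h a) (ρ g b) := by
    intro a b ha hb g h
    rw [← hip h⁻¹, ← End.mul_apply, ← End.mul_apply, ← map_mul, ← map_mul,
      inv_mul_cancel, map_one, End.one_apply, hsym1 a b ha hb, ← hip h,
      ← End.mul_apply, ← map_mul, mul_inv_cancel_left]
  have hM : Nontrivial M := ⟨t, 0, ht0⟩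
  have hd : (finrank ℂ M : ℂ) ≠ 0 := by exact_mod_cast finrank_pos.ne'
  have hcd : (Fintype.card G : ℂ) ≠ 0 := by exact_mod_cast Fintype.card_ne_zero
  obtain ⟨c1, hc1, h1⟩ := schur_ip ρ hip u t
  have hc10 : c1 = 0 := by
    rw [hut, mul_zero] at hc1
    exact (mul_eq_zero.1 hc1).resolve_right hd
  obtain ⟨c2, hc2, h2⟩ := schur_ip ρ hip t t
  have hc20 : c2 ≠ 0 := by
    rintro rfl
    rw [zero_mul] at hc2
    exact mul_ne_zero hcd ht00 hc2.symm
  obtain ⟨c3, hc3, h3⟩ := schur_ip ρ hip u u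
  have hc30 : c3 ≠ 0 := by
    rintro rfl
    rw [zero_mul] at hc3
    exact mul_ne_zero hcd huu hc3.symm
  have key : ∀ g : G, ip (ρ g u) t = 0 := by
    intro g
    have e1 := congrArg (ip t) (h1 (ρ g t))
    have e2 := congrArg (ip (ρ g u)) (h2 t)
    rw [hc10, zero_smul, map_zero, map_sum] at e1
    rw [map_sum, map_smul, smul_eq_mul] at e2
    refine (mul_eq_zero.1 (e2.symm.trans (Eq.trans ?_ e1))).resolve_left hc20
    refine sum_congr rfl fun h _ => ?_
    rw [map_smul, map_smul, smul_eq_mul, smul_eq_mul, hsym2 u t hufix ht g h,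
      hsym1 t t ht ht h]
    ring
  have e3 := h3 t
  simp only [key, zero_smul, sum_const_zero] at e3
  exact (smul_ne_zero hc30 ht0) e3.symm

end Perm

/-- Characters whose sum has the least possible norm are irreducible. -/
theorem irr_of_norm {G I : Type} [Group G] [Fintype G] [Fintype I] [DecidableEq I]
    {φ : I → G → ℂ} (hφ : ∀ i, IsChar (φ i)) (h0 : ∀ i, φ i ≠ 0) (ι : I → I)
    (hι : ∀ i, φ (ι i) = φ i)
    (hs : cip (∑ i, φ i) (∑ i, φ i) = ∑ i, (if ι i = i then 1 else 2 : ℂ)) :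
    (∀ i, IrrChar (φ i)) ∧ ∀ i j, φ i = φ j → j = i ∨ j = ι i := by
  choose n hn using fun i j => (hφ i).cip_nat (hφ j)
  have hle : ∀ i j, (if j = i ∨ j = ι i then 1 else 0 : ℕ) ≤ n i j := by
    intro i j
    split_ifs with h
    · refine (hφ i).one_le_cip (h0 i) ?_
      rw [← hn i j]
      rcases h with rfl | rfl
      · rfl
      · rw [hι]
    · exact Nat.zero_le _
  have hrow : ∀ i, ∑ j, (if j = i ∨ j = ι i then 1 else 0 : ℕ) = if ι i = i then 1 else 2 := by
    intro i
    rw [← card_filter]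
    have : (univ.filter fun j => j = i ∨ j = ι i) = {i, ι i} := by ext; simp
    rw [this]
    split_ifs with h
    · simp [h]
    · exact card_pair (Ne.symm h)
  have hsum : ∑ i, ∑ j, n i j = ∑ i, if ι i = i then 1 else 2 := by
    simp only [map_sum, LinearMap.sum_apply, hn] at hs
    rw [sum_comm] at hs
    exact_mod_cast hs
  have heq : ∀ i j, (if j = i ∨ j = ι i then 1 else 0 : ℕ) = n i j := by
    have h1 := (sum_eq_sum_iff_of_le (s := univ) fun i _ =>
      sum_le_sum fun j (_ : j ∈ univ) => hle i j).1
      ((sum_congr rfl fun i _ => hrow i).trans hsum.symm)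
    intro i j
    exact (sum_eq_sum_iff_of_le fun j _ => hle i j).1 (h1 i (mem_univ _)) j
      (mem_univ _)
  have hirr : ∀ i, IrrChar (φ i) := fun i => (hφ i).irr_of_cip (by
    rw [hn, ← heq]; simp)
  refine ⟨hirr, fun i j hij => ?_⟩
  have h1 := hn i j
  rw [hij, (hirr j).cip_self, ← heq] at h1
  by_contra hc
  simp [hc] at h1

variable {F V : Type} [Field F] [AddCommGroup V] [Module F V] [CharP F 2]
variable {Q : QuadraticForm F V}

/-- The nonzero vectors with a given value of the form. -/
@[ext] structure Xs (Q : QuadraticForm F V) (s : F) where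
  /-- The underlying vector. -/
  val : V
  quad : Q val = s
  ne : val ≠ 0

variable [Finite F] [FiniteDimensional F V]

instance (s : F) : MulAction (Om Q) (Xs Q s) where
  smul g x := ⟨g.1 x.val, by rw [g.quad, x.quad], g.ne_zero x.ne⟩
  one_smul _ := rfl
  mul_smul _ _ _ := rfl

@[simp] theorem Xs.smul_val {s : F} (g : Om Q) (x : Xs Q s) : (g • x).val = g.1 x.val := rfl

instance (s : F) : Finite (Xs Q s) :=
  have : Finite V := finite_of_finite F
  Finite.of_injective Xs.val fun _ _ => Xs.ext

noncomputable instance (s : F) : Fintype (Xs Q s) := Fintype.ofFinite _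

noncomputable instance (s : F) : DecidableEq (Xs Q s) := Classical.decEq _

noncomputable instance : Fintype (Om Q) := Fintype.ofFinite _

theorem card_Xs_zero : Fintype.card (Xs Q 0) + 1 = nsing Q := by
  have : Finite V := finite_of_finite F
  rw [nsing, ← Nat.card_eq_fintype_card, ← Finite.card_option]
  refine Nat.card_congr ⟨fun o => o.elim ⟨0, by simp⟩ fun x => ⟨x.val, x.quad⟩,
    fun v => open Classical in if h : v.1 = 0 then none else some ⟨v.1, v.2, h⟩, ?_, ?_⟩
  · rintro (_ | x)
    · simp
    · simp [x.ne]
  · rintro ⟨v, hv⟩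
    by_cases h : v = 0 <;> simp [h]

theorem card_Xs_ne {s : F} (hs : s ≠ 0) : Fintype.card (Xs Q s) = nval Q s := by
  rw [nval, ← Nat.card_eq_fintype_card]
  exact Nat.card_congr ⟨fun x => ⟨x.val, x.quad⟩,
    fun v => ⟨v.1, v.2, fun h => hs (by rw [← v.2, h, QuadraticMap.map_zero])⟩,
    fun _ => rfl, fun _ => rfl⟩

variable {k : ℕ} {α : ℤ}

theorem IsType.exists_map_one (h : IsType Q k α)
    (hk : 2 < k ∨ α = -1 ∧ 2 ≤ k) {x x' : V} (hx0 : x ≠ 0) (hx0' : x' ≠ 0)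
    (hq : Q x = Q x') : ∃ g : Om Q, g.1 x = x' := by
  obtain ⟨g, hg, -⟩ := h.exists_map hk (U := ∅) finrank_span_empty_le (by omega)
    (u := x) (u' := x') (by simpa) (by simpa) hq (by simp)
  exact ⟨g, hg⟩

theorem IsType.exists_map_two (h : IsType Q k α)
    (hk : 2 < k ∨ α = -1 ∧ 2 ≤ k) {x x' y y' : V} (hx0 : x ≠ 0) (hx0' : x' ≠ 0)
    (hq : Q x = Q x') (hy : y ∉ span F {x}) (hy' : y' ∉ span F {x'})
    (hqy : Q y = Q y') (hb : bl Q x y = bl Q x' y') : ∃ g : Om Q, g.1 x = x' ∧ g.1 y = y' := by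
  obtain ⟨g, rfl⟩ := h.exists_map_one hk hx0 hx0' hq
  obtain ⟨g', hg', hg''⟩ := h.exists_map hk (U := {g.1 x}) finrank_span_singleton_le (by omega)
    (u := g.1 y) (u' := y') (g.notMem_singleton hy) hy' (by rw [g.quad, hqy]) (by
      intro y hy
      rw [Set.mem_singleton_iff.1 hy, g.bl, hb])
  refine ⟨g' * g, ?_, ?_⟩
  · rw [Subgroup.coe_mul, LinearEquiv.mul_apply, hg'' _ rfl]
  · rw [Subgroup.coe_mul, LinearEquiv.mul_apply, hg']

theorem IsType.exists_pair (h : IsType Q k α) (hk : 3 < k) {x : V} (hx0 : x ≠ 0) (t β : F) :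
    ∃ y, y ∉ span F {x} ∧ Q y = t ∧ bl Q x y = β := by
  have h3 := two_eq F
  obtain ⟨w, -, hw⟩ := exists_perp h.nondeg (U := ∅) (v := x) (by simpa)
  obtain ⟨z, hz, hzU, hQz⟩ : ∃ z, Perp Q {x, β • w} z ∧ z ∉ span F {x, β • w} ∧
      Q z = t + Q (β • w) := by
    have hu : finrank F (span F {x, β • w}) ≤ 2 :=
      finrank_span_insert_le finrank_span_singleton_le
    by_cases hs : t + Q (β • w) = 0
    · rw [hs]
      exact h.exists_sing hu (by omega)
    · exact h.exists_nonsing hu (by omega) hs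
  simp only [perp_insert, perp_singleton] at hz
  refine ⟨z + β • w, fun hc => hzU ?_, ?_, ?_⟩
  · have h1 := Submodule.add_mem _ (Submodule.span_mono (by simp) hc :
      _ ∈ span F {x, β • w}) (subset_span (s := {x, β • w}) (by simp) : β • w ∈ _)
    rwa [add_assoc, add_self_v F, add_zero] at h1
  · rw [Q_add, hQz, bl_comm, hz.2]
    linear_combination Q (β • w) * h3
  · rw [map_add, map_smul, hw, hz.1]; simp

theorem Xs.trans (h : IsType Q k α) (hk : 2 < k) {s : F} (x y : Xs Q s) : ∃ g : Om Q, g • x = y := by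
  obtain ⟨g, hg⟩ := h.exists_map_one (.inl hk) x.ne y.ne (x.quad.trans y.quad.symm)
  exact ⟨g, Xs.ext hg⟩

theorem Xs.trans_two (h : IsType Q k α) (hk : 2 < k) {s t : F} {x x' : Xs Q s} {y y' : Xs Q t}
    (hy : y.val ∉ span F {x.val}) (hy' : y'.val ∉ span F {x'.val})
    (hb : bl Q x.val y.val = bl Q x'.val y'.val) : ∃ g : Om Q, g • x = x' ∧ g • y = y' := by
  obtain ⟨g, hg, hg'⟩ := h.exists_map_two (.inl hk) x.ne x'.ne (x.quad.trans x'.quad.symm) hy hy'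
    (y.quad.trans y'.quad.symm) hb
  exact ⟨g, Xs.ext hg, Xs.ext hg'⟩

theorem Xs.notMem_of_ne {x : V} {y : V} (hx : Q x = 0) (hy : Q y ≠ 0) :
    y ∉ span F {x} := by
  intro hc
  obtain ⟨c, rfl⟩ := mem_span_singleton.1 hc
  exact hy (by rw [Q_smul, hx, mul_zero])

theorem Xs.notMem_one {x y : Xs Q (1 : F)} (h : x ≠ y) : y.val ∉ span F {x.val} := by
  intro hc
  obtain ⟨c, hc⟩ := mem_span_singleton.1 hc
  have h1 := y.quad
  rw [← hc, Q_smul, x.quad] at h1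
  have h2 := two_eq F
  have h4 : (c + 1) * (c + 1) = 0 := by linear_combination h1 + (c + 1) * h2
  have h5 : c = 1 := by
    have := mul_self_eq_zero.1 h4
    linear_combination this - h2
  exact h (Xs.ext (by rw [← hc, h5, one_smul]))

variable [Fintype F]

theorem cip_zero_one (h : IsType Q k α) (hk : 3 < k) :
    cip (pchar (Om Q) (Xs Q 0)) (pchar (Om Q) (Xs Q 1)) = Fintype.card F := by
  refine cip_pchar (fun p => bl Q p.1.val p.2.val) (fun β => ?_) fun p p' => ⟨fun hp => ?_, ?_⟩
  · obtain ⟨x, hx, hxU, hQx⟩ := h.exists_sing (U := ∅) finrank_span_empty_le (by omega)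
    have hx0 : x ≠ 0 := by rintro rfl; simp at hxU
    obtain ⟨y, hy, hQy, hb⟩ := h.exists_pair hk hx0 1 β
    exact ⟨⟨⟨x, hQx, hx0⟩, ⟨y, hQy, by rintro rfl; simp at hy⟩⟩, hb⟩
  · obtain ⟨g, hg, hg'⟩ := Xs.trans_two h (by omega)
      (Xs.notMem_of_ne p.1.quad (by rw [p.2.quad]; exact one_ne_zero))
      (Xs.notMem_of_ne p'.1.quad (by rw [p'.2.quad]; exact one_ne_zero)) hp
    exact ⟨g, Prod.ext hg hg'⟩
  · rintro ⟨g, rfl⟩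
    exact (g.bl _ _).symm

theorem cip_one_one (h : IsType Q k α) (hk : 3 < k) :
    cip (pchar (Om Q) (Xs Q 1)) (pchar (Om Q) (Xs Q 1)) = Fintype.card F + 1 := by
  rw [cip_pchar (I := Option F) (fun p => if p.1 = p.2 then none else some (bl Q p.1.val p.2.val))
    ?_ fun p p' => ⟨fun hp => ?_, ?_⟩, Fintype.card_option, Nat.cast_succ]
  · have hex : ∃ x : V, Q x = 1 ∧ x ≠ 0 := by
      obtain ⟨x, hx, hxU, hQx⟩ := h.exists_nonsing (U := ∅) finrank_span_empty_le (by omega)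
        one_ne_zero
      exact ⟨x, hQx, by rintro rfl; simp at hxU⟩
    obtain ⟨x, hQx, hx0⟩ := hex
    rintro (_ | β)
    · exact ⟨⟨⟨x, hQx, hx0⟩, ⟨x, hQx, hx0⟩⟩, by simp⟩
    · obtain ⟨y, hy, hQy, hb⟩ := h.exists_pair hk hx0 1 β
      refine ⟨⟨⟨x, hQx, hx0⟩, ⟨y, hQy, by rintro rfl; simp at hy⟩⟩, ?_⟩
      simp only [hb]
      rw [if_neg]
      intro hxy
      obtain rfl : x = y := congrArg Xs.val hxy
      exact hy (Submodule.mem_span_singleton_self _)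
  · obtain ⟨x, y⟩ := p
    obtain ⟨x', y'⟩ := p'
    by_cases h1 : x = y <;> by_cases h2 : x' = y'
    · subst h1 h2
      obtain ⟨g, hg⟩ := Xs.trans h (by omega) x x'
      exact ⟨g, Prod.ext hg hg⟩
    · simp [h1, h2] at hp
    · simp [h1, h2] at hp
    · simp only [h1, h2, if_false, Option.some.injEq] at hp
      obtain ⟨g, hg, hg'⟩ := Xs.trans_two h (by omega) (Xs.notMem_one h1) (Xs.notMem_one h2) hp
      exact ⟨g, Prod.ext hg hg'⟩
  · rintro ⟨g, rfl⟩
    simp only [Prod.smul_fst, Prod.smul_snd, smul_left_cancel_iff, Xs.smul_val, g.bl]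

open Classical in
/-- The orbit invariant of a pair of singular vectors. -/
noncomputable def pinv (p : Xs Q (0 : F) × Xs Q (0 : F)) : Fˣ ⊕ F :=
  if h : ∃ c : Fˣ, p.2.val = c • p.1.val then .inl h.choose else .inr (bl Q p.1.val p.2.val)

theorem pinv_inl {x y : Xs Q (0 : F)} {c : Fˣ} : pinv (x, y) = .inl c ↔ y.val = c • x.val := by
  unfold pinv
  split_ifs with h
  · rw [Sum.inl.injEq]
    have h1 := h.choose_spec
    refine ⟨by rintro rfl; exact h1, fun h2 => ?_⟩
    have h4 : (c : F) • x.val = (h.choose : F) • x.val := h2.symm.trans h1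
    exact Units.ext (smul_left_injective F x.ne h4).symm
  · simp only [false_iff]
    exact fun h1 => h ⟨c, h1⟩

theorem pinv_inr {x y : Xs Q (0 : F)} {β : F} :
    pinv (x, y) = .inr β ↔ y.val ∉ span F {x.val} ∧ bl Q x.val y.val = β := by
  have key : y.val ∈ span F {x.val} ↔ ∃ c : Fˣ, y.val = c • x.val := by
    rw [mem_span_singleton]
    constructor
    · rintro ⟨c, hc⟩
      have hc0 : c ≠ 0 := by rintro rfl; exact y.ne (by rw [← hc, zero_smul])
      exact ⟨Units.mk0 c hc0, by rw [← hc]; rfl⟩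
    · rintro ⟨c, hc⟩
      exact ⟨c, hc.symm⟩
  unfold pinv
  rw [key]
  split_ifs with h
  · simp only [false_iff]
    exact fun h1 => h1.1 h
  · simp only [Sum.inr.injEq]
    exact ⟨fun h1 => ⟨h, h1⟩, fun h1 => h1.2⟩

theorem cip_zero_zero (h : IsType Q k α) (hk : 3 < k) :
    cip (pchar (Om Q) (Xs Q 0)) (pchar (Om Q) (Xs Q 0)) = 2 * Fintype.card F - 1 := by
  classical
  rw [cip_pchar pinv ?_ fun p p' => ⟨fun hp => ?_, ?_⟩, Fintype.card_sum, Fintype.card_units]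
  · have := Fintype.card_pos (α := F)
    rw [Nat.cast_add, Nat.cast_sub this]; push_cast; ring
  · obtain ⟨x, hx, hxU, hQx⟩ := h.exists_sing (U := ∅) finrank_span_empty_le (by omega)
    have hx0 : x ≠ 0 := by rintro rfl; simp at hxU
    rintro (c | β)
    · refine ⟨⟨⟨x, hQx, hx0⟩, ⟨c • x, ?_, ?_⟩⟩, pinv_inl.2 rfl⟩
      · rw [Units.smul_def, Q_smul, hQx, mul_zero]
      · rw [Units.smul_def]; exact smul_ne_zero c.ne_zero hx0
    · obtain ⟨y, hy, hQy, hb⟩ := h.exists_pair hk hx0 0 β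
      exact ⟨⟨⟨x, hQx, hx0⟩, ⟨y, hQy, by rintro rfl; simp at hy⟩⟩, pinv_inr.2 ⟨hy, hb⟩⟩
  · obtain ⟨x, y⟩ := p
    obtain ⟨x', y'⟩ := p'
    rcases h1 : pinv (x, y) with c | β
    · rw [h1] at hp
      have h2 := pinv_inl.1 h1
      have h2' := pinv_inl.1 hp.symm
      obtain ⟨g, hg⟩ := Xs.trans h (by omega) x x'
      refine ⟨g, Prod.ext hg (Xs.ext ?_)⟩
      simp only [Prod.smul_mk, Xs.smul_val]
      rw [h2', h2, Units.smul_def, Units.smul_def, map_smul, ← hg]; rfl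
    · rw [h1] at hp
      have h2 := pinv_inr.1 h1
      have h2' := pinv_inr.1 hp.symm
      obtain ⟨g, hg, hg'⟩ := Xs.trans_two h (by omega) h2.1 h2'.1 (h2.2.trans h2'.2.symm)
      exact ⟨g, Prod.ext hg hg'⟩
  · rintro ⟨g, rfl⟩
    obtain ⟨x, y⟩ := p
    rcases h1 : pinv (x, y) with c | β
    · symm
      rw [Prod.smul_mk, pinv_inl, Xs.smul_val, Xs.smul_val, pinv_inl.1 h1, Units.smul_def,
        Units.smul_def, map_smul]
    · symm
      rw [Prod.smul_mk, pinv_inr, Xs.smul_val, Xs.smul_val, g.bl]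
      exact ⟨g.notMem_singleton (pinv_inr.1 h1).1, (pinv_inr.1 h1).2⟩

section Counts
open Finset Classical

variable {F V : Type} [Field F] [AddCommGroup V] [Module F V] [CharP F 2]
  [Fintype F] [FiniteDimensional F V]
variable {Q : QuadraticForm F V} {k : ℕ} {α : ℤ}

/-- The number of nonzero singular vectors orthogonal to two vectors. -/
noncomputable def cnt (Q : QuadraticForm F V) (x y : V) : ℕ :=
  (univ.filter fun z : Xs Q 0 => bl Q x z.val = 0 ∧ bl Q y z.val = 0).card

theorem cnt_add_one [Fintype V] (x y : V) :
    cnt Q x y + 1 = (univ.filter fun v => (bl Q x v = 0 ∧ bl Q y v = 0) ∧ Q v = 0).card := by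
  have h1 : (univ.filter fun v => (bl Q x v = 0 ∧ bl Q y v = 0) ∧ Q v = 0) =
      insert 0 ((univ.filter fun z : Xs Q 0 => bl Q x z.val = 0 ∧ bl Q y z.val = 0).image
        Xs.val) := by
    ext v
    simp only [mem_filter, mem_univ, true_and, mem_insert, mem_image]
    constructor
    · rintro ⟨h1, h2⟩
      by_cases hv : v = 0
      · exact Or.inl hv
      · exact Or.inr ⟨⟨v, h2, hv⟩, h1, rfl⟩
    · rintro (rfl | ⟨z, hz, rfl⟩)
      · simp
      · exact ⟨hz, z.quad⟩
  rw [h1, card_insert_of_notMem, card_image_of_injective _ fun _ _ => Xs.ext, cnt]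
  simp only [mem_image, not_exists, not_and]
  exact fun z _ => z.ne

theorem card_Xs_zero_eq (h : IsType Q (k + 1) α) :
    (Fintype.card (Xs Q 0) : ℤ) = ((Fintype.card F : ℤ) ^ (k + 1) - α) *
      ((Fintype.card F : ℤ) ^ k + α) := by
  have h1 := h.card
  rw [Nat.card_eq_fintype_card, ← card_Xs_zero] at h1
  have h6 : (Fintype.card F : ℤ) ≠ 0 := by exact_mod_cast Fintype.card_ne_zero
  have hα : (α : ℤ) ^ 2 = 1 := by rcases h.sign with rfl | rfl <;> norm_num
  push_cast at h1
  apply mul_left_cancel₀ h6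
  linear_combination h1 + (Fintype.card F : ℤ) * hα

theorem card_Xs_one_eq (h : IsType Q (k + 1) α) :
    (Fintype.card (Xs Q 1) : ℤ) = (Fintype.card F : ℤ) ^ k *
      ((Fintype.card F : ℤ) ^ (k + 1) - α) := by
  have h1 := h.nval_one
  rw [Nat.card_eq_fintype_card, ← card_Xs_ne one_ne_zero] at h1
  have h6 : (Fintype.card F : ℤ) ≠ 0 := by exact_mod_cast Fintype.card_ne_zero
  apply mul_left_cancel₀ h6
  linear_combination h1

theorem cnt_one (h : IsType Q (k + 1) α) {x : V} (hx : Q x = 0) (hx0 : x ≠ 0) :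
    (cnt Q x x : ℤ) + 1 = (Fintype.card F : ℤ) ^ (2 * k) +
      α * ((Fintype.card F : ℤ) - 1) * (Fintype.card F : ℤ) ^ k := by
  have := finite_of_finite F (M := V)
  have := Fintype.ofFinite V
  have h1 := card_orth_singleton_sing h.nondeg hx hx0
  have h2 := cnt_add_one (Q := Q) x x
  simp only [and_self] at h2
  rw [← h2, h.rank] at h1
  have h3 := h.card
  rw [Nat.card_eq_fintype_card] at h3
  have h4 : 2 * (k + 1) - 1 = 2 * k + 1 := by omega
  rw [h4] at h1
  have h5 : (Fintype.card F : ℤ) * nsing Q + (Fintype.card F : ℤ) ^ (2 * k + 1) =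
      (Fintype.card F : ℤ) ^ (2 * (k + 1)) + Fintype.card F * (cnt Q x x + 1) := by
    exact_mod_cast h1
  have h6 : (Fintype.card F : ℤ) ≠ 0 := by exact_mod_cast Fintype.card_ne_zero
  apply mul_left_cancel₀ h6
  linear_combination h3 - h5

theorem cnt_two (h : IsType Q (k + 2) α) {x y : V} (hx : Q x = 0) (hx0 : x ≠ 0) (hy : Q y = 0)
    (hyx : y ∉ span F {x}) (hxy : bl Q x y = 0) :
    (cnt Q x y : ℤ) + 1 = (Fintype.card F : ℤ) ^ (2 * k + 1) +
      α * ((Fintype.card F : ℤ) - 1) * (Fintype.card F : ℤ) ^ (k + 1) := by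
  have := finite_of_finite F (M := V)
  have := Fintype.ofFinite V
  have h1 := nsing_totSing h.nondeg (span F {y, x}) (by
    intro u hu
    obtain ⟨a, b, rfl⟩ := Submodule.mem_span_pair.1 hu
    rw [Q_add, Q_smul, Q_smul, hx, hy, map_smul, map_smul, LinearMap.smul_apply, bl_comm, hxy]
    simp)
  have h0 := finrank_orth h.nondeg {y, x}
  have hr : finrank F (span F {y, x}) = 2 := by
    refine le_antisymm (finrank_span_insert_le finrank_span_singleton_le) ?_
    have hlt : span F {x} < span F {y, x} :=
      lt_of_le_of_ne (Submodule.span_mono (by simp)) fun hc => hyx (by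
        rw [hc]; exact subset_span (by simp))
    have := Submodule.finrank_lt_finrank_of_lt hlt
    rw [finrank_span_singleton hx0] at this
    omega
  have h2 := cnt_add_one (Q := Q) x y
  have hs : (univ.filter fun v => (bl Q x v = 0 ∧ bl Q y v = 0) ∧ Q v = 0) =
      univ.filter fun v => v ∈ orth Q {y, x} ∧ Q v = 0 := by
    ext v; simp [and_comm]
  rw [hs] at h2
  rw [orth_span, ← h2, h.rank] at h1
  rw [hr, h.rank] at h0
  rw [show finrank F (orth Q {y, x}) = 2 * k + 2 by omega] at h1
  have h3 := h.card
  rw [Nat.card_eq_fintype_card] at h3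
  have h5 : (Fintype.card F : ℤ) * nsing Q + (Fintype.card F : ℤ) ^ (2 * k + 2) =
      (Fintype.card F : ℤ) ^ (2 * (k + 2)) + Fintype.card F * (cnt Q x y + 1) := by
    exact_mod_cast h1
  have h6 : (Fintype.card F : ℤ) ≠ 0 := by exact_mod_cast Fintype.card_ne_zero
  apply mul_left_cancel₀ h6
  linear_combination h3 - h5

theorem cnt_three (h : IsType Q (k + 2) α) {x y : V} (hx : Q x = 0) (hy : Q y = 0)
    (hxy : bl Q x y ≠ 0) :
    (cnt Q x y : ℤ) + 1 = (Fintype.card F : ℤ) ^ (2 * k + 1) +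
      α * ((Fintype.card F : ℤ) - 1) * (Fintype.card F : ℤ) ^ k := by
  have := finite_of_finite F (M := V)
  have := Fintype.ofFinite V
  have hyp : Hyp Q x ((bl Q x y)⁻¹ • y) :=
    ⟨hx, by rw [Q_smul, hy, mul_zero], by rw [map_smul, smul_eq_mul, inv_mul_cancel₀ hxy]⟩
  have h1 := (hyp.isType (k := k + 1) h (by omega)).card
  have h2 := cnt_add_one (Q := Q) x y
  have h4 : nsing (res Q (hc Q x ((bl Q x y)⁻¹ • y))) = cnt Q x y + 1 := by
    rw [h2, nsing, ← Fintype.card_subtype, ← Nat.card_eq_fintype_card]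
    refine Nat.card_congr ⟨fun v => ⟨v.1.1, ?_⟩, fun v => ⟨⟨v.1, ?_⟩, v.2.2⟩, fun _ => rfl,
      fun _ => rfl⟩
    · have h3 := v.1.2
      simp only [mem_orth, perp_insert, perp_singleton, map_smul, LinearMap.smul_apply,
        smul_eq_mul, mul_eq_zero, inv_eq_zero, hxy, false_or] at h3
      exact ⟨h3, v.2⟩
    · have h3 := v.2.1
      simp [h3]
  rw [h4, Nat.card_eq_fintype_card] at h1
  have h6 : (Fintype.card F : ℤ) ≠ 0 := by exact_mod_cast Fintype.card_ne_zero
  apply mul_left_cancel₀ h6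
  push_cast at h1
  linear_combination h1

end Counts

/-- The idempotent attached to an eigenvalue in a rank three algebra. -/
theorem idem_of_rank_three {A : Type*} [Ring A] [Algebra ℂ A] {J T E : A} {a j s t : ℂ}
    (hTT : T * T = T) (hEE : E * E = E) (hTE : T * E = T) (hET : E * T = T) (hJE : J * E = J)
    (hEJ : E * J = J) (hJT : J * T = j • T) (hTJ : T * J = j • T)
    (hJJ : J * J = a • T + (s + t) • J - (s * t) • E) (ha : a = (j - s) * (j - t)) (hst : s ≠ t) :
    ((s - t)⁻¹ • (J - t • E - (j - t) • T)) * ((s - t)⁻¹ • (J - t • E - (j - t) • T)) =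
      (s - t)⁻¹ • (J - t • E - (j - t) • T) := by
  have h0 : s - t ≠ 0 := sub_ne_zero.2 hst
  simp only [mul_sub, sub_mul, smul_mul_assoc, mul_smul_comm, hTT, hEE, hTE, hET, hJE, hEJ, hJT,
    hTJ, hJJ, ha]
  match_scalars <;> field_simp <;> ring

section MulCharSum
variable {F : Type} [Field F] [Fintype F] [DecidableEq F]

noncomputable instance : Fintype (MulChar F ℂ) := Fintype.ofFinite _

noncomputable instance : DecidableEq (MulChar F ℂ) := Classical.decEq _

theorem card_mulChar : Fintype.card (MulChar F ℂ) = Fintype.card F - 1 := by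
  have : HasEnoughRootsOfUnity ℂ (Monoid.exponent Fˣ) := inferInstance
  rw [← Nat.card_eq_fintype_card, MulChar.card_eq_card_units_of_hasEnoughRootsOfUnity,
    Nat.card_eq_fintype_card, Fintype.card_units]

theorem sum_mulChar (c : Fˣ) :
    ∑ χ : MulChar F ℂ, χ c = if c = 1 then (Fintype.card F : ℂ) - 1 else 0 := by
  split_ifs with h
  · subst h
    simp only [Units.val_one, map_one, sum_const, card_univ, card_mulChar]
    rw [nsmul_eq_mul, mul_one, Nat.cast_sub Fintype.card_pos, Nat.cast_one]
  · have : HasEnoughRootsOfUnity ℂ (Monoid.exponent Fˣ) := inferInstance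
    obtain ⟨ψ, hψ⟩ := MulChar.exists_apply_ne_one_of_hasEnoughRootsOfUnity F ℂ (a := (c : F))
      (fun h1 => h (Units.ext h1))
    have h1 : ψ c * ∑ χ : MulChar F ℂ, χ c = ∑ χ : MulChar F ℂ, χ c := by
      rw [mul_sum, ← Equiv.sum_comp (Equiv.mulLeft ψ) fun χ : MulChar F ℂ => χ c]
      simp
    have h2 : (ψ c - 1) * ∑ χ : MulChar F ℂ, χ c = 0 := by rw [sub_mul, h1, one_mul, sub_self]
    exact (mul_eq_zero.1 h2).resolve_left (sub_ne_zero.2 hψ)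

theorem mulChar_inv_eq_iff [CharP F 2] (χ : MulChar F ℂ) : χ⁻¹ = χ ↔ χ = 1 := by
  refine ⟨fun h => ?_, by rintro rfl; simp⟩
  have h1 : χ ^ 2 = 1 := by
    rw [sq]; nth_rw 1 [← h]; exact inv_mul_cancel χ
  have h2 : χ ^ Fintype.card (MulChar F ℂ) = 1 := pow_card_eq_one
  rw [card_mulChar] at h2
  obtain ⟨n, hn⟩ : Even (Fintype.card F) := by
    obtain ⟨m, -, hm⟩ := FiniteField.card F 2
    rw [hm]
    exact (even_two.pow_of_ne_zero m.ne_zero)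
  have h3 : Fintype.card F - 1 = 2 * (n - 1) + 1 := by
    have := Fintype.card_pos (α := F)
    omega
  rw [h3, pow_succ, pow_mul, h1, one_pow, one_mul] at h2
  exact h2

end MulCharSum

section Kernels

variable {F V : Type} [Field F] [AddCommGroup V] [Module F V] [CharP F 2]
  [Fintype F] [DecidableEq F] [FiniteDimensional F V]
variable {Q : QuadraticForm F V} {k : ℕ} {α : ℤ}

/-- Scaling of singular vectors. -/
def Xs.sc (c : Fˣ) (x : Xs Q (0 : F)) : Xs Q (0 : F) where
  val := (c : F) • x.val
  quad := by rw [Q_smul, x.quad, mul_zero]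
  ne := smul_ne_zero c.ne_zero x.ne

theorem Xs.sc_sc (c d : Fˣ) (x : Xs Q (0 : F)) : (x.sc d).sc c = x.sc (c * d) :=
  Xs.ext (by simp [Xs.sc, mul_smul])

theorem Xs.sc_one (x : Xs Q (0 : F)) : x.sc 1 = x := Xs.ext (by simp [Xs.sc])

theorem Xs.smul_sc (g : Om Q) (c : Fˣ) (x : Xs Q (0 : F)) : g • x.sc c = (g • x).sc c :=
  Xs.ext (by simp [Xs.sc])

theorem Xs.eq_sc_iff {c : Fˣ} {x y : Xs Q (0 : F)} : x = y.sc c ↔ x.sc c⁻¹ = y := by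
  constructor
  · rintro rfl; rw [Xs.sc_sc, inv_mul_cancel, Xs.sc_one]
  · rintro rfl; rw [Xs.sc_sc, mul_inv_cancel, Xs.sc_one]

/-- The matrix of a scaling. -/
noncomputable def dmat (Q : QuadraticForm F V) (c : Fˣ) : Matrix (Xs Q (0 : F)) (Xs Q (0 : F)) ℂ :=
  Matrix.of fun x y => if x = y.sc c then 1 else 0

theorem mul_dmat (M : Matrix (Xs Q (0 : F)) (Xs Q (0 : F)) ℂ) (c : Fˣ) (x y) :
    (M * dmat Q c) x y = M x (y.sc c) := by
  simp [Matrix.mul_apply, dmat]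

theorem dmat_mul (M : Matrix (Xs Q (0 : F)) (Xs Q (0 : F)) ℂ) (c : Fˣ) (x y) :
    (dmat Q c * M) x y = M (x.sc c⁻¹) y := by
  simp [Matrix.mul_apply, dmat, Xs.eq_sc_iff]

theorem dmat_mul_dmat (c d : Fˣ) : dmat Q c * dmat Q d = dmat Q (c * d) := by
  ext x y
  rw [mul_dmat]
  simp [dmat, Xs.sc_sc]

theorem dmat_one : dmat Q 1 = 1 := by
  ext x y
  simp [dmat, Xs.sc_one, Matrix.one_apply]

variable (F) in
theorem q_sub_ne : (Fintype.card F : ℂ) - 1 ≠ 0 := by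
  have := Fintype.one_lt_card (α := F)
  rw [sub_ne_zero]
  exact_mod_cast this.ne'

/-- The projection to the functions homogeneous with respect to a multiplicative character. -/
noncomputable def kmat (Q : QuadraticForm F V) (χ : MulChar F ℂ) :
    Matrix (Xs Q (0 : F)) (Xs Q (0 : F)) ℂ :=
  ((Fintype.card F : ℂ) - 1)⁻¹ • ∑ c : Fˣ, χ c • dmat Q c

theorem card_units_cast : (Fintype.card Fˣ : ℂ) = (Fintype.card F : ℂ) - 1 := by
  rw [Fintype.card_units, Nat.cast_sub Fintype.card_pos, Nat.cast_one]

theorem kmat_mul_kmat (χ : MulChar F ℂ) : kmat Q χ * kmat Q χ = kmat Q χ := by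
  unfold kmat
  rw [smul_mul_smul_comm, sum_mul_sum]
  have h1 : ∀ c : Fˣ, ∑ d : Fˣ, (χ c • dmat Q c) * (χ d • dmat Q d) = ∑ d : Fˣ, χ d • dmat Q d := by
    intro c
    rw [← Equiv.sum_comp (Equiv.mulLeft c) fun d : Fˣ => χ d • dmat Q d]
    simp [smul_smul, dmat_mul_dmat, mul_comm]
  rw [sum_congr rfl fun c _ => h1 c, sum_const, card_univ,
    ← Nat.cast_smul_eq_nsmul ℂ, card_units_cast, smul_smul, mul_assoc,
    inv_mul_cancel₀ (q_sub_ne F), mul_one]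

theorem sum_kmat : ∑ χ : MulChar F ℂ, kmat Q χ = 1 := by
  unfold kmat
  rw [← smul_sum, sum_comm]
  simp_rw [← sum_smul, sum_mulChar]
  simp [dmat_one, smul_smul, inv_mul_cancel₀ (q_sub_ne F)]

theorem dmat_inv (g : Om Q) (c : Fˣ) (x y : Xs Q (0 : F)) :
    dmat Q c (g • x) (g • y) = dmat Q c x y := by
  simp [dmat, ← Xs.smul_sc]

theorem kmat_inv (χ : MulChar F ℂ) (g : Om Q) (x y : Xs Q (0 : F)) :
    kmat Q χ (g • x) (g • y) = kmat Q χ x y := by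
  simp [kmat, Matrix.sum_apply, dmat_inv]

theorem kmat_trace (χ : MulChar F ℂ) :
    (kmat Q χ).trace = Fintype.card (Xs Q 0) / ((Fintype.card F : ℂ) - 1) := by
  have h1 : ∀ c : Fˣ, (dmat Q c).trace = if c = 1 then (Fintype.card (Xs Q 0) : ℂ) else 0 := by
    intro c
    split_ifs with h
    · rw [h, dmat_one, Matrix.trace_one]
    · simp only [Matrix.trace, Matrix.diag, dmat, Matrix.of_apply]
      refine sum_eq_zero fun x _ => if_neg fun hx => h ?_
      have h2 : (1 : F) • x.val = (c : F) • x.val := by rw [one_smul]; exact congrArg Xs.val hx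
      exact Units.ext (smul_left_injective F x.ne h2).symm
  rw [kmat, Matrix.trace_smul, Matrix.trace_sum]
  simp [Matrix.trace_smul, h1]
  ring

/-- A vector is an eigenvector for `c` as often as for `c⁻¹`. -/
theorem card_eigen (hQ : Nondeg Q) (g : Om Q) (c : Fˣ) :
    Nat.card {v : V // g.1 v = (c : F) • v} = Nat.card {v : V // g.1 v = ((c⁻¹ : Fˣ) : F) • v} := by
  set A : V →ₗ[F] V := (g.1 : V →ₗ[F] V) - (c : F) • LinearMap.id with hA
  set B : V →ₗ[F] V := (g.1 : V →ₗ[F] V) - ((c⁻¹ : Fˣ) : F) • LinearMap.id with hB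
  have h1 : LinearMap.ker B = orth Q (LinearMap.range A : Set V) := by
    ext v
    rw [LinearMap.mem_ker, mem_orth]
    have key : ∀ w, bl Q (A w) v = (c : F) * bl Q (g.1 w) (B v) := by
      intro w
      have h1 : (c : F) * ((c⁻¹ : Fˣ) : F) = 1 := c.mul_inv
      have h2 := g.bl w v
      simp only [hA, hB, LinearMap.sub_apply, LinearMap.smul_apply, LinearMap.id_apply,
        LinearEquiv.coe_coe, map_sub, map_smul, smul_eq_mul, g.bl]
      have h3 := two_eq F
      linear_combination bl Q (g.1 w) v * h1 + bl Q (g.1 w) v * h3 - (c : F) * bl Q w v * h3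
    constructor
    · rintro hv _ ⟨w, rfl⟩
      rw [key, hv, map_zero, mul_zero]
    · intro hv
      apply hQ
      intro w
      have h2 := hv _ ⟨g.1.symm w, rfl⟩
      rw [key, LinearEquiv.apply_symm_apply] at h2
      rw [bl_comm]
      exact (mul_eq_zero.1 h2).resolve_left c.ne_zero
  have h2 := finrank_orth hQ (LinearMap.range A : Set V)
  rw [Submodule.span_eq, ← h1] at h2
  have h3 := LinearMap.finrank_range_add_finrank_ker A
  have h4 : finrank F (LinearMap.ker A) = finrank F (LinearMap.ker B) := by omega
  have hk : ∀ (a : F) (w : V), w ∈ LinearMap.ker ((g.1 : V →ₗ[F] V) - a • LinearMap.id) ↔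
      g.1 w = a • w := by
    intro a w
    simp [sub_eq_zero]
  have h5 := Module.natCard_eq_pow_finrank (K := F) (V := LinearMap.ker A)
  have h6 := Module.natCard_eq_pow_finrank (K := F) (V := LinearMap.ker B)
  rw [← h4, ← h5] at h6
  rw [Nat.card_congr (Equiv.subtypeEquivRight fun w => (hk (c : F) w).symm),
    Nat.card_congr (Equiv.subtypeEquivRight fun w => (hk ((c⁻¹ : Fˣ) : F) w).symm)]
  exact h6.symm

theorem kchar_dmat_add_one (g : Om Q) {c : Fˣ} (hc : c ≠ 1) :
    kchar (dmat Q c) g + 1 = Nat.card {v : V // g.1 v = ((c⁻¹ : Fˣ) : F) • v} := by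
  classical
  have hV : Finite V := finite_of_finite F
  have := Fintype.ofFinite V
  have h1 : kchar (dmat Q c) g =
      ((univ.filter fun x : Xs Q (0 : F) => x = (g • x).sc c).card : ℂ) := by
    simp [kchar, dmat]
  rw [h1, Nat.card_eq_fintype_card, Fintype.card_subtype]
  have h2 : (univ.filter fun v : V => g.1 v = ((c⁻¹ : Fˣ) : F) • v) =
      insert 0 ((univ.filter fun x : Xs Q (0 : F) => x = (g • x).sc c).image Xs.val) := by
    ext v
    simp only [mem_filter, mem_univ, true_and, mem_insert, mem_image]
    constructor
    · intro hv
      by_cases hv0 : v = 0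
      · exact Or.inl hv0
      · have hQv : Q v = 0 := by
          have h3 : Q v = ((c⁻¹ : Fˣ) : F) * ((c⁻¹ : Fˣ) : F) * Q v := by
            rw [← Q_smul, ← hv, g.quad]
          by_contra hq
          have h4 : ((c⁻¹ : Fˣ) : F) * ((c⁻¹ : Fˣ) : F) = 1 := by
            apply mul_right_cancel₀ hq
            rw [← h3, one_mul]
          have h5 := two_eq F
          have h6 : (((c⁻¹ : Fˣ) : F) + 1) * (((c⁻¹ : Fˣ) : F) + 1) = 0 := by
            linear_combination h4 + (((c⁻¹ : Fˣ) : F) + 1) * h5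
          have h7 : ((c⁻¹ : Fˣ) : F) = 1 := by
            have := mul_self_eq_zero.1 h6
            linear_combination this - h5
          exact hc (inv_eq_one.1 (Units.ext h7))
        refine Or.inr ⟨⟨v, hQv, hv0⟩, ?_, rfl⟩
        rw [Xs.eq_sc_iff]
        exact Xs.ext (by simp only [Xs.sc, Xs.smul_val, hv])
    · rintro (rfl | ⟨x, hx, rfl⟩)
      · simp
      · rw [Xs.eq_sc_iff] at hx
        exact (congrArg Xs.val hx).symm
  rw [h2, card_insert_of_notMem, card_image_of_injective _ fun _ _ => Xs.ext]
  · push_cast; rfl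
  · simp only [mem_image, not_exists, not_and]
    exact fun z _ => z.ne

theorem kchar_kmat_inv (hQ : Nondeg Q) (χ : MulChar F ℂ) :
    (kchar (kmat Q χ⁻¹) : Om Q → ℂ) = kchar (kmat Q χ) := by
  classical
  have h1 : ∀ (χ : MulChar F ℂ) (g : Om Q), kchar (kmat Q χ) g =
      ((Fintype.card F : ℂ) - 1)⁻¹ * ∑ c : Fˣ, χ c * kchar (dmat Q c) g := by
    intro χ g
    simp only [kchar, kmat, Matrix.smul_apply, Matrix.sum_apply, smul_eq_mul, ← mul_sum]
    rw [sum_comm]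
    simp only [mul_sum]
  ext g
  rw [h1, h1, ← Equiv.sum_comp (Equiv.inv Fˣ)]
  congr 1
  refine sum_congr rfl fun c _ => ?_
  have h2 : kchar (dmat Q c⁻¹) g = kchar (dmat Q c) g := by
    by_cases hc : c = 1
    · rw [hc, inv_one]
    · have h3 := kchar_dmat_add_one g hc
      have h4 := kchar_dmat_add_one g (inv_ne_one.2 hc)
      rw [inv_inv, card_eigen hQ] at h4
      exact add_right_cancel (h4.trans h3.symm)
  rw [Equiv.inv_apply, h2, MulChar.inv_apply']
  simp

theorem mul_kmat_one {M : Matrix (Xs Q (0 : F)) (Xs Q (0 : F)) ℂ}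
    (hM : ∀ (c : Fˣ) x y, M x (y.sc c) = M x y) : M * kmat Q 1 = M := by
  ext x y
  simp only [kmat, Matrix.mul_smul, Matrix.mul_sum, Matrix.smul_apply, Matrix.sum_apply, mul_dmat,
    hM, MulChar.one_apply_coe, one_smul, sum_const, card_univ, nsmul_eq_mul,
    smul_eq_mul, card_units_cast]
  rw [← mul_assoc, inv_mul_cancel₀ (q_sub_ne F), one_mul]

theorem kmat_one_mul {M : Matrix (Xs Q (0 : F)) (Xs Q (0 : F)) ℂ}
    (hM : ∀ (c : Fˣ) x y, M (x.sc c) y = M x y) : kmat Q 1 * M = M := by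
  ext x y
  simp only [kmat, Matrix.smul_mul, Matrix.sum_mul, Matrix.smul_apply, Matrix.sum_apply, dmat_mul,
    hM, MulChar.one_apply_coe, one_smul, sum_const, card_univ, nsmul_eq_mul,
    smul_eq_mul, card_units_cast]
  rw [← mul_assoc, inv_mul_cancel₀ (q_sub_ne F), one_mul]

theorem kmat_one_apply_of {c : Fˣ} {x y : Xs Q (0 : F)} (h : x = y.sc c) :
    kmat Q 1 x y = ((Fintype.card F : ℂ) - 1)⁻¹ := by
  simp only [kmat, Matrix.smul_apply, Matrix.sum_apply, MulChar.one_apply_coe, one_smul, dmat,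
    Matrix.of_apply, smul_eq_mul]
  rw [sum_eq_single c, if_pos h, mul_one]
  · intro d _ hd
    refine if_neg fun hx => hd ?_
    have h2 : (d : F) • y.val = (c : F) • y.val := congrArg Xs.val (hx.symm.trans h)
    exact Units.ext (smul_left_injective F y.ne h2)
  · simp

theorem kmat_one_apply_ne {x y : Xs Q (0 : F)} (h : x.val ∉ span F {y.val}) :
    kmat Q 1 x y = 0 := by
  simp only [kmat, Matrix.smul_apply, Matrix.sum_apply, MulChar.one_apply_coe, one_smul, dmat,
    Matrix.of_apply, smul_eq_mul]
  rw [sum_eq_zero, mul_zero]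
  intro d _
  refine if_neg fun hx => h ?_
  rw [hx]
  exact mem_span_singleton.2 ⟨d, rfl⟩

/-- The normalized orthogonality matrix. -/
noncomputable def jmat (Q : QuadraticForm F V) : Matrix (Xs Q (0 : F)) (Xs Q (0 : F)) ℂ :=
  Matrix.of fun x y => if bl Q x.val y.val = 0 then ((Fintype.card F : ℂ) - 1)⁻¹ else 0

/-- The projection to the constant functions. -/
noncomputable def tmat (Q : QuadraticForm F V) : Matrix (Xs Q (0 : F)) (Xs Q (0 : F)) ℂ :=
  Matrix.of fun _ _ => (Fintype.card (Xs Q (0 : F)) : ℂ)⁻¹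

variable (F) in
theorem q_pow_ne {m : ℕ} (hm : m ≠ 0) {a : ℂ} (ha : a ^ 2 = 1) : (Fintype.card F : ℂ) ^ m ≠ a := by
  intro h
  have h1 : (Fintype.card F : ℂ) ^ (m * 2) = 1 := by rw [pow_mul, h, ha]
  have h2 : Fintype.card F ^ (m * 2) = 1 := by exact_mod_cast h1
  have := Fintype.one_lt_card (α := F)
  rw [Nat.pow_eq_one] at h2
  omega

theorem IsType.sq (h : IsType Q k α) : (α : ℂ) ^ 2 = 1 := by
  rcases h.sign with rfl | rfl <;> norm_num

theorem card_Xs_zero_cast (h : IsType Q (k + 1) α) :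
    (Fintype.card (Xs Q (0 : F)) : ℂ) = ((Fintype.card F : ℂ) ^ (k + 1) - α) *
      ((Fintype.card F : ℂ) ^ k + α) := by
  exact_mod_cast congrArg (Int.cast : ℤ → ℂ) (card_Xs_zero_eq h)

theorem cnt_one_cast (h : IsType Q (k + 1) α) (x : Xs Q (0 : F)) :
    (cnt Q x.val x.val : ℂ) = (Fintype.card F : ℂ) ^ (2 * k) +
      α * ((Fintype.card F : ℂ) - 1) * (Fintype.card F : ℂ) ^ k - 1 := by
  have h1 := congrArg (Int.cast : ℤ → ℂ) (cnt_one h x.quad x.ne)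
  push_cast at h1
  linear_combination h1

theorem IsType.sign' (h : IsType Q k α) : (α : ℂ) = 1 ∨ (α : ℂ) = -1 := by
  rcases h.sign with rfl | rfl <;> simp

theorem jmat_row (x : Xs Q (0 : F)) :
    ∑ z, jmat Q x z = cnt Q x.val x.val / ((Fintype.card F : ℂ) - 1) := by
  simp only [jmat, Matrix.of_apply, cnt, and_self, ← sum_filter]
  simp [div_eq_mul_inv]

theorem jmat_symm (x y : Xs Q (0 : F)) : jmat Q x y = jmat Q y x := by
  simp [jmat, bl_comm Q x.val]

theorem jmat_sq_apply (x y : Xs Q (0 : F)) :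
    (jmat Q * jmat Q) x y = cnt Q x.val y.val / ((Fintype.card F : ℂ) - 1) ^ 2 := by
  rw [Matrix.mul_apply]
  simp only [jmat_symm _ y]
  simp only [jmat, Matrix.of_apply, cnt, ite_zero_mul_ite_zero, ← sum_filter]
  simp [div_eq_mul_inv, sq]
  left; congr

theorem jmat_sq (h : IsType Q (k + 2) α) {j : ℂ}
    (hj : j = ((Fintype.card F : ℂ) ^ (2 * (k + 1)) +
      α * ((Fintype.card F : ℂ) - 1) * (Fintype.card F : ℂ) ^ (k + 1) - 1) /
        ((Fintype.card F : ℂ) - 1)) :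
    jmat Q * jmat Q = ((j - α * (Fintype.card F : ℂ) ^ (k + 1)) *
      (j - -(α * (Fintype.card F : ℂ) ^ k))) • tmat Q +
      (α * (Fintype.card F : ℂ) ^ (k + 1) + -(α * (Fintype.card F : ℂ) ^ k)) • jmat Q -
      ((α * (Fintype.card F : ℂ) ^ (k + 1)) * -(α * (Fintype.card F : ℂ) ^ k)) • kmat Q 1 := by
  have hq := q_sub_ne F
  have hα := h.sq
  have hN := card_Xs_zero_cast (k := k + 1) h
  ext x y
  rw [jmat_sq_apply]
  simp only [Matrix.add_apply, Matrix.sub_apply, Matrix.smul_apply, smul_eq_mul]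
  have h1 : ((j - α * (Fintype.card F : ℂ) ^ (k + 1)) *
      (j - -(α * (Fintype.card F : ℂ) ^ k))) * tmat Q x y =
      ((Fintype.card F : ℂ) ^ (2 * k + 1) +
      α * ((Fintype.card F : ℂ) - 1) * (Fintype.card F : ℂ) ^ k - 1) /
        ((Fintype.card F : ℂ) - 1) ^ 2 := by
    have hN0 : (Fintype.card (Xs Q (0 : F)) : ℂ) ≠ 0 := by
      have : Nonempty (Xs Q (0 : F)) := ⟨x⟩
      exact_mod_cast Fintype.card_ne_zero
    rw [tmat, Matrix.of_apply, ← div_eq_mul_inv, div_eq_div_iff hN0 (pow_ne_zero 2 hq), hN, hj]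
    field_simp
    ring_nf
    ring_nf at hα
    grind
  rw [h1]
  rcases hp : pinv (y, x) with c | β
  · have hxy := pinv_inl.1 hp
    have hx : x = y.sc c := Xs.ext hxy
    have hb : bl Q x.val y.val = 0 := by rw [hxy, Units.smul_def]; simp
    have hc : cnt Q x.val y.val = cnt Q y.val y.val := by
      unfold cnt
      congr 1
      ext z
      rw [hxy, Units.smul_def]
      simp
    rw [kmat_one_apply_of hx, hc, cnt_one_cast (k := k + 1) h, jmat, Matrix.of_apply, if_pos hb]
    rcases h.sign' with h' | h' <;> rw [h'] <;> field_simp <;> ring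
  · have hxy := pinv_inr.1 hp
    rw [kmat_one_apply_ne hxy.1, jmat, Matrix.of_apply]
    have hyx : y.val ∉ span F {x.val} := by
      intro hc
      obtain ⟨c, hc⟩ := mem_span_singleton.1 hc
      have hc0 : c ≠ 0 := by rintro rfl; exact y.ne (by rw [← hc, zero_smul])
      exact hxy.1 (mem_span_singleton.2 ⟨c⁻¹, by rw [← hc, smul_smul, inv_mul_cancel₀ hc0,
        one_smul]⟩)
    split_ifs with hb
    · have h2 := congrArg (Int.cast : ℤ → ℂ) (cnt_two h x.quad x.ne y.quad hyx hb)
      push_cast at h2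
      rw [eq_sub_of_add_eq h2]
      field_simp
      ring
    · have h2 := congrArg (Int.cast : ℤ → ℂ) (cnt_three h x.quad y.quad hb)
      push_cast at h2
      rw [eq_sub_of_add_eq h2]
      ring

/-- The index set of the constituents of the permutation character on singular vectors. -/
abbrev Ix (F : Type) [Field F] := MulChar F ℂ ⊕ Bool

/-- The pairing of the constituents. -/
noncomputable def iot : Ix F → Ix F := Sum.map (fun χ => χ⁻¹) id

theorem sum_iot : ∑ i : Ix F, (if iot i = i then 1 else 2 : ℂ) = 2 * Fintype.card F - 1 := by
  rw [Fintype.sum_sum_type]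
  simp only [iot, Sum.map_inl, Sum.map_inr, Sum.inl.injEq, id, mulChar_inv_eq_iff]
  rw [← add_sum_erase _ _ (mem_univ (1 : MulChar F ℂ)),
    sum_congr rfl (g := fun _ => (2 : ℂ)) fun χ hχ => if_neg (ne_of_mem_erase hχ)]
  have := Fintype.one_lt_card (α := F)
  simp only [sum_const, card_erase_of_mem (mem_univ _), card_univ,
    card_mulChar, nsmul_eq_mul]
  rw [Nat.sub_sub, Nat.cast_sub this]
  simp
  ring

/-- The constituents of the permutation character on nonzero singular vectors. -/
theorem sing_decomp (h : IsType Q (k + 2) α) (hk : 2 ≤ k) :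
    ∃ φ : Ix F → Om Q → ℂ, (∀ i, IrrChar (φ i)) ∧ (∀ i, φ (iot i) = φ i) ∧
      (∀ i j, φ i = φ j → j = i ∨ j = iot i) ∧ φ (.inl 1) = (fun _ => 1) ∧
      (∀ χ, χ ≠ 1 → φ (.inl χ) 1 = ((Fintype.card F : ℂ) ^ (k + 2) - α) *
        ((Fintype.card F : ℂ) ^ (k + 1) + α) / ((Fintype.card F : ℂ) - 1)) ∧
      φ (.inr true) 1 = ((Fintype.card F : ℂ) ^ (k + 2) - α) *
        ((Fintype.card F : ℂ) ^ (k + 1) + α * Fintype.card F) / ((Fintype.card F : ℂ) ^ 2 - 1) ∧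
      φ (.inr false) 1 = ((Fintype.card F : ℂ) ^ (2 * (k + 2)) - (Fintype.card F : ℂ) ^ 2) /
        ((Fintype.card F : ℂ) ^ 2 - 1) ∧
      ∑ i, φ i = pchar (Om Q) (Xs Q (0 : F)) := by
  have hq := q_sub_ne F
  have hα := h.sq
  have hq0 : (Fintype.card F : ℂ) ≠ 0 := by exact_mod_cast Fintype.card_ne_zero
  have hq2 : (Fintype.card F : ℂ) ^ 2 - 1 ≠ 0 := sub_ne_zero.2 (q_pow_ne F two_ne_zero (by norm_num))
  have hq1 : (Fintype.card F : ℂ) + 1 ≠ 0 := fun h0 => hq2 (by linear_combination (Fintype.card F - 1 : ℂ) * h0)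
  have hN := card_Xs_zero_cast (k := k + 1) h
  have hα' : (-α : ℂ) ^ 2 = 1 := by rw [neg_sq, hα]
  have hN1 : (Fintype.card F : ℂ) ^ (k + 2) - α ≠ 0 := sub_ne_zero.2 (q_pow_ne F (by omega) hα)
  have hN2 : (Fintype.card F : ℂ) ^ (k + 1) + α ≠ 0 := by
    rw [← sub_neg_eq_add]; exact sub_ne_zero.2 (q_pow_ne F (by omega) hα')
  have hN0 : (Fintype.card (Xs Q (0 : F)) : ℂ) ≠ 0 := by rw [hN]; exact mul_ne_zero hN1 hN2
  set j : ℂ := ((Fintype.card F : ℂ) ^ (2 * (k + 1)) +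
      α * ((Fintype.card F : ℂ) - 1) * (Fintype.card F : ℂ) ^ (k + 1) - 1) /
        ((Fintype.card F : ℂ) - 1) with hj
  set s : ℂ := α * (Fintype.card F : ℂ) ^ (k + 1) with hs
  set t : ℂ := -(α * (Fintype.card F : ℂ) ^ k) with ht
  have hα0 : (α : ℂ) ≠ 0 := by rintro h0; rw [h0] at hα; norm_num at hα
  have hst : s - t ≠ 0 := by
    have : s - t = α * (Fintype.card F : ℂ) ^ k * (Fintype.card F + 1) := by rw [hs, ht]; ring
    rw [this]
    exact mul_ne_zero (mul_ne_zero hα0 (pow_ne_zero _ hq0)) hq1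
  have hrow : ∀ x, ∑ z, jmat Q x z = j := fun x => by
    rw [jmat_row, cnt_one_cast (k := k + 1) h, hj]
  have hTT : tmat Q * tmat Q = tmat Q := by
    ext x y
    simp [tmat, Matrix.mul_apply, hN0]
  have hEE : kmat Q (1 : MulChar F ℂ) * kmat Q 1 = kmat Q 1 := kmat_mul_kmat 1
  have hTE : tmat Q * kmat Q 1 = tmat Q := mul_kmat_one fun _ _ _ => rfl
  have hET : kmat Q 1 * tmat Q = tmat Q := kmat_one_mul fun _ _ _ => rfl
  have hJE : jmat Q * kmat Q 1 = jmat Q := mul_kmat_one fun c x y => by simp [jmat, Xs.sc]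
  have hEJ : kmat Q 1 * jmat Q = jmat Q := kmat_one_mul fun c x y => by simp [jmat, Xs.sc]
  have hJT : jmat Q * tmat Q = j • tmat Q := by
    ext x y
    simp [Matrix.mul_apply, tmat, ← sum_mul, hrow]
  have hTJ : tmat Q * jmat Q = j • tmat Q := by
    ext x y
    rw [Matrix.mul_apply]
    simp only [tmat, Matrix.of_apply, ← mul_sum, Matrix.smul_apply, smul_eq_mul]
    rw [sum_congr rfl fun z _ => jmat_symm z y, hrow, mul_comm]
  have hJJ := jmat_sq h hj
  rw [← hs, ← ht] at hJJ
  have hP1 := idem_of_rank_three hTT hEE hTE hET hJE hEJ hJT hTJ hJJ rfl (sub_ne_zero.1 hst)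
  have hP2 := idem_of_rank_three (s := t) (t := s) hTT hEE hTE hET hJE hEJ hJT hTJ
    (hJJ.trans (by rw [add_comm s t, mul_comm s t])) (mul_comm _ _) (sub_ne_zero.1 hst).symm
  set P1 := (s - t)⁻¹ • (jmat Q - t • kmat Q 1 - (j - t) • tmat Q) with hP1d
  set P2 := (t - s)⁻¹ • (jmat Q - s • kmat Q 1 - (j - s) • tmat Q) with hP2d
  have hsum : P1 + P2 + tmat Q = kmat Q 1 := by
    rw [hP1d, hP2d, show t - s = -(s - t) by ring]
    match_scalars <;> field_simp <;> ring
  have hTinv : ∀ (g : Om Q) x y, tmat Q (g • x) (g • y) = tmat Q x y := fun _ _ _ => rfl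
  have hJinv : ∀ (g : Om Q) x y, jmat Q (g • x) (g • y) = jmat Q x y := fun g x y => by
    simp [jmat, g.bl]
  have hTtr : (tmat Q).trace = 1 := by simp [tmat, Matrix.trace, hN0]
  have hEtr := kmat_trace (Q := Q) (1 : MulChar F ℂ)
  have hJtr : (jmat Q).trace = Fintype.card (Xs Q (0 : F)) / ((Fintype.card F : ℂ) - 1) := by
    simp [jmat, Matrix.trace, div_eq_mul_inv]
  let κ : Ix F → Matrix (Xs Q (0 : F)) (Xs Q (0 : F)) ℂ := fun i => match i with
    | .inl χ => if χ = 1 then tmat Q else kmat Q χ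
    | .inr true => P1
    | .inr false => P2
  have hκ : ∀ i, κ i * κ i = κ i := by
    rintro (χ | _ | _)
    · by_cases hχ : χ = 1
      · simp only [κ, hχ, if_true, hTT]
      · simp only [κ, hχ, if_false, kmat_mul_kmat]
    · exact hP2
    · exact hP1
  have hinv : ∀ i (g : Om Q) x y, κ i (g • x) (g • y) = κ i x y := by
    rintro (χ | _ | _) g x y
    · by_cases hχ : χ = 1
      · simp only [κ, hχ, if_true, hTinv]
      · simp only [κ, hχ, if_false, kmat_inv]
    · simp [κ, hP2d, hJinv, hTinv, kmat_inv]
    · simp [κ, hP1d, hJinv, hTinv, kmat_inv]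
  have hone : ∑ i, κ i = 1 := by
    rw [Fintype.sum_sum_type, Fintype.sum_bool, ← sum_kmat (F := F),
      ← add_sum_erase _ _ (mem_univ (1 : MulChar F ℂ)),
      ← add_sum_erase _ (fun χ => kmat Q χ) (mem_univ (1 : MulChar F ℂ)),
      ← hsum, sum_congr rfl fun χ hχ => if_neg (ne_of_mem_erase hχ)]
    simp only [κ, if_true]
    abel
  have hφsum : ∑ i, (kchar (κ i) : Om Q → ℂ) = pchar (Om Q) (Xs Q (0 : F)) := by
    rw [pchar, ← hone, kchar_sum]
  have d1 : ∀ χ, χ ≠ 1 → (kchar (κ (.inl χ)) : Om Q → ℂ) 1 =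
      ((Fintype.card F : ℂ) ^ (k + 2) - α) *
        ((Fintype.card F : ℂ) ^ (k + 1) + α) / ((Fintype.card F : ℂ) - 1) := by
    intro χ hχ
    rw [kchar_one]
    simp only [κ, hχ, if_false]
    rw [kmat_trace, hN]
  have d2 : (kchar (κ (.inr true)) : Om Q → ℂ) 1 = ((Fintype.card F : ℂ) ^ (k + 2) - α) *
        ((Fintype.card F : ℂ) ^ (k + 1) + α * Fintype.card F) / ((Fintype.card F : ℂ) ^ 2 - 1) := by
    rw [kchar_one]
    simp only [κ, hP1d, Matrix.trace_smul, Matrix.trace_sub, hTtr, hEtr, hJtr, smul_eq_mul]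
    rw [inv_mul_eq_iff_eq_mul₀ hst, hj, hs, ht, hN]
    have : (Fintype.card F : ℂ) ^ 2 - 1 = (Fintype.card F - 1) * (Fintype.card F + 1) := by ring
    rw [this]
    rcases h.sign' with h' | h' <;> rw [h'] <;> field_simp <;> ring
  have d3 : (kchar (κ (.inr false)) : Om Q → ℂ) 1 =
      ((Fintype.card F : ℂ) ^ (2 * (k + 2)) - (Fintype.card F : ℂ) ^ 2) /
        ((Fintype.card F : ℂ) ^ 2 - 1) := by
    rw [kchar_one]
    simp only [κ, hP2d, Matrix.trace_smul, Matrix.trace_sub, hTtr, hEtr, hJtr, smul_eq_mul]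
    rw [inv_mul_eq_iff_eq_mul₀ (by rw [← neg_sub]; exact neg_ne_zero.2 hst), hj, hs, ht, hN]
    have : (Fintype.card F : ℂ) ^ 2 - 1 = (Fintype.card F - 1) * (Fintype.card F + 1) := by ring
    rw [this]
    rcases h.sign' with h' | h' <;> rw [h'] <;> field_simp <;> ring
  have d0 : (kchar (κ (.inl 1)) : Om Q → ℂ) = fun _ => 1 := by
    ext g
    simp [kchar, κ, tmat, hN0]
  have hne : ∀ i, (kchar (κ i) : Om Q → ℂ) ≠ 0 := by
    rintro (χ | _ | _) h0
    · by_cases hχ : χ = 1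
      · rw [hχ, d0] at h0
        exact one_ne_zero (congrFun h0 1)
      · have := d1 χ hχ
        rw [h0] at this
        exact div_ne_zero (mul_ne_zero hN1 hN2) hq this.symm
    · rw [h0] at d3
      refine div_ne_zero ?_ hq2 d3.symm
      have := q_pow_ne F (m := 2 * (k + 1)) (by omega) (a := 1) (by norm_num)
      rw [show (Fintype.card F : ℂ) ^ (2 * (k + 2)) - (Fintype.card F : ℂ) ^ 2 =
        (Fintype.card F : ℂ) ^ 2 * ((Fintype.card F : ℂ) ^ (2 * (k + 1)) - 1) by ring]
      exact mul_ne_zero (pow_ne_zero _ hq0) (sub_ne_zero.2 this)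
    · rw [h0] at d2
      refine div_ne_zero (mul_ne_zero hN1 ?_) hq2 d2.symm
      have := q_pow_ne F (m := k) (by omega) hα'
      rw [show (Fintype.card F : ℂ) ^ (k + 1) + α * Fintype.card F =
        (Fintype.card F : ℂ) * ((Fintype.card F : ℂ) ^ k - -α) by ring]
      exact mul_ne_zero hq0 (sub_ne_zero.2 this)
  have hι : ∀ i, (kchar (κ (iot i)) : Om Q → ℂ) = kchar (κ i) := by
    rintro (χ | b)
    · simp only [iot, Sum.map_inl, κ]
      by_cases hχ : χ = 1
      · simp [hχ]
      · rw [if_neg hχ, if_neg (by rwa [inv_eq_one]), kchar_kmat_inv h.nondeg]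
    · rfl
  obtain ⟨r1, r2⟩ := irr_of_norm (fun i => kchar_isChar (hκ i) (hinv i)) hne iot hι (by
    rw [hφsum, cip_zero_zero h (by omega), sum_iot])
  exact ⟨fun i => kchar (κ i), r1, hι, r2, d0, d1, d2, d3, hφsum⟩

theorem cnt_nonsing (h : IsType Q (k + 1) α) {u : V} (hu : Q u ≠ 0) :
    (cnt Q u u : ℤ) + 1 = (Fintype.card F : ℤ) ^ (2 * k) := by
  have : Finite V := finite_of_finite F
  have := Fintype.ofFinite V
  classical
  have hq : (Fintype.card F : ℤ) ≠ 0 := by exact_mod_cast Fintype.card_ne_zero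
  have h1 := cnt_add_one (Q := Q) u u
  simp only [and_self] at h1
  have hr : ∀ x : F, ∃ c, c * c = x := exists_sqrt F
  choose r hr using hr
  have hP : (univ.filter fun v => bl Q u v = 0).card = Fintype.card F ^ (2 * k + 1) := by
    have h2 := finrank_orth h.nondeg {u}
    have hu0 : u ≠ 0 := by rintro rfl; simp at hu
    rw [finrank_span_singleton hu0, h.rank] at h2
    have h3 := card_eq_pow_finrank (K := F) (V := orth Q {u})
    rw [show finrank F (orth Q {u}) = 2 * k + 1 by omega, Fintype.card_subtype] at h3
    rw [← h3]
    congr 1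
    ext v
    simp
  have hb : (univ ×ˢ univ.filter fun v => bl Q u v = 0 ∧ Q v = 0 :
      Finset (F × V)).card = (univ.filter fun v => bl Q u v = 0).card := by
    refine card_nbij' (fun p => p.2 + p.1 • u)
      (fun v => (r (Q v / Q u), v + r (Q v / Q u) • u)) ?_ ?_ ?_ ?_
    · rintro ⟨c, v⟩ hp
      simp at hp ⊢
      simp [hp.1]
    · intro v hv
      simp at hv ⊢
      refine ⟨hv, ?_⟩
      rw [Q_add, Q_smul, map_smul, bl_comm Q v, hv, hr, div_mul_cancel₀ _ hu, smul_zero, add_zero,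
        CharTwo.add_self_eq_zero]
    · rintro ⟨c, v⟩ hp
      simp at hp
      have hc : r (Q (v + c • u) / Q u) = c := by
        have h3 : r (Q (v + c • u) / Q u) * r (Q (v + c • u) / Q u) = c * c := by
          rw [hr, Q_add, Q_smul, map_smul, bl_comm Q v, hp.1, hp.2]
          field_simp
          simp
        have h4 := two_eq F
        have h5 : (r (Q (v + c • u) / Q u) + c) * (r (Q (v + c • u) / Q u) + c) = 0 := by
          linear_combination h3 + c * c * h4 + c * (r (Q (v + c • u) / Q u)) * h4
        have := mul_self_eq_zero.1 h5
        exact CharTwo.add_eq_zero.1 this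
      simp only [Prod.mk.injEq]
      refine ⟨hc, ?_⟩
      rw [hc, add_assoc, add_self_v F, add_zero]
    · intro v hv
      simp only
      rw [add_assoc, add_self_v F, add_zero]
  rw [card_product, ← h1, hP, card_univ, pow_succ, mul_comm] at hb
  have := Nat.eq_of_mul_eq_mul_right Fintype.card_pos hb
  exact_mod_cast this

variable {M : Type} [AddCommGroup M] [Module ℂ M] {ρ : Representation ℂ (Om Q) M}

theorem exists_family {G X : Type} [Group G] [MulAction G X] {ρ : Representation ℂ G M} (x : X)
    (hx : ∀ y : X, ∃ g : G, g • x = y) {t : M} (ht : ∀ g : G, g • x = x → ρ g t = t) :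
    ∃ τ : X → M, τ x = t ∧ ∀ (g : G) y, ρ g (τ y) = τ (g • y) := by
  choose s hs using hx
  have key : ∀ g g' : G, g • x = g' • x → ρ g t = ρ g' t := by
    intro g g' hg
    have h1 := ht (g'⁻¹ * g) (by rw [mul_smul, hg, inv_smul_smul])
    calc ρ g t = ρ (g' * (g'⁻¹ * g)) t := by rw [mul_inv_cancel_left]
      _ = ρ g' t := by rw [map_mul]; exact congrArg (ρ g') h1
  refine ⟨fun y => ρ (s y) t, ht _ (hs x), fun g y => ?_⟩
  have h1 : ρ g (ρ (s y) t) = ρ (g * s y) t := by rw [map_mul]; rfl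
  change ρ g (ρ (s y) t) = ρ (s (g • y)) t
  rw [h1]
  exact key _ _ (by rw [mul_smul, hs, hs])

/-- No nonzero vector is fixed by the stabilizer of a singular vector. -/
def NoSing (ρ : Representation ℂ (Om Q) M) : Prop :=
  ∀ e, Q e = 0 → e ≠ 0 → ∀ m, (∀ g : Om Q, g.1 e = e → ρ g m = m) → m = 0

variable {t : Xs Q (1 : F) → M}

theorem sum_fiber_eq_zero (hno : NoSing ρ) (ht : ∀ g y, ρ g (t y) = t (g • y)) {e : V}
    (he : Q e = 0) (he0 : e ≠ 0) (β : F) :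
    ∑ y : Xs Q (1 : F) with bl Q e y.val = β, t y = 0 := by
  refine hno e he he0 _ fun g hg => ?_
  rw [map_sum]
  simp only [ht]
  refine sum_nbij' (fun y => g • y) (fun y => g⁻¹ • y) ?_ ?_ ?_ ?_ ?_
  · intro y hy
    simp only [mem_filter, mem_univ, true_and] at hy ⊢
    rw [← hy, Xs.smul_val]
    conv_lhs => rw [← hg]
    exact g.bl _ _
  · intro y hy
    simp only [mem_filter, mem_univ, true_and] at hy ⊢
    rw [← hy, Xs.smul_val, ← g.bl, hg, Om.apply_inv_self]
  · simp
  · simp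
  · simp

theorem sum_family_eq_zero (h : IsType Q (k + 2) α) (hno : NoSing ρ)
    (ht : ∀ g y, ρ g (t y) = t (g • y)) : ∑ y, t y = 0 := by
  obtain ⟨e, -, he, he0⟩ := h.exists_sing (U := ∅) finrank_span_empty_le (by omega)
  rw [← sum_fiberwise univ fun y : Xs Q (1 : F) => bl Q e y.val]
  exact sum_eq_zero fun β _ => sum_fiber_eq_zero hno ht he0 (by rintro rfl; simp at he) β

theorem sum_perp_family (h : IsType Q (k + 2) α) (hno : NoSing ρ)
    (ht : ∀ g y, ρ g (t y) = t (g • y)) (x : Xs Q (1 : F)) :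
    ∑ y : Xs Q (1 : F) with y ≠ x ∧ bl Q x.val y.val = 0, t y =
      (-(α * (Fintype.card F : ℂ) ^ (k + 1) + 1)) • t x := by
  classical
  have hq := q_sub_ne F
  have hα := h.sq
  have hq0 : (Fintype.card F : ℂ) ≠ 0 := by exact_mod_cast Fintype.card_ne_zero
  have h0 : ∑ y : Xs Q (1 : F), (cnt Q (x.val + y.val) (x.val + y.val) : ℂ) • t y = 0 := by
    have h1 : ∑ e : Xs Q (0 : F), ∑ y : Xs Q (1 : F) with bl Q e.val y.val = bl Q e.val x.val, t y
        = 0 := sum_eq_zero fun e _ => sum_fiber_eq_zero hno ht e.quad e.ne _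
    rw [← h1]
    simp only [sum_filter]
    rw [sum_comm]
    refine sum_congr rfl fun y _ => ?_
    rw [← sum_filter, sum_const, Nat.cast_smul_eq_nsmul, cnt]
    congr 2
    ext z
    simp only [and_self, mem_filter, mem_univ, true_and, map_add,
      LinearMap.add_apply, CharTwo.add_eq_zero]
    rw [bl_comm Q x.val, bl_comm Q y.val, eq_comm]
  have hc : ∀ y : Xs Q (1 : F), (cnt Q (x.val + y.val) (x.val + y.val) : ℂ) • t y =
      ((Fintype.card F : ℂ) ^ (2 * (k + 1)) - 1) • t y +
      ((if y = x then ((Fintype.card F : ℂ) ^ (k + 2) - α) * ((Fintype.card F : ℂ) ^ (k + 1) + α) -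
        ((Fintype.card F : ℂ) ^ (2 * (k + 1)) - 1) else 0) • t y +
      if y ≠ x ∧ bl Q x.val y.val = 0 then
        (α * ((Fintype.card F : ℂ) - 1) * (Fintype.card F : ℂ) ^ (k + 1)) • t y else 0) := by
    intro y
    by_cases hyx : y = x
    · subst hyx
      have : cnt Q (y.val + y.val) (y.val + y.val) = Fintype.card (Xs Q (0 : F)) := by
        rw [cnt, add_self_v F]
        simp
      rw [this, card_Xs_zero_cast (k := k + 1) h]
      simp only [if_true, ne_eq, not_true, false_and, if_false, add_zero]
      rw [← add_smul]
      congr 1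
      ring
    · have hne : x.val + y.val ≠ 0 := by
        intro h0
        have := add_add_cancel_v F x.val y.val
        rw [h0, add_zero] at this
        exact hyx (Xs.ext this.symm)
      have hQ : Q (x.val + y.val) = bl Q x.val y.val := by
        rw [Q_add, x.quad, y.quad, CharTwo.add_self_eq_zero, zero_add]
      by_cases hb : bl Q x.val y.val = 0
      · have h2 := congrArg (Int.cast : ℤ → ℂ) (cnt_one (k := k + 1) h (hQ.trans hb) hne)
        push_cast at h2
        rw [if_neg hyx, if_pos ⟨hyx, hb⟩, zero_smul, zero_add, ← add_smul]
        congr 1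
        linear_combination h2
      · have h2 := congrArg (Int.cast : ℤ → ℂ) (cnt_nonsing (k := k + 1) h (u := x.val + y.val)
          (by rwa [hQ]))
        push_cast at h2
        rw [if_neg hyx, if_neg (fun h => hb h.2), zero_smul, zero_add, add_zero]
        congr 1
        linear_combination h2
  simp only [hc, sum_add_distrib, ← smul_sum, sum_family_eq_zero h hno ht,
    smul_zero, zero_add, ite_smul, zero_smul, sum_ite_eq', mem_univ, if_true] at h0
  rw [← sum_filter, ← smul_sum] at h0
  have hα0 : (α : ℂ) ≠ 0 := by rintro h0; rw [h0] at hα; norm_num at hα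
  have hd : α * ((Fintype.card F : ℂ) - 1) * (Fintype.card F : ℂ) ^ (k + 1) ≠ 0 :=
    mul_ne_zero (mul_ne_zero hα0 hq) (pow_ne_zero _ hq0)
  refine smul_right_injective M hd ?_
  change _ • _ = _ • _
  rw [eq_neg_of_add_eq_zero_right h0, smul_smul, ← neg_smul]
  congr 1
  rcases h.sign' with h' | h' <;> rw [h'] <;> ring

variable {ip : M →ₗ⋆[ℂ] M →ₗ[ℂ] ℂ}

theorem ip_sum_fiber (hno : NoSing ρ) (ht : ∀ g y, ρ g (t y) = t (g • y)) {e : V}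
    (he : Q e = 0) (he0 : e ≠ 0) (β : F) (m : M) :
    ∑ y : Xs Q (1 : F) with bl Q e y.val = β, ip (t y) m = 0 := by
  have := congrArg (fun v => ip v m) (sum_fiber_eq_zero hno ht he he0 β)
  simpa [LinearMap.sum_apply] using this

theorem ip_family_sg (hip : ∀ g m m', ip (ρ g m) (ρ g m') = ip m m')
    (ht : ∀ g y, ρ g (t y) = t (g • y)) {e x w : V} (he : Q e = 0) (hew : bl Q e w = 0) {m : M}
    (hm : m ∈ wsp ρ e x) (y : Xs Q (1 : F)) :
    ip (t (sg Q e w • y)) m = psi F (bl Q w x) * ip (t y) m := by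
  rw [← ht, ip_sg hip he hew, hm w hew, map_smul, smul_eq_mul]

theorem exists_psi_bl (hQ : Nondeg Q) {U : Set V} {x : V} (hx : x ∉ span F U) {c : F}
    (hc : c ≠ 0) : ∃ w, Perp Q U w ∧ psi F (bl Q x w * c) ≠ 1 := by
  obtain ⟨w, hw, hxw⟩ := exists_perp hQ hx
  obtain ⟨s, hs⟩ := exists_psi_mul_ne hc
  exact ⟨s • w, hw.smul s, by rwa [map_smul, hxw, smul_eq_mul, mul_one]⟩

theorem ip_family_of_perp (hQ : Nondeg Q) (hip : ∀ g m m', ip (ρ g m) (ρ g m') = ip m m')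
    (ht : ∀ g y, ρ g (t y) = t (g • y)) {e x : V} (he : Q e = 0) (hx0 : Q x = 0)
    (hx : x ∉ span F {e}) {m : M} (hm : m ∈ wsp ρ e x)
    {y : Xs Q (1 : F)} (hy : bl Q e y.val = 0) : ip (t y) m = 0 := by
  have hxy : x ∉ span F {e, y.val} := by
    intro hc
    obtain ⟨c, d, hcd⟩ := Submodule.mem_span_pair.1 hc
    have hd : d * d = 0 := by
      rw [← hcd, Q_add, Q_smul, Q_smul, he, y.quad] at hx0
      simpa [hy] using hx0
    refine hx (mem_span_singleton.2 ⟨c, ?_⟩)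
    rw [← hcd, mul_self_eq_zero.1 hd, zero_smul, add_zero]
  obtain ⟨w, hw, hne⟩ := exists_psi_bl hQ hxy one_ne_zero
  simp only [perp_insert, perp_singleton] at hw
  have h1 := ip_family_sg hip ht he hw.1 hm y
  have h2 : sg Q e w • y = y := Xs.ext (by
    rw [Xs.smul_val, sg_apply he hw.1, hw.2, bl_comm Q y.val e, hy]
    simp)
  rw [h2] at h1
  rw [mul_one, bl_comm Q] at hne
  by_contra h0
  exact hne (mul_right_cancel₀ h0 (by rw [one_mul]; exact h1.symm))

theorem sg_smul_transitive {e : V} (he : Q e = 0) {y y' : Xs Q (1 : F)} {β : F} (hβ : β ≠ 0)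
    (hy : bl Q e y.val = β) (hy' : bl Q e y'.val = β) :
    ∃ w, bl Q e w = 0 ∧ sg Q e w • y = y' := by
  refine ⟨β⁻¹ • (y.val + y'.val), ?_, Xs.ext ?_⟩
  · rw [map_smul, map_add, hy, hy', CharTwo.add_self_eq_zero, smul_zero]
  · have hw : bl Q e (β⁻¹ • (y.val + y'.val)) = 0 := by
      rw [map_smul, map_add, hy, hy', CharTwo.add_self_eq_zero, smul_zero]
    rw [Xs.smul_val, sg_apply he hw, bl_comm Q y.val e, hy, Q_smul, Q_add, y.quad, y'.quad,
      map_smul, map_add, bl_self, smul_smul, mul_inv_cancel₀ hβ, one_smul]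
    have h2 := two_eq F
    have : (β⁻¹ * β⁻¹ * (1 + 1 + bl Q y.val y'.val) * β) = β⁻¹ * bl Q y.val y'.val := by
      field_simp
      linear_combination h2
    rw [this, zero_add, smul_eq_mul]
    match_scalars <;> grind

theorem ip_family_of_sing (hQ : Nondeg Q) (hno : NoSing ρ)
    (hip : ∀ g m m', ip (ρ g m) (ρ g m') = ip m m')
    (ht : ∀ g y, ρ g (t y) = t (g • y)) {e x : V} (he : Q e = 0) (hex : bl Q e x = 0)
    (hx0 : Q x = 0) (hx : x ∉ span F {e}) {m : M} (hm : m ∈ wsp ρ e x)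
    (y₀ : Xs Q (1 : F)) : ip (t y₀) m = 0 := by
  by_cases hβ : bl Q e y₀.val = 0
  · exact ip_family_of_perp hQ hip ht he hx0 hx hm hβ
  set β := bl Q e y₀.val with hβd
  have hxne : x ≠ 0 := by rintro rfl; exact hx (Submodule.zero_mem _)
  set f : Xs Q (1 : F) → ℂ := fun y => psi F (bl Q x y.val / β) * ip (t y) m with hf
  have hf1 : ∀ w, bl Q e w = 0 → ∀ y, f (sg Q e w • y) =
      psi F (bl Q x w * (1 + bl Q e y.val / β)) * f y := by
    intro w hw y
    simp only [hf]
    rw [ip_family_sg hip ht he hw hm, Xs.smul_val, sg_apply he hw]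
    simp only [map_add, map_smul, smul_eq_mul]
    rw [bl_comm Q x e, hex, bl_comm Q w x, bl_comm Q y.val e]
    have : (bl Q x y.val + bl Q y.val w * 0 + bl Q e y.val * bl Q x w +
      Q w * bl Q e y.val * 0) / β = bl Q x y.val / β + bl Q x w * (bl Q e y.val / β) := by
      field_simp
      ring
    rw [this, mul_add, mul_one, psi_add, psi_add]
    ring
  have hperm : ∀ w, bl Q e w = 0 → ∀ (γ : F) (g : Xs Q (1 : F) → ℂ),
      ∑ y : Xs Q (1 : F) with bl Q e y.val = γ, g (sg Q e w • y) =
        ∑ y : Xs Q (1 : F) with bl Q e y.val = γ, g y := by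
    intro w hw γ g
    have hfix : (sg Q e w).1 e = e := by rw [sg_apply he hw]; simp [hw]
    refine sum_nbij' (fun y => sg Q e w • y) (fun y => (sg Q e w)⁻¹ • y) ?_ ?_ ?_ ?_ ?_
    · intro y hy
      simp only [mem_filter, mem_univ, true_and] at hy ⊢
      have := (sg Q e w).bl e y.val
      rw [hfix] at this
      rw [← hy, Xs.smul_val, this]
    · intro y hy
      simp only [mem_filter, mem_univ, true_and] at hy ⊢
      rw [← hy, Xs.smul_val, ← (sg Q e w).bl, hfix, Om.apply_inv_self]
    · simp
    · simp
    · simp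
  have hother : ∀ γ, γ ≠ β → ∑ y : Xs Q (1 : F) with bl Q e y.val = γ, f y = 0 := by
    intro γ hγ
    by_cases hγ0 : γ = 0
    · refine sum_eq_zero fun y hy => ?_
      simp only [mem_filter, mem_univ, true_and] at hy
      simp only [hf]
      rw [ip_family_of_perp hQ hip ht he hx0 hx hm (hy.trans hγ0), mul_zero]
    have hc : 1 + γ / β ≠ 0 := by
      intro h0
      apply hγ
      have := CharTwo.add_eq_zero.1 h0
      field_simp at this
      exact this.symm
    obtain ⟨w, hw, hne⟩ := exists_psi_bl hQ hx hc
    simp only [perp_singleton] at hw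
    have h1 := hperm w hw γ f
    rw [sum_congr rfl (g := fun y => psi F (bl Q x w * (1 + γ / β)) * f y) fun y hy => by
      rw [hf1 w hw, (mem_filter.1 hy).2], ← mul_sum] at h1
    by_contra h0
    exact hne (mul_right_cancel₀ h0 (by rw [one_mul]; exact h1))
  have hall : ∑ y, f y = 0 := by
    rw [← sum_fiberwise univ fun y : Xs Q (1 : F) => bl Q x y.val]
    refine sum_eq_zero fun μ _ => ?_
    rw [sum_congr rfl (g := fun y => psi F (μ / β) * ip (t y) m) fun y hy => by
      simp only [hf]; rw [(mem_filter.1 hy).2], ← mul_sum,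
      ip_sum_fiber hno ht hx0 hxne, mul_zero]
  rw [← sum_fiberwise univ fun y : Xs Q (1 : F) => bl Q e y.val,
    sum_eq_single β (fun γ _ hγ => hother γ hγ) (fun h => absurd (mem_univ _) h),
    sum_congr rfl (g := fun _ => f y₀)] at hall
  · rw [sum_const, nsmul_eq_mul] at hall
    have hcard : (univ.filter fun y : Xs Q (1 : F) => bl Q e y.val = β).card ≠ 0 :=
      card_ne_zero_of_mem (a := y₀) (by simp [hβd])
    have h0 := (mul_eq_zero.1 hall).resolve_left (by exact_mod_cast hcard)
    exact (mul_eq_zero.1 h0).resolve_left (psi_ne_zero _)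
  · intro y hy
    obtain ⟨w, hw, rfl⟩ := sg_smul_transitive he hβ hβd.symm (mem_filter.1 hy).2
    rw [hf1 w hw, ← hβd, div_self hβ, CharTwo.add_self_eq_zero, mul_zero, psi_zero, one_mul]

theorem span_family [FiniteDimensional ℂ M] [hρ : ρ.IsIrreducible]
    (hip : ∀ g m m', ip (ρ g m) (ρ g m') = ip m m') (hpos : ∀ m, m ≠ 0 → 0 < (ip m m).re)
    (ht : ∀ g y, ρ g (t y) = t (g • y)) {y : Xs Q (1 : F)}
    (hy : t y ≠ 0) (m : M) : m ∈ span ℂ (Set.range t) := by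
  obtain ⟨c, hc, hs⟩ := schur_ip (ρ := ρ) hip (t y) (t y)
  have hc0 : c ≠ 0 := by
    rintro rfl
    rw [zero_mul] at hc
    have h1 := (mul_eq_zero.1 hc.symm).resolve_left (by exact_mod_cast Fintype.card_ne_zero)
    have := hpos _ hy
    rw [h1] at this
    simp at this
  rw [← inv_smul_smul₀ hc0 m, ← hs m]
  refine Submodule.smul_mem _ _ (Submodule.sum_mem _ fun g _ => Submodule.smul_mem _ _ ?_)
  rw [ht]
  exact subset_span ⟨_, rfl⟩

theorem wsp_sing_eq_bot [FiniteDimensional ℂ M] [hρ : ρ.IsIrreducible] (hQ : Nondeg Q) (hno : NoSing ρ)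
    (hip : ∀ g m m', ip (ρ g m) (ρ g m') = ip m m') (hpos : ∀ m, m ≠ 0 → 0 < (ip m m).re)
    (ht : ∀ g y, ρ g (t y) = t (g • y)) {y : Xs Q (1 : F)} (hy : t y ≠ 0)
    {e x : V} (he : Q e = 0) (hex : bl Q e x = 0)
    (hx0 : Q x = 0) (hx : x ∉ span F {e}) : wsp ρ e x = ⊥ := by
  rw [eq_bot_iff]
  intro m hm
  rw [Submodule.mem_bot]
  by_contra hm0
  have h1 : ip m m = 0 := by
    refine Submodule.span_induction (p := fun v _ => ip v m = 0) ?_ ?_ ?_ ?_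
      (span_family hip hpos ht hy m)
    · rintro _ ⟨y, rfl⟩
      exact ip_family_of_sing hQ hno hip ht he hex hx0 hx hm y
    · simp
    · intro a b _ _ ha hb
      simp [ha, hb]
    · intro c a _ ha
      simp [ha]
  have := hpos m hm0
  rw [h1] at this
  simp at this

theorem finrank_wsp_map (ρ : Representation ℂ (Om Q) M) (g : Om Q) (e x : V) :
    finrank ℂ (wsp ρ (g.1 e) (g.1 x)) = finrank ℂ (wsp ρ e x) := by
  refine (LinearEquiv.finrank_eq (LinearEquiv.ofLinearMap
    ((ρ g).restrict (p := wsp ρ e x) (q := wsp ρ (g.1 e) (g.1 x)) fun m hm => rho_mem_wsp ρ hm g)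
    ((ρ g⁻¹).restrict (p := wsp ρ (g.1 e) (g.1 x)) (q := wsp ρ e x) fun m hm => ?_) ?_ ?_)).symm
  · have := rho_mem_wsp ρ hm g⁻¹
    rwa [Om.inv_apply_self, Om.inv_apply_self] at this
  · ext m
    simp
  · ext m
    simp

theorem IsType.finrank_wsp_sing (h : IsType Q k α) (hk : 2 < k ∨ α = -1 ∧ 2 ≤ k)
    (ρ : Representation ℂ (Om Q) M)
    {e e' x x' : V} (he : Q e = 0) (he' : Q e' = 0) (he0 : e ≠ 0) (he0' : e' ≠ 0)
    (hex : bl Q e x = 0) (hex' : bl Q e' x' = 0) (hx : x ∉ span F {e})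
    (hx' : x' ∉ span F {e'}) (hq : Q x = Q x') :
    finrank ℂ (wsp ρ e x) = finrank ℂ (wsp ρ e' x') := by
  obtain ⟨g, rfl, rfl⟩ := h.exists_map_pair hk he he' he0 he0' hx hx' hq (hex.trans hex'.symm)
  exact (finrank_wsp_map ρ g e x).symm

theorem notMem_of_nonsing {e x : V} (he : Q e = 0) (hx : Q x ≠ 0) : x ∉ span F {e} := by
  intro hc
  obtain ⟨c, rfl⟩ := mem_span_singleton.1 hc
  exact hx (by rw [Q_smul, he, mul_zero])

theorem IsType.finrank_wsp_nonsing (h : IsType Q k α) (hk : 2 < k ∨ α = -1 ∧ 2 ≤ k)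
    (ρ : Representation ℂ (Om Q) M)
    {e e' x x' : V} (he : Q e = 0) (he' : Q e' = 0) (he0 : e ≠ 0) (he0' : e' ≠ 0)
    (hex : bl Q e x = 0) (hex' : bl Q e' x' = 0) (hx : Q x ≠ 0) (hx' : Q x' ≠ 0) :
    finrank ℂ (wsp ρ e x) = finrank ℂ (wsp ρ e' x') := by
  obtain ⟨s, hs⟩ := exists_sqrt F (Q x / Q x')
  have hs0 : s ≠ 0 := by
    rintro rfl
    rw [mul_zero] at hs
    exact div_ne_zero hx hx' hs.symm
  have h1 : wsp ρ e' x' = wsp ρ (s • e') (s • x') := by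
    ext m
    rw [mem_wsp_smul ρ he' hs0, inv_smul_smul₀ hs0]
  have hse : Q (s • e') = 0 := by rw [Q_smul, he', mul_zero]
  rw [h1]
  refine h.finrank_wsp_sing hk ρ he hse he0 (smul_ne_zero hs0 he0') hex (by simp [hex'])
    (notMem_of_nonsing he hx) (notMem_of_nonsing hse ?_) ?_
  · rw [Q_smul]; exact mul_ne_zero (mul_ne_zero hs0 hs0) hx'
  · rw [Q_smul, hs, div_mul_cancel₀ _ hx']

open scoped Classical in
theorem finrank_sub_trace [FiniteDimensional ℂ M] [Fintype V] (hQ : Nondeg Q) {e f : V}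
    (h : Hyp Q e f) {w : V} (hw : bl Q e w = 0) :
    (finrank ℂ M : ℂ) - ρ.character (sg Q e w) =
      ∑ x : hc Q e f, (1 - psi F (bl Q w x)) * finrank ℂ (wsp ρ e x) := by
  have hex : ∀ x : hc Q e f, bl Q e x = 0 := fun x => by
    have := x.2
    simp only [hc, mem_orth, perp_insert] at this
    exact this.1
  have h1 : ρ (sg Q e w) = ∑ x : hc Q e f, psi F (bl Q w x) • wproj ρ e f x := by
    ext m
    conv_lhs => rw [← LinearMap.id_apply (R := ℂ) m, ← sum_wproj ρ hQ h]
    rw [LinearMap.sum_apply, map_sum, LinearMap.sum_apply]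
    refine sum_congr rfl fun x _ => ?_
    exact (wproj_isProj ρ h x (hex x)).map_mem m w hw
  rw [Representation.character, h1, map_sum, finrank_eq_sum_wsp ρ hQ h, Nat.cast_sum,
    ← sum_sub_distrib]
  refine sum_congr rfl fun x _ => ?_
  rw [map_smul, (wproj_isProj ρ h x (hex x)).trace, smul_eq_mul]
  ring

theorem sum_nonsing_psi [Fintype V] (hQ : Nondeg Q) {w : V} (hw : Q w = 0) (hw0 : w ≠ 0) :
    (∑ x : V, if Q x = 0 then 0 else (1 - psi F (bl Q w x))) * Fintype.card F =
      Fintype.card V * ((Fintype.card F : ℂ) - 1) := by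
  have hall : ∑ x : V, (1 - psi F (bl Q w x)) = Fintype.card V := by
    rw [sum_sub_distrib, sum_psi_lin (bl Q w) (fun h0 => hw0 (hQ w fun v => by rw [h0]; rfl))]
    simp
  have htr : ∀ τ : F, ∑ x : V, (if Q x = 0 then (1 - psi F (bl Q w x)) else 0) =
      ∑ x : V, if Q (x + τ • w) = 0 then (1 - psi F (bl Q w x)) else 0 := fun τ => by
    rw [← Equiv.sum_comp (Equiv.addRight (τ • w))]
    refine sum_congr rfl fun x _ => ?_
    simp
  have hs : (Fintype.card F : ℂ) * ∑ x : V, (if Q x = 0 then (1 - psi F (bl Q w x)) else 0) =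
      Fintype.card V := by
    rw [← hall, ← nsmul_eq_mul, ← card_univ, ← sum_const,
      sum_congr rfl fun τ _ => htr τ, sum_comm]
    refine sum_congr rfl fun x _ => ?_
    by_cases hb : bl Q w x = 0
    · simp [hb]
    · rw [sum_eq_single (Q x / bl Q w x)]
      · rw [if_pos]
        rw [Q_add, Q_smul, hw, map_smul, bl_comm Q x, smul_eq_mul, div_mul_cancel₀ _ hb, mul_zero,
          add_zero, CharTwo.add_self_eq_zero]
      · intro τ _ hτ
        rw [if_neg]
        intro h0
        rw [Q_add, Q_smul, hw, map_smul, bl_comm Q x, smul_eq_mul, mul_zero, add_zero,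
          CharTwo.add_eq_zero] at h0
        exact hτ (by rw [h0, mul_div_cancel_right₀ _ hb])
      · exact fun h => absurd (mem_univ _) h
  have : ∑ x : V, (if Q x = 0 then 0 else (1 - psi F (bl Q w x))) =
      Fintype.card V - ∑ x : V, (if Q x = 0 then (1 - psi F (bl Q w x)) else 0) := by
    rw [← hall, ← sum_sub_distrib]
    refine sum_congr rfl fun x _ => ?_
    split_ifs <;> simp
  rw [this]
  linear_combination -hs

theorem card_not_perp (h : IsType Q (k + 2) α) {e w : V} (he : Q e = 0) (hw : Q w = 0)
    (hew : bl Q e w = 0) (he0 : e ≠ 0) (hwe : w ∉ span F {e}) :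
    ((univ.filter fun y : Xs Q (1 : F) => ¬(bl Q e y.val = 0 ∧ bl Q w y.val = 0)).card : ℂ) =
      (Fintype.card F : ℂ) ^ (2 * k + 3) - (Fintype.card F : ℂ) ^ (2 * k + 1) := by
  have : Finite V := finite_of_finite F
  have := Fintype.ofFinite V
  classical
  have hq0 : (Fintype.card F : ℂ) ≠ 0 := by exact_mod_cast Fintype.card_ne_zero
  have hU : ∀ u ∈ span F {e, w}, Q u = 0 := by
    intro u hu
    obtain ⟨c, d, rfl⟩ := Submodule.mem_span_pair.1 hu
    simp [Q_add, Q_smul, he, hw, hew]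
  have hor : ∀ v, v ∈ orth Q {e, w} ↔ bl Q e v = 0 ∧ bl Q w v = 0 := fun v => by simp
  obtain ⟨P, hP⟩ : ∃ P : Finset V, P = univ.filter fun v => v ∉ orth Q {e, w} := ⟨_, rfl⟩
  have hmP : ∀ v, v ∈ P ↔ v ∉ orth Q {e, w} := fun v => by simp [hP]
  have h1 : (P.filter fun v => Q v = 1).card * Fintype.card F = P.card := by
    convert card_Q_eq (Q := Q) (span F {e, w}) hU P (by
      intro v hv u hu
      rw [hmP] at hv ⊢
      obtain ⟨c, d, rfl⟩ := Submodule.mem_span_pair.1 hu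
      rw [hor] at hv ⊢
      simpa [he, hw, hew, bl_comm Q w e] using hv) (by
      intro v hv
      rw [hmP, hor, not_and_or] at hv
      rcases hv with hv | hv
      · exact ⟨e, subset_span (by simp), by rwa [bl_comm]⟩
      · exact ⟨w, subset_span (by simp), by rwa [bl_comm]⟩) 1
  have h2 : P.card + Fintype.card (orth Q {e, w}) =
      Fintype.card V := by
    rw [hP, Fintype.card_subtype, ← card_univ (α := V), add_comm]
    exact card_filter_add_card_filter_not _
  have h3 := finrank_orth h.nondeg {e, w}
  have h4 : finrank F (span F {e, w}) = 2 := by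
    have : LinearIndependent F ![e, w] := by
      rw [LinearIndependent.pair_iff' he0]
      intro a ha
      exact hwe (mem_span_singleton.2 ⟨a, ha⟩)
    have := finrank_span_eq_card this
    rwa [Matrix.range_cons, Matrix.range_cons, Matrix.range_empty, Set.union_empty,
      Set.singleton_union, Fintype.card_fin] at this
  rw [h4, h.rank] at h3
  rw [card_eq_pow_finrank (K := F) (V := V), h.rank,
    card_eq_pow_finrank (K := F) (V := orth Q {e, w}),
    show finrank F (orth Q {e, w}) = 2 * k + 2 by omega, ← h1] at h2
  have h5 : (univ.filter fun y : Xs Q (1 : F) =>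
      ¬(bl Q e y.val = 0 ∧ bl Q w y.val = 0)).card =
      (P.filter fun v => Q v = 1).card := by
    refine card_bij (fun y _ => y.val) ?_ ?_ ?_
    · intro y hy
      simp only [mem_filter, mem_univ, true_and, hmP, hor] at hy ⊢
      exact ⟨hy, y.quad⟩
    · intro y _ y' _ hyy
      exact Xs.ext hyy
    · intro v hv
      simp only [mem_filter, hmP, hor] at hv
      exact ⟨⟨v, hv.2, by rintro rfl; simp at hv⟩, by simpa using hv.1, rfl⟩
  rw [h5]
  have h6 := congrArg (Nat.cast : ℕ → ℂ) h2
  push_cast at h6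
  refine mul_right_cancel₀ hq0 ?_
  rw [eq_sub_of_add_eq h6]
  ring

end Kernels

theorem card_smul_filter {G X : Type} [Group G] [Fintype G] [MulAction G X] [Fintype X]
    (hx : ∀ x y : X, ∃ g : G, g • x = y) (x : X) (p : X → Prop) [DecidablePred p] :
    (univ.filter fun g : G => p (g • x)).card * Fintype.card X =
      Fintype.card G * (univ.filter p).card := by
  classical
  have hc : ∀ y, (univ.filter fun g : G => g • x = y).card =
      (univ.filter fun g : G => g • x = x).card := by
    intro y
    obtain ⟨k, rfl⟩ := hx x y
    refine card_nbij' (fun g => k⁻¹ * g) (fun g => k * g) ?_ ?_ ?_ ?_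
    · intro g hg
      simp only [coe_filter, mem_univ, true_and, Set.mem_ofPred_eq] at hg ⊢
      rw [mul_smul, hg, inv_smul_smul]
    · intro g hg
      simp only [coe_filter, mem_univ, true_and, Set.mem_ofPred_eq] at hg ⊢
      rw [mul_smul, hg]
    · intro g _; simp
    · intro g _; simp
  have h1 : (univ.filter fun g : G => p (g • x)).card =
      ∑ y with p y, (univ.filter fun g : G => g • x = y).card := by
    rw [card_eq_sum_card_fiberwise (f := fun g => g • x) (t := univ.filter p)]
    · refine sum_congr rfl fun y hy => ?_
      congr 1
      ext g
      simp only [mem_filter, mem_univ, true_and] at hy ⊢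
      constructor
      · exact fun h => h.2
      · rintro rfl; exact ⟨hy, rfl⟩
    · intro g hg
      simpa using hg
  have h2 : Fintype.card G = ∑ y : X, (univ.filter fun g : G => g • x = y).card := by
    rw [← card_univ]
    exact card_eq_sum_card_fiberwise fun _ _ => mem_univ _
  rw [h1, h2]
  simp only [hc, sum_const, smul_eq_mul, card_univ]
  ring

section Degree

variable {F V : Type} [Field F] [AddCommGroup V] [Module F V] [CharP F 2]
  [Fintype F] [DecidableEq F] [FiniteDimensional F V]
variable {Q : QuadraticForm F V} {k : ℕ} {α : ℤ}
variable {M : Type} [AddCommGroup M] [Module ℂ M] {ρ : Representation ℂ (Om Q) M}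
variable {t : Xs Q (1 : F) → M} {ip : M →ₗ⋆[ℂ] M →ₗ[ℂ] ℂ}

theorem card_perp_one (h : IsType Q (k + 1) α) (x : Xs Q (1 : F)) :
    ((univ.filter fun y : Xs Q (1 : F) => y ≠ x ∧ bl Q x.val y.val = 0).card : ℂ) =
      (Fintype.card F : ℂ) ^ (2 * k) - 1 := by
  have h1 := congrArg (Int.cast : ℤ → ℂ) (cnt_nonsing h (u := x.val) (by rw [x.quad]; exact one_ne_zero))
  push_cast at h1
  rw [← eq_sub_of_add_eq h1]
  congr 1
  rw [cnt]
  refine card_bij (fun y hy => ⟨x.val + y.val, ?_, ?_⟩) ?_ ?_ ?_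
  · simp only [mem_filter, mem_univ, true_and] at hy
    rw [Q_add, x.quad, y.quad, hy.2, CharTwo.add_self_eq_zero, zero_add]
  · simp only [mem_filter, mem_univ, true_and] at hy
    intro h0
    have := add_add_cancel_v F x.val y.val
    rw [h0, add_zero] at this
    exact hy.1 (Xs.ext this.symm)
  · intro y hy
    simp only [mem_filter, mem_univ, true_and] at hy
    simp [hy.2]
  · intro y _ y' _ hyy
    have := congrArg Xs.val hyy
    exact Xs.ext (add_left_cancel this)
  · intro a ha
    simp only [mem_filter, mem_univ, true_and, and_self] at ha
    refine ⟨⟨x.val + a.val, ?_, ?_⟩, ?_, ?_⟩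
    · rw [Q_add, x.quad, a.quad, ha, add_zero, add_zero]
    · intro h0
      have h1 := add_add_cancel_v F x.val a.val
      rw [h0, add_zero] at h1
      have := congrArg Q h1
      rw [x.quad, a.quad] at this
      exact one_ne_zero this
    · simp only [mem_filter, mem_univ, true_and]
      refine ⟨fun h0 => a.ne ?_, by simp [ha]⟩
      have := congrArg Xs.val h0
      simpa using this
    · exact Xs.ext (add_add_cancel_v F _ _)

theorem sg_smul_eq_iff {e w : V} (he : Q e = 0) (hw : Q w = 0) (hew : bl Q e w = 0) (he0 : e ≠ 0)
    (hwe : w ∉ span F {e}) (x : Xs Q (1 : F)) :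
    (sg Q e w • x = x ↔ bl Q e x.val = 0 ∧ bl Q w x.val = 0) ∧
      bl Q x.val (sg Q e w • x).val = 0 := by
  have hv : (sg Q e w • x).val = x.val + (bl Q w x.val • e + bl Q e x.val • w) := by
    rw [Xs.smul_val, sg_apply he hew, hw, bl_comm Q x.val w, bl_comm Q x.val e]
    simp [add_assoc]
  constructor
  · constructor
    · intro h
      have h1 := congrArg Xs.val h
      rw [hv] at h1
      have h2 := add_eq_left.1 h1
      have h3 : bl Q e x.val = 0 := by
        by_contra hne
        refine hwe (mem_span_singleton.2 ⟨(bl Q e x.val)⁻¹ * bl Q w x.val, ?_⟩)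
        have h4 : bl Q w x.val • e = bl Q e x.val • w := by
          have := add_add_cancel_v F (bl Q w x.val • e) (bl Q e x.val • w)
          rwa [h2, add_zero] at this
        rw [mul_smul, h4, smul_smul, inv_mul_cancel₀ hne, one_smul]
      rw [h3, zero_smul, add_zero] at h2
      exact ⟨h3, (smul_eq_zero.1 h2).resolve_right he0⟩
    · rintro ⟨h1, h2⟩
      refine Xs.ext ?_
      rw [hv, h1, h2]
      simp
  · rw [hv]
    simp only [map_add, map_smul, bl_self, smul_eq_mul, bl_comm Q x.val w, bl_comm Q x.val e]
    rw [mul_comm, zero_add]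
    exact CharTwo.add_self_eq_zero _

theorem class_sum (h : IsType Q (k + 2) α) (hk : 2 ≤ k) (hno : NoSing ρ)
    (ht : ∀ g y, ρ g (t y) = t (g • y)) {e w : V} (he : Q e = 0) (hw : Q w = 0)
    (hew : bl Q e w = 0) (he0 : e ≠ 0) (hwe : w ∉ span F {e}) (x : Xs Q (1 : F)) :
    ∃ c : ℂ, ∑ g : Om Q, ρ g (ρ (sg Q e w) (ρ g⁻¹ (t x))) = c • t x ∧
      (Fintype.card (Om Q) - c) * (((Fintype.card F : ℂ) ^ (k + 2) - α) *
        ((Fintype.card F : ℂ) ^ (k + 1) - α)) =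
      Fintype.card (Om Q) * ((Fintype.card F : ℂ) ^ (2 * k + 1) * ((Fintype.card F : ℂ) ^ 2 - 1)) := by
  classical
  have hα := h.sq
  have hq0 : (Fintype.card F : ℂ) ≠ 0 := by exact_mod_cast Fintype.card_ne_zero
  set A := univ.filter fun y : Xs Q (1 : F) => y ≠ x ∧ bl Q x.val y.val = 0 with hA
  set Y : Om Q → Xs Q (1 : F) := fun g => sg Q (g.1 e) (g.1 w) • x with hY
  have hYg : ∀ g, (Y g = x ↔ bl Q (g.1 e) x.val = 0 ∧ bl Q (g.1 w) x.val = 0) ∧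
      bl Q x.val (Y g).val = 0 := fun g =>
    sg_smul_eq_iff (by rw [g.quad, he]) (by rw [g.quad, hw]) (by rw [g.bl, hew]) (Om.ne_zero g he0)
      (Om.notMem_singleton g hwe) x
  have hterm : ∀ g : Om Q, ρ g (ρ (sg Q e w) (ρ g⁻¹ (t x))) = t (Y g) := fun g => by
    rw [rho_sg_conj, rho_inv_self, ht]
  set μ : Xs Q (1 : F) → ℕ := fun y => (univ.filter fun g : Om Q => Y g = y).card with hμ
  have hμA : ∀ y ∈ A, ∀ y' ∈ A, μ y = μ y' := by
    intro y hy y' hy'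
    simp only [hA, mem_filter, mem_univ, true_and] at hy hy'
    obtain ⟨c, hc, hc'⟩ := h.exists_map_two (.inl (by omega)) x.ne x.ne rfl
      (Xs.notMem_one hy.1.symm) (Xs.notMem_one hy'.1.symm) (y.quad.trans y'.quad.symm)
      (hy.2.trans hy'.2.symm)
    have hcx : c • x = x := Xs.ext hc
    have hcy : c • y = y' := Xs.ext hc'
    have hYc : ∀ g, Y (c * g) = c • Y g := fun g => by
      simp only [hY]
      rw [Om.mul_apply, Om.mul_apply, smul_smul, sg_conj, mul_smul, hcx]
    refine card_nbij' (fun g => c * g) (fun g => c⁻¹ * g) ?_ ?_ ?_ ?_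
    · intro g hg
      simp only [coe_filter, mem_univ, true_and, Set.mem_ofPred_eq] at hg ⊢
      rw [hYc, hg, hcy]
    · intro g hg
      simp only [coe_filter, mem_univ, true_and, Set.mem_ofPred_eq] at hg ⊢
      have := hYc (c⁻¹ * g)
      rw [mul_inv_cancel_left, hg, ← hcy] at this
      exact (smul_left_cancel c this).symm
    · intro g _; simp
    · intro g _; simp
  have hμ0 : ∀ y, y ∉ A → y ≠ x → μ y = 0 := by
    intro y hy hyx
    rw [hμ]
    simp only [card_eq_zero, filter_eq_empty_iff, mem_univ, true_imp_iff]
    rintro g rfl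
    exact hy (by simp only [hA, mem_filter, mem_univ, true_and]; exact ⟨hyx, (hYg g).2⟩)
  obtain ⟨m, hm⟩ : ∃ m, ∀ y ∈ A, μ y = m := by
    rcases A.eq_empty_or_nonempty with h0 | ⟨y, hy⟩
    · exact ⟨0, by simp [h0]⟩
    · exact ⟨μ y, fun y' hy' => hμA _ hy' _ hy⟩
  have hxA : x ∉ A := by simp [hA]
  have hsplit : ∀ (N : Type) [AddCommMonoid N] (f : Xs Q (1 : F) → N),
      ∑ g : Om Q, f (Y g) = μ x • f x + m • ∑ y ∈ A, f y := by
    intro N _ f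
    have h1 : ∑ g : Om Q, f (Y g) = ∑ y, μ y • f y := by
      rw [← sum_fiberwise univ Y]
      refine sum_congr rfl fun y _ => ?_
      rw [sum_congr rfl (g := fun _ => f y) fun g hg => by rw [(mem_filter.1 hg).2],
        sum_const]
    rw [h1, ← add_sum_erase _ _ (mem_univ x)]
    congr 1
    rw [smul_sum, ← sum_subset (s₁ := A)]
    · exact sum_congr rfl fun y hy => by rw [hm y hy]
    · intro y hy
      exact mem_erase.2 ⟨fun h => hxA (h ▸ hy), mem_univ _⟩
    · intro y hy hyA
      rw [hμ0 y hyA (ne_of_mem_erase hy), zero_smul]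
  have hcardG : (Fintype.card (Om Q) : ℂ) = μ x + m * ((Fintype.card F : ℂ) ^ (2 * (k + 1)) - 1) := by
    have := hsplit ℕ fun _ => 1
    simp only [sum_const, card_univ, smul_eq_mul, mul_one] at this
    rw [← card_perp_one h x, ← hA, this]
    push_cast
    ring
  have hμx : (Fintype.card (Om Q) - μ x : ℂ) * Fintype.card (Xs Q (1 : F)) = Fintype.card (Om Q) *
      ((Fintype.card F : ℂ) ^ (2 * k + 3) - (Fintype.card F : ℂ) ^ (2 * k + 1)) := by
    have h1 := card_smul_filter (G := Om Q) (Xs.trans h (by omega)) x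
      fun y => ¬(bl Q e y.val = 0 ∧ bl Q w y.val = 0)
    have h2 : (univ.filter fun g : Om Q =>
        ¬(bl Q e (g • x).val = 0 ∧ bl Q w (g • x).val = 0)).card + μ x = Fintype.card (Om Q) := by
      rw [← card_univ, ← card_filter_add_card_filter_not (s := univ)
        fun g : Om Q => (bl Q e (g • x).val = 0 ∧ bl Q w (g • x).val = 0), add_comm]
      congr 1
      refine card_nbij' (fun g => g⁻¹) (fun g => g⁻¹) ?_ ?_ ?_ ?_
      · intro g hg
        simp only [coe_filter, mem_univ, true_and, Set.mem_ofPred_eq] at hg ⊢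
        rw [(hYg g).1] at hg
        rwa [Xs.smul_val, ← g.bl, ← g.bl w, Om.apply_inv_self]
      · intro g hg
        simp only [coe_filter, mem_univ, true_and, Set.mem_ofPred_eq] at hg ⊢
        rw [(hYg _).1]
        rwa [Xs.smul_val, ← g⁻¹.bl, ← g⁻¹.bl w, Om.inv_apply_self] at hg
      · intro g _; simp
      · intro g _; simp
    have h3 := congrArg (Nat.cast : ℕ → ℂ) h1
    have h4 := congrArg (Nat.cast : ℕ → ℂ) h2
    push_cast at h3 h4
    rw [card_not_perp h he hw hew he0 hwe] at h3
    rw [← h3, ← h4]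
    ring
  have hN := congrArg (Int.cast : ℤ → ℂ) (card_Xs_one_eq (k := k + 1) h)
  push_cast at hN
  rw [hN] at hμx
  refine ⟨μ x - m * (α * (Fintype.card F : ℂ) ^ (k + 1) + 1), ?_, ?_⟩
  · simp only [hterm]
    rw [hsplit M t, hA, sum_perp_family h hno ht x, ← Nat.cast_smul_eq_nsmul ℂ,
      ← Nat.cast_smul_eq_nsmul ℂ m, smul_smul, ← add_smul]
    congr 1
    ring
  · have e1 : (Fintype.card (Om Q) : ℂ) - μ x = m * ((Fintype.card F : ℂ) ^ (2 * (k + 1)) - 1) := by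
      rw [hcardG]; ring
    rw [e1] at hμx
    have e2 : (Fintype.card (Om Q) : ℂ) - (μ x - m * (α * (Fintype.card F : ℂ) ^ (k + 1) + 1)) =
      m * ((Fintype.card F : ℂ) ^ (2 * (k + 1)) + α * (Fintype.card F : ℂ) ^ (k + 1)) := by
      linear_combination e1
    rw [e2]
    rcases h.sign' with h' | h' <;> rw [h'] at hμx ⊢ <;> linear_combination hμx

theorem schur_conj {G : Type} [Group G] [Fintype G] [FiniteDimensional ℂ M]
    (σ : Representation ℂ G M) [σ.IsIrreducible] (z : G) :
    ∃ c : ℂ, (∀ m, ∑ g, σ g (σ z (σ g⁻¹ m)) = c • m) ∧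
      c * finrank ℂ M = Fintype.card G * σ.character z := by
  set T : M →ₗ[ℂ] M := ∑ g, σ (g * z * g⁻¹) with hT
  have hTm : ∀ m, T m = ∑ g, σ g (σ z (σ g⁻¹ m)) := fun m => by
    simp [hT, LinearMap.sum_apply]
  obtain ⟨c, hc⟩ := schur σ T fun g m => by
    rw [hT, LinearMap.sum_apply, LinearMap.sum_apply, map_sum]
    refine Fintype.sum_equiv (Equiv.mulLeft g⁻¹) _ _ fun a => ?_
    simp only [Equiv.coe_mulLeft, ← End.mul_apply, ← map_mul]
    congr 2
    group
  refine ⟨c, fun m => by rw [← hTm, hc], ?_⟩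
  have h1 : LinearMap.trace ℂ M T = c * finrank ℂ M := by
    have : T = c • LinearMap.id := by ext m; simp [hc]
    rw [this, map_smul, LinearMap.trace_id, smul_eq_mul]
  rw [← h1, hT, map_sum]
  have h2 : ∀ g ∈ univ, LinearMap.trace ℂ M (σ (g * z * g⁻¹)) = σ.character z :=
    fun g _ => σ.char_conj z g
  rw [sum_congr rfl h2, sum_const]
  simp

theorem sum_wsp_nonsing (hQ : Nondeg Q) [FiniteDimensional ℂ M] {e f w : V} (hef : Hyp Q e f)
    (hw : w ∈ hc Q e f) (hw0 : w ≠ 0) (hQw : Q w = 0) {n c : ℕ} (hn : finrank F V = n + 2)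
    (hs : ∀ x : hc Q e f, Q x.1 = 0 → x ≠ 0 → wsp ρ e x.1 = ⊥)
    (hns : ∀ x : hc Q e f, Q x.1 ≠ 0 → finrank ℂ (wsp ρ e x.1) = c) :
    ((finrank ℂ M : ℂ) - ρ.character (sg Q e w)) * Fintype.card F =
      c * (Fintype.card F : ℂ) ^ n * (Fintype.card F - 1) := by
  classical
  have : Finite V := finite_of_finite F
  have : Fintype V := Fintype.ofFinite V
  have hew : bl Q e w = 0 := by
    simp only [mem_orth, perp_insert, perp_singleton, hc] at hw
    exact hw.1
  have h1 := sum_nonsing_psi (Q := res Q (hc Q e f)) (hef.nondeg hQ) (w := ⟨w, hw⟩) (by simpa using hQw)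
    (fun h => hw0 (congrArg Subtype.val h))
  have h2 := hef.finrank hQ
  have h3 : Fintype.card (hc Q e f) = Fintype.card F ^ n := by
    rw [card_eq_pow_finrank (K := F)]
    congr 1
    omega
  rw [h3] at h1
  rw [finrank_sub_trace hQ hef hew]
  push_cast at h1
  rw [mul_assoc, ← h1, ← mul_assoc, mul_sum]
  congr 1
  refine sum_congr (by congr) fun x _ => ?_
  have hb : bl (res Q (hc Q e f)) ⟨w, hw⟩ x = bl Q w x.1 := bl_res ..
  rw [hb]
  by_cases hx : Q x.1 = 0
  · rw [if_pos (show res Q (hc Q e f) x = 0 from hx)]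
    by_cases hx0 : x = 0
    · subst hx0; simp
    · rw [hs x hx hx0]; simp
  · rw [if_neg (show ¬res Q (hc Q e f) x = 0 from hx), hns x hx, mul_comm]

theorem family_degree [FiniteDimensional ℂ M] [hρ : ρ.IsIrreducible] (h : IsType Q (k + 2) α)
    (hk : 2 ≤ k) (hno : NoSing ρ) {x : Xs Q (1 : F)} {t : M} (ht0 : t ≠ 0)
    (ht : ∀ g : Om Q, g • x = x → ρ g t = t) :
    ∃ c : ℕ, c ≠ 0 ∧ (finrank ℂ M : ℂ) * (Fintype.card F + 1) =
      c * (((Fintype.card F : ℂ) ^ (k + 2) - α) * ((Fintype.card F : ℂ) ^ (k + 1) - α)) := by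
  classical
  have hQ := h.nondeg
  obtain ⟨τ, rfl, hτ⟩ := exists_family x (Xs.trans h (by omega) x) ht
  obtain ⟨ip, hip, hnn, hpos⟩ := exists_ip ρ
  obtain ⟨e, -, he', he⟩ := h.exists_sing (U := ∅) finrank_span_empty_le (by omega)
  have he0 : e ≠ 0 := by rintro rfl; simp at he'
  obtain ⟨f, hef, -⟩ := exists_hyp hQ he he' (by simp)
  obtain ⟨w, hwp, hws, hw⟩ := h.exists_sing (U := {e, f}) (u := 2)
    (finrank_span_insert_le finrank_span_singleton_le) (by omega)
  have hwe : w ∉ span F {e} := fun h0 =>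
    hws (Submodule.span_mono (by simp) h0)
  have hw0 : w ≠ 0 := by rintro rfl; simp at hws
  have hew : bl Q e w = 0 := by
    simp only [perp_insert, perp_singleton] at hwp
    exact hwp.1
  obtain ⟨y, hyp, -, hy⟩ := h.exists_nonsing (U := {e, f}) (u := 2) (s := 1)
    (finrank_span_insert_le finrank_span_singleton_le) (by omega) one_ne_zero
  set c := finrank ℂ (wsp ρ e y) with hc'
  have hey : bl Q e y = 0 := by
    simp only [perp_insert, perp_singleton] at hyp
    exact hyp.1
  have hhc : ∀ x : hc Q e f, bl Q e x.1 = 0 := fun x => by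
    have := x.2
    simp only [mem_orth, perp_insert, perp_singleton, hc] at this
    exact this.1
  have h1 := sum_wsp_nonsing (ρ := ρ) (n := 2 * k + 2) (c := c) hQ hef
    (by rw [hc]; exact mem_orth.2 hwp) hw0 hw
    (by rw [h.rank]; ring) (fun z hz hz0 => by
      refine wsp_sing_eq_bot hQ hno hip hpos hτ ht0 he (hhc z) hz ?_
      intro hmem
      obtain ⟨r, hr⟩ := mem_span_singleton.1 hmem
      have h2 : bl Q f z.1 = 0 := by
        have := z.2
        simp only [mem_orth, perp_insert, perp_singleton, hc] at this
        exact this.2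
      rw [← hr, map_smul, hef.fe, smul_eq_mul, mul_one] at h2
      exact hz0 (Subtype.ext (by rw [← hr, h2, zero_smul]; rfl)))
    fun z hz => h.finrank_wsp_nonsing (.inl (by omega)) ρ he he he0 he0 (hhc z) hey hz (by rw [hy]; exact one_ne_zero)
  obtain ⟨c', hc1, hc2⟩ := schur_conj ρ (sg Q e w)
  obtain ⟨c'', hc3, hc4⟩ := class_sum h hk hno hτ he hw hew he0 hwe x
  rw [hc1] at hc3
  obtain rfl : c' = c'' := by
    by_contra hne
    have : (c' - c'') • τ x = 0 := by rw [sub_smul, hc3, sub_self]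
    rcases smul_eq_zero.1 this with h0 | h0
    · exact hne (sub_eq_zero.1 h0)
    · exact ht0 h0
  have hq0 : (Fintype.card F : ℂ) ≠ 0 := by exact_mod_cast Fintype.card_ne_zero
  have hG0 : (Fintype.card (Om Q) : ℂ) ≠ 0 := by exact_mod_cast Fintype.card_ne_zero
  have hq1 : (Fintype.card F : ℂ) - 1 ≠ 0 := q_sub_ne F
  have key : (finrank ℂ M : ℂ) * (Fintype.card F + 1) =
      c * (((Fintype.card F : ℂ) ^ (k + 2) - α) * ((Fintype.card F : ℂ) ^ (k + 1) - α)) := by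
    have h2 : (Fintype.card (Om Q) : ℂ) * ((Fintype.card F : ℂ) ^ (2 * k + 2) * ((Fintype.card F : ℂ) - 1)) *
        ((finrank ℂ M : ℂ) * (Fintype.card F + 1) -
      c * (((Fintype.card F : ℂ) ^ (k + 2) - α) * ((Fintype.card F : ℂ) ^ (k + 1) - α))) = 0 := by
      linear_combination (-(Fintype.card (Om Q) : ℂ) * (((Fintype.card F : ℂ) ^ (k + 2) - α) * ((Fintype.card F : ℂ) ^ (k + 1) - α))) * (-h1) * (-1) * (-1) - (finrank ℂ M : ℂ) * Fintype.card F * hc4 - (((Fintype.card F : ℂ) ^ (k + 2) - α) * ((Fintype.card F : ℂ) ^ (k + 1) - α)) * Fintype.card F * hc2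
    have := (mul_eq_zero.1 h2).resolve_left (by positivity)
    exact sub_eq_zero.1 this
  refine ⟨c, ?_, key⟩
  intro h0
  rw [h0, Nat.cast_zero, zero_mul] at key
  have : Nontrivial M := ⟨⟨τ x, 0, ht0⟩⟩
  have h3 : (finrank ℂ M : ℂ) ≠ 0 := by exact_mod_cast (finrank_pos (R := ℂ) (M := M)).ne'
  refine (mul_ne_zero h3 ?_) key
  exact_mod_cast Nat.succ_ne_zero (Fintype.card F)

open scoped Classical in
theorem nonsing_constituents (h : IsType Q (k + 2) α) (hk : 2 ≤ k) (x : Xs Q (1 : F)) :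
    ∃ S : Finset (Om Q → ℂ), (∀ ψ ∈ S, IrrChar ψ) ∧
      pchar (Om Q) (Xs Q (1 : F)) = ∑ ψ ∈ S, ψ ∧ S.card = Fintype.card F + 1 ∧
      ∀ ψ, IrrChar ψ → cip ψ (pchar (Om Q) (Xs Q (1 : F))) = if ψ ∈ S then 1 else 0 := by
  obtain ⟨S, m, hS, hm, hsum, hcip, hcip0, hnorm⟩ :=
    (pchar_isChar (G := Om Q) (X := Xs Q (1 : F))).exists_finset
  have hle : ∀ ψ ∈ S, m ψ = 1 := by
    intro ψ hψ
    have h1 := hcip ψ hψ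
    obtain ⟨M, _, _, _, ρ, hρ, rfl⟩ := hS ψ hψ
    rw [cip_comm] at h1
    refine le_antisymm (cip_pchar_le_one ρ x (Xs.trans h (by omega) x) ?_ h1)
      (Nat.one_le_iff_ne_zero.2 (hm _ hψ))
    intro t t' ht0 ht ht'
    refine fixed_unique ρ x (fun g => ?_) ht0 ht ht'
    by_cases hg : g • x = x
    · exact ⟨1, by simp [hg], by simp [hg]⟩
    · obtain ⟨c, hc, hc'⟩ := h.exists_map_two (.inl (by omega)) x.ne (g • x).ne
        (x.quad.trans (g • x).quad.symm) (Xs.notMem_one (Ne.symm hg)) (Xs.notMem_one hg)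
        ((g • x).quad.trans x.quad.symm) (bl_comm Q _ _)
      exact ⟨c, Xs.ext hc, Xs.ext hc'⟩
  refine ⟨S, hS, ?_, ?_, fun ψ hψ => ?_⟩
  · rw [hsum]
    exact sum_congr rfl fun ψ hψ => by rw [hle ψ hψ, one_smul]
  · rw [cip_one_one h (by omega), sum_congr rfl (g := fun _ => (1 : ℂ)) fun ψ hψ => by
      rw [hle ψ hψ]; simp] at hnorm
    simp only [sum_const, nsmul_eq_mul, mul_one] at hnorm
    exact_mod_cast hnorm.symm
  · rw [cip_comm]
    split_ifs with hψS
    · rw [hcip ψ hψS, hle ψ hψS, Nat.cast_one]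
    · exact hcip0 ψ hψ hψS

theorem even_card_of_char (F : Type) [Field F] [CharP F 2] [Fintype F] : Even (Fintype.card F) :=
  Nat.even_iff.2 (FiniteField.even_card_iff_char_two.1 (ringChar.eq F 2))

theorem even_card_filter_mulChar (p : MulChar F ℂ → Prop) [DecidablePred p]
    (hp : ∀ χ, p χ → p χ⁻¹) : Even (univ.filter fun χ : MulChar F ℂ => χ ≠ 1 ∧ p χ).card := by
  have h0 : ∑ χ with χ ≠ 1 ∧ p χ, (1 : ZMod 2) = 0 := by
    refine sum_involution (fun χ _ => χ⁻¹) (fun _ _ => by decide) ?_ ?_ ?_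
    · intro χ hχ _ h
      exact (mem_filter.1 hχ).2.1 ((mulChar_inv_eq_iff χ).1 h)
    · intro χ hχ
      simp only [mem_filter, mem_univ, true_and] at hχ ⊢
      exact ⟨by simpa using hχ.1, hp χ hχ.2⟩
    · intro χ _
      exact inv_inv χ
  rw [sum_const, nsmul_one] at h0
  exact (ZMod.natCast_eq_zero_iff_even).1 h0

theorem parity_choice {T : Type} {S : Finset T} [DecidableEq T] {φ : Ix F → T}
    (hiot : ∀ i, φ (iot i) = φ i) (h1 : φ (.inl 1) ∈ S)
    (hcard : (univ.filter fun i => φ i ∈ S).card = Fintype.card F) :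
    ∃ b : Bool, φ (.inr b) ∈ S ∧ φ (.inr !b) ∉ S ∧ ∀ χ, φ (.inl χ) ∈ S := by
  have heven := even_card_filter_mulChar (F := F) (fun χ => φ (.inl χ) ∈ S) fun χ hχ => by
    have := hiot (.inl χ)
    rw [iot, Sum.map_inl] at this
    rwa [this]
  obtain ⟨r, hr⟩ := even_card_of_char F
  have hsub : (univ.filter fun χ : MulChar F ℂ => χ ≠ 1 ∧ φ (.inl χ) ∈ S) ⊆
      univ.erase 1 := by
    intro χ hχ
    simp only [mem_filter, mem_univ, true_and] at hχ
    exact mem_erase.2 ⟨hχ.1, mem_univ _⟩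
  have hc : (univ.erase (1 : MulChar F ℂ)).card = Fintype.card F - 2 := by
    rw [card_erase_of_mem (mem_univ _), card_univ, card_mulChar]
    rfl
  have hle := card_le_card hsub
  have hs : (univ.filter fun i => φ i ∈ S).card =
      1 + (univ.filter fun χ : MulChar F ℂ => χ ≠ 1 ∧ φ (.inl χ) ∈ S).card +
        ((if φ (.inr true) ∈ S then 1 else 0) + (if φ (.inr false) ∈ S then 1 else 0)) := by
    rw [card_filter, Fintype.sum_sum_type, Fintype.sum_bool]
    congr 1
    rw [← card_filter, ← card_filter_add_card_filter_not (s := univ.filter _)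
      fun χ => χ = 1, filter_filter, filter_filter]
    congr 1
    · rw [card_eq_one]
      refine ⟨1, ?_⟩
      ext χ
      simp only [mem_filter, mem_univ, true_and, mem_singleton]
      constructor
      · exact fun h => h.2
      · rintro rfl; exact ⟨h1, rfl⟩
    · congr 1
      ext χ
      simp only [mem_filter, mem_univ, true_and]
      tauto
  rw [hcard] at hs
  have hq2 : 2 ≤ Fintype.card F := Fintype.one_lt_card
  obtain ⟨r', hr'⟩ := heven
  have hall : (univ.filter fun χ : MulChar F ℂ => χ ≠ 1 ∧ φ (.inl χ) ∈ S).card =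
      Fintype.card F - 2 → ∀ χ, φ (.inl χ) ∈ S := by
    intro h2 χ
    by_cases hχ : χ = 1
    · rw [hχ]; exact h1
    · have h3 := eq_of_subset_of_card_le hsub (by rw [h2, hc])
      have h4 : χ ∈ univ.erase (1 : MulChar F ℂ) := mem_erase.2 ⟨hχ, mem_univ _⟩
      rw [← h3] at h4
      exact (mem_filter.1 h4).2.2
  by_cases ht : φ (.inr true) ∈ S <;> by_cases hf : φ (.inr false) ∈ S <;>
    simp only [ht, hf, if_true, if_false] at hs
  · omega
  · exact ⟨true, ht, hf, hall (by omega)⟩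
  · exact ⟨false, hf, ht, hall (by omega)⟩
  · omega

theorem two_mul_card_image {T : Type} [DecidableEq T] {φ : Ix F → T}
    (hiot : ∀ i, φ (iot i) = φ i) (hinj : ∀ i j, φ i = φ j → j = i ∨ j = iot i) :
    2 * ((univ.erase (1 : MulChar F ℂ)).image fun χ => φ (.inl χ)).card + 2 =
      Fintype.card F := by
  have hq2 : 2 ≤ Fintype.card F := Fintype.one_lt_card
  have hc : (univ.erase (1 : MulChar F ℂ)).card = Fintype.card F - 2 := by
    rw [card_erase_of_mem (mem_univ _), card_univ, card_mulChar]
    rfl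
  rw [card_eq_sum_card_image fun χ => φ (.inl χ), sum_congr rfl (g := fun _ => 2),
    sum_const, smul_eq_mul] at hc
  · omega
  · intro ψ hψ
    obtain ⟨χ, hχ, rfl⟩ := mem_image.1 hψ
    have hχ1 := (mem_erase.1 hχ).1
    rw [card_eq_two]
    refine ⟨χ, χ⁻¹, fun h => hχ1 ((mulChar_inv_eq_iff χ).1 h.symm), ?_⟩
    ext χ'
    simp only [mem_filter, mem_erase, mem_univ, and_true, mem_insert,
      mem_singleton]
    constructor
    · rintro ⟨_, h⟩
      have := hinj _ _ h.symm
      simpa [iot] using this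
    · rintro (rfl | rfl)
      · exact ⟨hχ1, rfl⟩
      · refine ⟨by simpa using hχ1, ?_⟩
        have := hiot (.inl χ)
        rwa [iot, Sum.map_inl] at this

theorem apply_eq_trace_smul {M : Type} [AddCommGroup M] [Module ℂ M] (hd : finrank ℂ M = 1)
    (f : M →ₗ[ℂ] M) (m : M) : f m = LinearMap.trace ℂ M f • m := by
  obtain ⟨v, hv, hvs⟩ := finrank_eq_one_iff'.1 hd
  have : FiniteDimensional ℂ M := FiniteDimensional.of_finrank_pos (by omega)
  obtain ⟨c, hc⟩ := hvs (f v)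
  have hf : f = c • LinearMap.id := by
    ext w
    obtain ⟨d, rfl⟩ := hvs w
    rw [map_smul, ← hc, smul_comm]
    rfl
  rw [hf, map_smul, LinearMap.trace_id, hd]
  simp

theorem noSing_of_cip (h : IsType Q k α) (hk : 2 < k) {M : Type} [AddCommGroup M] [Module ℂ M]
    [FiniteDimensional ℂ M] (ρ : Representation ℂ (Om Q) M)
    (h0 : cip ρ.character (pchar (Om Q) (Xs Q (0 : F))) = 0) : NoSing ρ := by
  intro e he he0 m hm
  by_contra hm0
  exact cip_pchar_ne_zero ρ (⟨e, he, he0⟩ : Xs Q (0 : F)) (Xs.trans h hk _) hm0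
    (fun g hg => hm g (congrArg Xs.val hg)) h0

theorem irr_degree (h : IsType Q (k + 2) α) (hk : 2 ≤ k) {ψ : Om Q → ℂ} (hψ : IrrChar ψ)
    (h0 : cip ψ (pchar (Om Q) (Xs Q (0 : F))) = 0)
    (h1 : cip ψ (pchar (Om Q) (Xs Q (1 : F))) ≠ 0) :
    ∃ c : ℕ, c ≠ 0 ∧ ψ 1 * (Fintype.card F + 1) =
      c * (((Fintype.card F : ℂ) ^ (k + 2) - α) * ((Fintype.card F : ℂ) ^ (k + 1) - α)) := by
  obtain ⟨M, _, _, _, ρ, hρ, rfl⟩ := hψ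
  obtain ⟨y, -, -, hy⟩ := h.exists_nonsing (U := ∅) (u := 0) (s := 1)
    finrank_span_empty_le (by omega) one_ne_zero
  obtain ⟨t, ht0, ht⟩ := fixed_of_cip_ne_zero ρ
    (⟨y, hy, by rintro rfl; simp at hy⟩ : Xs Q (1 : F)) (Xs.trans h (by omega) _) h1
  obtain ⟨c, hc, hc'⟩ := family_degree h hk (noSing_of_cip h (by omega) ρ h0) ht0 ht
  exact ⟨c, hc, by rw [← hc', Representation.char_one]⟩

theorem multiplicity_one {q α : ℤ} (hq : 2 ≤ q) (hα : α = 1 ∨ α = -1) {k : ℕ} (hk : 2 ≤ k) {C : ℤ}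
    (hC : (2 * C - q - 2) * ((q ^ (k + 2) - α) * (q ^ (k + 1) - α)) = -(2 * (q + 1))) : False := by
  have h1 : q ^ 3 ≤ q ^ (k + 1) := pow_le_pow_right₀ (by linarith) (by omega)
  have h2 : q ^ 3 ≤ q ^ (k + 2) := pow_le_pow_right₀ (by linarith) (by omega)
  have h3 : 4 * q ≤ q ^ 3 := by nlinarith [mul_nonneg (by linarith : 0 ≤ q - 2) (by linarith : (0:ℤ) ≤ q)]
  have h4 : q + 1 ≤ q ^ (k + 2) - α := by rcases hα with rfl | rfl <;> linarith
  have h5 : 3 ≤ q ^ (k + 1) - α := by rcases hα with rfl | rfl <;> linarith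
  have h6 : 2 * (q + 1) < (q ^ (k + 2) - α) * (q ^ (k + 1) - α) := by nlinarith
  rcases lt_trichotomy (2 * C - q - 2) 0 with h | h | h
  · nlinarith
  · rw [h] at hC; linarith
  · nlinarith

set_option maxHeartbeats 1000000 in
theorem list_chars (h : IsType Q (k + 2) α) (hk : 2 ≤ k) :
    ∃ (sA sB : Finset (Om Q → ℂ)) (E₁ E₂ : Om Q → ℂ),
      (∀ ψ ∈ sA, IrrChar ψ ∧ ψ 1 = ((Fintype.card F : ℂ) ^ (k + 2) - α) *
        ((Fintype.card F : ℂ) ^ (k + 1) + α) / ((Fintype.card F : ℂ) - 1)) ∧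
      (∀ ψ ∈ sB, IrrChar ψ ∧ ψ 1 = ((Fintype.card F : ℂ) ^ (k + 2) - α) *
        ((Fintype.card F : ℂ) ^ (k + 1) - α) / ((Fintype.card F : ℂ) + 1)) ∧
      (IrrChar E₁ ∧ E₁ 1 = ((Fintype.card F : ℂ) ^ (2 * (k + 2)) - (Fintype.card F : ℂ) ^ 2) /
        ((Fintype.card F : ℂ) ^ 2 - 1)) ∧
      (IrrChar E₂ ∧ E₂ 1 = ((Fintype.card F : ℂ) ^ (k + 2) - α) *
        ((Fintype.card F : ℂ) ^ (k + 1) + α * Fintype.card F) / ((Fintype.card F : ℂ) ^ 2 - 1)) ∧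
      2 * sA.card + 2 = Fintype.card F ∧ 2 * sB.card = Fintype.card F ∧
      ∀ ψ, IrrChar ψ → (cip ψ (pchar (Om Q) (Xs Q (0 : F))) ≠ 0 ∨
          cip ψ (pchar (Om Q) (Xs Q (1 : F))) ≠ 0) →
        ψ = (fun _ => 1) ∨ ψ ∈ sA ∨ ψ ∈ sB ∨ ψ = E₁ ∨ ψ = E₂ := by
  classical
  obtain ⟨φ, hφ, hiot, hinj, hφ1, hφA, hφt, hφf, hφs⟩ := sing_decomp h hk
  obtain ⟨y, -, -, hy⟩ := h.exists_nonsing (U := ∅) (u := 0) (s := 1)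
    finrank_span_empty_le (by omega) one_ne_zero
  set x : Xs Q (1 : F) := ⟨y, hy, by rintro rfl; simp at hy⟩
  obtain ⟨S, hS, hSs, hSc, hScip⟩ := nonsing_constituents h hk x
  have h1S : φ (.inl 1) ∈ S := by
    by_contra h0
    have := hScip _ (hφ (.inl 1))
    rw [if_neg h0] at this
    obtain ⟨M, _, _, _, ρ, hρ, hc⟩ := hφ (.inl 1)
    have hd : finrank ℂ M = 1 := by
      have h2 := congrFun hc 1
      rw [hφ1, Representation.char_one] at h2
      exact Nat.cast_injective (R := ℂ) (by rw [Nat.cast_one]; exact h2.symm)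
    have hfix : ∀ (g : Om Q) m, ρ g m = m := by
      intro g m
      have h3 := congrFun hc g
      rw [hφ1] at h3
      rw [apply_eq_trace_smul hd]
      change ρ.character g • m = m
      rw [← h3, one_smul]
    have : Nontrivial M := Module.nontrivial_of_finrank_pos (R := ℂ) (by omega)
    obtain ⟨t, ht⟩ := exists_ne (0 : M)
    exact cip_pchar_ne_zero ρ x (Xs.trans h (by omega) x) ht (fun g _ => hfix g t)
      (by rw [← hc]; assumption)
  have hcard : (univ.filter fun i => φ i ∈ S).card = Fintype.card F := by
    have h2 := cip_zero_one h (by omega)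
    rw [← hφs, map_sum, LinearMap.sum_apply, sum_congr rfl fun i _ => hScip _ (hφ i),
      ← sum_filter, sum_const, nsmul_one] at h2
    exact_mod_cast h2
  obtain ⟨b, hb, hb', hall⟩ := parity_choice hiot h1S hcard
  have hsA := two_mul_card_image hiot hinj
  set sA := (univ.erase (1 : MulChar F ℂ)).image fun χ => φ (.inl χ) with hsAdef
  set T := insert (φ (.inr b)) (insert (φ (.inl 1)) sA) with hT
  have hTS : T ⊆ S := by
    intro ψ hψ
    simp only [hT, mem_insert] at hψ
    rcases hψ with rfl | rfl | hψ
    · exact hb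
    · exact h1S
    · obtain ⟨χ, -, rfl⟩ := mem_image.1 hψ
      exact hall χ
  have hn1 : φ (.inl 1) ∉ sA := by
    intro h0
    obtain ⟨χ, hχ, h2⟩ := mem_image.1 h0
    have := hinj _ _ h2.symm
    simp only [iot, Sum.map_inl, Sum.inl.injEq, inv_one, or_self] at this
    exact (mem_erase.1 hχ).1 this
  have hnb : φ (.inr b) ∉ insert (φ (.inl 1)) sA := by
    intro h0
    rcases mem_insert.1 h0 with h0 | h0
    · have := hinj _ _ h0
      simp [iot] at this
    · obtain ⟨χ, hχ, h2⟩ := mem_image.1 h0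
      have := hinj _ _ h2.symm
      simp [iot] at this
  have hTc : T.card = sA.card + 2 := by
    rw [hT, card_insert_of_notMem hnb, card_insert_of_notMem hn1]
  set sB := S \ T with hsB
  have hsBc : sB.card + (sA.card + 2) = Fintype.card F + 1 := by
    rw [hsB, ← hTc, ← hSc, card_sdiff_add_card_eq_card hTS]
  have hsBp : ∀ ψ ∈ sB, ∀ i, φ i ≠ ψ := by
    rintro ψ hψ i rfl
    rw [hsB, mem_sdiff] at hψ
    rcases i with χ | b'
    · refine hψ.2 ?_
      by_cases hχ : χ = 1
      · rw [hχ]; simp [hT]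
      · refine mem_insert_of_mem (mem_insert_of_mem ?_)
        exact mem_image_of_mem _ (mem_erase.2 ⟨hχ, mem_univ _⟩)
    · by_cases hbb : b' = b
      · exact hψ.2 (by rw [hbb]; simp [hT])
      · have : b' = !b := by cases b <;> cases b' <;> simp_all
        exact hb' (this ▸ hψ.1)
  have hdeg : ∀ ψ : Om Q → ℂ, ∃ c : ℕ, ψ ∈ sB → c ≠ 0 ∧ ψ 1 * (Fintype.card F + 1) =
      c * (((Fintype.card F : ℂ) ^ (k + 2) - α) * ((Fintype.card F : ℂ) ^ (k + 1) - α)) := by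
    intro ψ
    by_cases hψ : ψ ∈ sB
    · have hψS := (mem_sdiff.1 hψ).1
      obtain ⟨c, hc⟩ := irr_degree h hk (hS ψ hψS)
        (by
          rw [← hφs, map_sum]
          exact sum_eq_zero fun i _ => (hS ψ hψS).cip_ne (hφ i) (hsBp ψ hψ i).symm)
        (by rw [hScip ψ (hS ψ hψS), if_pos hψS]; exact one_ne_zero)
      exact ⟨c, fun _ => hc⟩
    · exact ⟨0, fun h => absurd h hψ⟩
  choose c hc using hdeg
  set q : ℂ := (Fintype.card F : ℂ) with hq
  have hα := h.sq
  have hα' := h.sign'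
  have hq0 : q ≠ 0 := by rw [hq]; exact_mod_cast Fintype.card_ne_zero
  have hq1 : q - 1 ≠ 0 := q_sub_ne F
  have hqp : q + 1 ≠ 0 := by rw [hq]; exact_mod_cast Nat.succ_ne_zero (Fintype.card F)
  have hq2 : q ^ 2 - 1 ≠ 0 := by
    rw [show q ^ 2 - 1 = (q - 1) * (q + 1) by ring]; exact mul_ne_zero hq1 hqp
  have hAdeg : ∀ ψ ∈ sA, ψ 1 = (q ^ (k + 2) - α) * (q ^ (k + 1) + α) / (q - 1) := by
    intro ψ hψ
    obtain ⟨χ, hχ, rfl⟩ := mem_image.1 hψ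
    exact hφA χ (mem_erase.1 hχ).1
  have htot : (Fintype.card (Xs Q (1 : F)) : ℂ) = q ^ (k + 1) * (q ^ (k + 2) - α) := by
    have := congrArg (Int.cast : ℤ → ℂ) (card_Xs_one_eq (k := k + 1) h)
    push_cast at this
    exact this
  have hsumB : (∑ ψ ∈ sB, ψ 1) * (q + 1) =
      (∑ ψ ∈ sB, c ψ : ℕ) * ((q ^ (k + 2) - α) * (q ^ (k + 1) - α)) := by
    push_cast
    rw [sum_mul, sum_mul]
    exact sum_congr rfl fun ψ hψ => (hc ψ hψ).2
  have hsum : q ^ (k + 1) * (q ^ (k + 2) - α) = ∑ ψ ∈ sB, ψ 1 + (φ (.inr b) 1 + (1 +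
      sA.card * ((q ^ (k + 2) - α) * (q ^ (k + 1) + α) / (q - 1)))) := by
    have h2 := congrFun hSs 1
    rw [pchar_one, htot, Finset.sum_apply, ← sum_sdiff hTS, ← hsB, hT,
      sum_insert hnb, sum_insert hn1, sum_congr rfl hAdeg, hφ1,
      sum_const, nsmul_eq_mul] at h2
    exact h2
  set C : ℕ := ∑ ψ ∈ sB, c ψ with hC
  have hsAc : 2 * (sA.card : ℂ) = q - 2 := by
    rw [hq, ← hsA]; push_cast; ring
  have hmain : (2 * (C : ℂ) - q) * ((q ^ (k + 2) - α) * (q ^ (k + 1) - α)) =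
      2 * (q + 1) * (φ (.inr false) 1 - φ (.inr b) 1) := by
    rw [hφf]
    rw [show (sA.card : ℂ) = (q - 2) / 2 by linear_combination hsAc / 2] at hsum
    have h2 : ∑ ψ ∈ sB, ψ 1 = C * ((q ^ (k + 2) - α) * (q ^ (k + 1) - α)) / (q + 1) :=
      eq_div_of_mul_eq hqp hsumB
    rw [h2] at hsum
    have h3 : φ (.inr b) 1 = q ^ (k + 1) * (q ^ (k + 2) - α) -
      C * ((q ^ (k + 2) - α) * (q ^ (k + 1) - α)) / (q + 1) - 1 -
      (q - 2) / 2 * ((q ^ (k + 2) - α) * (q ^ (k + 1) + α) / (q - 1)) := by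
      linear_combination -hsum
    rw [h3]
    have h4 : q ^ 2 - 1 = (q - 1) * (q + 1) := by ring
    rw [h4]
    rcases hα' with h' | h' <;> rw [h'] <;> field_simp <;> ring
  have hbf : b = false := by
    by_contra hbt
    obtain rfl : b = true := by simpa using hbt
    rw [hφf, hφt] at hmain
    have h2 : (2 * (C : ℂ) - q - 2) * ((q ^ (k + 2) - α) * (q ^ (k + 1) - α)) = -(2 * (q + 1)) := by
      rw [sub_mul, hmain]
      have h4 : q ^ 2 - 1 = (q - 1) * (q + 1) := by ring
      rw [h4]
      rcases hα' with h' | h' <;> rw [h'] <;> field_simp <;> ring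
    rw [hq] at h2
    refine multiplicity_one (q := Fintype.card F) (α := α) (C := C)
      (by exact_mod_cast Fintype.one_lt_card) h.sign hk ?_
    exact_mod_cast h2
  subst hbf
  rw [sub_self, mul_zero] at hmain
  have hN0 : (q ^ (k + 2) - α) * (q ^ (k + 1) - α) ≠ 0 :=
    mul_ne_zero (sub_ne_zero.2 (q_pow_ne F (by omega) hα)) (sub_ne_zero.2 (q_pow_ne F (by omega) hα))
  have hCq : 2 * C = Fintype.card F := by
    have := sub_eq_zero.1 ((mul_eq_zero.1 hmain).resolve_right hN0)
    rw [hq] at this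
    exact_mod_cast this
  have hcB : ∀ ψ ∈ sB, c ψ = 1 := by
    have h2 : ∑ ψ ∈ sB, 1 = ∑ ψ ∈ sB, c ψ := by
      rw [sum_const, smul_eq_mul, mul_one, ← hC]
      omega
    intro ψ hψ
    exact ((sum_eq_sum_iff_of_le fun ψ hψ => Nat.one_le_iff_ne_zero.2 (hc ψ hψ).1).1 h2 ψ hψ).symm
  refine ⟨sA, sB, φ (.inr false), φ (.inr true), ?_, ?_, ⟨hφ _, hφf⟩, ⟨hφ _, hφt⟩, hsA, by omega, ?_⟩
  · intro ψ hψ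
    refine ⟨?_, hAdeg ψ hψ⟩
    obtain ⟨χ, hχ, rfl⟩ := mem_image.1 hψ
    exact hφ _
  · intro ψ hψ
    refine ⟨hS ψ (mem_sdiff.1 hψ).1, ?_⟩
    refine eq_div_of_mul_eq hqp ?_
    rw [(hc ψ hψ).2, hcB ψ hψ, Nat.cast_one, one_mul]
  · intro ψ hψ hor
    by_cases hi : ∃ i, φ i = ψ
    · obtain ⟨χ | b', rfl⟩ := hi
      · by_cases hχ : χ = 1
        · left; rw [hχ, hφ1]
        · right; left
          exact mem_image_of_mem _ (mem_erase.2 ⟨hχ, mem_univ _⟩)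
      · cases b' <;> tauto
    · push Not at hi
      have h0 : cip ψ (pchar (Om Q) (Xs Q (0 : F))) = 0 := by
        rw [← hφs, map_sum]
        exact sum_eq_zero fun i _ => hψ.cip_ne (hφ i) (hi i).symm
      have h2 := hor.resolve_left (not_not.2 h0)
      rw [hScip ψ hψ] at h2
      have hψS : ψ ∈ S := by by_contra h3; simp [h3] at h2
      right; right; left
      refine mem_sdiff.2 ⟨hψS, fun hψT => ?_⟩
      simp only [hT, mem_insert] at hψT
      rcases hψT with h3 | h3 | h3
      · exact hi _ h3.symm
      · exact hi _ h3.symm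
      · obtain ⟨χ, -, h4⟩ := mem_image.1 h3
        exact hi _ h4

theorem cip_ne_zero_of_fixed (h : IsType Q k α) (hk : 2 < k) {M : Type} [AddCommGroup M] [Module ℂ M]
    [FiniteDimensional ℂ M] (ρ : Representation ℂ (Om Q) M) {x : V} (hx : x ≠ 0) {t : M}
    (ht0 : t ≠ 0) (ht : ∀ g : Om Q, g.1 x = x → ρ g t = t) :
    cip ρ.character (pchar (Om Q) (Xs Q (0 : F))) ≠ 0 ∨
      cip ρ.character (pchar (Om Q) (Xs Q (1 : F))) ≠ 0 := by
  by_cases hQx : Q x = 0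
  · left
    exact cip_pchar_ne_zero ρ (⟨x, hQx, hx⟩ : Xs Q (0 : F)) (Xs.trans h hk _) ht0
      fun g hg => ht g (congrArg Xs.val hg)
  · right
    obtain ⟨c, hc⟩ := exists_sqrt F (Q x)⁻¹
    have hc0 : c ≠ 0 := by rintro rfl; exact hQx (by simpa [eq_comm] using hc)
    refine cip_pchar_ne_zero ρ (⟨c • x, by rw [Q_smul, hc, inv_mul_cancel₀ hQx],
      smul_ne_zero hc0 hx⟩ : Xs Q (1 : F)) (Xs.trans h hk _) ht0 fun g hg => ht g ?_
    have h1 : g.1 (c • x) = c • x := congrArg Xs.val hg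
    rw [map_smul] at h1
    exact smul_right_injective V hc0 h1

end Degree

section Ext

variable {F V : Type} [Field F] [AddCommGroup V] [Module F V] [CharP F 2]
variable {Q : QuadraticForm F V} {e f : V}

/-- The extension of a linear map of `hc Q e f` acting trivially on `e` and `f`. -/
noncomputable def Hyp.extL (h : Hyp Q e f) (g : hc Q e f ≃ₗ[F] hc Q e f) : V →ₗ[F] V :=
  (hc Q e f).subtype ∘ₗ g.toLinearMap ∘ₗ h.pr + (bl Q f).smulRight e + (bl Q e).smulRight f

theorem Hyp.extL_apply (h : Hyp Q e f) (g : hc Q e f ≃ₗ[F] hc Q e f) (v : V) :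
    h.extL g v = g (h.pr v) + bl Q f v • e + bl Q e v • f := rfl

theorem Hyp.extL_bf (h : Hyp Q e f) (g : hc Q e f ≃ₗ[F] hc Q e f) (v : V) :
    bl Q f (h.extL g v) = bl Q f v := by
  simp [h.extL_apply, h.bf, h.fe]

theorem Hyp.extL_be (h : Hyp Q e f) (g : hc Q e f ≃ₗ[F] hc Q e f) (v : V) :
    bl Q e (h.extL g v) = bl Q e v := by
  simp [h.extL_apply, h.be, h.ef]

theorem Hyp.extL_pr (h : Hyp Q e f) (g : hc Q e f ≃ₗ[F] hc Q e f) (v : V) :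
    h.pr (h.extL g v) = g (h.pr v) := by
  apply Subtype.ext
  rw [h.pr_coe, h.extL_bf, h.extL_be, h.extL_apply]
  have h3 := two_eq F
  match_scalars <;> grind

theorem Hyp.extL_mul (h : Hyp Q e f) (g g' : hc Q e f ≃ₗ[F] hc Q e f) (v : V) :
    h.extL (g * g') v = h.extL g (h.extL g' v) := by
  rw [h.extL_apply, h.extL_apply g, h.extL_bf, h.extL_be, h.extL_pr]; rfl

theorem Hyp.extL_one (h : Hyp Q e f) (v : V) : h.extL 1 v = v := (h.decomp v).symm

theorem Hyp.extL_S (h : Hyp Q e f) {a w : hc Q e f} (ha : Q a = 0) (haw : bl Q (a : V) w = 0) (v : V) :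
    h.extL (S (res Q (hc Q e f)) a w) v = S Q (a : V) w v := by
  rw [h.extL_apply, S_apply (Q := res Q (hc Q e f)) ha haw, S_apply ha haw]
  simp only [Submodule.coe_add, Submodule.coe_smul, bl_res, res_apply, h.bl_pr]
  conv_rhs => rw [h.decomp v]
  simp only [map_add, map_smul, LinearMap.add_apply, LinearMap.smul_apply, h.be, h.bf, h.bl_pr]
  simp only [smul_zero, add_zero]
  match_scalars <;> grind

variable [Finite F] [FiniteDimensional F V]

/-- The embedding of the group of a hyperbolic complement, fixing `e` and `f`. -/
noncomputable def Hyp.ext (h : Hyp Q e f) : Om (res Q (hc Q e f)) →* Om Q where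
  toFun g := ⟨LinearEquiv.ofLinearMap (h.extL g.1) (h.extL g⁻¹.1)
    (by ext v; exact (h.extL_mul g.1 g⁻¹.1 v).symm.trans (by
      rw [Subgroup.coe_inv, mul_inv_cancel]; exact h.extL_one v))
    (by ext v; exact (h.extL_mul g⁻¹.1 g.1 v).symm.trans (by
      rw [Subgroup.coe_inv, inv_mul_cancel]; exact h.extL_one v)), by
    have key : ∃ x : Om Q, ∀ v, x.1 v = h.extL g.1 v := by
      induction g using Om.induction with
      | h1 => exact ⟨1, fun v => (h.extL_one v).symm⟩
      | hm g g' hg hg' =>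
        obtain ⟨x, hx⟩ := hg
        obtain ⟨y, hy⟩ := hg'
        exact ⟨x * y, fun v => by
          rw [Om.mul_apply, hy, hx, ← h.extL_mul]; rfl⟩
      | hs a w ha haw => exact ⟨sg Q a w, fun v => (h.extL_S ha haw v).symm⟩
    obtain ⟨x, hx⟩ := key
    convert x.2
    exact LinearEquiv.ext fun v => (hx v).symm⟩
  map_one' := Subtype.ext (LinearEquiv.ext h.extL_one)
  map_mul' g g' := Subtype.ext (LinearEquiv.ext (h.extL_mul g.1 g'.1))

theorem Hyp.ext_apply (h : Hyp Q e f) (g : Om (res Q (hc Q e f))) (v : V) :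
    (h.ext g).1 v = g.1 (h.pr v) + bl Q f v • e + bl Q e v • f := rfl

theorem Hyp.ext_coe (h : Hyp Q e f) (g : Om (res Q (hc Q e f))) (w : hc Q e f) :
    (h.ext g).1 w = g.1 w := by
  rw [h.ext_apply, h.pr_of_mem]; simp [h.be, h.bf]

theorem Hyp.ext_e (h : Hyp Q e f) (g : Om (res Q (hc Q e f))) : (h.ext g).1 e = e := by
  have : h.pr e = 0 := Subtype.ext (by rw [h.pr_coe]; simp [h.fe, add_self_v F])
  rw [h.ext_apply, this]; simp [h.fe]

theorem Hyp.ext_sg (h : Hyp Q e f) {a w : hc Q e f} (ha : Q a = 0) (haw : bl Q (a : V) w = 0) :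
    h.ext (sg _ a w) = sg Q a w :=
  Subtype.ext (LinearEquiv.ext (h.extL_S ha haw))

end Ext

section LowerBound

variable {F V : Type} [Field F] [AddCommGroup V] [Module F V] [CharP F 2]
  [Fintype F] [DecidableEq F] [FiniteDimensional F V]
variable {Q : QuadraticForm F V} {k : ℕ} {α : ℤ} {e f : V}
variable {M : Type} [AddCommGroup M] [Module ℂ M] [FiniteDimensional ℂ M]

/-- The number of nonzero singular vectors of a form of type `(k + 1, α)`. -/
def nS (q α : ℤ) (k : ℕ) : ℤ := (q ^ (k + 1) - α) * (q ^ k + α)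

/-- The number of nonsingular vectors of a form of type `(k + 1, α)`. -/
def nN (q α : ℤ) (k : ℕ) : ℤ := (q - 1) * q ^ k * (q ^ (k + 1) - α)

theorem IsType.exists_finrank_sing (h : IsType Q k α) (hk : 2 < k ∨ α = -1 ∧ 2 ≤ k)
    (ρ : Representation ℂ (Om Q) M) : ∃ b : ℕ, ∀ e x, Q e = 0 → e ≠ 0 → bl Q e x = 0 →
      x ∉ span F {e} → Q x = 0 → finrank ℂ (wsp ρ e x) = b := by
  by_cases hx : ∃ e x, Q e = 0 ∧ e ≠ 0 ∧ bl Q e x = 0 ∧ x ∉ span F {e} ∧ Q x = 0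
  · obtain ⟨e, x, he, he0, hex, hxe, hx0⟩ := hx
    exact ⟨_, fun e' x' he' he0' hex' hxe' hx0' =>
      h.finrank_wsp_sing hk ρ he' he he0' he0 hex' hex hxe' hxe (hx0'.trans hx0.symm)⟩
  · exact ⟨0, fun e x h1 h2 h3 h4 h5 => absurd ⟨e, x, h1, h2, h3, h4, h5⟩ hx⟩

theorem IsType.exists_finrank_nonsing (h : IsType Q k α) (hk : 2 < k ∨ α = -1 ∧ 2 ≤ k)
    (ρ : Representation ℂ (Om Q) M) : ∃ c : ℕ, ∀ e x, Q e = 0 → e ≠ 0 → bl Q e x = 0 →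
      Q x ≠ 0 → finrank ℂ (wsp ρ e x) = c := by
  by_cases hx : ∃ e x, Q e = 0 ∧ e ≠ 0 ∧ bl Q e x = 0 ∧ Q x ≠ 0
  · obtain ⟨e, x, he, he0, hex, hx0⟩ := hx
    exact ⟨_, fun e' x' he' he0' hex' hx0' =>
      h.finrank_wsp_nonsing hk ρ he' he he0' he0 hex' hex hx0' hx0⟩
  · exact ⟨0, fun e x h1 h2 h3 h4 => absurd ⟨e, x, h1, h2, h3, h4⟩ hx⟩

theorem notMem_span_of_hc (hef : Hyp Q e f) {x : hc Q e f} (hx : x ≠ 0) :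
    (x : V) ∉ span F {e} := by
  intro hc'
  obtain ⟨c, hc'⟩ := mem_span_singleton.1 hc'
  have := hef.bf x
  rw [← hc', map_smul, hef.fe, smul_eq_mul, mul_one] at this
  rw [this, zero_smul] at hc'
  exact hx (Subtype.ext hc'.symm)

/-- The dimension of a representation in terms of its eigenspaces. -/
theorem IsType.finrank_eq (h : IsType Q (k + 2) α) (hef : Hyp Q e f)
    (ρ : Representation ℂ (Om Q) M) {b c : ℕ}
    (hb : ∀ e x, Q e = 0 → e ≠ 0 → bl Q e x = 0 →
      x ∉ span F {e} → Q x = 0 → finrank ℂ (wsp ρ e x) = b)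
    (hc' : ∀ e x, Q e = 0 → e ≠ 0 → bl Q e x = 0 → Q x ≠ 0 → finrank ℂ (wsp ρ e x) = c) :
    (finrank ℂ M : ℤ) = finrank ℂ (wsp ρ e 0) + nS (Fintype.card F) α k * b +
      nN (Fintype.card F) α k * c := by
  classical
  have := finite_of_finite F (M := V)
  have := Fintype.ofFinite V
  have ht := Hyp.isType h (by omega) hef
  have hs : ∀ x : hc Q e f, x ≠ 0 → Q x = 0 → finrank ℂ (wsp ρ e x) = b := fun x hx hx0 =>
    hb e x hef.e0 hef.ne (hef.be x) (notMem_span_of_hc hef hx) hx0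
  have hn : ∀ x : hc Q e f, Q x ≠ 0 → finrank ℂ (wsp ρ e x) = c := fun x hx0 =>
    hc' e x hef.e0 hef.ne (hef.be x) hx0
  have c1 : (univ.filter fun x : hc Q e f => Q x = 0).card =
      Fintype.card (Xs (res Q (hc Q e f)) 0) + 1 := by
    rw [card_Xs_zero, nsing, ← Fintype.card_subtype, Nat.card_eq_fintype_card]; rfl
  have c2 : (univ.filter fun x : hc Q e f => Q x = 0).card +
      (univ.filter fun x : hc Q e f => ¬ Q x = 0).card = Fintype.card F ^ (2 * (k + 1)) := by
    rw [card_filter_add_card_filter_not, card_univ, card_eq_pow_finrank (K := F),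
      ht.rank]
  have c3 := card_Xs_zero_eq ht
  have h0 : (0 : hc Q e f) ∈ univ.filter fun x : hc Q e f => Q x = 0 := by simp
  have h1 := finrank_eq_sum_wsp ρ h.nondeg hef
  rw [← sum_filter_add_sum_filter_not univ (fun x : hc Q e f => Q x = 0), ← add_sum_erase _ _ h0,
    sum_congr rfl (fun x hx => hs x (mem_erase.1 hx).1 (mem_filter.1 (mem_erase.1 hx).2).2),
    sum_congr rfl (fun x hx => hn x (mem_filter.1 hx).2), sum_const, sum_const,
    card_erase_of_mem h0, c1, Nat.add_sub_cancel] at h1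
  rw [c1] at c2
  rw [smul_eq_mul, smul_eq_mul] at h1
  zify at h1 c2
  rw [c3] at h1 c2
  have c4 : α ^ 2 = 1 := by exact_mod_cast h.sq
  rw [h1, nS, nN]
  linear_combination c * c2 + c * c4

end LowerBound

section Sub

variable {F V : Type} [Field F] [AddCommGroup V] [Module F V] [CharP F 2]
  [Fintype F] [DecidableEq F] [FiniteDimensional F V]
variable {Q : QuadraticForm F V} {k : ℕ} {α : ℤ} {e f x y : V}
variable {M : Type} [AddCommGroup M] [Module ℂ M]

theorem Hyp.ext_f (h : Hyp Q e f) (g : Om (res Q (hc Q e f))) : (h.ext g).1 f = f := by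
  have : h.pr f = 0 := Subtype.ext (by rw [h.pr_coe]; simp [h.ef, add_self_v F])
  rw [h.ext_apply, this]; simp [h.ef]

theorem Hyp.exists_sub (h : IsType Q (k + 2) α) (hk : 0 < k) (hef : Hyp Q e f)
    (he : Perp Q {x, y} e) (hf : Perp Q {x, y} f) (hxy : bl Q x y = 1) (hy : Q y = 0) :
    ∃ (W : Type) (_ : AddCommGroup W) (_ : Module F W) (_ : FiniteDimensional F W)
      (Q' : QuadraticForm F W) (i : W →ₗ[F] V) (φ : Om Q' →* Om Q), IsType Q' k α ∧
      (∀ w, Q (i w) = Q' w) ∧ (∀ v w, bl Q (i v) (i w) = bl Q' v w) ∧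
      (∀ v, Perp Q {e, f, x, y} v → ∃ w, i w = v) ∧ (∀ w, Perp Q {e, f, x, y} (i w)) ∧
      (∀ g, (φ g).1 e = e ∧ (φ g).1 x = x) ∧
      ∀ a w, Q' a = 0 → bl Q' a w = 0 → φ (sg Q' a w) = sg Q (i a) (i w) := by
  simp only [perp_insert, perp_singleton] at he hf
  let x₁ : hc Q e f := ⟨x, by simp [bl_comm Q e, bl_comm Q f, he.1, hf.1]⟩
  let y₁ : hc Q e f := ⟨y, by simp [bl_comm Q e, bl_comm Q f, he.2, hf.2]⟩
  have hyp : Hyp (res Q (hc Q e f)) (x₁ + Q x • y₁) y₁ := by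
    refine ⟨?_, hy, ?_⟩
    · show Q (x + Q x • y) = 0
      rw [Q_add, Q_smul, hy, map_smul, hxy, smul_eq_mul, mul_one, mul_zero, add_zero,
        CharTwo.add_self_eq_zero]
    · show bl Q (x + Q x • y) y = 1
      simp [hxy]
  refine ⟨_, _, _, inferInstance, res (res Q (hc Q e f)) (hc _ (x₁ + Q x • y₁) y₁),
    (hc Q e f).subtype ∘ₗ Submodule.subtype _, hef.ext.comp hyp.ext,
    hyp.isType (hef.isType h (by omega)) hk, fun _ => rfl, fun _ _ => rfl, fun v hv => ?_,
    fun w => ?_, fun g => ⟨hef.ext_e _, ?_⟩, fun a w ha haw => ?_⟩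
  · simp only [perp_insert, perp_singleton] at hv
    refine ⟨⟨⟨v, by simp [hv.1, hv.2.1]⟩, ?_⟩, rfl⟩
    simp only [mem_orth, perp_insert, perp_singleton, bl_res]
    simp [x₁, y₁, hv.2.2.1, hv.2.2.2]
  · have h1 : bl Q (x + Q x • y) w.1.1 = 0 := hyp.be w
    have h2 : bl Q y w.1.1 = 0 := hyp.bf w
    rw [map_add, map_smul, LinearMap.add_apply, LinearMap.smul_apply, h2, smul_zero, add_zero] at h1
    simp only [perp_insert, perp_singleton]
    exact ⟨hef.be w.1, hef.bf w.1, h1, h2⟩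
  · have h1 := hyp.ext_e g
    rw [map_add, map_smul, hyp.ext_f] at h1
    have h2 := hef.ext_coe (hyp.ext g) x₁
    rw [add_right_cancel h1] at h2
    exact h2
  · rw [MonoidHom.comp_apply, hyp.ext_sg ha haw]; exact hef.ext_sg ha haw

/-- All representations of degree less than `d` of the group of a form of type `(k, α)` are
trivial. -/
def TrivialBelow (F : Type) [Field F] [CharP F 2] [Finite F] (k : ℕ) (α : ℤ) (d : ℝ) : Prop :=
  ∀ (V : Type) [AddCommGroup V] [Module F V] [FiniteDimensional F V] (Q : QuadraticForm F V),
    IsType Q k α → ∀ (M : Type) [AddCommGroup M] [Module ℂ M] [FiniteDimensional ℂ M]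
    (ρ : Representation ℂ (Om Q) M), (finrank ℂ M : ℝ) < d → ∀ g m, ρ g m = m

/-- The action on an eigenspace of a group fixing the data. -/
noncomputable def wspRep {G : Type} [Group G] (ρ : Representation ℂ (Om Q) M) (φ : G →* Om Q)
    (e x : V) (hφ : ∀ g, (φ g).1 e = e ∧ (φ g).1 x = x) : Representation ℂ G (wsp ρ e x) where
  toFun g := (ρ (φ g)).restrict fun m hm => by
    have := rho_mem_wsp ρ hm (φ g)
    rwa [(hφ g).1, (hφ g).2] at this
  map_one' := by ext m; simp
  map_mul' g g' := by ext m; simp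

theorem TT0_of_trivialBelow [FiniteDimensional ℂ M] (h : IsType Q (k + 2) α) (hk : 0 < k) {d : ℝ}
    (hd : TrivialBelow F k α d) (ρ : Representation ℂ (Om Q) M)
    (hw : (finrank ℂ (wsp ρ e x) : ℝ) < d) : TT0 ρ e x := by
  intro f y hef he hf hxy hy a w ha hw' m hm
  by_cases haw : Q a = 0 ∧ bl Q a w = 0
  · obtain ⟨W, _, _, _, Q', i, φ, ht, hi, hib, hsurj, -, hφ, hsg⟩ :=
      hef.exists_sub h hk he hf hxy hy
    obtain ⟨a, rfl⟩ := hsurj a ha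
    obtain ⟨w, rfl⟩ := hsurj w hw'
    rw [← hsg a w (by rw [← hi, haw.1]) (by rw [← hib, haw.2])]
    exact congrArg Subtype.val (hd W Q' ht _ (wspRep ρ φ e x hφ) hw (sg Q' a w) ⟨m, hm⟩)
  · rw [sg_junk haw, rho_one]

end Sub

theorem trivial_of_irr {G : Type} [Group G] [Finite G] {d : ℝ}
    (hd : ∀ (M : Type) [AddCommGroup M] [Module ℂ M] [FiniteDimensional ℂ M]
      (ρ : Representation ℂ G M), ρ.IsIrreducible → (finrank ℂ M : ℝ) < d → ∀ g m, ρ g m = m)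
    (M : Type) [AddCommGroup M] [Module ℂ M] [FiniteDimensional ℂ M] (ρ : Representation ℂ G M)
    (hM : (finrank ℂ M : ℝ) < d) (g : G) (m : M) : ρ g m = m := by
  induction hn : finrank ℂ M using Nat.strong_induction_on generalizing M with
  | _ n ih =>
  subst hn
  by_cases hirr : ρ.IsIrreducible
  · exact hd M ρ hirr hM g m
  by_cases hm : m = 0
  · rw [hm, map_zero]
  have hne : Nontrivial (Subrepresentation ρ) := by
    refine ⟨⊥, ⊤, fun h => hm ?_⟩
    have : m ∈ (⊤ : Subrepresentation ρ) := Submodule.mem_top (R := ℂ) (M := M)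
    rw [← h] at this
    exact this
  have : ∃ N : Subrepresentation ρ, N ≠ ⊥ ∧ N ≠ ⊤ := by
    by_contra hc
    push Not at hc
    exact hirr ⟨fun N => or_iff_not_imp_left.2 (hc N)⟩
  obtain ⟨N, hN0, hN1⟩ := this
  obtain ⟨N', hNN'⟩ := exists_isCompl N
  have hN' : N' ≠ ⊤ := by
    rintro rfl
    exact hN0 (by simpa using hNN'.inf_eq_bot)
  have hs : N.toSubmodule ⊔ N'.toSubmodule = ⊤ := by
    rw [← Subrepresentation.toSubmodule_sup, hNN'.sup_eq_top]; rfl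
  obtain ⟨a, ha, b, hb, rfl⟩ := Submodule.mem_sup.1 (hs ▸ Submodule.mem_top (x := m))
  have key : ∀ N : Subrepresentation ρ, N ≠ ⊤ → ∀ a ∈ N.toSubmodule, ρ g a = a := by
    intro N hN a ha
    have hlt : finrank ℂ N.toSubmodule < finrank ℂ M := Submodule.finrank_lt fun h =>
      hN (Subrepresentation.toSubmodule_injective h)
    exact congrArg Subtype.val (ih _ hlt N.toSubmodule N.toRepresentation
      ((Nat.cast_lt.2 hlt).trans hM) ⟨a, ha⟩ rfl)
  rw [map_add, key N hN1 a ha, key N' hN' b hb]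

section Trivial

variable {F : Type} [Field F] [CharP F 2] [Fintype F] [DecidableEq F] {k : ℕ} {α : ℤ} {d : ℝ}

theorem two_le_card (F : Type) [Field F] [Fintype F] : (2 : ℤ) ≤ Fintype.card F :=
  Int.ofNat_le.2 Fintype.one_lt_card

theorem nS_nonneg {q : ℤ} (hq : 2 ≤ q) (hα : α = 1 ∨ α = -1) (k : ℕ) : 0 ≤ nS q α k := by
  have h1 := one_le_pow₀ (by linarith : 1 ≤ q) (n := k)
  have h2 := one_le_pow₀ (by linarith : 1 ≤ q) (n := k + 1)
  rcases hα with rfl | rfl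
  · exact mul_nonneg (by linarith) (by linarith)
  · exact mul_nonneg (by linarith) (by linarith)

theorem nN_nonneg {q : ℤ} (hq : 2 ≤ q) (hα : α = 1 ∨ α = -1) (k : ℕ) : 0 ≤ nN q α k := by
  have h1 := one_le_pow₀ (by linarith : 1 ≤ q) (n := k)
  have h2 := one_le_pow₀ (by linarith : 1 ≤ q) (n := k + 1)
  refine mul_nonneg (mul_nonneg (by linarith) (by linarith)) ?_
  rcases hα with rfl | rfl <;> linarith

variable {V : Type} [AddCommGroup V] [Module F V] [FiniteDimensional F V] {Q : QuadraticForm F V}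
variable {M : Type} [AddCommGroup M] [Module ℂ M] [FiniteDimensional ℂ M]

/-- Lower bounds for the degree in terms of the dimensions of the eigenspaces. -/
theorem IsType.le_finrank (h : IsType Q (k + 2) α) (hk : 0 < k ∨ α = -1)
    (ρ : Representation ℂ (Om Q) M) {e x : V} (he : Q e = 0) (he0 : e ≠ 0) (hex : bl Q e x = 0)
    (hx : x ∉ span F {e}) :
    (Q x = 0 → nS (Fintype.card F) α k * finrank ℂ (wsp ρ e x) ≤ (finrank ℂ M : ℤ)) ∧
      (Q x ≠ 0 → nN (Fintype.card F) α k * finrank ℂ (wsp ρ e x) ≤ (finrank ℂ M : ℤ)) := by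
  have hk' : 2 < k + 2 ∨ α = -1 ∧ 2 ≤ k + 2 := by omega
  obtain ⟨b, hb⟩ := h.exists_finrank_sing hk' ρ
  obtain ⟨c, hc⟩ := h.exists_finrank_nonsing hk' ρ
  obtain ⟨f, hef, -⟩ := exists_hyp h.nondeg (U := ∅) he (by simpa using he0) (by simp)
  have h1 := h.finrank_eq hef ρ hb hc
  have h2 := mul_nonneg (nS_nonneg (two_le_card F) h.sign k) (Nat.cast_nonneg b)
  have h3 := mul_nonneg (nN_nonneg (two_le_card F) h.sign k) (Nat.cast_nonneg c)
  have h4 : (0 : ℤ) ≤ finrank ℂ (wsp ρ e 0) := Nat.cast_nonneg _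
  exact ⟨fun h0 => by rw [hb e x he he0 hex hx h0]; linarith,
    fun h0 => by rw [hc e x he he0 hex h0]; linarith⟩

theorem trivialBelow_of_le (hk : 0 < k ∨ α = -1) (hN : d ≤ nN (Fintype.card F) α k)
    (hS : d ≤ nS (Fintype.card F) α k ∨ (k = 0 ∧ α = -1)) : TrivialBelow F (k + 2) α d := by
  intro V _ _ _ Q h M _ _ _ ρ hM g m
  by_contra hg
  obtain ⟨e, x, he, he0, hex, hx, v, hv, hv0⟩ := exists_wsp_of_nontrivial h.nondeg hg
  have h1 : (1 : ℤ) ≤ finrank ℂ (wsp ρ e x) := by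
    have : Nontrivial (wsp ρ e x) := ⟨⟨v, hv⟩, 0, fun h => hv0 (congrArg Subtype.val h)⟩
    exact_mod_cast (finrank_pos : 0 < finrank ℂ (wsp ρ e x))
  obtain ⟨h2, h3⟩ := h.le_finrank hk ρ he he0 hex hx
  by_cases hQx : Q x = 0
  · rcases hS with hS | ⟨rfl, rfl⟩
    · have h4 := (le_mul_of_one_le_right (nS_nonneg (two_le_card F) h.sign k) h1).trans (h2 hQx)
      have : ((nS (Fintype.card F) α k : ℤ) : ℝ) ≤ finrank ℂ M := by exact_mod_cast h4
      linarith
    · have hts : ∀ u ∈ span F {e, x}, Q u = 0 := by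
        intro u hu
        obtain ⟨a, b, rfl⟩ := Submodule.mem_span_pair.1 hu
        rw [Q_add, Q_smul, Q_smul, he, hQx]; simp [hex]
      have h5 := (h.totSing_le _ hts).2 rfl
      have h6 : LinearIndependent F ![e, x] := (LinearIndependent.pair_iff' he0).2 fun a ha =>
        hx (mem_span_singleton.2 ⟨a, ha⟩)
      have h7 := finrank_span_eq_card h6
      rw [Matrix.range_cons_cons_empty, Fintype.card_fin] at h7
      omega
  · have h4 := (le_mul_of_one_le_right (nN_nonneg (two_le_card F) h.sign k) h1).trans (h3 hQx)
    have : ((nN (Fintype.card F) α k : ℤ) : ℝ) ≤ finrank ℂ M := by exact_mod_cast h4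
    linarith

theorem trivialBelow_two (hα : α = 1 ∨ α = -1) (hk : 0 < k ∨ α = -1) :
    TrivialBelow F (k + 2) α 2 := by
  have hq := two_le_card F
  have h1 := one_le_pow₀ (by linarith : (1 : ℤ) ≤ Fintype.card F) (n := k)
  have h2 : ∀ k, 0 < k → (2 : ℤ) ≤ (Fintype.card F : ℤ) ^ k := fun k hk =>
    hq.trans (le_self_pow₀ (by linarith) hk.ne')
  have h3 : (2 : ℤ) * 2 ^ k ≤ (Fintype.card F : ℤ) ^ (k + 1) := by
    rw [← pow_succ']; exact pow_le_pow_left₀ (by norm_num) hq _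
  have h4 : 0 < k → (2 : ℤ) ≤ 2 ^ k := fun hk => le_self_pow₀ (by norm_num) hk.ne'
  have h5 := one_le_pow₀ (by norm_num : (1 : ℤ) ≤ 2) (n := k)
  refine trivialBelow_of_le hk ?_ ?_
  · have : (2 : ℤ) ≤ nN (Fintype.card F) α k := by
      rw [nN]
      have h6 : (2 : ℤ) ≤ (Fintype.card F : ℤ) ^ (k + 1) - α := by
        rcases hα with rfl | rfl
        · have := h4 (by omega); linarith
        · linarith
      nlinarith [mul_le_mul (by linarith : (1 : ℤ) ≤ Fintype.card F - 1) h1 (by norm_num)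
        (by linarith)]
    exact_mod_cast this
  · rcases Nat.eq_zero_or_pos k with rfl | hk0
    · exact .inr ⟨rfl, by simpa using hk⟩
    · refine .inl ?_
      have : (2 : ℤ) ≤ nS (Fintype.card F) α k := by
        rw [nS]
        have h6 := h2 k hk0
        have h7 := h4 hk0
        rcases hα with rfl | rfl <;> nlinarith
      exact_mod_cast this

theorem IsType.cip_of_TTall (h : IsType Q k α) (hk : 5 ≤ k ∨ 4 ≤ k ∧ α = -1)
    {ρ : Representation ℂ (Om Q) M} (hT : TTall ρ) {g : Om Q} {m : M} (hg : ρ g m ≠ m) :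
    cip ρ.character (pchar (Om Q) (Xs Q (0 : F))) ≠ 0 ∨
      cip ρ.character (pchar (Om Q) (Xs Q (1 : F))) ≠ 0 := by
  obtain ⟨ip, hip, hnn, hpos⟩ := exists_ip ρ
  obtain ⟨e, x, he, he0, hex, hx, v, hv, hv0⟩ := exists_wsp_of_nontrivial h.nondeg hg
  obtain ⟨t, ht0, ht⟩ := exists_fixed_of_wsp h hk hT hip hnn hpos he he0 hex hx hv hv0
  exact cip_ne_zero_of_fixed h (by omega) ρ (fun h0 => hx (by rw [h0]; exact zero_mem _)) ht0 ht

theorem TTall_of_TT0 (h : IsType Q k α) {ρ : Representation ℂ (Om Q) M}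
    (hk : 5 ≤ k ∨ (4 ≤ k ∧ α = -1 ∧ ∀ e x, Q e = 0 → e ≠ 0 → bl Q e x = 0 → Q x ≠ 0 →
      wsp ρ e x = ⊥))
    (h0 : ∀ e x, Q e = 0 → e ≠ 0 → bl Q e x = 0 → x ∉ span F {e} → TT0 ρ e x) :
    TTall ρ := by
  intro e x he he0 hex hx
  rcases hk with hk | ⟨hk, hα, hn⟩
  · exact TT_of_TT0 ρ h he he0 hx hex (.inl hk) (h0 e x he he0 hex hx)
  · by_cases hx0 : Q x = 0
    · exact TT_of_TT0 ρ h he he0 hx hex (.inr ⟨hk, hα, hx0⟩) (h0 e x he he0 hex hx)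
    · intro a w _ _ m hm
      rw [hn e x he he0 hex hx0, Submodule.mem_bot] at hm
      rw [hm, map_zero]

theorem finrank_wsp_lt (h : IsType Q (k + 2) α) (hk : 0 < k ∨ α = -1)
    (ρ : Representation ℂ (Om Q) M) (hS : (finrank ℂ M : ℝ) < nS (Fintype.card F) α k * d)
    (hN : (finrank ℂ M : ℝ) < nN (Fintype.card F) α k * d) {e x : V} (he : Q e = 0) (he0 : e ≠ 0)
    (hex : bl Q e x = 0) (hx : x ∉ span F {e}) : (finrank ℂ (wsp ρ e x) : ℝ) < d := by
  obtain ⟨h2, h3⟩ := h.le_finrank hk ρ he he0 hex hx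
  have n1 : (0 : ℝ) ≤ nS (Fintype.card F) α k := by exact_mod_cast nS_nonneg (two_le_card F) h.sign k
  have n2 : (0 : ℝ) ≤ nN (Fintype.card F) α k := by exact_mod_cast nN_nonneg (two_le_card F) h.sign k
  by_cases hx0 : Q x = 0
  · have h4 : (nS (Fintype.card F) α k : ℝ) * finrank ℂ (wsp ρ e x) ≤ finrank ℂ M := by
      exact_mod_cast h2 hx0
    exact lt_of_mul_lt_mul_left (h4.trans_lt hS) n1
  · have h4 : (nN (Fintype.card F) α k : ℝ) * finrank ℂ (wsp ρ e x) ≤ finrank ℂ M := by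
      exact_mod_cast h3 hx0
    exact lt_of_mul_lt_mul_left (h4.trans_lt hN) n2

/-- A bound for the degrees of nontrivial representations improving `trivialBelow_of_le`. -/
theorem trivialBelow_of_list (hα : α = 1 ∨ α = -1) (hS : d ≤ nS (Fintype.card F) α (k + 2) * 2)
    (hN : d ≤ nN (Fintype.card F) α (k + 2) * 2)
    (hk : 5 ≤ k + 4 ∨ α = -1 ∧ d ≤ nN (Fintype.card F) α (k + 2))
    (hA : d ≤ ((Fintype.card F : ℝ) ^ (k + 4) - α) * ((Fintype.card F : ℝ) ^ (k + 3) + α) /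
      ((Fintype.card F : ℝ) - 1))
    (hB : d ≤ ((Fintype.card F : ℝ) ^ (k + 4) - α) * ((Fintype.card F : ℝ) ^ (k + 3) - α) /
      ((Fintype.card F : ℝ) + 1))
    (h1 : d ≤ ((Fintype.card F : ℝ) ^ (2 * (k + 4)) - (Fintype.card F : ℝ) ^ 2) /
      ((Fintype.card F : ℝ) ^ 2 - 1))
    (h2 : d ≤ ((Fintype.card F : ℝ) ^ (k + 4) - α) *
      ((Fintype.card F : ℝ) ^ (k + 3) + α * Fintype.card F) / ((Fintype.card F : ℝ) ^ 2 - 1)) :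
    TrivialBelow F (k + 4) α d := by
  intro V _ _ _ Q h M _ _ _ ρ hM
  have : Finite V := finite_of_finite F
  refine trivial_of_irr ?_ M ρ hM
  clear! M
  intro M _ _ _ ρ hirr hM g m
  by_contra hg
  have hw := fun e x => finrank_wsp_lt (k := k + 2) (e := e) (x := x) h (by omega) ρ (hM.trans_le hS)
    (hM.trans_le hN)
  have hT : TTall ρ := by
    refine TTall_of_TT0 h ?_ fun e x he he0 hex hx => TT0_of_trivialBelow h (by omega)
      (trivialBelow_two hα (by omega)) ρ (hw e x he he0 hex hx)
    refine or_iff_not_imp_left.2 fun hk5 => ?_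
    obtain ⟨rfl, hk⟩ := hk.resolve_left hk5
    refine ⟨by omega, rfl, fun e x he he0 hex hx0 => ?_⟩
    have h3 := (h.le_finrank (k := k + 2) (by omega) ρ he he0 hex (notMem_of_nonsing he hx0)).2 hx0
    by_contra hb
    have h4 : (1 : ℤ) ≤ finrank ℂ (wsp ρ e x) := by
      exact_mod_cast Submodule.one_le_finrank_iff.2 hb
    have h5 := (le_mul_of_one_le_right (nN_nonneg (two_le_card F) h.sign (k + 2)) h4).trans h3
    have : ((nN (Fintype.card F) (-1) (k + 2) : ℤ) : ℝ) ≤ finrank ℂ M := by exact_mod_cast h5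
    linarith
  obtain ⟨sA, sB, E₁, E₂, eA, eB, e1, e2, -, -, hl⟩ := list_chars (k := k + 2) h (by omega)
  have h1' : ρ.character 1 = finrank ℂ M := Representation.char_one _
  rcases hl _ ⟨M, _, _, inferInstance, ρ, hirr, rfl⟩ (h.cip_of_TTall (by omega) hT hg)
    with h3 | h3 | h3 | h3 | h3
  · have h4 : finrank ℂ M = 1 := by
      rw [h3] at h1'
      have h5 : (finrank ℂ M : ℂ) = 1 := h1'.symm
      exact_mod_cast h5
    refine hg ((apply_eq_trace_smul h4 (ρ g) m).trans ?_)
    rw [show LinearMap.trace ℂ M (ρ g) = ρ.character g from rfl, h3, one_smul]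
  · have h4 := h1'.symm.trans (eA _ h3).2
    exact absurd hM (not_lt.2 (hA.trans_eq (by exact_mod_cast h4.symm)))
  · have h4 := h1'.symm.trans (eB _ h3).2
    exact absurd hM (not_lt.2 (hB.trans_eq (by exact_mod_cast h4.symm)))
  · have h4 := h1'.symm.trans (h3 ▸ e1.2)
    exact absurd hM (not_lt.2 (h1.trans_eq (by exact_mod_cast h4.symm)))
  · have h4 := h1'.symm.trans (h3 ▸ e2.2)
    exact absurd hM (not_lt.2 (h2.trans_eq (by exact_mod_cast h4.symm)))

end Trivial

section Bounds

variable {F : Type} [Field F] [CharP F 2] [Fintype F] [DecidableEq F] {k : ℕ} {α : ℤ}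

/-- The degree bound. -/
noncomputable def degBound (n : ℕ) (q : ℝ) (α : ℤ) : ℝ :=
  if n = 5 ∧ α = -1 then (q - 1) * (q ^ 2 + 1) * (q ^ 3 - 1) * (q ^ 4 + 1) else q ^ (4 * n - 10) + 1

theorem exists_eq_add {a b : ℝ} (h : b ≤ a) : ∃ c, 0 ≤ c ∧ a = b + c :=
  ⟨a - b, sub_nonneg.2 h, by ring⟩

theorem exists_trivialBelow_five :
    ∃ d, TrivialBelow F (0 + 3) (-1) d ∧
      degBound (0 + 5) (Fintype.card F) (-1) ≤ nS (Fintype.card F) (-1) (0 + 3) * d ∧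
      degBound (0 + 5) (Fintype.card F) (-1) ≤ nN (Fintype.card F) (-1) (0 + 3) * d := by
  have hq : (2 : ℝ) ≤ Fintype.card F := by exact_mod_cast two_le_card F
  refine ⟨nS (Fintype.card F) (-1) 1, trivialBelow_of_le (k := 1) (by omega) ?_ (.inl le_rfl), ?_, ?_⟩
  all_goals
    simp only [degBound, nS, nN]
    push_cast
    generalize (Fintype.card F : ℝ) = q at *
    obtain ⟨a, ha, rfl⟩ := exists_eq_add hq
    norm_num
    rw [← sub_nonneg]
    ring_nf
    positivity

theorem exists_trivialBelow_minus {j : ℕ} :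
    ∃ d, TrivialBelow F (j + 4) (-1) d ∧
      degBound (j + 6) (Fintype.card F) (-1) ≤ nS (Fintype.card F) (-1) (j + 4) * d ∧
      degBound (j + 6) (Fintype.card F) (-1) ≤ nN (Fintype.card F) (-1) (j + 4) * d := by
  have hq : (2 : ℝ) ≤ Fintype.card F := by exact_mod_cast two_le_card F
  have hZ : (1 : ℝ) ≤ (Fintype.card F : ℝ) ^ j := one_le_pow₀ (by linarith)
  have hq2 : 0 < (Fintype.card F : ℝ) ^ 2 - 1 := by nlinarith
  have hq1 : 0 < (Fintype.card F : ℝ) - 1 := by linarith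
  refine ⟨((Fintype.card F : ℝ) ^ (j + 4) - (-1 : ℤ)) *
      ((Fintype.card F : ℝ) ^ (j + 3) + (-1 : ℤ) * Fintype.card F) / ((Fintype.card F : ℝ) ^ 2 - 1),
    trivialBelow_of_list (.inr rfl) ?_ ?_ ?_ ?_ ?_ ?_ le_rfl, ?_, ?_⟩
  rotate_left 2
  · rcases Nat.eq_zero_or_pos j with rfl | hj
    · refine .inr ⟨rfl, ?_⟩
      rw [div_le_iff₀ hq2]
      simp only [nN]
      push_cast
      generalize (Fintype.card F : ℝ) = q at *
      obtain ⟨a, ha, rfl⟩ := exists_eq_add hq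
      rw [← sub_nonneg]
      ring_nf
      positivity
    · exact .inl (by omega)
  rotate_right 2
  any_goals
    rw [degBound, if_neg (by omega), show 4 * (j + 6) - 10 = j * 4 + 14 by omega]
  any_goals rw [← mul_div_assoc, le_div_iff₀ hq2]
  any_goals rw [div_le_div_iff₀ hq2 (by linarith)]
  any_goals rw [div_le_iff₀ hq2]
  all_goals
    try simp only [nS, nN]
    push_cast
    simp only [mul_add, pow_add, mul_comm 2 j, pow_mul]
    generalize (Fintype.card F : ℝ) ^ j = Z at *
    generalize (Fintype.card F : ℝ) = q at *
    obtain ⟨a, ha, rfl⟩ := exists_eq_add hq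
    obtain ⟨b, hb, rfl⟩ := exists_eq_add hZ
    rw [← sub_nonneg]
    ring_nf
    positivity

theorem exists_trivialBelow_plus (hq : 4 ≤ Fintype.card F) :
    ∃ d, TrivialBelow F (k + 3) 1 d ∧
      degBound (k + 5) (Fintype.card F) 1 ≤ nS (Fintype.card F) 1 (k + 3) * d ∧
      degBound (k + 5) (Fintype.card F) 1 ≤ nN (Fintype.card F) 1 (k + 3) * d := by
  have hq : (4 : ℝ) ≤ Fintype.card F := by exact_mod_cast hq
  have hZ : (1 : ℝ) ≤ (Fintype.card F : ℝ) ^ k := one_le_pow₀ (by linarith)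
  refine ⟨nS (Fintype.card F) 1 (k + 1), trivialBelow_of_le (k := k + 1) (by omega) ?_ (.inl le_rfl),
    ?_, ?_⟩
  any_goals
    rw [degBound, if_neg (by omega), show 4 * (k + 5) - 10 = k * 4 + 10 by omega]
  all_goals
    simp only [nS, nN]
    push_cast
    simp only [mul_add, pow_add, pow_mul]
    generalize (Fintype.card F : ℝ) ^ k = Z at *
    generalize (Fintype.card F : ℝ) = q at *
    obtain ⟨a, ha, rfl⟩ := exists_eq_add hq
    obtain ⟨b, hb, rfl⟩ := exists_eq_add hZ
    rw [← sub_nonneg]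
    ring_nf
    positivity

theorem exists_trivialBelow_plus_two {j : ℕ} (hq : Fintype.card F = 2) :
    ∃ d, TrivialBelow F (j + 5) 1 d ∧
      degBound (j + 7) (Fintype.card F) 1 ≤ nS (Fintype.card F) 1 (j + 5) * d ∧
      degBound (j + 7) (Fintype.card F) 1 ≤ nN (Fintype.card F) 1 (j + 5) * d := by
  have hZ : (1 : ℝ) ≤ 2 ^ j := one_le_pow₀ (by linarith)
  refine ⟨nS (Fintype.card F) 1 (j + 3),
    trivialBelow_of_list (.inl rfl) ?_ ?_ (.inl (by omega)) ?_ ?_ ?_ ?_, ?_, ?_⟩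
  any_goals
    rw [degBound, if_neg (by omega), show 4 * (j + 7) - 10 = j * 4 + 18 by omega]
  any_goals rw [le_div_iff₀ (by rw [hq]; norm_num)]
  all_goals
    simp only [nS, nN, hq]
    push_cast
    simp only [mul_add, pow_add, pow_mul, mul_comm 2 j]
    generalize (2 : ℝ) ^ j = Z at *
    obtain ⟨b, hb, rfl⟩ := exists_eq_add hZ
    rw [← sub_nonneg]
    ring_nf
    positivity

end Bounds

/-- An embedding of a quadratic space into the orthogonal space of two vectors. -/
structure Emb {F V W : Type} [Field F] [CharP F 2] [AddCommGroup V] [Module F V] [AddCommGroup W]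
    [Module F W] (Q : QuadraticForm F V) (Q' : QuadraticForm F W) (e x : V) (i : W →ₗ[F] V)
    (φ : Om Q' →* Om Q) : Prop where
  quad : ∀ w, Q (i w) = Q' w
  bl : ∀ v w, bl Q (i v) (i w) = OC.bl Q' v w
  perp : ∀ w, Perp Q {e, x} (i w)
  fix : ∀ g, (φ g).1 e = e ∧ (φ g).1 x = x
  sg : ∀ a w, Q' a = 0 → OC.bl Q' a w = 0 → φ (sg Q' a w) = OC.sg Q (i a) (i w)

section Special

variable {F V W : Type} [Field F] [CharP F 2] [Fintype F] [DecidableEq F] [AddCommGroup V]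
  [Module F V] [FiniteDimensional F V] [AddCommGroup W] [Module F W] [FiniteDimensional F W]
variable {Q : QuadraticForm F V} {Q' : QuadraticForm F W} {e x : V} {i : W →ₗ[F] V}
  {φ : Om Q' →* Om Q}
variable {M : Type} [AddCommGroup M] [Module ℂ M]

theorem Emb.be (E : Emb Q Q' e x i φ) (w : W) : OC.bl Q e (i w) = 0 := E.perp w _ (by simp)

theorem Emb.bx (E : Emb Q Q' e x i φ) (w : W) : OC.bl Q x (i w) = 0 := E.perp w _ (by simp)

theorem Emb.sg_x (E : Emb Q Q' e x i φ) {b : W} (hb : Q' b = 0) (v : V) :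
    (OC.sg Q (i b) x).1 v = v + OC.bl Q v x • i b + OC.bl Q v (i b) • x +
      (Q x * OC.bl Q v (i b)) • i b :=
  sg_apply (by rw [E.quad, hb]) (by rw [bl_comm, E.bx]) v

/-- The action on `wsp ρ e x` of the transformation given by `i b` and `x`. -/
noncomputable def tau (E : Emb Q Q' e x i φ) (hex : bl Q e x = 0) (ρ : Representation ℂ (Om Q) M)
    {b : W} (hb : Q' b = 0) : wsp ρ e x →ₗ[ℂ] wsp ρ e x :=
  (ρ (sg Q (i b) x)).restrict fun m hm => by
    have h1 := rho_mem_wsp ρ hm (sg Q (i b) x)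
    have h2 : (sg Q (i b) x).1 e = e := by rw [E.sg_x hb, E.be, hex]; simp
    have h3 : (sg Q (i b) x).1 x = x := by rw [E.sg_x hb, E.bx]; simp
    rwa [h2, h3] at h1

variable (E : Emb Q Q' e x i φ) (hex : bl Q e x = 0) (ρ : Representation ℂ (Om Q) M)
variable {a b z : W} {ε : F} {m : wsp ρ e x}

theorem tau_tau (hb : Q' b = 0) : tau E hex ρ hb (tau E hex ρ hb m) = m := by
  refine Subtype.ext ?_
  show ρ (sg Q (i b) x) (ρ (sg Q (i b) x) m) = m
  rw [← rho_mul, sg_mul_self (by rw [E.quad, hb]) (by rw [bl_comm, E.bx]), rho_one]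

theorem tau_comm (ha : Q' a = 0) {t : W} (ht : bl Q' a t = 0) :
    wspRep ρ φ e x E.fix (sg Q' a t) (tau E hex ρ ha m) =
      tau E hex ρ ha (wspRep ρ φ e x E.fix (sg Q' a t) m) := by
  refine Subtype.ext ?_
  show ρ (φ (sg Q' a t)) (ρ (sg Q (i a) x) m) = ρ (sg Q (i a) x) (ρ (φ (sg Q' a t)) m)
  rw [E.sg a t ha ht, rho_sg_conj ρ (sg Q (i a) x), E.sg_x ha, E.sg_x ha, E.bl, E.bl, bl_self, bl_comm Q' t, ht,
    bl_comm Q _ x, bl_comm Q _ x, E.bx, E.bx]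
  simp

theorem tau_mem_wsp (hF : ∀ c : F, c = 0 ∨ c = 1) (ha : Q' a = 0) (hb : Q' b = 0)
    (hab : bl Q' a b = 0) (hm : m ∈ wsp (wspRep ρ φ e x E.fix) a z)
    (hε : tau E hex ρ ha m = psi F ε • m) :
    tau E hex ρ hb m ∈ wsp (wspRep ρ φ e x E.fix) a (z + (ε + Q x * bl Q' b z) • b) := by
  intro t ht
  have h3 := two_eq F
  have hx : ∀ w, bl Q (i w) x = 0 := fun w => by rw [bl_comm, E.bx]
  have ha' : Q (i a) = 0 := by rw [E.quad, ha]
  refine Subtype.ext ?_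
  show ρ (φ (sg Q' a t)) (ρ (sg Q (i b) x) m) =
    psi F (bl Q' t (z + (ε + Q x * bl Q' b z) • b)) • ρ (sg Q (i b) x) m
  set c := bl Q' t b with hc
  have h1 : (sg Q (i b) x).1 (i a) = i a := by rw [E.sg_x hb, E.bl, hab, hx]; simp
  have h2 : (sg Q (i b) x).1 (i (t + (Q x * c) • b) + c • x) = i t := by
    rw [E.sg_x hb]
    simp only [map_add, map_smul, LinearMap.add_apply, LinearMap.smul_apply, E.bl, E.bx, hx, ← hc,
      bl_self, smul_eq_mul]
    match_scalars <;> grind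
  rw [E.sg a t ha ht, ← h2]
  nth_rewrite 1 [← h1]
  rw [← rho_sg_conj, ← map_smul]
  congr 1
  have ht' : bl Q' a (t + (Q x * c) • b) = 0 := by simp [ht, hab]
  have h4 : ρ (sg Q (i a) (c • x)) (m : M) = psi F (c * ε) • (m : M) := by
    rcases hF c with h0 | h0
    · rw [h0, zero_smul, sg_zero, rho_one, zero_mul, psi_zero, one_smul]
    · rw [h0, one_smul, one_mul]
      exact congrArg Subtype.val hε
  have h5 := congrArg Subtype.val (hm _ ht')
  change ρ (φ (sg Q' a _)) (m : M) = psi F _ • (m : M) at h5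
  rw [E.sg _ _ ha ht'] at h5
  rw [sg_add ha' (by rw [E.bl, ht']) (by simp [hx]), rho_mul, h4, map_smul, h5, smul_smul,
    ← psi_add]
  congr 2
  simp only [map_add, map_smul, LinearMap.add_apply, LinearMap.smul_apply, smul_eq_mul, ← hc]
  ring

theorem tau_eq (hF : ∀ c : F, c = 0 ∨ c = 1) (ha : Q' a = 0) (hb : Q' b = 0)
    (hab : bl Q' a b = 0) (hm : m ∈ wsp (wspRep ρ φ e x E.fix) a z)
    (h0 : wsp (wspRep ρ φ e x E.fix) a (z + (ε + 1 + Q x * bl Q' b z) • b) = ⊥) :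
    tau E hex ρ ha m = psi F ε • m := by
  have h1 : psi F (ε + 1) = -psi F ε := by
    rw [psi_add, (psi_cases (1 : F)).resolve_left (psi_ne F), mul_neg_one]
  have h2 := tau_mem_wsp E hex ρ (m := m - psi F ε • tau E hex ρ ha m) hF ha hb hab (z := z)
    (ε := ε + 1) ((wsp _ a z).sub_mem hm ((wsp _ a z).smul_mem _ fun t ht => by
      rw [tau_comm E hex ρ ha ht, hm t ht, map_smul])) (by
      rw [map_sub, map_smul, tau_tau, h1, neg_smul, smul_sub, smul_smul, psi_mul_self, one_smul,
        neg_sub])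
  rw [h0, Submodule.mem_bot] at h2
  have h4 := congrArg (tau E hex ρ hb) h2
  rw [tau_tau, map_zero, sub_eq_zero] at h4
  conv_rhs => rw [h4]
  rw [smul_smul, psi_mul_self, one_smul]

end Special

section Special

variable {F V W : Type} [Field F] [CharP F 2] [Fintype F] [DecidableEq F] [AddCommGroup V]
  [Module F V] [FiniteDimensional F V] [AddCommGroup W] [Module F W] [FiniteDimensional F W]
variable {Q : QuadraticForm F V} {Q' : QuadraticForm F W} {e x : V} {i : W →ₗ[F] V}
  {φ : Om Q' →* Om Q}
variable {M : Type} [AddCommGroup M] [Module ℂ M]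

theorem eq_zero_of_eq_neg {m : M} (h : m = -m) : m = 0 := by
  have h1 : (2 : ℂ) • m = 0 := by rw [two_smul, ← sub_neg_eq_add, ← h, sub_self]
  exact (smul_eq_zero.1 h1).resolve_left two_ne_zero

theorem eq_zero_or_one (hq : Fintype.card F = 2) (c : F) : c = 0 ∨ c = 1 := by
  by_contra hc
  push Not at hc
  have := card_le_univ ({c, 0, 1} : Finset F)
  rw [card_eq_three.2 ⟨c, 0, 1, hc.1, hc.2, zero_ne_one, rfl⟩] at this
  omega

/-- The shape of a small nontrivial representation of the group of type `(4, 1)` for `q = 2`. -/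
structure Small (σ : Representation ℂ (Om Q') M) : Prop where
  sing : ∀ a z, Q' a = 0 → a ≠ 0 → bl Q' a z = 0 → z ∉ span F {a} → Q' z = 0 →
    wsp σ a z = ⊥
  nonsing : ∀ a z, Q' a = 0 → a ≠ 0 → bl Q' a z = 0 → Q' z ≠ 0 → wsp σ a z ≠ ⊥
  zero : ∀ a, Q' a = 0 → a ≠ 0 → finrank ℂ (wsp σ a 0) < 6

theorem Small.mk' [FiniteDimensional ℂ M] (hq : Fintype.card F = 2) (h : IsType Q' 4 1)
    (σ : Representation ℂ (Om Q') M) (hd : finrank ℂ M < 34) {g : Om Q'} {m : M}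
    (hg : σ g m ≠ m) : Small σ := by
  have : Finite W := finite_of_finite F
  obtain ⟨b, hb⟩ := h.exists_finrank_sing (by omega) σ
  obtain ⟨c, hc⟩ := h.exists_finrank_nonsing (by omega) σ
  have key : ∀ a, Q' a = 0 → a ≠ 0 → finrank ℂ M = finrank ℂ (wsp σ a 0) + 35 * b + 28 * c := by
    intro a ha ha0
    obtain ⟨a', hp, -⟩ := exists_hyp h.nondeg (U := ∅) ha (by simpa using ha0) (by simp)
    have := IsType.finrank_eq (k := 2) h hp σ hb hc
    rw [hq, nS, nN] at this
    norm_num at this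
    exact_mod_cast this
  obtain ⟨e, x, he, he0, hex, hx, v, hv, hv0⟩ := exists_wsp_of_nontrivial h.nondeg hg
  have hne : wsp σ e x ≠ ⊥ := fun h0 => hv0 (by rwa [h0, Submodule.mem_bot] at hv)
  have h1 := key e he he0
  have hb0 : b = 0 := by omega
  have hc0 : c ≠ 0 := fun hc0 => hne <| Submodule.finrank_eq_zero.1 <| by
    by_cases hx0 : Q' x = 0
    · rw [hb e x he he0 hex hx hx0, hb0]
    · rw [hc e x he he0 hex hx0, hc0]
  exact ⟨fun a z ha ha0 haz hz hz0 => Submodule.finrank_eq_zero.1 ((hb a z ha ha0 haz hz hz0).trans hb0),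
    fun a z ha ha0 haz hz0 h0 => hc0 ((hc a z ha ha0 haz hz0).symm.trans
      (Submodule.finrank_eq_zero.2 h0)), fun a ha ha0 => by have := key a ha ha0; omega⟩

variable (E : Emb Q Q' e x i φ) (hex : bl Q e x = 0) (ρ : Representation ℂ (Om Q) M)
variable {a b z : W} {m : wsp ρ e x}

theorem Small.tau_nonsing (hs : Small (wspRep ρ φ e x E.fix)) (h : IsType Q' 4 1)
    (hF : ∀ c : F, c = 0 ∨ c = 1) (ha : Q' a = 0) (ha0 : a ≠ 0) (haz : bl Q' a z = 0)
    (hz : Q' z ≠ 0) (hm : m ∈ wsp (wspRep ρ φ e x E.fix) a z) :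
    tau E hex ρ ha m = psi F (Q x) • m := by
  have h3 := two_eq F
  obtain ⟨b, hab, hb, hzb⟩ : ∃ b, bl Q' a b = 0 ∧ Q' b = 0 ∧ bl Q' z b = 1 := by
    obtain ⟨w, hw, hzw⟩ := exists_perp h.nondeg (notMem_of_nonsing ha hz)
    rw [perp_singleton] at hw
    by_cases hw0 : Q' w = 0
    · exact ⟨w, hw, hw0, hzw⟩
    · obtain ⟨y, hy, -, hyw⟩ := h.exists_nonsing (U := {a, z, w})
        (finrank_span_insert_le (finrank_span_insert_le finrank_span_singleton_le))
        (by norm_num) hw0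
      simp only [perp_insert, perp_singleton] at hy
      refine ⟨w + y, by rw [map_add, hw, hy.1, add_zero], ?_, by rw [map_add, hzw, hy.2.1, add_zero]⟩
      rw [Q_add, hyw, hy.2.2]
      grind
  have hbz : bl Q' b z = 1 := by rw [bl_comm, hzb]
  have h1 : z + (Q x + 1 + Q x * bl Q' b z) • b = z + b := by
    rw [hbz]
    match_scalars <;> grind
  refine tau_eq E hex ρ hF ha hb hab hm ?_
  rw [h1]
  refine hs.sing _ _ ha ha0 (by rw [map_add, haz, hab, add_zero])
    (notMem_of_bl (Q := Q') (w := z) (by simpa using haz) (by simp [hbz])) ?_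
  rw [Q_add, hb, hzb, (hF _).resolve_left hz]
  grind

theorem Small.mem_wsp_zero (hs : Small (wspRep ρ φ e x E.fix)) (h : IsType Q' 4 1)
    (hF : ∀ c : F, c = 0 ∨ c = 1) (hx : Q x ≠ 0) (ha : Q' a = 0) (ha0 : a ≠ 0)
    (hm : tau E hex ρ ha m = m) : m ∈ wsp (wspRep ρ φ e x E.fix) a 0 := by
  classical
  have : Finite W := finite_of_finite F
  have := Fintype.ofFinite W
  set σ := wspRep ρ φ e x E.fix with hσ
  obtain ⟨a', hp, -⟩ := exists_hyp h.nondeg (U := ∅) ha (by simpa using ha0) (by simp)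
  have hP := fun y : hc Q' a a' => wproj_isProj σ hp y (hp.be y)
  have hcomm : ∀ y : hc Q' a a', tau E hex ρ ha (wproj σ a a' y m) = wproj σ a a' y m := by
    intro y
    conv_rhs => rw [← hm]
    simp only [wproj, LinearMap.smul_apply, LinearMap.sum_apply, map_smul, map_sum]
    congr 1
    refine sum_congr rfl fun w _ => ?_
    rw [← tau_comm E hex ρ ha (hp.be w)]
  have h0 : ∀ y : hc Q' a a', y ≠ 0 → wproj σ a a' y m = 0 := by
    intro y hy
    by_cases hy0 : Q' y = 0
    · have := (hP y).map_mem m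
      rwa [hs.sing a y ha ha0 (hp.be y) (notMem_span_of_hc hp hy) hy0, Submodule.mem_bot] at this
    · have := hs.tau_nonsing E hex ρ h hF ha ha0 (hp.be y) hy0 ((hP y).map_mem m)
      rw [hcomm, (hF _).resolve_left hx, (psi_cases (1 : F)).resolve_left (psi_ne F),
        neg_one_smul] at this
      exact eq_zero_of_eq_neg this
  have h1 := LinearMap.congr_fun (sum_wproj σ h.nondeg hp) m
  rw [LinearMap.sum_apply, sum_eq_single 0 (fun y _ hy => h0 y hy) (by simp)] at h1
  have h2 := (hP 0).map_mem m
  rwa [h1] at h2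

/-- For nonsingular `x` a small representation on `wsp ρ e x` is trivial. -/
theorem not_small [FiniteDimensional ℂ M] (hex : bl Q e x = 0) (hq : Fintype.card F = 2)
    (h : IsType Q' 4 1) (hx : Q x ≠ 0) : ¬ Small (wspRep ρ φ e x E.fix) := by
  intro hs
  have hF := eq_zero_or_one hq
  have hx1 := (hF _).resolve_left hx
  have h3 := two_eq F
  obtain ⟨a, -, ha0, ha⟩ := h.exists_sing (U := ∅) (u := 0) (by simp) (by norm_num)
  replace ha0 : a ≠ 0 := by simpa using ha0
  obtain ⟨b, hab, hba, hb⟩ := h.exists_sing finrank_span_singleton_le (by norm_num)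
  have hb0 : b ≠ 0 := fun h0 => hba (by rw [h0]; exact zero_mem _)
  rw [perp_singleton] at hab
  obtain ⟨b', hp, hab'⟩ := exists_hyp h.nondeg (U := {a}) hb hba (by simpa using hab)
  rw [perp_singleton] at hab'
  obtain ⟨z, hz, hzn, hz1⟩ := h.exists_nonsing (U := {a, b, b'})
    (finrank_span_insert_le (finrank_span_insert_le finrank_span_singleton_le))
    (by norm_num) one_ne_zero
  simp only [perp_insert, perp_singleton] at hz
  obtain ⟨haz, hbz, hbz'⟩ := hz
  have hz0 : Q' z ≠ 0 := by rw [hz1]; exact one_ne_zero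
  set σ := wspRep ρ φ e x E.fix with hσ
  obtain ⟨m, hm, hm0⟩ := Submodule.exists_mem_ne_zero_of_ne_bot (hs.nonsing a z ha ha0 haz hz0)
  have hτa := hs.tau_nonsing E hex ρ h hF ha ha0 haz hz0 hm
  have h4 := tau_mem_wsp E hex ρ hF ha hb hab hm hτa
  rw [hbz, mul_zero, add_zero, hx1, one_smul] at h4
  set n := m + tau E hex ρ hb m with hn
  have hn1 : n ∈ wsp σ b 0 := hs.mem_wsp_zero E hex ρ h hF hx hb hb0 (by
    rw [hn, map_add, tau_tau, add_comm])
  have hn0 : n ≠ 0 := by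
    intro h0
    have h5 : m = -tau E hex ρ hb m := eq_neg_of_add_eq_zero_left h0
    refine hm0 (wsp_disjoint σ (w := b') (y := z + b) hab' ?_ hm (by rw [h5]; exact neg_mem h4))
    rw [map_add, hp.fe, hbz', zero_add, psi_zero]
    exact (psi_ne F).symm
  obtain ⟨t, ht, hzt⟩ := exists_perp h.nondeg hzn
  simp only [perp_insert, perp_singleton] at ht
  have hfix : ∀ g, (hp.ext g).1 b = b ∧ (hp.ext g).1 0 = 0 := fun g => ⟨hp.ext_e g, map_zero _⟩
  have h5 : TrivialBelow F (1 + 2) 1 6 :=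
    trivialBelow_of_le (by omega) (by rw [hq, nN]; norm_num) (.inl (by rw [hq, nS]; norm_num))
  have h6 := h5 _ _ (hp.isType h (by norm_num)) _ (wspRep σ hp.ext b 0 hfix)
    (by exact_mod_cast hs.zero b hb hb0)
    (sg _ ⟨a, by simp [bl_comm Q' _ a, hab', hab]⟩ ⟨t, by simp [ht]⟩) ⟨n, hn1⟩
  have h7 : σ (sg Q' a t) n = n := by
    rw [← hp.ext_sg (a := ⟨a, _⟩) (w := ⟨t, _⟩) ha ht.1]
    exact congrArg Subtype.val h6
  have h8 : σ (sg Q' a t) n = -n := by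
    rw [hn, map_add, hm t ht.1, h4 t ht.1, map_add (bl Q' t), bl_comm Q' t z, bl_comm Q' t b, hzt, ht.2.1,
      add_zero, (psi_cases (1 : F)).resolve_left (psi_ne F), neg_one_smul, neg_one_smul, neg_add]
  exact hn0 (eq_zero_of_eq_neg (h7.symm.trans h8))

end Special

section Special

variable {F V W : Type} [Field F] [CharP F 2] [Fintype F] [DecidableEq F] [AddCommGroup V]
  [Module F V] [FiniteDimensional F V] [AddCommGroup W] [Module F W] [FiniteDimensional F W]
variable {Q : QuadraticForm F V} {Q' : QuadraticForm F W} {e x : V} {i : W →ₗ[F] V}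
  {φ : Om Q' →* Om Q}
variable {M : Type} [AddCommGroup M] [Module ℂ M] [FiniteDimensional ℂ M]

/-- For singular `x` a small representation on `wsp ρ e x` is trivial. -/
theorem not_small_sing (E : Emb Q Q' e x i φ) (hex : bl Q e x = 0) (ρ : Representation ℂ (Om Q) M)
    (hq : Fintype.card F = 2) (hQ : Nondeg Q) (h : IsType Q' 4 1) (hx : Q x = 0) {f y : V}
    (hef : Hyp Q e f) (he : Perp Q {x, y} e) (hf : Perp Q {x, y} f) (hxy : bl Q x y = 1)
    (hi : ∀ w, Perp Q {e, f, x, y} (i w)) (hs : ∀ v, Perp Q {e, f, x, y} v → ∃ w, i w = v)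
    (hT : ∀ a z, Q a = 0 → a ≠ 0 → bl Q a z = 0 → Q z ≠ 0 → TT ρ a z) :
    ¬ Small (wspRep ρ φ e x E.fix) := by
  classical
  intro hsm
  have : Finite V := finite_of_finite F
  have := Fintype.ofFinite V
  have h3 := two_eq F
  have hF := eq_zero_or_one hq
  have hpsi : ∀ s s' : F, psi F s = psi F s' → s = s' := by
    intro s s' h0
    rcases hF s with rfl | rfl <;> rcases hF s' with rfl | rfl
    · rfl
    · exact absurd (h0.symm.trans (psi_zero)) (psi_ne F)
    · exact absurd (h0.trans (psi_zero)) (psi_ne F)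
    · rfl
  simp only [perp_insert, perp_singleton] at he hf hi hs
  obtain ⟨a, -, ha0, ha⟩ := h.exists_sing (U := ∅) (u := 0) (by simp) (by norm_num)
  replace ha0 : a ≠ 0 := by simpa using ha0
  obtain ⟨a', hp, -⟩ := exists_hyp h.nondeg (U := ∅) ha (by simpa using ha0) (by simp)
  obtain ⟨z, hz, hzn, hz1⟩ := h.exists_nonsing (U := {a, a'})
    (finrank_span_insert_le finrank_span_singleton_le) (by norm_num) one_ne_zero
  simp only [perp_insert, perp_singleton] at hz
  have hz0 : Q' z ≠ 0 := by rw [hz1]; exact one_ne_zero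
  obtain ⟨v, hv, hv0⟩ := Submodule.exists_mem_ne_zero_of_ne_bot (hsm.nonsing a z ha ha0 hz.1 hz0)
  have hτ := congrArg Subtype.val (hsm.tau_nonsing E hex ρ h hF ha ha0 hz.1 hz0 hv)
  change ρ (sg Q (i a) x) (v : M) = psi F (Q x) • (v : M) at hτ
  have hQa : Q (i a) = 0 := by rw [E.quad, ha]
  have hia : i a ≠ 0 := fun h0 => one_ne_zero <| hp.ef.symm.trans (by rw [← E.bl, h0]; simp)
  have hI : Hyp Q (i a) (i a') := ⟨hQa, by rw [E.quad, hp.f0], by rw [E.bl, hp.ef]⟩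
  obtain ⟨ip, hip, -, hpos⟩ := exists_ip ρ
  have key : ∀ Z : hc Q (i a) (i a'), ∀ n ∈ wsp ρ (i a) Z, ip v n = 0 := by
    intro Z n hn
    have hK : ∀ g s s', ρ g v = psi F s • (v : M) → ρ g n = psi F s' • n → ip v n ≠ 0 → s = s' := by
      intro g s s' h1 h2 h0
      have h4 := hip g v n
      simp only [h1, h2, LinearMap.map_smulₛₗ, LinearMap.smul_apply, psi_conj, RingHom.id_apply,
        smul_eq_mul] at h4
      refine hpsi s s' ?_
      have h5 : psi F s * psi F s' = 1 := mul_right_cancel₀ h0 (by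
        linear_combination h4)
      calc psi F s = psi F s * (psi F s' * psi F s') := by rw [psi_mul_self, mul_one]
        _ = psi F s' := by rw [← mul_assoc, h5, one_mul]
    by_contra h0
    have hC : ∀ t s, bl Q (i a) t = 0 → ρ (sg Q (i a) t) v = psi F s • (v : M) → s = bl Q t Z :=
      fun t s ht hs => hK _ _ _ hs (hn t ht) h0
    have hCe : 0 = bl Q e Z := hC _ _ (by rw [bl_comm, (hi a).1]) <| by
      rw [sg_swap hQa hef.e0 (by rw [bl_comm, (hi a).1]), v.2 _ (hi a).1, bl_comm, (hi a).2.2.1]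
    have hCx : 0 = bl Q x Z := hC _ _ (by rw [bl_comm, (hi a).2.2.1]) (by rw [hτ, hx])
    have hCw : ∀ w, bl Q' a w = 0 → bl Q' w z = bl Q (i w) Z := fun w hw =>
      hC _ _ (by rw [E.bl, hw]) <| by
        rw [← E.sg a w ha hw]
        exact congrArg Subtype.val (hv w hw)
    have hZ : (Z : V) = i z + bl Q f Z • e + bl Q y Z • x := by
      obtain ⟨d, hd⟩ := hs (Z + (i z + bl Q f Z • e + bl Q y Z • x)) (by
        simp only [map_add, map_smul, bl_self, ← hCe, ← hCx, hi z, he, hf, hef.fe, hex, hxy,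
          bl_comm Q f x, bl_comm Q y x, smul_eq_mul]
        grind)
      have hd0 : d = 0 := h.nondeg d fun w => by
        have h4 : ∀ w, bl Q' a w = 0 → bl Q' d w = 0 := by
          intro w hw
          rw [← E.bl, hd]
          simp [(hi w).1, (hi w).2.2.1, E.bl, bl_comm Q Z, ← hCw w hw, bl_comm Q' w,
            CharTwo.add_self_eq_zero]
        have h5 : bl Q' d a' = 0 := by
          rw [← E.bl, hd]
          simp [(hi a').1, (hi a').2.2.1, E.bl, bl_comm Q Z, hI.bf Z, bl_comm Q' z, hz.2]
        have h6 := h4 (w + bl Q' a w • a') (by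
          simp [hp.ef, CharTwo.add_self_eq_zero])
        simpa [h5] using h6
      rw [hd0, map_zero] at hd
      have h7 := add_add_cancel_v F (Z : V) (i z + bl Q f Z • e + bl Q y Z • x)
      rwa [← hd, add_zero] at h7
    have hQZ : Q Z ≠ 0 := by
      rw [hZ]
      simp only [Q_add, Q_smul, E.quad, hz1, hef.e0, hx, map_add, LinearMap.add_apply, map_smul,
        LinearMap.smul_apply, hex, bl_comm Q _ e, bl_comm Q _ x, hi z]
      simp
    obtain ⟨t₀, ht₀, hzt⟩ := exists_perp h.nondeg hzn
    simp only [perp_insert, perp_singleton] at ht₀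
    set t := bl Q y Z • t₀ with ht
    have hat : bl Q' a t = 0 := by rw [ht, map_smul, ht₀.1, smul_zero]
    have hta : bl Q (i t) Z = bl Q y Z := by
      rw [← hCw t hat, ht, map_smul, LinearMap.smul_apply, bl_comm Q' _ z, hzt, smul_eq_mul, mul_one]
    have h4 := hT (i a) Z hQa hia (hI.be Z) hQZ e (y + i t) (by
      simp [bl_comm Q _ e, (hi a).1, ← hCe]) (by
      simp [bl_comm Q _ y, bl_comm Q _ (i t), (hi a).2.2.2, hta, E.bl, bl_comm Q' t, hat,
        CharTwo.add_self_eq_zero]) n hn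
    refine one_ne_zero (hK (sg Q e (y + i t)) 1 0 ?_ (by rw [h4, psi_zero, one_smul]) h0)
    rw [v.2 _ (by rw [map_add, (hi t).1, bl_comm, he.2, add_zero])]
    simp [bl_comm Q _ x, hxy, (hi t).2.2.1]
  have h4 := LinearMap.congr_fun (sum_wproj ρ hQ hI) (v : M)
  have h5 : ip v v = 0 := by
    nth_rewrite 2 [← LinearMap.id_apply (R := ℂ) (v : M)]
    rw [← h4, LinearMap.sum_apply, map_sum]
    exact sum_eq_zero fun Z _ => key Z _ ((wproj_isProj ρ hI _ (hI.be Z)).map_mem _)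
  have h6 := hpos v (fun h0 => hv0 (Subtype.ext h0))
  rw [h5] at h6
  exact lt_irrefl _ h6

end Special

section SpecialTT

variable {F V : Type} [Field F] [CharP F 2] [Fintype F] [DecidableEq F] [AddCommGroup V]
  [Module F V] [FiniteDimensional F V] {Q : QuadraticForm F V} {e x : V}
variable {M : Type} [AddCommGroup M] [Module ℂ M] [FiniteDimensional ℂ M]

theorem TT0_of_not_small (hq : Fintype.card F = 2) (h : IsType Q (4 + 2) 1)
    (ρ : Representation ℂ (Om Q) M) (hw : finrank ℂ (wsp ρ e x) < 34) (hex : bl Q e x = 0)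
    (hT : Q x = 0 → ∀ a z, Q a = 0 → a ≠ 0 → bl Q a z = 0 → Q z ≠ 0 → TT ρ a z) : TT0 ρ e x := by
  intro f y hef he hf hxy hy a w ha hw' m hm
  by_cases haw : Q a = 0 ∧ bl Q a w = 0
  · obtain ⟨W, _, _, _, Q', i, φ, ht, hi, hib, hsurj, hp, hφ, hsg⟩ :=
      hef.exists_sub h (by norm_num) he hf hxy hy
    have E : Emb Q Q' e x i φ := ⟨hi, hib, fun w => (hp w).mono (by
      rintro _ (rfl | rfl) <;> simp), hφ, hsg⟩
    obtain ⟨a, rfl⟩ := hsurj a ha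
    obtain ⟨w, rfl⟩ := hsurj w hw'
    rw [← hsg a w (by rw [← hi, haw.1]) (by rw [← hib, haw.2])]
    by_contra h0
    have hs : Small (wspRep ρ φ e x E.fix) := Small.mk' hq ht _ hw (g := sg Q' a w) (m := ⟨m, hm⟩)
      fun h1 => h0 (congrArg Subtype.val h1)
    by_cases hx : Q x = 0
    · exact not_small_sing E hex ρ hq h.nondeg ht hx hef he hf hxy hp hsurj (hT hx) hs
    · exact not_small E ρ hex hq ht hx hs
  · rw [sg_junk haw, rho_one]

theorem TTall_special (hq : Fintype.card F = 2) (h : IsType Q (4 + 2) 1)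
    (ρ : Representation ℂ (Om Q) M) (hd : finrank ℂ M < 16385) : TTall ρ := by
  have hw : ∀ e x, Q e = 0 → e ≠ 0 → bl Q e x = 0 → x ∉ span F {e} →
      finrank ℂ (wsp ρ e x) < 34 := by
    intro e x he he0 hex hx
    have h1 := h.le_finrank (.inl (by norm_num)) ρ he he0 hex hx
    rw [hq, nS, nN] at h1
    norm_num at h1
    by_cases hx0 : Q x = 0
    · have := h1.1 hx0
      omega
    · have := h1.2 hx0
      omega
  have hT : ∀ a z, Q a = 0 → a ≠ 0 → bl Q a z = 0 → Q z ≠ 0 → TT ρ a z := by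
    intro a z ha ha0 haz hz
    have hza := notMem_of_nonsing ha hz
    exact TT_of_TT0 ρ h ha ha0 hza haz (.inl (by norm_num))
      (TT0_of_not_small hq h ρ (hw a z ha ha0 haz hza) haz fun h0 => absurd h0 hz)
  exact TTall_of_TT0 h (.inl (by norm_num)) fun e x he he0 hex hx =>
    TT0_of_not_small hq h ρ (hw e x he he0 hex hx) hex fun _ => hT

end SpecialTT

section Degrees

/-- The numerators over `q ^ 2 - 1` of the small degrees, where `Y = q ^ (n - 1)`. -/
theorem degree_order {q Y a : ℝ} (hq : 2 ≤ q) (hY : q ^ 4 ≤ Y) (ha : a = 1 ∨ a = -1) :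
    q ^ 2 - 1 < (q * Y - a) * (Y - a) * (q - 1) ∧ q ^ 2 - 1 < (q * Y - a) * (Y + a * q) ∧
      (q * Y - a) * (Y - a) * (q - 1) < q ^ 2 * Y ^ 2 - q ^ 2 ∧
      (q * Y - a) * (Y + a * q) < q ^ 2 * Y ^ 2 - q ^ 2 ∧
      q ^ 2 * Y ^ 2 - q ^ 2 < (q * Y - a) * (Y + a) * (q + 1) := by
  obtain ⟨b, hb, rfl⟩ := exists_eq_add hq
  obtain ⟨c, hc, rfl⟩ := exists_eq_add hY
  rcases ha with rfl | rfl
  all_goals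
    refine ⟨?_, ?_, ?_, ?_, ?_⟩ <;>
    · rw [← sub_pos]
      ring_nf
      positivity

theorem degree_ne {q Y a : ℝ} (hq : q = 2 ∨ 4 ≤ q) (hY : q ^ 4 ≤ Y) (ha : a = 1 ∨ a = -1) :
    (q * Y - a) * (Y - a) * (q - 1) ≠ (q * Y - a) * (Y + a * q) := by
  rcases hq with rfl | hq
  · intro h
    have h1 : (2 * Y - a) * a = 0 := by linarith
    rcases ha with rfl | rfl <;> nlinarith
  · refine (lt_of_sub_pos ?_).ne'
    obtain ⟨b, hb, rfl⟩ := exists_eq_add hq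
    obtain ⟨c, hc, rfl⟩ := exists_eq_add hY
    rcases ha with rfl | rfl <;> ring_nf <;> positivity

theorem degree_lt_degBound {q : ℝ} {k : ℕ} {α : ℤ} (hq : 2 ≤ q) (hα : α = 1 ∨ α = -1) :
    (q ^ (k + 5) - α) * (q ^ (k + 4) + α) / (q - 1) < degBound (k + 5) q α := by
  rw [div_lt_iff₀ (by linarith)]
  have hZ : 1 ≤ q ^ k := one_le_pow₀ (by linarith)
  obtain ⟨a, ha, rfl⟩ := exists_eq_add hq
  by_cases h : k + 5 = 5 ∧ α = -1
  · obtain ⟨h1, rfl⟩ := h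
    obtain rfl : k = 0 := by omega
    simp only [degBound]
    norm_num
    rw [← sub_pos]
    ring_nf
    positivity
  · rw [degBound, if_neg h, show 4 * (k + 5) - 10 = k * 4 + 10 by omega]
    simp only [pow_add _ k, pow_add _ (k * 4), pow_mul]
    obtain ⟨b, hb, h1⟩ := exists_eq_add hZ
    rw [h1]
    rw [← sub_pos]
    rcases hα with rfl | rfl
    all_goals
      push_cast
      ring_nf
      positivity

end Degrees

section Classification

variable {F V : Type} [Field F] [CharP F 2] [Fintype F] [DecidableEq F] [AddCommGroup V]
  [Module F V] [FiniteDimensional F V] {Q : QuadraticForm F V} {k : ℕ} {α : ℤ}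
variable {M : Type} [AddCommGroup M] [Module ℂ M] [FiniteDimensional ℂ M]

theorem TTall_of_lt_degBound (h : IsType Q (k + 5) α) (hF : Fintype.card F = 2 ∨ 4 ≤ Fintype.card F)
    (hexc : ¬(k = 0 ∧ Fintype.card F = 2 ∧ α = 1)) (ρ : Representation ℂ (Om Q) M)
    (hd : (finrank ℂ M : ℝ) < degBound (k + 5) (Fintype.card F) α) : TTall ρ := by
  by_cases hsp : k = 1 ∧ Fintype.card F = 2 ∧ α = 1
  · obtain ⟨rfl, hq, rfl⟩ := hsp
    refine TTall_special hq h ρ ?_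
    rw [degBound, hq] at hd
    norm_num at hd
    exact_mod_cast hd
  have key : ∃ d, TrivialBelow F (k + 3) α d ∧
      degBound (k + 5) (Fintype.card F) α ≤ nS (Fintype.card F) α (k + 3) * d ∧
      degBound (k + 5) (Fintype.card F) α ≤ nN (Fintype.card F) α (k + 3) * d := by
    rcases h.sign with rfl | rfl
    · rcases hF with hq | hq
      · obtain ⟨j, rfl⟩ : ∃ j, k = j + 2 := ⟨k - 2, by omega⟩
        exact exists_trivialBelow_plus_two hq
      · exact exists_trivialBelow_plus hq
    · rcases k with _ | j
      · exact exists_trivialBelow_five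
      · exact exists_trivialBelow_minus
  obtain ⟨d, hT, hS, hN⟩ := key
  exact TTall_of_TT0 h (.inl (by omega)) fun e x he he0 hex hx =>
    TT0_of_trivialBelow (k := k + 3) h (by omega) hT ρ (finrank_wsp_lt (k := k + 3) h
      (.inl (by omega)) ρ (hd.trans_le hS) (hd.trans_le hN) he he0 hex hx)

theorem cip_of_lt_degBound (h : IsType Q (k + 5) α)
    (hF : Fintype.card F = 2 ∨ 4 ≤ Fintype.card F)
    (hexc : ¬(k = 0 ∧ Fintype.card F = 2 ∧ α = 1)) (ρ : Representation ℂ (Om Q) M) [Nontrivial M]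
    (hd : (finrank ℂ M : ℝ) < degBound (k + 5) (Fintype.card F) α) :
    cip ρ.character (pchar (Om Q) (Xs Q (0 : F))) ≠ 0 ∨
      cip ρ.character (pchar (Om Q) (Xs Q (1 : F))) ≠ 0 := by
  by_cases ht : ∀ g m, ρ g m = m
  · obtain ⟨t, ht0⟩ := exists_ne (0 : M)
    obtain ⟨x, -, hx, -⟩ := h.exists_sing (U := ∅) (u := 0) (by simp) (by omega)
    exact cip_ne_zero_of_fixed h (by omega) ρ (x := x) (by simpa using hx) ht0 fun g _ => ht g t
  · push Not at ht
    obtain ⟨g, m, hg⟩ := ht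
    exact h.cip_of_TTall (.inl (by omega)) (TTall_of_lt_degBound h hF hexc ρ hd) hg

theorem classification {n : ℕ} (hn : 5 ≤ n) (h : IsType Q n α)
    (hF : Fintype.card F = 2 ∨ 4 ≤ Fintype.card F)
    (hexc : ¬(n = 5 ∧ Fintype.card F = 2 ∧ α = 1)) :
    (∀ χ : Om Q → ℂ, IrrChar χ → (degBound n (Fintype.card F) α ≤ (χ 1).re ∨ χ 1 = 1 ∨
        χ 1 = ((Fintype.card F : ℂ) ^ n - (α : ℂ)) *
          ((Fintype.card F : ℂ) ^ (n - 1) + (α : ℂ) * Fintype.card F) /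
            ((Fintype.card F : ℂ) ^ 2 - 1) ∨
        χ 1 = ((Fintype.card F : ℂ) ^ (2 * n) - (Fintype.card F : ℂ) ^ 2) /
          ((Fintype.card F : ℂ) ^ 2 - 1) ∨
        (∃ β : ℤ, (β = 1 ∨ β = -1) ∧
          χ 1 = ((Fintype.card F : ℂ) ^ n - (α : ℂ)) *
            ((Fintype.card F : ℂ) ^ (n - 1) + (α : ℂ) * (β : ℂ)) /
              ((Fintype.card F : ℂ) - (β : ℂ))))) ∧
    {χ : Om Q → ℂ | IrrChar χ ∧ χ 1 = 1}.ncard = 1 ∧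
    {χ : Om Q → ℂ | IrrChar χ ∧ χ 1 = ((Fintype.card F : ℂ) ^ n - (α : ℂ)) *
      ((Fintype.card F : ℂ) ^ (n - 1) + (α : ℂ) * Fintype.card F) /
        ((Fintype.card F : ℂ) ^ 2 - 1)}.ncard = 1 ∧
    {χ : Om Q → ℂ | IrrChar χ ∧ χ 1 = ((Fintype.card F : ℂ) ^ (2 * n) -
      (Fintype.card F : ℂ) ^ 2) / ((Fintype.card F : ℂ) ^ 2 - 1)}.ncard = 1 ∧
    (∀ β : ℤ, (β = 1 ∨ β = -1) →
      (2 * ({χ : Om Q → ℂ | IrrChar χ ∧ χ 1 = ((Fintype.card F : ℂ) ^ n - (α : ℂ)) *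
        ((Fintype.card F : ℂ) ^ (n - 1) + (α : ℂ) * (β : ℂ)) /
          ((Fintype.card F : ℂ) - (β : ℂ))}.ncard) : ℤ) = Fintype.card F - β - 1) := by
  obtain ⟨k, rfl⟩ : ∃ k, n = k + 5 := ⟨n - 5, by omega⟩
  obtain ⟨sA, sB, E₁, E₂, eA, eB, e1, e2, cA, cB, hl⟩ := list_chars (k := k + 3) h (by omega)
  have hq2 : (2 : ℝ) ≤ Fintype.card F := by exact_mod_cast two_le_card F
  have hα : (α : ℝ) = 1 ∨ (α : ℝ) = -1 := by exact_mod_cast h.sign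
  have hF' : (Fintype.card F : ℝ) = 2 ∨ (4 : ℝ) ≤ Fintype.card F := by exact_mod_cast hF
  have hY : (Fintype.card F : ℝ) ^ 4 ≤ (Fintype.card F : ℝ) ^ (k + 4) :=
    pow_le_pow_right₀ (by linarith) (by omega)
  obtain ⟨o1, o2, o3, o4, o5⟩ := degree_order hq2 hY hα
  have o6 := degree_ne hF' hY hα
  have o7 := degree_lt_degBound (k := k) hq2 h.sign
  have key : ∀ (χ : Om Q → ℂ) (r : ℝ), IrrChar χ → χ 1 = (r : ℂ) →
      r < degBound (k + 5) (Fintype.card F) α →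
      χ = (fun _ => 1) ∨ χ ∈ sA ∨ χ ∈ sB ∨ χ = E₁ ∨ χ = E₂ := by
    intro χ r hχ hr hrD
    refine hl χ hχ ?_
    obtain ⟨M, _, _, _, ρ, hirr, rfl⟩ := hχ
    have hM : Nontrivial M := by
      by_contra hM
      rw [not_nontrivial_iff_subsingleton] at hM
      obtain ⟨p, p', hp⟩ := hirr.toNontrivial
      exact hp (Subrepresentation.toSubmodule_injective (Subsingleton.elim _ _))
    refine cip_of_lt_degBound h hF (by simpa using hexc) ρ ?_
    rw [Representation.char_one] at hr
    rwa [show (finrank ℂ M : ℝ) = r by exact_mod_cast hr]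
  simp only [show k + 3 + 2 = k + 5 from rfl, show k + 3 + 1 = k + 4 from rfl,
    show k + 5 - 1 = k + 4 from rfl] at *
  generalize hQ : (Fintype.card F : ℝ) = q at *
  have hQ' : (Fintype.card F : ℂ) = (q : ℂ) := by rw [← hQ]; simp
  have hq1 : 0 < q - 1 := by linarith
  have hq3 : 0 < q + 1 := by linarith
  have hqq : 0 < q ^ 2 - 1 := by nlinarith
  set rA : ℝ := (q ^ (k + 5) - α) * (q ^ (k + 4) + α) / (q - 1) with hrA
  set rB : ℝ := (q ^ (k + 5) - α) * (q ^ (k + 4) - α) / (q + 1) with hrB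
  set r1 : ℝ := (q ^ (2 * (k + 5)) - q ^ 2) / (q ^ 2 - 1) with hr1
  set r2 : ℝ := (q ^ (k + 5) - α) * (q ^ (k + 4) + α * q) / (q ^ 2 - 1) with hr2
  have nA : rA * (q ^ 2 - 1) = (q * q ^ (k + 4) - α) * (q ^ (k + 4) + α) * (q + 1) := by
    rw [hrA]; field_simp; ring
  have nB : rB * (q ^ 2 - 1) = (q * q ^ (k + 4) - α) * (q ^ (k + 4) - α) * (q - 1) := by
    rw [hrB]; field_simp; ring
  have n1 : r1 * (q ^ 2 - 1) = q ^ 2 * (q ^ (k + 4)) ^ 2 - q ^ 2 := by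
    rw [hr1, div_mul_cancel₀ _ hqq.ne']; ring
  have n2 : r2 * (q ^ 2 - 1) = (q * q ^ (k + 4) - α) * (q ^ (k + 4) + α * q) := by
    rw [hr2, div_mul_cancel₀ _ hqq.ne']; ring
  rw [← nB] at o1 o3 o6
  rw [← n2] at o2 o4 o6
  rw [← n1] at o3 o4 o5
  rw [← nA] at o5
  replace o1 : 1 < rB := by nlinarith
  replace o2 : 1 < r2 := by nlinarith
  replace o3 : rB < r1 := lt_of_mul_lt_mul_right o3 hqq.le
  replace o4 : r2 < r1 := lt_of_mul_lt_mul_right o4 hqq.le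
  replace o5 : r1 < rA := lt_of_mul_lt_mul_right o5 hqq.le
  replace o6 : rB ≠ r2 := fun h0 => o6 (by rw [h0])
  have vA : ((q : ℂ) ^ (k + 5) - α) * ((q : ℂ) ^ (k + 4) + α) / ((q : ℂ) - 1) = (rA : ℂ) := by
    rw [hrA]; push_cast; rfl
  have vB : ((q : ℂ) ^ (k + 5) - α) * ((q : ℂ) ^ (k + 4) - α) / ((q : ℂ) + 1) = (rB : ℂ) := by
    rw [hrB]; push_cast; rfl
  have v1 : ((q : ℂ) ^ (2 * (k + 5)) - (q : ℂ) ^ 2) / ((q : ℂ) ^ 2 - 1) = (r1 : ℂ) := by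
    rw [hr1]; push_cast; rfl
  have v2 : ((q : ℂ) ^ (k + 5) - α) * ((q : ℂ) ^ (k + 4) + α * q) / ((q : ℂ) ^ 2 - 1) =
      (r2 : ℂ) := by
    rw [hr2]; push_cast; rfl
  simp only [hQ', vA, vB, v1, v2] at eA eB e1 e2 ⊢
  have key' : ∀ (χ : Om Q → ℂ) (r : ℝ), IrrChar χ → χ 1 = (r : ℂ) →
      r < degBound (k + 5) q α → (χ = (fun _ => 1) ∧ r = 1) ∨ (χ ∈ sA ∧ r = rA) ∨
        (χ ∈ sB ∧ r = rB) ∨ (χ = E₁ ∧ r = r1) ∨ (χ = E₂ ∧ r = r2) := by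
    intro χ r hχ hr hrD
    rcases key χ r hχ hr hrD with h0 | h0 | h0 | h0 | h0
    · refine .inl ⟨h0, ?_⟩
      have h1 : (1 : ℂ) = r := by rw [← hr, h0]
      exact_mod_cast h1.symm
    · exact .inr (.inl ⟨h0, by exact_mod_cast hr.symm.trans (eA _ h0).2⟩)
    · exact .inr (.inr (.inl ⟨h0, by exact_mod_cast hr.symm.trans (eB _ h0).2⟩))
    · exact .inr (.inr (.inr (.inl ⟨h0, by subst h0; exact_mod_cast hr.symm.trans e1.2⟩)))
    · exact .inr (.inr (.inr (.inr ⟨h0, by subst h0; exact_mod_cast hr.symm.trans e2.2⟩)))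
  have hr : ∀ χ : Om Q → ℂ, IrrChar χ → χ 1 = ((χ 1).re : ℂ) := by
    rintro _ ⟨M, _, _, _, ρ, -, rfl⟩
    rw [Representation.char_one]
    simp
  refine ⟨fun χ hχ => ?_, ?_, ?_, ?_, ?_⟩
  · by_cases hD : degBound (k + 5) q α ≤ (χ 1).re
    · exact .inl hD
    rcases key' χ _ hχ (hr χ hχ) (not_le.1 hD) with h0 | h0 | h0 | h0 | h0
    · exact .inr (.inl (by rw [hr χ hχ, h0.2]; simp))
    · exact .inr (.inr (.inr (.inr ⟨1, .inl rfl, by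
        rw [hr χ hχ, h0.2, ← vA]; push_cast; rw [mul_one]⟩)))
    · exact .inr (.inr (.inr (.inr ⟨-1, .inr rfl, by
        rw [hr χ hχ, h0.2, ← vB]; push_cast; rw [mul_neg_one, sub_neg_eq_add]; rfl⟩)))
    · exact .inr (.inr (.inr (.inl (by rw [hr χ hχ, h0.2]))))
    · exact .inr (.inr (.inl (by rw [hr χ hχ, h0.2])))
  · rw [Set.ncard_eq_one]
    refine ⟨fun _ => 1, Set.ext fun χ => ⟨fun ⟨h1, h2⟩ => ?_, ?_⟩⟩
    · rcases key' χ 1 h1 (by rw [h2]; simp) (by linarith) with h0 | h0 | h0 | h0 | h0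
      · exact h0.1
      all_goals
        exfalso
        linarith [h0.2]
    · rintro rfl
      exact ⟨isChar_one, rfl⟩
  · rw [Set.ncard_eq_one]
    refine ⟨E₂, Set.ext fun χ => ⟨fun ⟨h1, h2⟩ => ?_, ?_⟩⟩
    · rcases key' χ _ h1 h2 (by linarith) with h0 | h0 | h0 | h0 | h0
      · exfalso; linarith [h0.2]
      · exfalso; linarith [h0.2]
      · exact absurd h0.2.symm o6
      · exfalso; linarith [h0.2]
      · exact h0.1
    · rintro rfl
      exact e2
  · rw [Set.ncard_eq_one]
    refine ⟨E₁, Set.ext fun χ => ⟨fun ⟨h1, h2⟩ => ?_, ?_⟩⟩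
    · rcases key' χ _ h1 h2 (by linarith) with h0 | h0 | h0 | h0 | h0
      · exfalso; linarith [h0.2]
      · exfalso; linarith [h0.2]
      · exfalso; linarith [h0.2]
      · exact h0.1
      · exfalso; linarith [h0.2]
    · rintro rfl
      exact e1
  · rintro β (rfl | rfl)
    · rw [show {χ : Om Q → ℂ | IrrChar χ ∧ χ 1 = ((q : ℂ) ^ (k + 5) - α) *
          ((q : ℂ) ^ (k + 4) + α * (1 : ℤ)) / ((q : ℂ) - (1 : ℤ))} = (sA : Set (Om Q → ℂ)) from ?_]
      · rw [Set.ncard_coe_finset]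
        omega
      · refine Set.ext fun χ => ⟨fun ⟨h1, h2⟩ => ?_, fun h0 => ⟨(eA χ h0).1, ?_⟩⟩
        · rw [Int.cast_one, mul_one, vA] at h2
          rcases key' χ _ h1 h2 o7 with h0 | h0 | h0 | h0 | h0
          · exfalso; linarith [h0.2]
          · exact h0.1
          all_goals
            exfalso
            linarith [h0.2]
        · rw [Int.cast_one, mul_one, vA]
          exact (eA χ h0).2
    · rw [show {χ : Om Q → ℂ | IrrChar χ ∧ χ 1 = ((q : ℂ) ^ (k + 5) - α) *
          ((q : ℂ) ^ (k + 4) + α * (-1 : ℤ)) / ((q : ℂ) - (-1 : ℤ))} = (sB : Set (Om Q → ℂ)) from ?_]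
      · rw [Set.ncard_coe_finset]
        omega
      · have vB' : ((q : ℂ) ^ (k + 5) - α) * ((q : ℂ) ^ (k + 4) + α * (-1 : ℤ)) /
            ((q : ℂ) - (-1 : ℤ)) = (rB : ℂ) := by
          rw [← vB]; push_cast; rw [mul_neg_one, sub_neg_eq_add]; rfl
        refine Set.ext fun χ => ⟨fun ⟨h1, h2⟩ => ?_, fun h0 => ⟨(eB χ h0).1, ?_⟩⟩
        · rw [vB'] at h2
          rcases key' χ _ h1 h2 (by linarith) with h0 | h0 | h0 | h0 | h0
          · exfalso; linarith [h0.2]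
          · exfalso; linarith [h0.2]
          · exact h0.1
          · exfalso; linarith [h0.2]
          · exact absurd h0.2 o6
        · rw [vB']
          exact (eB χ h0).2

end Classification

section Transport

variable {G : Type} [Group G] [Finite G]

theorem isIrrChar_iff {χ : G → ℂ} : IsIrrChar G χ ↔ IrrChar χ := by
  have := Fintype.ofFinite G
  have key : ∀ φ : G → ℂ, (∑ g, φ g * φ g⁻¹ = Nat.card G) ↔ cip φ φ = 1 := fun φ => by
    rw [cip_apply, inv_mul_eq_one₀ (Nat.cast_ne_zero.2 Nat.card_pos.ne'), eq_comm]
  constructor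
  · rintro ⟨V, hV, rfl⟩
    exact IsChar.irr_of_cip ⟨V, inferInstance, inferInstance, inferInstance, V.ρ, rfl⟩
      ((key _).1 ((FDRep.simple_iff_char_is_norm_one V).1 hV))
  · intro h
    have h1 := (key χ).2 h.cip_self
    obtain ⟨M, _, _, _, ρ, -, rfl⟩ := h
    exact ⟨FDRep.of ρ, (FDRep.simple_iff_char_is_norm_one _).2 h1, rfl⟩

variable {H : Type} [Group H]

theorem IrrChar.comp_mulEquiv (e : G ≃* H) {χ : H → ℂ} (h : IrrChar χ) : IrrChar (χ ∘ e) := by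
  have := Fintype.ofFinite G
  have := Fintype.ofEquiv G e.toEquiv
  have h1 := h.cip_self
  obtain ⟨M, _, _, _, ρ, -, rfl⟩ := h
  refine IsChar.irr_of_cip ⟨M, inferInstance, inferInstance, inferInstance,
    ρ.comp e.toMonoidHom, rfl⟩ ?_
  rw [← h1, cip_apply, cip_apply, Nat.card_congr e.toEquiv]
  congr 1
  exact Fintype.sum_equiv e.toEquiv _ _ fun g => by simp

theorem isIrrChar_comp_iff (e : G ≃* H) {χ : H → ℂ} : IsIrrChar G (χ ∘ e) ↔ IrrChar χ := by
  have := Finite.of_equiv G e.toEquiv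
  refine isIrrChar_iff.trans ⟨fun h => ?_, fun h => h.comp_mulEquiv e⟩
  have h1 := h.comp_mulEquiv e.symm
  rwa [Function.comp_assoc, show (e : G → H) ∘ e.symm = id from funext e.apply_symm_apply] at h1

theorem ncard_isIrrChar (e : G ≃* H) (r : ℂ) :
    {χ : G → ℂ | IsIrrChar G χ ∧ χ 1 = r}.ncard = {χ : H → ℂ | IrrChar χ ∧ χ 1 = r}.ncard := by
  rw [← Set.ncard_image_of_injective _ (Function.Surjective.injective_comp_right e.surjective)]
  refine congrArg _ (Set.ext fun χ => ⟨fun ⟨h1, h2⟩ => ⟨χ ∘ e.symm, ⟨?_, ?_⟩, ?_⟩, ?_⟩)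
  · rw [← isIrrChar_comp_iff e]
    rwa [Function.comp_assoc, show (e.symm : H → G) ∘ e = id from funext e.symm_apply_apply]
  · rw [Function.comp_apply, map_one, h2]
  · funext g
    simp
  · rintro ⟨χ', ⟨h1, h2⟩, rfl⟩
    exact ⟨(isIrrChar_comp_iff e).2 h1, (congrArg χ' (map_one e)).trans h2⟩

end Transport

section MatrixGroup

variable {F : Type} [Field F] [CharP F 2] {m : ℕ}

noncomputable def glEquiv : GL (Fin m) F ≃* ((Fin m → F) ≃ₗ[F] (Fin m → F)) :=
  Matrix.GeneralLinearGroup.toLin.trans (LinearMap.GeneralLinearGroup.generalLinearEquiv F _)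

theorem map_isomGroup (Q : QuadraticForm F (Fin m → F)) :
    (isomGroup Q).map (glEquiv (F := F) (m := m)).toMonoidHom = isom Q := by
  ext g
  constructor
  · rintro ⟨a, ha, rfl⟩
    exact ha
  · intro hg
    obtain ⟨a, rfl⟩ := (glEquiv (F := F) (m := m)).surjective g
    exact ⟨a, hg, rfl⟩

theorem map_commutator_isomGroup (Q : QuadraticForm F (Fin m → F)) :
    ((commutator ↥(isomGroup Q)).map (isomGroup Q).subtype).map
      (glEquiv (F := F) (m := m)).toMonoidHom = ⁅isom Q, isom Q⁆ := by
  rw [Subgroup.map_subtype_commutator, Subgroup.map_commutator, map_isomGroup]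

theorem nonempty_mulEquiv_Om {Q : QuadraticForm F (Fin m → F)} (h : ⁅isom Q, isom Q⁆ = El Q ∅) :
    Nonempty (↥(commutator ↥(isomGroup Q)) ≃* Om Q) :=
  ⟨((commutator ↥(isomGroup Q)).equivMapOfInjective _ (isomGroup Q).subtype_injective).trans
    ((Subgroup.equivMapOfInjective _ _ (glEquiv (F := F) (m := m)).injective).trans
      (MulEquiv.subgroupCongr ((map_commutator_isomGroup Q).trans h)))⟩

end MatrixGroup

end OC

/-- Theorem 1.3: classification of the irreducible complex characters of
`Ω^α_{2n}(q)` (`q` a power of `2`, `n ≥ 5`, `(n,q,α) ≠ (5,2,+)`) of degree below `D(n,q,α)`,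
with multiplicities.  Here `Ω^α_{2n}(q)` is the commutator subgroup of the isometry group of a
nondegenerate quadratic form on `F_q^{2n}` of Witt index `n` (for `α = 1`) or `n - 1`
(for `α = -1`). -/
theorem omega_even_char_low_degree_characters (n q : ℕ) (hn : 5 ≤ n)
    (hq : ∃ k : ℕ, 0 < k ∧ q = 2 ^ k) (α : ℤ) (hα : α = 1 ∨ α = -1)
    (hexc : ¬(n = 5 ∧ q = 2 ∧ α = 1))
    (F : Type) [Field F] [Fintype F] (hF : Fintype.card F = q)
    (Q : QuadraticForm F (Fin (2 * n) → F)) (hQ : IsNondegQF Q)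
    (hW : HasWittIndex Q (if α = 1 then n else n - 1)) :
    (∀ χ : ↥(commutator ↥(isomGroup Q)) → ℂ, IsIrrChar ↥(commutator ↥(isomGroup Q)) χ →
      ((if n = 5 ∧ α = -1 then
          ((q : ℝ) - 1) * ((q : ℝ) ^ 2 + 1) * ((q : ℝ) ^ 3 - 1) * ((q : ℝ) ^ 4 + 1)
        else (q : ℝ) ^ (4 * n - 10) + 1) ≤ (χ 1).re ∨
        χ 1 = 1 ∨
        χ 1 = ((q : ℂ) ^ n - (α : ℂ)) * ((q : ℂ) ^ (n - 1) + (α : ℂ) * q) / ((q : ℂ) ^ 2 - 1) ∨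
        χ 1 = ((q : ℂ) ^ (2 * n) - (q : ℂ) ^ 2) / ((q : ℂ) ^ 2 - 1) ∨
        (∃ β : ℤ, (β = 1 ∨ β = -1) ∧
          χ 1 = ((q : ℂ) ^ n - (α : ℂ)) * ((q : ℂ) ^ (n - 1) + (α : ℂ) * (β : ℂ)) /
            ((q : ℂ) - (β : ℂ))))) ∧
    {χ : ↥(commutator ↥(isomGroup Q)) → ℂ |
      IsIrrChar ↥(commutator ↥(isomGroup Q)) χ ∧ χ 1 = 1}.ncard = 1 ∧
    {χ : ↥(commutator ↥(isomGroup Q)) → ℂ | IsIrrChar ↥(commutator ↥(isomGroup Q)) χ ∧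
      χ 1 = ((q : ℂ) ^ n - (α : ℂ)) * ((q : ℂ) ^ (n - 1) + (α : ℂ) * q) /
        ((q : ℂ) ^ 2 - 1)}.ncard = 1 ∧
    {χ : ↥(commutator ↥(isomGroup Q)) → ℂ | IsIrrChar ↥(commutator ↥(isomGroup Q)) χ ∧
      χ 1 = ((q : ℂ) ^ (2 * n) - (q : ℂ) ^ 2) / ((q : ℂ) ^ 2 - 1)}.ncard = 1 ∧
    (∀ β : ℤ, (β = 1 ∨ β = -1) →
      (2 * ({χ : ↥(commutator ↥(isomGroup Q)) → ℂ | IsIrrChar ↥(commutator ↥(isomGroup Q)) χ ∧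
        χ 1 = ((q : ℂ) ^ n - (α : ℂ)) * ((q : ℂ) ^ (n - 1) + (α : ℂ) * (β : ℂ)) /
          ((q : ℂ) - (β : ℂ))}.ncard) : ℤ) = q - β - 1) := by
  classical
  obtain ⟨k, hk, hqk⟩ := hq
  subst hF
  have : CharP F 2 := by
    have h2 : ringChar F = 2 := FiniteField.even_card_iff_char_two.2 (by
      rw [hqk]
      exact Nat.mod_eq_zero_of_dvd (dvd_pow_self 2 hk.ne'))
    rw [← h2]
    exact ringChar.charP F
  have hc : Fintype.card F = 2 ∨ 4 ≤ Fintype.card F := by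
    rcases Nat.eq_or_lt_of_le hk with h | h
    · exact Or.inl (by rw [hqk, ← h, Nat.succ_eq_add_one, zero_add, pow_one])
    · exact Or.inr (hqk ▸ Nat.pow_le_pow_right (n := 2) two_pos h)
  obtain ⟨⟨W, hW1, hW2⟩, hmax⟩ := hW
  have hT : OC.IsType Q n α := OC.isType_of_witt (by omega) hα (by simp)
    (fun v hv => hQ v fun w => hv w) W hW1 hW2
    fun W' h => hW2 ▸ hmax ⟨W', h, rfl⟩
  obtain ⟨e⟩ := OC.nonempty_mulEquiv_Om (OC.commutator_isom hT.nondeg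
    (hT.ample' OC.finrank_span_empty_le (by omega))
    fun a => hT.ample' OC.finrank_span_singleton_le (by omega))
  obtain ⟨h0, h1, h2, h3, h4⟩ := OC.classification hn hT hc hexc
  refine ⟨fun χ hχ => ?_, ?_, ?_, ?_, fun β hβ => ?_⟩
  · have h5 : χ = (χ ∘ e.symm) ∘ e := by
      funext g
      simp
    rw [h5, OC.isIrrChar_comp_iff e] at hχ
    have h6 := h0 _ hχ
    rwa [Function.comp_apply, map_one] at h6
  · rw [OC.ncard_isIrrChar e, h1]
  · rw [OC.ncard_isIrrChar e, h2]
  · rw [OC.ncard_isIrrChar e, h3]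
  · rw [OC.ncard_isIrrChar e, h4 β hβ]
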